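/- There is an absolute constant C > 0 with the following property. Let p be a large enough prime, let j be an odd prime with 2 < j < p − 2, and let I ⊆ F_p be the image of a finite arithmetic progression. Then |I| ≥ |P_j(I)| ≥ |I| − C·(|I|²/p + j²·√p·(log p)²), where P_j(x) = ∏_{i=1}^{j} (x+i) and P_j(I) = {P_j(a) : a ∈ I}. -/

import Mathlib

/-- `P_j(x) = ∏_{i=1}^{j} (x + i)` over `ZMod p`. -/
noncomputable def Pfact (p j : ℕ) : Polynomial (ZMod p) :=
  ∏ i ∈ Finset.Icc 1 j, (Polynomial.X + Polynomial.C (i : ZMod p))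

/-- The image in `ZMod p` of the arithmetic progression `{s, s+r, …, s+(m-1)r}`. -/
def apImage (p : ℕ) (s r : ZMod p) (m : ℕ) : Finset (ZMod p) :=
  (Finset.range m).image (fun i : ℕ => s + (i : ZMod p) * r)

open Polynomial in
theorem finrank_le_of_coeff_ne_zero {Ω A : Type*} [Field Ω] [AddCommGroup A] [Module Ω A]
    (W : Submodule Ω A) (φ : A →ₗ[Ω] PowerSeries Ω) (n : ℕ)
    (h : ∀ a ∈ W, a ≠ 0 → ∃ k ≤ n, PowerSeries.coeff k (φ a) ≠ 0) :
    FiniteDimensional Ω W ∧ Module.finrank Ω W ≤ n + 1 := by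
  let L : W →ₗ[Ω] (Fin (n + 1) → Ω) :=
    LinearMap.pi fun i => (PowerSeries.coeff (i : ℕ)).comp (φ.comp W.subtype)
  have hL : Function.Injective L := by
    rw [← LinearMap.ker_eq_bot, LinearMap.ker_eq_bot']
    intro a ha
    by_contra hne
    obtain ⟨k, hk, hk'⟩ := h a a.2 (fun h0 => hne (Subtype.ext h0))
    exact hk' (congrFun ha ⟨k, Nat.lt_succ_of_le hk⟩)
  refine ⟨FiniteDimensional.of_injective L hL, ?_⟩
  simpa using LinearMap.finrank_le_finrank_of_injective hL

set_option maxHeartbeats 1000000 in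
/-- Stepanov's method in an abstract filtered algebra. -/
theorem card_le_of_stepanov {Ω A ι : Type*} [Field Ω] [IsAlgClosed Ω] (p : ℕ) [Fact p.Prime]
    [CharP Ω p] [CommRing A] [IsDomain A] [Algebra Ω A] (V : ℕ → Submodule Ω A)
    (hV : ∀ l m, ∀ a ∈ V l, ∀ b ∈ V m, a * b ∈ V (l + m)) (hV1 : (1 : A) ∈ V 0)
    (φ : A →ₐ[Ω] PowerSeries Ω) (g D : ℕ) (hg : 1 ≤ g)
    (hφ : ∀ m, ∀ a ∈ V m, a ≠ 0 → ∃ k ≤ g * m, PowerSeries.coeff k (φ a) ≠ 0)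
    (hdim : ∀ m, g * (m + 1) ≤ Module.finrank Ω (V m) + g * D)
    (k : ℕ) (hk : (g * D + 1) * (g * D) + 2 * (g * D) + 3 ≤ p ^ k)
    (σ : A →+* A)
    (hσV : ∀ m, ∀ a ∈ V m, σ a ∈ V m)
    (T : Finset ι) (e : ι → A →+* Ω)
    (hz : ∀ M, ∀ a ∈ V M, a ≠ 0 → {t : ι | t ∈ T ∧ e t a = 0}.ncard ≤ g * M)
    (hF : ∀ t ∈ T, ∀ a, (e t a) ^ ((p ^ k) ^ 2) = e t (σ a)) :
    T.card ≤ (p ^ k) ^ 2 + (2 * (g * D) + 2) * p ^ k := by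
  classical
  have : CharP A p := charP_of_injective_algebraMap (algebraMap Ω A).injective p
  set q₀ := p ^ k with hq₀
  have hpos : 0 < q₀ := pow_pos (Fact.out : p.Prime).pos k
  set m := (q₀ + 2 * (g * D) + 1) / g with hm
  set l := (q₀ - 1) / g with hl
  have hgm : g * m ≤ q₀ + 2 * (g * D) + 1 := Nat.mul_div_le _ _
  have hgm' : q₀ + 2 * (g * D) + 1 < g * (m + 1) := Nat.lt_mul_div_succ _ hg
  have hgl : g * l ≤ q₀ - 1 := Nat.mul_div_le _ _
  have hgl' : q₀ - 1 < g * (l + 1) := Nat.lt_mul_div_succ _ hg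
  have hfd : ∀ m, FiniteDimensional Ω (V m) ∧ Module.finrank Ω (V m) ≤ g * m + 1 := fun m =>
    finrank_le_of_coeff_ne_zero (V m) φ.toLinearMap (g * m) (hφ m)
  have := fun m => (hfd m).1
  let s := Module.finBasis Ω (V m)
  let b := Module.finBasis Ω (V l)
  have hpow : ∀ m n a, a ∈ V m → a ^ n ∈ V (m * n) := by
    intro m n a ha
    induction n with
    | zero => simpa using hV1
    | succ n ih => rw [pow_succ, Nat.mul_succ]; exact hV _ _ _ ih _ ha
  have hdm := hdim m
  have hdl := hdim l
  -- a nontrivial linear relation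
  obtain ⟨μ, hμ, ⟨i₀, b₀⟩, hμ0⟩ : ∃ μ : Fin (Module.finrank Ω (V m)) × Fin (Module.finrank Ω (V l)) → Ω,
      ∑ x, μ x • ((b x.2 : A) ^ q₀ * σ (s x.1)) = 0 ∧ ∃ x, μ x ≠ 0 := by
    have hmem : ∀ x : Fin (Module.finrank Ω (V m)) × Fin (Module.finrank Ω (V l)),
        (b x.2 : A) ^ q₀ * σ (s x.1) ∈ V (l * q₀ + m) := fun x =>
      hV _ _ _ (hpow _ _ _ (b x.2).2) _ (hσV _ _ (s x.1).2)
    have hnl : ¬ LinearIndependent Ω (fun x => (⟨_, hmem x⟩ : V (l * q₀ + m))) := by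
      intro hli
      have h1 := hli.fintype_card_le_finrank
      have h2 := (hfd (l * q₀ + m)).2
      rw [Fintype.card_prod, Fintype.card_fin, Fintype.card_fin] at h1
      have h3 : q₀ + g * D + 1 ≤ Module.finrank Ω (V m) := by omega
      have h4 : q₀ ≤ Module.finrank Ω (V l) + g * D := by omega
      have h5 : g * (l * q₀ + m) + 1 ≤ (q₀ - 1) * q₀ + (q₀ + 2 * (g * D) + 1) + 1 := by
        nlinarith [Nat.mul_le_mul_right q₀ hgl]
      obtain ⟨y, hy⟩ : ∃ y, q₀ = g * D + y := ⟨q₀ - g * D, by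
        have : 0 ≤ (g * D + 1) * (g * D) := Nat.zero_le _
        omega⟩
      have h6 : (q₀ + g * D + 1) * y ≤ (q₀ - 1) * q₀ + (q₀ + 2 * (g * D) + 1) + 1 :=
        (Nat.mul_le_mul h3 (by omega)).trans (h1.trans (h2.trans h5))
      have h7 : (q₀ - 1) * q₀ + q₀ = q₀ * q₀ := by
        obtain ⟨z, hz⟩ : ∃ z, q₀ = z + 1 := ⟨q₀ - 1, by omega⟩
        rw [hz]; simp; ring
      have h8 : (q₀ + g * D + 1) * y ≤ q₀ * q₀ + (2 * (g * D) + 1) + 1 := by omega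
      rw [hy] at h8 hk
      nlinarith
    rw [Fintype.not_linearIndependent_iff] at hnl
    obtain ⟨μ, h1, h2⟩ := hnl
    refine ⟨μ, ?_, h2⟩
    have := congrArg (Submodule.subtype _) h1
    simpa using this
  have hroot : ∀ c : Ω, ∃ d, d ^ (q₀ ^ 2) = c := fun c =>
    IsAlgClosed.exists_pow_nat_eq c (pow_pos hpos 2)
  choose ρ hρ using hroot
  set ν := fun i c => ρ (μ (i, c)) with hν
  have hν0 : ν i₀ b₀ ≠ 0 := by
    intro h
    apply hμ0
    rw [← hρ (μ (i₀, b₀))]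
    change ν i₀ b₀ ^ _ = 0
    rw [h, zero_pow (pow_pos hpos 2).ne']
  set v : Fin (Module.finrank Ω (V m)) → A := fun i => ∑ c, ν i c ^ q₀ • (b c : A) with hv
  have hvV : ∀ i, v i ∈ V l := fun i =>
    Submodule.sum_mem _ fun c _ => Submodule.smul_mem _ _ (b c).2
  have hrel : ∑ i, v i ^ q₀ * σ (s i) = 0 := by
    rw [← hμ, Fintype.sum_prod_type]
    refine Finset.sum_congr rfl fun i _ => ?_
    rw [hv, hq₀]
    simp only
    rw [sum_pow_char_pow, Finset.sum_mul]
    refine Finset.sum_congr rfl fun c _ => ?_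
    rw [smul_pow, ← pow_mul, ← pow_two, ← hq₀, hν]
    simp only
    rw [hρ, smul_mul_assoc]
  set h := ∑ i, v i * (s i : A) ^ q₀ with hh
  have hhV : h ∈ V (l + m * q₀) :=
    Submodule.sum_mem _ fun i _ => hV _ _ _ (hvV i) _ (hpow _ _ _ (s i).2)
  have hT : ∀ t ∈ T, e t h = 0 := by
    intro t ht
    have : (e t h) ^ q₀ = 0 := by
      have h0 := congrArg (e t) hrel
      rw [map_zero, map_sum] at h0
      rw [← h0, hh, map_sum, hq₀, sum_pow_char_pow]
      refine Finset.sum_congr rfl fun i _ => ?_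
      rw [map_mul, mul_pow, map_mul, map_pow, map_pow, ← hF t ht, ← hq₀]
      ring
    exact pow_eq_zero_iff hpos.ne' |>.1 this
  have hne : h ≠ 0 := by
    intro h0
    -- coefficients in the second factor
    set U : ℕ → A := fun a => ∑ i, (PowerSeries.coeff a (φ (s i))) ^ q₀ • v i with hU
    have hUV : ∀ a, U a ∈ V l := fun a =>
      Submodule.sum_mem _ fun i _ => Submodule.smul_mem _ _ (hvV i)
    have hcoeff : ∀ n, PowerSeries.coeff n (φ h) = ∑ x ∈ Finset.HasAntidiagonal.antidiagonal n,
        if q₀ ∣ x.2 then PowerSeries.coeff x.1 (φ (U (x.2 / q₀))) else 0 := by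
      intro n
      have hfrob : ∀ i n', PowerSeries.coeff n' (φ (s i) ^ q₀) =
          if q₀ ∣ n' then (PowerSeries.coeff (n' / q₀) (φ (s i))) ^ q₀ else 0 := by
        intro i n'
        have hexp : PowerSeries.map (iterateFrobenius Ω p k) (PowerSeries.expand (p ^ k)
            (pow_ne_zero k (NeZero.ne p)) (φ (s i))) = φ (s i) ^ p ^ k :=
          MvPowerSeries.map_iterateFrobenius_expand p (NeZero.ne p) (φ (s i)) k
        rw [hq₀, ← hexp, PowerSeries.coeff_map, PowerSeries.coeff_expand]
        split_ifs with hd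
        · rfl
        · exact map_zero _
      rw [hh, map_sum, map_sum]
      simp_rw [map_mul, map_pow, PowerSeries.coeff_mul, hfrob]
      rw [Finset.sum_comm]
      refine Finset.sum_congr rfl fun x _ => ?_
      split_ifs with hd
      · simp only [hU, map_sum, map_smul, smul_eq_mul]
        exact Finset.sum_congr rfl fun i _ => mul_comm _ _
      · simp
    have hU0 : ∀ a, U a = 0 := by
      intro a
      induction a using Nat.strong_induction_on with
      | _ a ih =>
        by_contra hne
        obtain ⟨k₀, hk₀, hk₀'⟩ := hφ l _ (hUV a) hne
        have hlt : k₀ < q₀ := by omega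
        have := hcoeff (k₀ + a * q₀)
        rw [h0, map_zero, map_zero] at this
        rw [Finset.sum_eq_single (k₀, a * q₀)] at this
        · rw [if_pos (Dvd.intro_left a rfl), Nat.mul_div_cancel _ hpos] at this
          exact hk₀' this.symm
        · rintro ⟨x, y⟩ hxy hne'
          split_ifs with hd
          · obtain ⟨a', rfl⟩ := hd
            rw [Finset.HasAntidiagonal.mem_antidiagonal] at hxy
            simp only at hxy ⊢
            rw [Nat.mul_div_cancel_left _ hpos]
            rcases lt_trichotomy a' a with h' | h' | h'
            · rw [ih a' h', map_zero, map_zero]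
            · subst h'
              exact absurd (Prod.ext (by simp only; nlinarith) (mul_comm _ _)) hne'
            · exfalso
              nlinarith
          · rfl
        · intro hx
          exact absurd (by rw [Finset.HasAntidiagonal.mem_antidiagonal]) hx
    have hcol : ∀ c, ∑ i, ν i c • (s i : A) = 0 := by
      intro c
      by_contra hne
      obtain ⟨a, -, ha⟩ := hφ m _ (Submodule.sum_mem _ fun i _ =>
        Submodule.smul_mem _ _ (s i).2) hne
      apply ha
      have h1 : ∑ c, (∑ i, (PowerSeries.coeff a (φ (s i))) ^ q₀ * ν i c ^ q₀) • (b c : A) = 0 := by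
        rw [← hU0 a, hU]
        simp only [hv, Finset.smul_sum, Finset.sum_smul, smul_smul]
        rw [Finset.sum_comm]
      have h2 := Fintype.linearIndependent_iff.1 b.linearIndependent
        (fun c => ∑ i, (PowerSeries.coeff a (φ (s i))) ^ q₀ * ν i c ^ q₀)
        (by apply Subtype.ext; simpa using h1) c
      have h3 : (∑ i, PowerSeries.coeff a (φ (s i)) * ν i c) ^ q₀ = 0 := by
        rw [hq₀, sum_pow_char_pow, ← h2]
        exact Finset.sum_congr rfl fun i _ => mul_pow _ _ _
      have h4 := pow_eq_zero_iff hpos.ne' |>.1 h3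
      rw [← h4, map_sum, map_sum]
      refine Finset.sum_congr rfl fun i _ => ?_
      rw [map_smul, map_smul, smul_eq_mul, mul_comm]
    exact hν0 (Fintype.linearIndependent_iff.1 s.linearIndependent (fun i => ν i b₀)
      (by apply Subtype.ext; simpa using hcol b₀) i₀)
  have hfin := hz _ h hhV hne
  rw [show {t | t ∈ T ∧ e t h = 0} = (T : Set ι) by ext t; simpa using hT t,
    Set.ncard_coe_finset] at hfin
  refine hfin.trans ?_
  have : g * (l + m * q₀) = g * l + (g * m) * q₀ := by ring
  rw [this]
  have h1 := Nat.mul_le_mul_right q₀ hgm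
  have h2 : (q₀ + 2 * (g * D) + 1) * q₀ + q₀ = q₀ ^ 2 + (2 * (g * D) + 2) * q₀ := by ring
  omega

section

open Polynomial

theorem exists_algEquiv_comp_eq {K E L : Type*} [Field K] [Field E] [Field L] [Algebra K E]
    [FiniteDimensional K E] [IsGalois K E] (φ₁ φ₂ : E →+* L)
    (h : φ₁.comp (algebraMap K E) = φ₂.comp (algebraMap K E)) :
    ∃ σ : E ≃ₐ[K] E, ∀ x, φ₁ x = φ₂ (σ x) := by
  let := (φ₂.comp (algebraMap K E)).toAlgebra
  let ψ₁ : E →ₐ[K] L := { φ₁ with commutes' := fun r => RingHom.congr_fun h r }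
  let ψ₂ : E →ₐ[K] L := { φ₂ with commutes' := fun r => rfl }
  have hinj : Function.Injective (fun σ : E ≃ₐ[K] E => ψ₂.comp (σ : E →ₐ[K] E)) := by
    intro σ τ hστ
    ext x
    exact φ₂.injective (DFunLike.congr_fun hστ x)
  have hbij : Function.Bijective (fun σ : E ≃ₐ[K] E => ψ₂.comp (σ : E →ₐ[K] E)) := by
    classical
    rw [Nat.bijective_iff_injective_and_card]
    refine ⟨hinj, le_antisymm (Nat.card_le_card_of_injective _ hinj) ?_⟩
    rw [IsGalois.card_aut_eq_finrank K E]
    exact card_algHom_le_finrank K E L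
  obtain ⟨σ, hσ⟩ := hbij.2 ψ₁
  exact ⟨σ, fun x => (DFunLike.congr_fun hσ x).symm⟩

theorem exists_ringHom_of_splits {K E L : Type*} [Field K] [Field E] [Field L] [Algebra K E]
    (f : K[X]) [IsSplittingField K E f] (γ : K →+* L) (h : (f.map γ).Splits) :
    ∃ ι : E →+* L, ι.comp (algebraMap K E) = γ := by
  let := γ.toAlgebra
  let ψ : E →ₐ[K] L := IsSplittingField.lift E f h
  exact ⟨ψ, ψ.comp_algebraMap⟩

/-- The expansion of a polynomial around `u`. -/
noncomputable def expandAt {F : Type*} [Field F] (u : F) : F[X] →ₐ[F] PowerSeries F :=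
  (Polynomial.coeToPowerSeries.algHom F).comp (taylorAlgHom u)

section expandAt
variable {F : Type*} [Field F] (u : F)

theorem expandAt_apply (P : F[X]) : expandAt u P = (taylor u P : PowerSeries F) := by
  simp [expandAt, PowerSeries.map_id]

theorem expandAt_injective : Function.Injective (expandAt u) := by
  intro P R h
  rw [expandAt_apply, expandAt_apply, Polynomial.coe_inj] at h
  exact taylor_injective u h

theorem expandAt_X : expandAt u X = PowerSeries.C u + PowerSeries.X := by
  rw [expandAt_apply, taylor_X]
  simp [add_comm]

theorem expandAt_C (c : F) : expandAt u (C c) = PowerSeries.C c := by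
  rw [expandAt_apply, taylor_C, Polynomial.coe_C]

theorem constantCoeff_expandAt (P : F[X]) :
    PowerSeries.constantCoeff (expandAt u P) = P.eval u := by
  rw [expandAt_apply, ← PowerSeries.coeff_zero_eq_constantCoeff_apply, Polynomial.coeff_coe,
    taylor_coeff_zero]

theorem le_rootMultiplicity_of_X_pow_dvd_expandAt {P : F[X]} (hP : P ≠ 0) {k : ℕ}
    (h : (PowerSeries.X : PowerSeries F) ^ k ∣ expandAt u P) : k ≤ P.rootMultiplicity u := by
  rw [le_rootMultiplicity_iff hP]
  rw [PowerSeries.X_pow_dvd_iff] at h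
  have h1 : (X : F[X]) ^ k ∣ taylor u P := by
    rw [X_pow_dvd_iff]
    intro d hd
    have := h d hd
    rwa [expandAt_apply, Polynomial.coeff_coe] at this
  obtain ⟨R, hR⟩ := h1
  refine ⟨taylor (-u) R, ?_⟩
  have := congrArg (taylor (-u)) hR
  rw [taylor_taylor, taylor_mul, taylor_pow, taylor_X] at this
  simpa [sub_eq_add_neg] using this

/-- The expansion of a rational function around `u`. -/
noncomputable def ratExpandAt : RatFunc F →+* LaurentSeries F :=
  IsFractionRing.lift (A := F[X])
    (g := (algebraMap (PowerSeries F) (LaurentSeries F)).comp (expandAt u).toRingHom)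
    ((IsFractionRing.injective (PowerSeries F) (LaurentSeries F)).comp (expandAt_injective u))

theorem ratExpandAt_algebraMap (P : F[X]) : ratExpandAt u (algebraMap F[X] (RatFunc F) P) =
    algebraMap (PowerSeries F) (LaurentSeries F) (expandAt u P) :=
  IsFractionRing.lift_algebraMap _ _

theorem exists_powerSeries_root (Q : F[X]) (hQ : Q.Monic) (α : F) (hα : Q.eval α = u)
    (hα' : Q.derivative.eval α ≠ 0) : ∃ z : PowerSeries F, PowerSeries.constantCoeff z = α ∧
      aeval z Q = PowerSeries.C u + PowerSeries.X := by
  by_cases hd : Q.natDegree = 0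
  · rw [hQ.natDegree_eq_zero.1 hd] at hα'
    simp at hα'
  have hmon : (Q.map (PowerSeries.C (R := F)) -
      Polynomial.C (PowerSeries.C u + PowerSeries.X : PowerSeries F)).Monic := by
    refine (hQ.map _).sub_of_left ?_
    rw [degree_map]
    refine (degree_C_le).trans_lt ?_
    rw [← natDegree_pos_iff_degree_pos]
    omega
  obtain ⟨z, hz, hz'⟩ := HenselianRing.is_henselian (I := Ideal.span {(PowerSeries.X : PowerSeries F)})
    _ hmon (PowerSeries.C α) (by
      rw [Ideal.mem_span_singleton, PowerSeries.X_dvd_iff]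
      simp [eval_map, hα]) (by
      refine IsUnit.map _ ?_
      rw [PowerSeries.isUnit_iff_constantCoeff]
      simpa [eval_map] using hα')
  refine ⟨z, ?_, ?_⟩
  · rw [Ideal.mem_span_singleton, PowerSeries.X_dvd_iff] at hz'
    simpa [sub_eq_zero] using hz'
  · have := hz
    rw [IsRoot.def, eval_sub, eval_C, sub_eq_zero, eval_map] at this
    rw [aeval_def]
    exact this
end expandAt

end

section

open Polynomial

/-- The polynomial `Q(Z) - X` over `F(X)`. -/
noncomputable def genericFiber {F : Type*} [Field F] (Q : F[X]) : (RatFunc F)[X] :=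
  Q.map (algebraMap F (RatFunc F)) - C RatFunc.X

section
variable {F : Type*} [Field F]

theorem map_genericFiber {L : Type*} [CommRing L] (γ : RatFunc F →+* L) (Q : F[X]) :
    (genericFiber Q).map γ =
      Q.map (γ.comp (algebraMap F (RatFunc F))) - C (γ RatFunc.X) := by
  rw [genericFiber, Polynomial.map_sub, Polynomial.map_map, map_C]

theorem natDegree_sub_C_pos {R : Type*} [Ring R] {Q : R[X]} (hQ : Q.Monic) (hd : 0 < Q.natDegree)
    (c : R) : (Q - C c).Monic ∧ (Q - C c).natDegree = Q.natDegree := by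
  refine ⟨hQ.sub_of_left ((degree_C_le).trans_lt (natDegree_pos_iff_degree_pos.1 hd)),
    natDegree_sub_C⟩

theorem splits_map_ratExpandAt [IsAlgClosed F] (u : F) (Q : F[X]) (hQ : Q.Monic)
    (hd : 0 < Q.natDegree) (hu : (Q - C u).Separable) :
    ((genericFiber Q).map (ratExpandAt u)).Splits := by
  classical
  have hz : ∀ α ∈ (Q - C u).roots, ∃ z : PowerSeries F, PowerSeries.constantCoeff z = α ∧
      aeval z Q = PowerSeries.C u + PowerSeries.X := by
    intro α hα
    have hα1 : (Q - C u).eval α = 0 := (mem_roots'.1 hα).2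
    have hα2 : Q.eval α = u := by simpa [sub_eq_zero] using hα1
    refine exists_powerSeries_root u Q hQ α hα2 ?_
    have := hu.eval₂_derivative_ne_zero (RingHom.id F) (x := α) (by simpa [eval₂_id] using hα1)
    simpa [eval₂_id] using this
  choose! z hz1 hz2 using hz
  have hγX : ratExpandAt u RatFunc.X =
      algebraMap (PowerSeries F) (LaurentSeries F) (PowerSeries.C u + PowerSeries.X) := by
    rw [← RatFunc.algebraMap_X, ratExpandAt_algebraMap, expandAt_X]
  have hγC : (ratExpandAt u).comp (algebraMap F (RatFunc F)) =
      (algebraMap (PowerSeries F) (LaurentSeries F)).comp (algebraMap F (PowerSeries F)) := by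
    ext1 c
    rw [RingHom.comp_apply, IsScalarTower.algebraMap_apply F F[X] (RatFunc F),
      ratExpandAt_algebraMap, ← C_eq_algebraMap, expandAt_C]
    rfl
  rw [map_genericFiber, hγC, hγX]
  obtain ⟨hmon, hdeg⟩ := natDegree_sub_C_pos (hQ.map ((algebraMap (PowerSeries F)
    (LaurentSeries F)).comp (algebraMap F (PowerSeries F)))) (by rwa [natDegree_map])
    (algebraMap (PowerSeries F) (LaurentSeries F) (PowerSeries.C u + PowerSeries.X))
  rw [splits_iff_card_roots]
  refine le_antisymm (card_roots' _) ?_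
  rw [hdeg, natDegree_map, ← (natDegree_sub_C_pos hQ hd u).2,
    (IsAlgClosed.splits (Q - C u)).natDegree_eq_card_roots]
  have hsub : (Q - C u).roots.map (fun α => algebraMap (PowerSeries F) (LaurentSeries F) (z α)) ≤
      (Q.map ((algebraMap (PowerSeries F) (LaurentSeries F)).comp (algebraMap F (PowerSeries F))) -
        C (algebraMap (PowerSeries F) (LaurentSeries F) (PowerSeries.C u + PowerSeries.X))).roots := by
    rw [Multiset.le_iff_subset]
    · intro x hx
      obtain ⟨α, hα, rfl⟩ := Multiset.mem_map.1 hx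
      rw [mem_roots hmon.ne_zero, IsRoot.def, eval_sub, eval_C, eval_map, ← hom_eval₂, ← hz2 α hα,
        aeval_def, sub_self]
    · refine (Multiset.nodup_map_iff_of_inj_on ?_).2 (nodup_roots hu)
      intro α hα β hβ h
      have := IsFractionRing.injective (PowerSeries F) (LaurentSeries F) h
      rw [← hz1 α hα, this, hz1 β hβ]
  simpa using Multiset.card_le_card hsub

variable {E : Type*} [Field E] [Algebra (RatFunc F) E] [Algebra F[X] E]
  [IsScalarTower F[X] (RatFunc F) E] [Algebra F E] [IsScalarTower F F[X] E]

/-- Elements integral over `F[X]` have power series expansions at unramified points. -/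
theorem exists_integral_expansion [IsAlgClosed F] (u : F) (Q : F[X]) (hQ : Q.Monic)
    (hd : 0 < Q.natDegree) (hu : (Q - C u).Separable)
    [IsSplittingField (RatFunc F) E (genericFiber Q)] :
    ∃ φ : integralClosure F[X] E →ₐ[F] PowerSeries F, Function.Injective φ ∧
      ∀ P : F[X], φ (algebraMap F[X] _ P) = expandAt u P := by
  obtain ⟨ι, hι⟩ := exists_ringHom_of_splits (E := E) (genericFiber Q) (ratExpandAt u)
    (splits_map_ratExpandAt u Q hQ hd hu)
  have hιP : ∀ P : F[X], ι (algebraMap F[X] E P) =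
      algebraMap (PowerSeries F) (LaurentSeries F) (expandAt u P) := by
    intro P
    rw [IsScalarTower.algebraMap_apply F[X] (RatFunc F) E, ← ratExpandAt_algebraMap, ← hι]
    rfl
  have hinj := IsFractionRing.injective (PowerSeries F) (LaurentSeries F)
  have hmem : ∀ a : integralClosure F[X] E,
      ∃ b, algebraMap (PowerSeries F) (LaurentSeries F) b = ι a := by
    intro a
    have h1 : IsIntegral (PowerSeries F) (ι a) :=
      a.2.map_of_comp_eq (expandAt u).toRingHom ι (RingHom.ext fun P => (hιP P).symm)
    exact IsIntegrallyClosed.isIntegral_iff.1 h1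
  choose b hb using hmem
  have hbP : ∀ P : F[X], b (algebraMap F[X] _ P) = expandAt u P := by
    intro P
    apply hinj
    rw [hb, ← hιP]
    rfl
  refine ⟨{ toFun := b, map_one' := ?_, map_mul' := ?_, map_zero' := ?_, map_add' := ?_,
            commutes' := ?_ }, ?_, hbP⟩
  · apply hinj; rw [hb]; simp
  · intro x y; apply hinj; rw [hb, map_mul, hb, hb, Subalgebra.coe_mul, map_mul]
  · apply hinj; rw [hb]; simp
  · intro x y; apply hinj; rw [hb, map_add, hb, hb, Subalgebra.coe_add, map_add]
  · intro r
    rw [IsScalarTower.algebraMap_apply F F[X] (integralClosure F[X] E), hbP, ← C_eq_algebraMap, expandAt_C]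
    rfl
  · intro x y hxy
    have : b x = b y := hxy
    apply Subtype.ext
    apply ι.injective
    rw [← hb, this, hb]

end

end

section

open Polynomial

open scoped Classical in
/-- The valuation ring at infinity of `F(X)`. -/
noncomputable def inftyRing (F : Type*) [Field F] : Subring (RatFunc F) :=
  (RatFunc.inftyValuation F).valuationSubring.toSubring

section
variable {F : Type*} [Field F]

open scoped Classical in
theorem mem_inftyRing (r : RatFunc F) : r ∈ inftyRing F ↔ RatFunc.inftyValuation F r ≤ 1 := Iff.rfl

instance : IsIntegrallyClosed (inftyRing F) := by
  classical
  exact inferInstanceAs (IsIntegrallyClosed (RatFunc.inftyValuation F).valuationSubring)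

instance : IsFractionRing (inftyRing F) (RatFunc F) := by
  classical
  exact inferInstanceAs (IsFractionRing (RatFunc.inftyValuation F).valuationSubring (RatFunc F))

open scoped Classical in
theorem inftyValuation_polynomial {P : F[X]} (hP : P ≠ 0) :
    RatFunc.inftyValuation F (algebraMap F[X] (RatFunc F) P) = WithZero.exp (P.natDegree : ℤ) :=
  RatFunc.inftyValuation.polynomial F hP

theorem algebraMap_mem_inftyRing (c : F) : algebraMap F (RatFunc F) c ∈ inftyRing F := by
  classical
  rw [mem_inftyRing]
  by_cases hc : c = 0
  · simp [hc]
  · rw [IsScalarTower.algebraMap_apply F F[X] (RatFunc F), inftyValuation_polynomial]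
    · simp
    · simpa using hc

theorem inv_X_pow_mem_inftyRing (k : ℕ) : (RatFunc.X ^ k : RatFunc F)⁻¹ ∈ inftyRing F := by
  classical
  rw [mem_inftyRing, map_inv₀, map_pow, RatFunc.inftyValuation.X, ← WithZero.exp_nsmul,
    ← WithZero.exp_neg, ← WithZero.exp_zero,
    WithZero.exp_le_exp]
  simp

theorem natDegree_le_of_mem_inftyRing {P : F[X]} {k : ℕ}
    (h : (RatFunc.X ^ k : RatFunc F)⁻¹ * algebraMap F[X] (RatFunc F) P ∈ inftyRing F) :
    P.natDegree ≤ k := by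
  classical
  by_cases hP : P = 0
  · simp [hP]
  rw [mem_inftyRing, map_mul, map_inv₀, map_pow, RatFunc.inftyValuation.X, ← WithZero.exp_nsmul,
    ← WithZero.exp_neg, inftyValuation_polynomial hP, ← WithZero.exp_add,
    ← WithZero.exp_zero, WithZero.exp_le_exp] at h
  simp at h
  omega

/-- The endomorphism of `F(X)` induced by an endomorphism of `F`. -/
noncomputable def ratFuncMap (θ : F →+* F) : RatFunc F →+* RatFunc F :=
  IsFractionRing.lift (A := F[X]) (g := (algebraMap F[X] (RatFunc F)).comp (mapRingHom θ))
    ((IsFractionRing.injective F[X] (RatFunc F)).comp (map_injective θ θ.injective))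

theorem ratFuncMap_algebraMap (θ : F →+* F) (P : F[X]) :
    ratFuncMap θ (algebraMap F[X] (RatFunc F) P) = algebraMap F[X] (RatFunc F) (P.map θ) :=
  IsFractionRing.lift_algebraMap _ _

theorem ratFuncMap_mem_inftyRing (θ : F →+* F) {r : RatFunc F} (hr : r ∈ inftyRing F) :
    ratFuncMap θ r ∈ inftyRing F := by
  classical
  obtain ⟨P, R, hR, rfl⟩ := IsFractionRing.div_surjective (A := F[X]) r
  have hR0 : R ≠ 0 := nonZeroDivisors.ne_zero hR
  by_cases hP : P = 0
  · simp [hP, zero_mem]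
  rw [mem_inftyRing] at hr ⊢
  rw [map_div₀, ratFuncMap_algebraMap, ratFuncMap_algebraMap, map_div₀,
    inftyValuation_polynomial (by rwa [Ne, Polynomial.map_eq_zero]),
    inftyValuation_polynomial (by rwa [Ne, Polynomial.map_eq_zero]), natDegree_map, natDegree_map]
  rwa [map_div₀, inftyValuation_polynomial hP, inftyValuation_polynomial hR0] at hr

variable (E : Type*) [Field E] [Algebra (RatFunc F) E] [Algebra F[X] E]
  [IsScalarTower F[X] (RatFunc F) E] [Algebra F E] [IsScalarTower F F[X] E]

/-- Integral elements with poles of order at most `m` at infinity. -/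
noncomputable def poleFiltration (m : ℕ) : Submodule F (integralClosure F[X] E) where
  carrier := {a | IsIntegral (inftyRing F) (algebraMap (RatFunc F) E (RatFunc.X ^ m)⁻¹ * a)}
  add_mem' := by
    intro a b ha hb
    simp only [Set.mem_ofPred_eq, Subalgebra.coe_add, mul_add] at ha hb ⊢
    exact ha.add hb
  zero_mem' := by
    simp only [Set.mem_ofPred_eq, ZeroMemClass.coe_zero, mul_zero]
    exact isIntegral_zero
  smul_mem' := by
    intro c a ha
    simp only [Set.mem_ofPred_eq] at ha ⊢
    have h1 : ((c • a : integralClosure F[X] E) : E) =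
        algebraMap (inftyRing F) E ⟨_, algebraMap_mem_inftyRing c⟩ * a := by
      rw [Algebra.smul_def, Subalgebra.coe_mul]
      congr 1
      rw [IsScalarTower.algebraMap_apply (inftyRing F) (RatFunc F) E]
      change algebraMap F E c = algebraMap (RatFunc F) E (algebraMap F (RatFunc F) c)
      rw [IsScalarTower.algebraMap_apply F F[X] (RatFunc F),
        ← IsScalarTower.algebraMap_apply F[X] (RatFunc F) E,
        ← IsScalarTower.algebraMap_apply F F[X] E]
    rw [h1, mul_left_comm]
    exact isIntegral_algebraMap.mul ha

variable {E}

theorem mem_poleFiltration {m : ℕ} {a : integralClosure F[X] E} : a ∈ poleFiltration E m ↔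
    IsIntegral (inftyRing F) (algebraMap (RatFunc F) E (RatFunc.X ^ m)⁻¹ * a) := Iff.rfl

theorem mul_mem_poleFiltration (l m : ℕ) (a b : integralClosure F[X] E)
    (ha : a ∈ poleFiltration E l) (hb : b ∈ poleFiltration E m) :
    a * b ∈ poleFiltration E (l + m) := by
  rw [mem_poleFiltration] at *
  have h : algebraMap (RatFunc F) E (RatFunc.X ^ (l + m))⁻¹ * ((a * b : integralClosure F[X] E) : E) =
      (algebraMap (RatFunc F) E (RatFunc.X ^ l)⁻¹ * a) *
        (algebraMap (RatFunc F) E (RatFunc.X ^ m)⁻¹ * b) := by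
    rw [pow_add, mul_inv, map_mul, Subalgebra.coe_mul]
    ring
  rw [h]
  exact ha.mul hb

theorem one_mem_poleFiltration : (1 : integralClosure F[X] E) ∈ poleFiltration E 0 := by
  rw [mem_poleFiltration]
  simpa using isIntegral_one

theorem map_mem_poleFiltration (θ : F →+* F) (s : E →+* E)
    (hs : s.comp (algebraMap (RatFunc F) E) = (algebraMap (RatFunc F) E).comp (ratFuncMap θ))
    {m : ℕ} {a b : integralClosure F[X] E} (hb : (b : E) = s a)
    (ha : a ∈ poleFiltration E m) : b ∈ poleFiltration E m := by
  rw [mem_poleFiltration] at *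
  have h1 := ha.map_of_comp_eq ((ratFuncMap θ).restrict (inftyRing F) (inftyRing F)
    fun x hx => ratFuncMap_mem_inftyRing θ hx) s (by
      ext1 x
      exact (RingHom.congr_fun hs (x : RatFunc F)).symm)
  suffices h3 : algebraMap (RatFunc F) E (RatFunc.X ^ m)⁻¹ * (b : E) =
      s (algebraMap (RatFunc F) E (RatFunc.X ^ m)⁻¹ * a) by
    rw [h3]
    exact h1
  rw [map_mul, hb]
  congr 1
  have h2 := RingHom.congr_fun hs (RatFunc.X ^ m)⁻¹
  simp only [RingHom.comp_apply] at h2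
  rw [h2, map_inv₀ (ratFuncMap θ), map_pow, ← RatFunc.algebraMap_X, ratFuncMap_algebraMap, map_X]

theorem isIntegral_map (θ : F →+* F) (s : E →+* E)
    (hs : s.comp (algebraMap (RatFunc F) E) = (algebraMap (RatFunc F) E).comp (ratFuncMap θ))
    {a : E} (ha : IsIntegral F[X] a) : IsIntegral F[X] (s a) := by
  refine ha.map_of_comp_eq (mapRingHom θ) s (RingHom.ext fun P => ?_)
  have := RingHom.congr_fun hs (algebraMap F[X] (RatFunc F) P)
  simp only [RingHom.comp_apply, ratFuncMap_algebraMap] at this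
  simp only [RingHom.comp_apply, coe_mapRingHom]
  rw [IsScalarTower.algebraMap_apply F[X] (RatFunc F) E,
    IsScalarTower.algebraMap_apply F[X] (RatFunc F) E, this]

variable [FiniteDimensional (RatFunc F) E]

theorem exists_prod_eq_polynomial [IsGalois (RatFunc F) E] {m : ℕ} {a : integralClosure F[X] E}
    (ha : a ∈ poleFiltration E m) (ha0 : a ≠ 0) :
    ∃ P : F[X], P ≠ 0 ∧ P.natDegree ≤ Module.finrank (RatFunc F) E * m ∧
      algebraMap F[X] E P = ∏ σ : E ≃ₐ[RatFunc F] E, σ a := by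
  have h1 : IsIntegral F[X] (Algebra.norm (RatFunc F) (a : E)) := Algebra.isIntegral_norm _ a.2
  obtain ⟨P, hP⟩ := IsIntegrallyClosed.isIntegral_iff.1 h1
  have h2 := Algebra.isIntegral_norm (RatFunc F) (mem_poleFiltration.1 ha)
  obtain ⟨r, hr⟩ := IsIntegrallyClosed.isIntegral_iff.1 h2
  have hn : Algebra.norm (RatFunc F) (a : E) ≠ 0 := by
    rw [Algebra.norm_ne_zero_iff]
    simpa using ha0
  refine ⟨P, ?_, ?_, ?_⟩
  · rintro rfl
    exact hn (by rw [← hP, map_zero])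
  · apply natDegree_le_of_mem_inftyRing
    rw [map_mul, Algebra.norm_algebraMap, ← hP, inv_pow, ← pow_mul, mul_comm m] at hr
    rw [← hr]
    exact r.2
  · rw [IsScalarTower.algebraMap_apply F[X] (RatFunc F) E, hP, Algebra.norm_eq_prod_automorphisms]

theorem exists_mem_poleFiltration (b : E) : ∃ c : F[X], c ≠ 0 ∧ ∃ m, ∃ a : integralClosure F[X] E,
    (a : E) = c • b ∧ a ∈ poleFiltration E m := by
  classical
  have h1 : IsAlgebraic F[X] b :=
    (IsFractionRing.isAlgebraic_iff F[X] (RatFunc F) E).2 (Algebra.IsAlgebraic.isAlgebraic b)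
  obtain ⟨c, hc, hcb⟩ := h1.exists_integral_multiple
  refine ⟨c, hc, ?_⟩
  have h2 : IsAlgebraic (inftyRing F) (c • b) :=
    (IsFractionRing.isAlgebraic_iff (inftyRing F) (RatFunc F) E).2
      (Algebra.IsAlgebraic.isAlgebraic _)
  obtain ⟨y, hy, hyb⟩ := h2.exists_integral_multiple
  have hy' : (y : RatFunc F) ≠ 0 := by simpa using hy
  obtain ⟨m, hm⟩ : ∃ m : ℕ, (RatFunc.X ^ m : RatFunc F)⁻¹ * (y : RatFunc F)⁻¹ ∈ inftyRing F := by
    refine ⟨(- (y : RatFunc F).intDegree).toNat, ?_⟩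
    rw [mem_inftyRing, map_mul, map_inv₀, map_inv₀, map_pow, RatFunc.inftyValuation.X,
      RatFunc.inftyValuation_apply, RatFunc.inftyValuation_of_nonzero F hy',
      ← WithZero.exp_nsmul, ← WithZero.exp_neg, ← WithZero.exp_neg, ← WithZero.exp_add,
      ← WithZero.exp_zero, WithZero.exp_le_exp]
    simp
    omega
  refine ⟨m, ⟨c • b, hcb⟩, rfl, ?_⟩
  rw [mem_poleFiltration]
  have h3 := (isIntegral_algebraMap (R := inftyRing F) (A := E) (x := ⟨_, hm⟩)).mul hyb
  suffices h4 : algebraMap (RatFunc F) E (RatFunc.X ^ m)⁻¹ * (c • b) =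
      algebraMap (inftyRing F) E ⟨_, hm⟩ * y • c • b by
    change IsIntegral _ (algebraMap (RatFunc F) E (RatFunc.X ^ m)⁻¹ * (c • b))
    rw [h4]
    exact h3
  rw [Algebra.smul_def y, ← mul_assoc, IsScalarTower.algebraMap_apply (inftyRing F) (RatFunc F) E,
    IsScalarTower.algebraMap_apply (inftyRing F) (RatFunc F) E, ← map_mul]
  congr 2
  change _ = (RatFunc.X ^ m : RatFunc F)⁻¹ * (y : RatFunc F)⁻¹ * (y : RatFunc F)
  rw [mul_assoc, inv_mul_cancel₀ hy', mul_one]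

end

end

section

open Polynomial

section
variable {F : Type*} [Field F] {E : Type*} [Field E] [Algebra (RatFunc F) E] [Algebra F[X] E]
  [IsScalarTower F[X] (RatFunc F) E] [Algebra F E] [IsScalarTower F F[X] E]

theorem X_pow_mul_mem_poleFiltration {m k n : ℕ} (hn : m + k ≤ n) {a : integralClosure F[X] E}
    (ha : a ∈ poleFiltration E m) :
    algebraMap F[X] (integralClosure F[X] E) (X ^ k) * a ∈ poleFiltration E n := by
  rw [mem_poleFiltration] at *
  have hX : (RatFunc.X : RatFunc F) ≠ 0 := RatFunc.X_ne_zero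
  have h : algebraMap (RatFunc F) E (RatFunc.X ^ n)⁻¹ *
      ((algebraMap F[X] (integralClosure F[X] E) (X ^ k) * a : integralClosure F[X] E) : E) =
      algebraMap (inftyRing F) E ⟨_, inv_X_pow_mem_inftyRing (n - (m + k))⟩ *
        (algebraMap (RatFunc F) E (RatFunc.X ^ m)⁻¹ * a) := by
    rw [Subalgebra.coe_mul, ← mul_assoc, ← mul_assoc]
    congr 1
    rw [IsScalarTower.algebraMap_apply (inftyRing F) (RatFunc F) E, ← map_mul]
    change _ * algebraMap F[X] E (X ^ k) = algebraMap (RatFunc F) E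
      ((RatFunc.X ^ (n - (m + k)) : RatFunc F)⁻¹ * _)
    rw [IsScalarTower.algebraMap_apply F[X] (RatFunc F) E, ← map_mul]
    congr 1
    rw [map_pow, RatFunc.algebraMap_X]
    have : n = (n - (m + k)) + m + k := by omega
    conv_lhs => rw [this]
    rw [pow_add, pow_add]
    field_simp
  rw [h]
  exact isIntegral_algebraMap.mul ha

theorem linearIndependent_ratFunc_X_pow :
    LinearIndependent F (fun k : ℕ => (RatFunc.X : RatFunc F) ^ k) := by
  have h1 := (basisMonomials F).linearIndependent.map' (Algebra.linearMap F[X] (RatFunc F) |>.restrictScalars F)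
    (LinearMap.ker_eq_bot.2 (IsFractionRing.injective F[X] (RatFunc F)))
  have h2 : (fun k : ℕ => (RatFunc.X : RatFunc F) ^ k) =
      ((Algebra.linearMap F[X] (RatFunc F)).restrictScalars F) ∘ (basisMonomials F) := by
    funext k
    simp [← X_pow_eq_monomial]
  rw [h2]
  exact h1

theorem exists_finrank_poleFiltration_ge [FiniteDimensional (RatFunc F) E]
    (hfd : ∀ m, FiniteDimensional F (poleFiltration (F := F) E m)) :
    ∃ D, ∀ m, Module.finrank (RatFunc F) E * (m + 1) ≤
      Module.finrank F (poleFiltration (F := F) E m) + Module.finrank (RatFunc F) E * D := by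
  let b := Module.finBasis (RatFunc F) E
  have hst : IsScalarTower F (RatFunc F) E := IsScalarTower.of_algebraMap_eq fun x => by
    rw [IsScalarTower.algebraMap_apply F F[X] (RatFunc F),
        ← IsScalarTower.algebraMap_apply F[X] (RatFunc F) E,
        ← IsScalarTower.algebraMap_apply F F[X] E]
  choose c hc n a ha hV using fun i => exists_mem_poleFiltration (F := F) (b i)
  refine ⟨∑ i, n i, fun m => ?_⟩
  set D := ∑ i, n i with hD
  rcases lt_or_ge m D with hm | hm
  · exact le_add_left (Nat.mul_le_mul_left _ hm)
  have hli : LinearIndependent (RatFunc F) fun i => (a i : E) := by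
    have := b.linearIndependent.units_smul fun i =>
      Units.mk0 (algebraMap F[X] (RatFunc F) (c i)) (by simpa using hc i)
    convert this using 1
    funext i
    rw [ha]
    simp [Units.smul_def]
  have hli2 := linearIndependent_smul (linearIndependent_ratFunc_X_pow (F := F)) hli
  let v : Fin (m - D + 1) × Fin (Module.finrank (RatFunc F) E) → poleFiltration E m := fun x =>
    ⟨algebraMap F[X] (integralClosure F[X] E) (X ^ (x.1 : ℕ)) * a x.2,
      X_pow_mul_mem_poleFiltration (by
        have := Finset.single_le_sum (fun i _ => Nat.zero_le (n i)) (Finset.mem_univ x.2)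
        have := x.1.2
        omega) (hV x.2)⟩
  have hv : LinearIndependent F v := by
    let L : poleFiltration E m →ₗ[F] E :=
      ((integralClosure F[X] E).val.toLinearMap.restrictScalars F) ∘ₗ (poleFiltration E m).subtype
    apply LinearIndependent.of_comp L
    have := hli2.comp (fun x : Fin (m - D + 1) × Fin (Module.finrank (RatFunc F) E) =>
      ((x.1 : ℕ), x.2)) (by
        rintro ⟨x, y⟩ ⟨x', y'⟩ h
        simpa [Fin.ext_iff] using h)
    convert this using 1
    funext x
    simp only [L, v, Function.comp, Algebra.smul_def, LinearMap.comp_apply]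
    change algebraMap F[X] E (X ^ (x.1 : ℕ)) * (a x.2 : E) = _
    rw [IsScalarTower.algebraMap_apply F[X] (RatFunc F) E, map_pow, RatFunc.algebraMap_X]
  have h1 := hv.fintype_card_le_finrank
  rw [Fintype.card_prod, Fintype.card_fin, Fintype.card_fin] at h1
  have : m + 1 = (m - D + 1) + D := by omega
  rw [this]
  nlinarith

end

end

section

open Polynomial

section
variable {F : Type*} [Field F]

theorem separable_genericFiber [IsAlgClosed F] {Q : F[X]} (hQ : derivative Q ≠ 0) :
    (genericFiber Q).Separable := by
  have h1 : derivative (genericFiber Q) = (derivative Q).map (algebraMap F (RatFunc F)) := by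
    simp [genericFiber, derivative_map]
  rw [Polynomial.Separable, h1, (IsAlgClosed.splits (derivative Q)).eq_prod_roots, Polynomial.map_mul,
    Polynomial.map_multiset_prod, Multiset.map_map, map_C]
  apply IsCoprime.mul_right
  · have : IsUnit (C (algebraMap F (RatFunc F) (derivative Q).leadingCoeff)) := by simpa using hQ
    exact IsCoprime.of_isCoprime_of_dvd_right isCoprime_one_right this.dvd
  apply Multiset.prod_induction
  · exact fun a b => IsCoprime.mul_right
  · exact isCoprime_one_right
  · intro x hx
    obtain ⟨α, -, rfl⟩ := Multiset.mem_map.1 hx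
    rw [Function.comp_apply, Polynomial.map_sub, map_X, map_C]
    refine IsCoprime.symm ((irreducible_X_sub_C _).coprime_iff_not_dvd.2 fun h => ?_)
    rw [dvd_iff_isRoot, genericFiber, IsRoot.def, eval_sub, eval_C, eval_map_algebraMap, aeval_algebraMap_apply,
      sub_eq_zero] at h
    have h2 : algebraMap F[X] (RatFunc F) (C (aeval α Q)) = algebraMap F[X] (RatFunc F) X := by
      rw [RatFunc.algebraMap_X, ← h]
      rfl
    have h3 := congrArg natDegree (IsFractionRing.injective F[X] (RatFunc F) h2)
    simp at h3

theorem isGalois_genericFiber [IsAlgClosed F] {Q : F[X]} (hQ : derivative Q ≠ 0)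
    (E : Type*) [Field E] [Algebra (RatFunc F) E] [IsSplittingField (RatFunc F) E (genericFiber Q)] :
    IsGalois (RatFunc F) E :=
  IsGalois.of_separable_splitting_field (separable_genericFiber hQ)

theorem sum_rootMultiplicity_le (P : F[X]) (S : Finset F) :
    ∑ u ∈ S, P.rootMultiplicity u ≤ P.natDegree := by
  classical
  refine le_trans ?_ (card_roots' P)
  have h := Multiset.sum_count_eq_card (s := S) (m := P.roots.filter (· ∈ S)) (by simp)
  refine le_trans (le_of_eq ?_) (h.le.trans (Multiset.card_le_card (Multiset.filter_le _ _)))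
  refine Finset.sum_congr rfl fun u hu => ?_
  rw [Multiset.count_filter_of_pos hu, count_roots]

variable {E : Type*} [Field E] [Algebra (RatFunc F) E] [Algebra F[X] E]
  [IsScalarTower F[X] (RatFunc F) E] [Algebra F E] [IsScalarTower F F[X] E]
  [FiniteDimensional (RatFunc F) E] [IsGalois (RatFunc F) E]

/-- The Galois action on integral elements. -/
noncomputable def galInt (σ : E ≃ₐ[RatFunc F] E) :
    integralClosure F[X] E ≃ₐ[F[X]] integralClosure F[X] E :=
  galRestrict F[X] (RatFunc F) E (integralClosure F[X] E) σ

theorem coe_galInt (σ : E ≃ₐ[RatFunc F] E) (a : integralClosure F[X] E) :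
    (galInt σ a : E) = σ a :=
  algebraMap_galRestrict_apply F[X] σ a

theorem galInt_one (a : integralClosure F[X] E) :
    galInt (1 : E ≃ₐ[RatFunc F] E) a = a := Subtype.ext (by rw [coe_galInt]; rfl)

theorem exists_prod_galInt {m : ℕ} {a : integralClosure F[X] E}
    (ha : a ∈ poleFiltration E m) (ha0 : a ≠ 0) :
    ∃ P : F[X], P ≠ 0 ∧ P.natDegree ≤ Module.finrank (RatFunc F) E * m ∧
      algebraMap F[X] (integralClosure F[X] E) P = ∏ σ : E ≃ₐ[RatFunc F] E, galInt σ a := by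
  obtain ⟨P, h0, h1, h2⟩ := exists_prod_eq_polynomial ha ha0
  refine ⟨P, h0, h1, Subtype.ext ?_⟩
  change algebraMap F[X] E P = (integralClosure F[X] E).val (∏ σ : E ≃ₐ[RatFunc F] E, galInt σ a)
  rw [h2, map_prod]
  exact Finset.prod_congr rfl fun σ _ => (coe_galInt σ a).symm

theorem exists_coeff_ne_zero_of_mem_poleFiltration {u : F}
    {φ : integralClosure F[X] E →+* PowerSeries F}
    (hφ : ∀ P, φ (algebraMap F[X] _ P) = expandAt u P) {m : ℕ} {a : integralClosure F[X] E}
    (ha : a ∈ poleFiltration E m) (ha0 : a ≠ 0) :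
    ∃ k ≤ Module.finrank (RatFunc F) E * m, PowerSeries.coeff k (φ a) ≠ 0 := by
  obtain ⟨P, h0, h1, h2⟩ := exists_prod_galInt ha ha0
  by_contra! h
  have h3 : (PowerSeries.X ^ (Module.finrank (RatFunc F) E * m + 1) : PowerSeries F) ∣
      expandAt u P := by
    rw [← hφ, h2, map_prod]
    refine dvd_trans ?_ (Finset.dvd_prod_of_mem _ (Finset.mem_univ 1))
    rw [galInt_one]
    exact PowerSeries.X_pow_dvd_iff.2 fun k hk => h k (Nat.lt_succ_iff.1 hk)
  have h4 := le_rootMultiplicity_of_X_pow_dvd_expandAt _ h0 h3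
  have h5 := (sum_rootMultiplicity_le P {u})
  rw [Finset.sum_singleton] at h5
  omega

theorem ncard_zeros_le (S : Finset F) (φ : F → integralClosure F[X] E →+* PowerSeries F)
    (hφ : ∀ u ∈ S, ∀ P, φ u (algebraMap F[X] _ P) = expandAt u P) {m : ℕ}
    {a : integralClosure F[X] E} (ha : a ∈ poleFiltration E m) (ha0 : a ≠ 0) :
    {t : F × (E ≃ₐ[RatFunc F] E) | t.1 ∈ S ∧
      PowerSeries.constantCoeff (φ t.1 (galInt t.2 a)) = 0}.ncard ≤
        Module.finrank (RatFunc F) E * m := by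
  classical
  obtain ⟨P, h0, h1, h2⟩ := exists_prod_galInt ha ha0
  let Z : F → Finset (E ≃ₐ[RatFunc F] E) := fun u =>
    Finset.univ.filter fun τ => PowerSeries.constantCoeff (φ u (galInt τ a)) = 0
  have hZ : {t : F × (E ≃ₐ[RatFunc F] E) | t.1 ∈ S ∧
      PowerSeries.constantCoeff (φ t.1 (galInt t.2 a)) = 0} =
      ((S.sigma Z).map (Equiv.sigmaEquivProd F _).toEmbedding : Finset _) := by
    ext ⟨u, τ⟩
    simp [Z]
  rw [hZ, Set.ncard_coe_finset, Finset.card_map, Finset.card_sigma]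
  refine le_trans (Finset.sum_le_sum fun u hu => ?_) ((sum_rootMultiplicity_le P S).trans h1)
  apply le_rootMultiplicity_of_X_pow_dvd_expandAt _ h0
  rw [← hφ u hu, h2, map_prod, ← Finset.prod_const]
  refine dvd_trans ?_ (Finset.prod_dvd_prod_of_subset (Z u) _ _ (Finset.subset_univ _))
  refine Finset.prod_dvd_prod_of_dvd _ _ fun τ hτ => PowerSeries.X_dvd_iff.2 ?_
  simpa [Z] using hτ

end

end

section

open Polynomial

section
variable {F : Type*} [Field F] {E : Type*} [Field E] [Algebra (RatFunc F) E] [Algebra F[X] E]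
  [IsScalarTower F[X] (RatFunc F) E]

theorem ringHom_eq_of_comp_algebraMap_eq {L : Type*} [Field L] {f g : E →+* L}
    (Q : (RatFunc F)[X]) [IsSplittingField (RatFunc F) E Q]
    (h1 : ∀ P : F[X], f (algebraMap F[X] E P) = g (algebraMap F[X] E P))
    (h2 : ∀ z ∈ Q.rootSet E, f z = g z) : f = g := by
  have hK : f.comp (algebraMap (RatFunc F) E) = g.comp (algebraMap (RatFunc F) E) := by
    apply IsLocalization.ringHom_ext (nonZeroDivisors F[X])
    refine RingHom.ext fun P => ?_
    simp only [RingHom.comp_apply, ← IsScalarTower.algebraMap_apply]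
    exact h1 P
  refine RingHom.ext fun x => ?_
  have hx : x ∈ Algebra.adjoin (RatFunc F) (Q.rootSet E) := by
    rw [IsSplittingField.adjoin_rootSet]
    trivial
  induction hx using Algebra.adjoin_induction with
  | mem x hx => exact h2 x hx
  | algebraMap r => exact RingHom.congr_fun hK r
  | add x y _ _ hx hy => rw [map_add, map_add, hx, hy]
  | mul x y _ _ hx hy => rw [map_mul, map_mul, hx, hy]

/-- `s` extends the endomorphism of `F[X]` acting on coefficients through `θ`. -/
def IsCoeffLift (θ : F →+* F) (s : E →+* E) : Prop :=
  ∀ P : F[X], s (algebraMap F[X] E P) = algebraMap F[X] E (P.map θ)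

theorem IsCoeffLift.comp_algebraMap {θ : F →+* F} {s : E →+* E} (hs : IsCoeffLift θ s) :
    s.comp (algebraMap (RatFunc F) E) = (algebraMap (RatFunc F) E).comp (ratFuncMap θ) := by
  apply IsLocalization.ringHom_ext (nonZeroDivisors F[X])
  refine RingHom.ext fun P => ?_
  simp only [RingHom.comp_apply, ← IsScalarTower.algebraMap_apply, ratFuncMap_algebraMap]
  exact hs P

theorem exists_isCoeffLift (θ : F →+* F) {Q : F[X]} (hQ : Q.map θ = Q)
    [IsSplittingField (RatFunc F) E (genericFiber Q)] : ∃ s : E →+* E, IsCoeffLift θ s := by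
  have h0 : (ratFuncMap θ).comp (algebraMap F (RatFunc F)) =
      (algebraMap F (RatFunc F)).comp θ := RingHom.ext fun x => by
    have := ratFuncMap_algebraMap θ (C x)
    rw [map_C] at this
    exact this
  have h1 : (genericFiber Q).map (ratFuncMap θ) = genericFiber Q := by
    rw [genericFiber, Polynomial.map_sub, Polynomial.map_map, h0, ← Polynomial.map_map, hQ, map_C,
      ← RatFunc.algebraMap_X, ratFuncMap_algebraMap, map_X]
  obtain ⟨s, hs⟩ := exists_ringHom_of_splits (E := E) (genericFiber Q)
    ((algebraMap (RatFunc F) E).comp (ratFuncMap θ)) (by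
      rw [← Polynomial.map_map, h1]
      exact IsSplittingField.splits E (genericFiber Q))
  refine ⟨s, fun P => ?_⟩
  have := RingHom.congr_fun hs (algebraMap F[X] (RatFunc F) P)
  simpa only [RingHom.comp_apply, ← IsScalarTower.algebraMap_apply, ratFuncMap_algebraMap] using this

theorem IsCoeffLift.pow {θ : F →+* F} {s : E →+* E} (hs : IsCoeffLift θ s) (n : ℕ) :
    IsCoeffLift (θ ^ n) (s ^ n) := by
  induction n with
  | zero => exact fun P => by simp [RingHom.one_def]
  | succ n ih =>
    intro P
    rw [pow_succ, pow_succ, RingHom.mul_def, RingHom.mul_def, RingHom.comp_apply, hs, ih,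
      Polynomial.map_map]

theorem IsCoeffLift.map_root {θ : F →+* F} {s : E →+* E} (hs : IsCoeffLift θ s) {Q : F[X]}
    (hQ : Q.map θ = Q) {z : E} (hz : z ∈ (genericFiber Q).rootSet E) :
    s z ∈ (genericFiber Q).rootSet E := by
  have h0 : genericFiber Q ≠ 0 := by
    rintro h
    simp [h] at hz
  rw [mem_rootSet_of_ne h0] at hz ⊢
  have h1 : ∀ z : E, aeval z (genericFiber Q) =
      (Q.map ((algebraMap F[X] E).comp C)).eval z - algebraMap F[X] E X := fun z => by
    rw [genericFiber, map_sub, aeval_C, ← RatFunc.algebraMap_X, ← IsScalarTower.algebraMap_apply,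
      aeval_def, ← eval_map, Polynomial.map_map]
    congr 3
    refine RingHom.ext fun x => ?_
    change algebraMap (RatFunc F) E (algebraMap F[X] (RatFunc F) (C x)) = _
    rw [← IsScalarTower.algebraMap_apply]
    rfl
  rw [h1] at hz ⊢
  have h2 := congrArg s hz
  rw [map_zero, map_sub, hs, map_X, eval_map, hom_eval₂] at h2
  rw [← h2, ← hQ, Polynomial.map_map, eval_map, hQ]
  congr 2
  refine RingHom.ext fun x => ?_
  simpa using (hs (C x)).symm

/-- A power of the lift fixes the roots. -/
theorem IsCoeffLift.exists_pow_fixes {θ : F →+* F} {s : E →+* E} (hs : IsCoeffLift θ s) {Q : F[X]}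
    (hQ : Q.map θ = Q) : ∃ N : ℕ, 1 ≤ N ∧ ∀ n, N ∣ n → ∀ z ∈ (genericFiber Q).rootSet E,
      (s ^ n) z = z := by
  classical
  let R := (genericFiber Q).rootSet E
  let f : R → R := fun z => ⟨s z, hs.map_root hQ z.2⟩
  have hf : Function.Injective f := fun z w h => by
    exact Subtype.ext (s.injective (Subtype.ext_iff.1 h))
  have : Finite R := (rootSet_finite (genericFiber Q) E).to_subtype
  let e : Equiv.Perm R := Equiv.ofBijective f (Finite.injective_iff_bijective.1 hf)
  have he : ∀ n, ∀ z : R, (((e ^ n) z : R) : E) = (s ^ n) z := by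
    intro n
    induction n with
    | zero => simp
    | succ n ih =>
      intro z
      rw [pow_succ, pow_succ, Equiv.Perm.mul_apply, ih, RingHom.mul_def]
      rfl
  have : Fintype R := Fintype.ofFinite R
  refine ⟨orderOf e, orderOf_pos e, fun n hn z hz => ?_⟩
  have := he n ⟨z, hz⟩
  rw [orderOf_dvd_iff_pow_eq_one.1 hn] at this
  exact this.symm

theorem IsCoeffLift.comm {θ : F →+* F} {s : E →+* E} (hs : IsCoeffLift θ s) {Q : F[X]}
    [IsSplittingField (RatFunc F) E (genericFiber Q)]
    (hfix : ∀ z ∈ (genericFiber Q).rootSet E, s z = z) (σ : E ≃ₐ[RatFunc F] E) (x : E) :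
    s (σ x) = σ (s x) := by
  have h0 : ∀ P : F[X], σ (algebraMap F[X] E P) = algebraMap F[X] E P := fun P => by
    rw [IsScalarTower.algebraMap_apply F[X] (RatFunc F) E, AlgEquiv.commutes]
  have := ringHom_eq_of_comp_algebraMap_eq (f := s.comp (σ : E →+* E))
    (g := (σ : E →+* E).comp s) (genericFiber Q) (fun P => by
      simp [h0, hs P]) (fun z hz => by
      have h1 : σ z ∈ (genericFiber Q).rootSet E := by
        have h2 : genericFiber Q ≠ 0 := by
          rintro h
          simp [h] at hz
        rw [mem_rootSet_of_ne h2] at hz ⊢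
        rw [aeval_algHom_apply, hz, map_zero]
      simp [hfix _ h1, hfix _ hz])
  exact RingHom.congr_fun this x

variable [Algebra F E] [IsScalarTower F F[X] E]
  [FiniteDimensional (RatFunc F) E] [IsGalois (RatFunc F) E]

theorem exists_galInt_comp_eq {R : Type*} [CommRing R] [IsDomain R]
    (f g : integralClosure F[X] E →+* R) (hf : Function.Injective f) (hg : Function.Injective g)
    (hfg : ∀ P, f (algebraMap F[X] _ P) = g (algebraMap F[X] _ P)) :
    ∃ σ : E ≃ₐ[RatFunc F] E, ∀ a, f a = g (galInt σ a) := by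
  have : IsFractionRing (integralClosure F[X] E) E :=
    integralClosure.isFractionRing_of_finite_extension (RatFunc F) E
  have hi := IsFractionRing.injective R (FractionRing R)
  let f' : E →+* FractionRing R := IsFractionRing.lift (A := integralClosure F[X] E)
    (g := (algebraMap R (FractionRing R)).comp f) (hi.comp hf)
  let g' : E →+* FractionRing R := IsFractionRing.lift (A := integralClosure F[X] E)
    (g := (algebraMap R (FractionRing R)).comp g) (hi.comp hg)
  have hf' : ∀ a : integralClosure F[X] E, f' a = algebraMap R (FractionRing R) (f a) :=
    fun a => IsFractionRing.lift_algebraMap _ _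
  have hg' : ∀ a : integralClosure F[X] E, g' a = algebraMap R (FractionRing R) (g a) :=
    fun a => IsFractionRing.lift_algebraMap _ _
  obtain ⟨σ, hσ⟩ := exists_algEquiv_comp_eq (K := RatFunc F) f' g' (by
    apply IsLocalization.ringHom_ext (nonZeroDivisors F[X])
    refine RingHom.ext fun P => ?_
    simp only [RingHom.comp_apply, ← IsScalarTower.algebraMap_apply]
    have h1 := hf' (algebraMap F[X] _ P)
    have h2 := hg' (algebraMap F[X] _ P)
    rw [hfg, ← h2] at h1
    exact h1)
  refine ⟨σ, fun a => hi ?_⟩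
  rw [← hf', ← hg', hσ, coe_galInt]

end

end

section

open Polynomial

theorem norm_sum_classFunction_sub_le {G α : Type*} [Group G] [Fintype G] [DecidableEq G]
    (S : Finset α) (σ : α → G) (h : G → ℂ) (hh : ∀ s t, h (t⁻¹ * s * t) = h s) {q c δ M : ℝ}
    (hM : ∀ s, ‖h s‖ ≤ M) (hcq : q ≤ c) (hδ0 : 0 ≤ δ) (hS : q ≤ S.card + δ)
    (hT : ∀ s : G, (((S ×ˢ (Finset.univ : Finset G)).filter
      fun t => t.2⁻¹ * σ t.1 * t.2 = s).card : ℝ) ≤ c) :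
    ‖∑ u ∈ S, h (σ u) - q * ((∑ s, h s) / Fintype.card G)‖ ≤
      Fintype.card G * ((c - q) + δ) * M := by
  set T : G → Finset (α × G) := fun s => (S ×ˢ (Finset.univ : Finset G)).filter
      fun t => t.2⁻¹ * σ t.1 * t.2 = s with hTdef
  have hM0 : 0 ≤ M := (norm_nonneg _).trans (hM 1)
  set g : ℝ := (Fintype.card G : ℝ) with hg
  have hg0 : 0 < g := by simp [hg, Fintype.card_pos]
  have hsum : ∀ f : G → ℂ, ∑ s, (f s) * ((T s).card : ℂ) =
      ∑ u ∈ S, ∑ t : G, f (t⁻¹ * σ u * t) := by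
    intro f
    rw [← Finset.sum_product', ← Finset.sum_fiberwise (S ×ˢ (Finset.univ : Finset G))
      (fun t => t.2⁻¹ * σ t.1 * t.2)]
    refine Finset.sum_congr rfl fun s _ => ?_
    rw [Finset.sum_congr rfl (g := fun _ => f s) (by
      intro t ht
      rw [(Finset.mem_filter.1 ht).2]), Finset.sum_const, nsmul_eq_mul, mul_comm]
  have h1 : ∑ s, h s * ((T s).card : ℂ) = g * ∑ u ∈ S, h (σ u) := by
    rw [hsum]
    simp_rw [hh, Finset.sum_const, Finset.card_univ, nsmul_eq_mul, ← Finset.mul_sum]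
    simp [hg]
  have h2 : ∑ s, ((T s).card : ℝ) = g * S.card := by
    have := hsum fun _ => 1
    simp only [one_mul, Finset.sum_const, Finset.card_univ, nsmul_eq_mul, mul_one] at this
    have h3 : ((∑ s, ((T s).card : ℝ) : ℝ) : ℂ) = ((S.card * g : ℝ) : ℂ) := by
      push_cast
      rw [this]
      simp [hg]
    rw [Complex.ofReal_inj.1 h3, mul_comm]
  have h3 : ∀ s, |((T s).card : ℝ) - q| ≤ g * ((c - q) + δ) := by
    intro s
    have hg1 : (1 : ℝ) ≤ g := by
      have := Fintype.card_pos (α := G)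
      rw [hg]
      exact_mod_cast this
    rw [abs_le]
    constructor
    · classical
      have h4 := Finset.add_sum_erase Finset.univ (fun s => ((T s).card : ℝ)) (Finset.mem_univ s)
      have h5 : ∑ s ∈ Finset.univ.erase s, ((T s).card : ℝ) ≤ ∑ s' ∈ Finset.univ.erase s, c :=
        Finset.sum_le_sum fun s _ => hT s
      rw [Finset.sum_const, Finset.card_erase_of_mem (Finset.mem_univ s), Finset.card_univ,
        nsmul_eq_mul, Nat.cast_sub Fintype.card_pos] at h5
      rw [h2] at h4
      simp only [Nat.cast_one, ← hg] at h4 h5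
      nlinarith
    · have := hT s
      nlinarith
  have h4 : ∑ u ∈ S, h (σ u) - q * ((∑ s, h s) / Fintype.card G) =
      (∑ s, h s * (((T s).card : ℝ) - q : ℝ)) / g := by
    have : (g : ℂ) ≠ 0 := by exact_mod_cast hg0.ne'
    push_cast
    simp_rw [mul_sub]
    rw [Finset.sum_sub_distrib, h1, ← Finset.sum_mul]
    have h6 : ((Fintype.card G : ℕ) : ℂ) = (g : ℂ) := by simp [hg]
    rw [h6]
    field_simp
  rw [h4, norm_div, Complex.norm_real, Real.norm_of_nonneg hg0.le, div_le_iff₀ hg0]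
  refine (norm_sum_le _ _).trans ?_
  have h5 : ∀ s ∈ Finset.univ, ‖h s * (((T s).card : ℝ) - q : ℝ)‖ ≤ M * (g * ((c - q) + δ)) := by
    intro s _
    rw [norm_mul, Complex.norm_real]
    exact mul_le_mul (hM s) (h3 s) (norm_nonneg _) hM0
  refine (Finset.sum_le_sum h5).trans (le_of_eq ?_)
  rw [Finset.sum_const, Finset.card_univ, nsmul_eq_mul, ← hg]
  ring

section
variable {F : Type*} [Field F] {E : Type*} [Field E] [Algebra (RatFunc F) E] [Algebra F[X] E]
  [IsScalarTower F[X] (RatFunc F) E] [Algebra F E] [IsScalarTower F F[X] E]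

/-- The restriction of a coefficient lift to integral elements. -/
noncomputable def IsCoeffLift.restrictInt {θ : F →+* F} {s : E →+* E} (hs : IsCoeffLift θ s) :
    integralClosure F[X] E →+* integralClosure F[X] E where
  toFun a := ⟨s a, isIntegral_map θ s hs.comp_algebraMap a.2⟩
  map_one' := Subtype.ext (map_one s)
  map_zero' := Subtype.ext (map_zero s)
  map_add' a b := Subtype.ext (map_add s (a : E) b)
  map_mul' a b := Subtype.ext (map_mul s (a : E) b)

theorem IsCoeffLift.coe_restrictInt {θ : F →+* F} {s : E →+* E} (hs : IsCoeffLift θ s)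
    (a : integralClosure F[X] E) : (hs.restrictInt a : E) = s a := rfl

variable [FiniteDimensional (RatFunc F) E] [IsGalois (RatFunc F) E]

theorem galInt_mul (σ τ : E ≃ₐ[RatFunc F] E) (a : integralClosure F[X] E) :
    galInt (σ * τ) a = galInt σ (galInt τ a) :=
  Subtype.ext (by rw [coe_galInt, coe_galInt, coe_galInt]; rfl)

theorem IsCoeffLift.exists_frobenius_element {θ : F →+* F} {s : E →+* E} (hs : IsCoeffLift θ s)
    {u : F} (hu : θ u = u) {φ : integralClosure F[X] E →+* PowerSeries F}
    (hφ : Function.Injective φ) (hφu : ∀ P, φ (algebraMap F[X] _ P) = expandAt u P) :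
    ∃ σ : E ≃ₐ[RatFunc F] E, ∀ a, θ (PowerSeries.constantCoeff (φ a)) =
      PowerSeries.constantCoeff (φ (hs.restrictInt (galInt σ a))) := by
  obtain ⟨σ, hσ⟩ := exists_galInt_comp_eq ((PowerSeries.map θ).comp φ) (φ.comp hs.restrictInt)
    ((PowerSeries.map_injective θ θ.injective).comp hφ)
    (hφ.comp fun a b h => Subtype.ext (s.injective (Subtype.ext_iff.1 h))) (by
      intro P
      have h1 : hs.restrictInt (algebraMap F[X] _ P) = algebraMap F[X] _ (P.map θ) :=
        Subtype.ext (hs P)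
      rw [RingHom.comp_apply, RingHom.comp_apply, h1, hφu, hφu, expandAt_apply, expandAt_apply,
        ← polynomial_map_coe, map_taylor, hu])
  refine ⟨σ, fun a => ?_⟩
  have := congrArg PowerSeries.constantCoeff (hσ a)
  rw [RingHom.comp_apply, RingHom.comp_apply] at this
  rw [← this, ← PowerSeries.coeff_zero_eq_constantCoeff_apply,
    ← PowerSeries.coeff_zero_eq_constantCoeff_apply, PowerSeries.coeff_map]

theorem card_frobenius_conj_le [IsAlgClosed F] (p : ℕ) [Fact p.Prime] [CharP F p] {D k n : ℕ}
    (hn : n = 2 * k)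
    (hD : ∀ m, Module.finrank (RatFunc F) E * (m + 1) ≤
      Module.finrank F (poleFiltration (F := F) E m) + Module.finrank (RatFunc F) E * D)
    (hk : (Module.finrank (RatFunc F) E * D + 1) * (Module.finrank (RatFunc F) E * D) +
      2 * (Module.finrank (RatFunc F) E * D) + 3 ≤ p ^ k)
    {s : E →+* E} (hs : IsCoeffLift (iterateFrobenius F p n) s)
    (hcomm : ∀ (σ : E ≃ₐ[RatFunc F] E) x, s (σ x) = σ (s x))
    (S : Finset F) (φ : F → integralClosure F[X] E →ₐ[F] PowerSeries F)
    (hφ : ∀ u ∈ S, ∀ P, φ u (algebraMap F[X] _ P) = expandAt u P)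
    (f : F → E ≃ₐ[RatFunc F] E) (hf : ∀ u ∈ S, ∀ a, (PowerSeries.constantCoeff (φ u a)) ^ p ^ n =
      PowerSeries.constantCoeff (φ u (hs.restrictInt (galInt (f u) a))))
    [DecidableEq (E ≃ₐ[RatFunc F] E)] (τ : E ≃ₐ[RatFunc F] E) :
    ((S ×ˢ (Finset.univ : Finset (E ≃ₐ[RatFunc F] E))).filter
      fun t => t.2⁻¹ * f t.1 * t.2 = τ).card ≤
      (p ^ k) ^ 2 + (2 * (Module.finrank (RatFunc F) E * D) + 2) * p ^ k := by
  rcases S.eq_empty_or_nonempty with rfl | ⟨u₀, hu₀⟩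
  · simp
  have hq : p ^ n = (p ^ k) ^ 2 := by rw [hn, ← pow_mul, mul_comm]
  refine card_le_of_stepanov p (fun m => poleFiltration (F := F) E m)
    (fun l m a ha b hb => mul_mem_poleFiltration l m a b ha hb) one_mem_poleFiltration (φ u₀) (Module.finrank (RatFunc F) E) D Module.finrank_pos
    (fun m a ha ha0 => exists_coeff_ne_zero_of_mem_poleFiltration
      (φ := (φ u₀ : integralClosure F[X] E →+* PowerSeries F)) (hφ u₀ hu₀) ha ha0) hD k hk
    ((galInt τ : integralClosure F[X] E →+* integralClosure F[X] E).comp hs.restrictInt)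
    (fun m a ha => ?_) _ (fun t => (PowerSeries.constantCoeff.comp
      (φ t.1 : integralClosure F[X] E →+* PowerSeries F)).comp
        (galInt t.2 : integralClosure F[X] E →+* integralClosure F[X] E)) (fun m a ha ha0 => ?_)
    (fun t ht a => ?_)
  · have h1 : IsCoeffLift (F := F) (iterateFrobenius F p n) ((τ : E →+* E).comp s) := fun P => by
      rw [RingHom.comp_apply, hs]
      change τ _ = _
      rw [IsScalarTower.algebraMap_apply F[X] (RatFunc F) E, AlgEquiv.commutes]
    refine map_mem_poleFiltration (iterateFrobenius F p n) _ h1.comp_algebraMap ?_ ha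
    rw [RingHom.comp_apply]
    change (galInt τ (hs.restrictInt a) : E) = _
    rw [coe_galInt]
    rfl
  · refine le_trans (Set.ncard_le_ncard ?_ ?_) (ncard_zeros_le S
      (fun u => (φ u : integralClosure F[X] E →+* PowerSeries F)) hφ ha ha0)
    · rintro t ⟨ht, h0⟩
      exact ⟨(Finset.mem_product.1 (Finset.mem_filter.1 ht).1).1, h0⟩
    · exact (S ×ˢ Finset.univ).finite_toSet.subset fun t ht =>
        Finset.mem_coe.2 (Finset.mem_product.2 ⟨ht.1, Finset.mem_univ _⟩)
  · obtain ⟨h1, h2⟩ := Finset.mem_filter.1 ht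
    rw [← hq]
    change (PowerSeries.constantCoeff (φ t.1 (galInt t.2 a))) ^ p ^ n =
      PowerSeries.constantCoeff (φ t.1 (galInt t.2 (galInt τ (hs.restrictInt a))))
    rw [hf t.1 (Finset.mem_product.1 h1).1, ← h2]
    congr 2
    apply Subtype.ext
    rw [hs.coe_restrictInt]
    rw [← galInt_mul, ← galInt_mul, coe_galInt, coe_galInt, hs.coe_restrictInt, hcomm, ← mul_assoc,
      ← mul_assoc, mul_inv_cancel, one_mul]

end

end

section

open Polynomial

section
variable {F : Type*} [Field F] [IsAlgClosed F]

theorem separable_sub_C_of_roots {Q : F[X]} (hQ : derivative Q ≠ 0) {u : F}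
    (hu : ∀ α ∈ (derivative Q).roots, Q.eval α ≠ u) : (Q - C u).Separable := by
  have h1 : derivative (Q - C u) = derivative Q := by simp
  rw [Polynomial.Separable, h1, (IsAlgClosed.splits (derivative Q)).eq_prod_roots]
  apply IsCoprime.mul_right
  · have : IsUnit (C (derivative Q).leadingCoeff) := by simpa using hQ
    exact IsCoprime.of_isCoprime_of_dvd_right isCoprime_one_right this.dvd
  apply Multiset.prod_induction
  · exact fun a b => IsCoprime.mul_right
  · exact isCoprime_one_right
  · intro x hx
    obtain ⟨α, hα, rfl⟩ := Multiset.mem_map.1 hx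
    refine IsCoprime.symm ((irreducible_X_sub_C _).coprime_iff_not_dvd.2 fun h => ?_)
    rw [dvd_iff_isRoot, IsRoot.def, eval_sub, eval_C, sub_eq_zero] at h
    exact hu α hα h

theorem card_fixed_roots (p : ℕ) [Fact p.Prime] [CharP F p] {n : ℕ} (hn : n ≠ 0) [DecidableEq F] :
    (X ^ p ^ n - X : F[X]).roots.toFinset.card = p ^ n ∧
      ∀ u, u ∈ (X ^ p ^ n - X : F[X]).roots.toFinset ↔ u ^ p ^ n = u := by
  have hp := (Fact.out : p.Prime).one_lt
  have hd := FiniteField.X_pow_card_pow_sub_X_natDegree_eq F hn hp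
  have h0 : (X ^ p ^ n - X : F[X]) ≠ 0 := FiniteField.X_pow_card_pow_sub_X_ne_zero F hn hp
  constructor
  · rw [Multiset.toFinset_card_of_nodup
      (nodup_roots (galois_poly_separable p _ (dvd_pow_self p hn)))]
    refine Eq.trans ?_ hd
    exact ((IsAlgClosed.splits (X ^ p ^ n - X : F[X])).natDegree_eq_card_roots).symm
  · intro u
    rw [Multiset.mem_toFinset, mem_roots h0, IsRoot.def, eval_sub, eval_pow, eval_X, sub_eq_zero]

theorem card_good_points (p : ℕ) [Fact p.Prime] [CharP F p] {n : ℕ} (hn : n ≠ 0) {Q : F[X]}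
    (hQ : derivative Q ≠ 0) {S : Finset F}
    (hS : ∀ u, u ∈ S ↔ u ^ p ^ n = u ∧ (Q - C u).Separable) :
    p ^ n ≤ S.card + Q.natDegree ∧ S.card ≤ p ^ n := by
  classical
  obtain ⟨h1, h2⟩ := card_fixed_roots (F := F) p hn
  constructor
  · have h3 : (X ^ p ^ n - X : F[X]).roots.toFinset ⊆
        S ∪ ((derivative Q).roots.map fun α => Q.eval α).toFinset := by
      intro u hu
      rw [Finset.mem_union, or_iff_not_imp_right]
      intro h
      refine (hS u).2 ⟨(h2 u).1 hu, separable_sub_C_of_roots hQ fun α hα h' => h ?_⟩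
      rw [Multiset.mem_toFinset]
      exact Multiset.mem_map.2 ⟨α, hα, h'⟩
    rw [← h1]
    refine (Finset.card_le_card h3).trans ((Finset.card_union_le _ _).trans ?_)
    gcongr
    refine (Multiset.toFinset_card_le _).trans ?_
    rw [Multiset.card_map]
    exact (card_roots' _).trans ((natDegree_derivative_le Q).trans (Nat.sub_le _ _))
  · rw [← h1]
    exact Finset.card_le_card fun u hu => (h2 u).2 ((hS u).1 hu).1

variable {E : Type*} [Field E] [Algebra (RatFunc F) E] [Algebra F[X] E]
  [IsScalarTower F[X] (RatFunc F) E] [Algebra F E] [IsScalarTower F F[X] E]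
  [FiniteDimensional (RatFunc F) E] [IsGalois (RatFunc F) E]

theorem finiteDimensional_poleFiltration {u : F}
    {φ : integralClosure F[X] E →ₐ[F] PowerSeries F}
    (hφ : ∀ P, φ (algebraMap F[X] _ P) = expandAt u P) (m : ℕ) :
    FiniteDimensional F (poleFiltration (F := F) E m) :=
  (finrank_le_of_coeff_ne_zero (poleFiltration (F := F) E m) φ.toLinearMap
    (Module.finrank (RatFunc F) E * m) fun a ha ha0 =>
      exists_coeff_ne_zero_of_mem_poleFiltration
        (φ := (φ : integralClosure F[X] E →+* PowerSeries F)) hφ ha ha0).1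

theorem exists_good_point {Q : F[X]} (hQ : derivative Q ≠ 0) : ∃ u, (Q - C u).Separable := by
  classical
  obtain ⟨u, hu⟩ := Infinite.exists_notMem_finset ((derivative Q).roots.map fun α => Q.eval α).toFinset
  refine ⟨u, separable_sub_C_of_roots hQ fun α hα hαe => hu ?_⟩
  rw [Multiset.mem_toFinset]
  exact Multiset.mem_map.2 ⟨α, hα, hαe⟩

/-- Square-root equidistribution of Frobenius elements for the splitting field of `Q - X`. -/
theorem exists_frobenius_equidistribution (p : ℕ) [Fact p.Prime] [CharP F p] (Q : F[X])
    (hQm : Q.Monic) (hQ' : derivative Q ≠ 0) (hQF : Q.map (frobenius F p) = Q)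
    [IsSplittingField (RatFunc F) E (genericFiber Q)] :
    ∃ N₀ : ℕ, 1 ≤ N₀ ∧ ∃ B : ℝ, 0 ≤ B ∧ ∀ n, n ≠ 0 → N₀ ∣ n →
      ∀ S : Finset F, (∀ u, u ∈ S ↔ u ^ p ^ n = u ∧ (Q - C u).Separable) →
      ∃ (f : F → E ≃ₐ[RatFunc F] E) (e : F → integralClosure F[X] E →ₐ[F] F),
        (∀ u ∈ S, e u (algebraMap F[X] _ X) = u ∧
          ∀ z : integralClosure F[X] E, (z : E) ∈ (genericFiber Q).rootSet E →
            (e u z) ^ p ^ n = e u (galInt (f u) z)) ∧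
        ∀ h : (E ≃ₐ[RatFunc F] E) → ℂ, (∀ σ τ, h (τ⁻¹ * σ * τ) = h σ) → ∀ M,
          (∀ σ, ‖h σ‖ ≤ M) →
          ‖∑ u ∈ S, h (f u) - (p : ℝ) ^ n *
            ((∑ σ, h σ) / Fintype.card (E ≃ₐ[RatFunc F] E))‖ ≤ B * √((p : ℝ) ^ n) * M := by
  classical
  have hp := (Fact.out : p.Prime)
  have hd : 0 < Q.natDegree := by
    rw [Nat.pos_iff_ne_zero]
    intro h
    exact hQ' (derivative_of_natDegree_zero h)
  obtain ⟨u₀, hu₀⟩ := exists_good_point hQ'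
  obtain ⟨φ₀, -, hφ₀⟩ := exists_integral_expansion (E := E) u₀ Q hQm hd hu₀
  obtain ⟨D, hD⟩ := exists_finrank_poleFiltration_ge (F := F) (E := E)
    (finiteDimensional_poleFiltration hφ₀)
  obtain ⟨s, hs⟩ := exists_isCoeffLift (E := E) (frobenius F p) hQF
  obtain ⟨N, hN1, hN⟩ := hs.exists_pow_fixes hQF
  set gD := Module.finrank (RatFunc F) E * D with hgD
  set K := (gD + 1) * gD + 2 * gD + 3 with hK
  set g := Fintype.card (E ≃ₐ[RatFunc F] E) with hg
  refine ⟨N * (2 * K), by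
    have : 1 ≤ 2 * K := by omega
    exact Nat.one_le_iff_ne_zero.2 (by positivity), g * ((2 * gD + 2) + Q.natDegree),
    by positivity, ?_⟩
  intro n hn0 hNn S hS
  obtain ⟨c, rfl⟩ := hNn
  set k := N * K * c with hkdef
  have hn : N * (2 * K) * c = 2 * k := by rw [hkdef]; ring
  have hk0 : k ≠ 0 := by omega
  have hKk : K ≤ p ^ k := by
    refine le_trans ?_ (Nat.lt_pow_self hp.one_lt).le
    exact Nat.le_of_dvd (Nat.pos_of_ne_zero hk0) ⟨N * c, by rw [hkdef]; ring⟩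
  set n := N * (2 * K) * c with hndef
  have hsn : IsCoeffLift (iterateFrobenius F p n) (s ^ n) := by
    rw [iterateFrobenius_eq_pow]
    exact hs.pow n
  have hfix := hN n ⟨2 * K * c, by rw [hndef]; ring⟩
  have hcomm := hsn.comm (Q := Q) hfix
  have hex : ∀ u, ∃ φ : integralClosure F[X] E →ₐ[F] PowerSeries F, u ∈ S →
      Function.Injective φ ∧ ∀ P : F[X], φ (algebraMap F[X] _ P) = expandAt u P := fun u => by
    by_cases hu : u ∈ S
    · obtain ⟨φ, hφ⟩ := exists_integral_expansion (E := E) u Q hQm hd ((hS u).1 hu).2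
      exact ⟨φ, fun _ => hφ⟩
    · exact ⟨φ₀, fun h => absurd h hu⟩
  choose φ hφ using hex
  have hex2 : ∀ u, ∃ σ : E ≃ₐ[RatFunc F] E, u ∈ S → ∀ a,
      (PowerSeries.constantCoeff (φ u a)) ^ p ^ n =
        PowerSeries.constantCoeff (φ u (hsn.restrictInt (galInt σ a))) := fun u => by
    by_cases hu : u ∈ S
    · obtain ⟨σ, hσ⟩ := hsn.exists_frobenius_element
        (by rw [iterateFrobenius_def]; exact ((hS u).1 hu).1)
        (φ := (φ u : integralClosure F[X] E →+* PowerSeries F)) (hφ u hu).1 (hφ u hu).2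
      exact ⟨σ, fun _ a => by
        rw [← iterateFrobenius_def]
        exact hσ a⟩
    · exact ⟨1, fun h => absurd h hu⟩
  choose f hf using hex2
  obtain ⟨hS1, hS2⟩ := card_good_points p hn0 hQ' hS
  refine ⟨f, fun u =>
    { PowerSeries.constantCoeff.comp
      (φ u : integralClosure F[X] E →+* PowerSeries F) with
      commutes' := fun r => by
        change PowerSeries.constantCoeff (φ u (algebraMap F _ r)) = r
        rw [AlgHom.commutes]
        simp }, fun u hu => ⟨?_, fun z hz => ?_⟩, ?_⟩
  · change PowerSeries.constantCoeff (φ u _) = u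
    rw [(hφ u hu).2, constantCoeff_expandAt, eval_X]
  · change (PowerSeries.constantCoeff (φ u z)) ^ p ^ n = PowerSeries.constantCoeff (φ u _)
    rw [hf u hu]
    congr 2
    apply Subtype.ext
    rw [hsn.coe_restrictInt, coe_galInt, hcomm, hfix _ hz]
  · intro h hh M hM
    have hqk : (p : ℝ) ^ n = ((p : ℝ) ^ k) ^ 2 := by rw [hn, ← pow_mul, mul_comm]
    have hpk : (1 : ℝ) ≤ (p : ℝ) ^ k := one_le_pow₀ (by exact_mod_cast hp.one_le)
    have hM0 : 0 ≤ M := (norm_nonneg _).trans (hM 1)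
    have hsq : √((p : ℝ) ^ n) = (p : ℝ) ^ k := by
      rw [hqk, Real.sqrt_sq (by positivity)]
    have := norm_sum_classFunction_sub_le S f h hh
      (q := (p : ℝ) ^ n) (c := (p : ℝ) ^ n + (2 * gD + 2) * (p : ℝ) ^ k) (δ := Q.natDegree) hM
      (by
        have : (0 : ℝ) ≤ (2 * gD + 2) * (p : ℝ) ^ k := by positivity
        linarith) (by positivity) (by exact_mod_cast hS1) (fun τ => by
        have := card_frobenius_conj_le p hn hD hKk hsn hcomm S φ (fun u hu => (hφ u hu).2) f hf τ
        rw [hqk]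
        exact_mod_cast this)
    push_cast at this ⊢
    refine this.trans ?_
    rw [hsq]
    gcongr ?_ * M
    rw [mul_assoc]
    refine mul_le_mul_of_nonneg_left ?_ (by positivity)
    have : (0 : ℝ) ≤ Q.natDegree := by positivity
    nlinarith

end

end

section

open Polynomial

section puiseux
variable {F : Type*} [Field F]

theorem exists_powerSeries_scaleRoots (P : F[X]) (hP : P.Monic) {j : ℕ} (hj : P.natDegree = j)
    (hj2 : 2 ≤ j) (hjF : (j : F) ≠ 0) (hc : P.coeff (j - 1) = 0) :
    ∃ w : PowerSeries F, PowerSeries.coeff 0 w = 1 ∧ PowerSeries.coeff 1 w = 0 ∧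
      ((P.map (PowerSeries.C (R := F))).scaleRoots PowerSeries.X).eval w = 1 := by
  set f := (P.map (PowerSeries.C (R := F))).scaleRoots PowerSeries.X with hf
  have hfm : f.Monic := (monic_scaleRoots_iff _).2 (hP.map _)
  have hfd : f.natDegree = j := by
    rw [hf, natDegree_scaleRoots, hP.natDegree_map, hj]
  have hf0 : f.map (PowerSeries.constantCoeff (R := F)) = X ^ j := by
    ext i
    rw [coeff_map, hf, coeff_scaleRoots, coeff_map, hP.natDegree_map, hj, map_mul, map_pow,
      PowerSeries.constantCoeff_X, coeff_X_pow, PowerSeries.constantCoeff_C]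
    split_ifs with h
    · subst h
      simp [← hj, hP.coeff_natDegree]
    · rcases lt_or_gt_of_ne h with h | h
      · rw [zero_pow (by omega), mul_zero]
      · rw [coeff_eq_zero_of_natDegree_lt (by omega), zero_mul]
  have hmon : (f - C 1).Monic := by
    refine hfm.sub_of_left ?_
    refine degree_C_le.trans_lt ?_
    rw [← natDegree_pos_iff_degree_pos]
    omega
  obtain ⟨w, hw, hw'⟩ := HenselianRing.is_henselian
    (I := Ideal.span {(PowerSeries.X : PowerSeries F)}) _ hmon (PowerSeries.C 1) (by
      rw [Ideal.mem_span_singleton, PowerSeries.X_dvd_iff, ← eval₂_at_apply, ← eval_map,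
        Polynomial.map_sub, hf0]
      simp) (by
      refine IsUnit.map _ ?_
      rw [PowerSeries.isUnit_iff_constantCoeff, ← eval₂_at_apply, ← eval_map, ← derivative_map,
        Polynomial.map_sub, hf0]
      simp [derivative_X_pow, hjF])
  have hw0 : PowerSeries.coeff 0 w = 1 := by
    rw [Ideal.mem_span_singleton, PowerSeries.X_dvd_iff] at hw'
    simpa [sub_eq_zero] using hw'
  have hw1 : f.eval w = 1 := by
    have := hw
    rwa [IsRoot.def, eval_sub, eval_C, sub_eq_zero] at this
  refine ⟨w, hw0, ?_, hw1⟩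
  have := congrArg (PowerSeries.coeff 1) hw1
  rw [eval_eq_sum_range, map_sum, hfd, Finset.sum_range_succ, Finset.sum_eq_zero] at this
  · rw [← hfd, hfm.coeff_natDegree, one_mul, hfd, zero_add, PowerSeries.coeff_one_pow] at this
    rw [PowerSeries.coeff_zero_eq_constantCoeff_apply] at hw0
    rw [PowerSeries.coeff_one] at this
    simpa [hw0, hjF] using this
  · intro i hi
    rw [Finset.mem_range] at hi
    rw [hf, coeff_scaleRoots, coeff_map, hP.natDegree_map, hj]
    by_cases h : i = j - 1
    · rw [h, hc]
      simp
    · have h2 : (PowerSeries.X : PowerSeries F) ^ 2 ∣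
          PowerSeries.C (P.coeff i) * PowerSeries.X ^ (j - i) * w ^ i :=
        Dvd.dvd.mul_right (Dvd.dvd.mul_left (pow_dvd_pow _ (by omega)) _) _
      exact PowerSeries.X_pow_dvd_iff.1 h2 1 (by norm_num)

/-- The coefficientwise map underlying the substitution `t ↦ c t`. -/
def laurentRescaleFun (c : F) (f : LaurentSeries F) : LaurentSeries F :=
  ⟨fun n => c ^ n * f.coeff n, f.isPWO_support.mono (by
    intro n hn h0
    exact hn (by simp [h0]))⟩

theorem coeff_laurentRescaleFun (c : F) (f : LaurentSeries F) (n : ℤ) :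
    (laurentRescaleFun c f).coeff n = c ^ n * f.coeff n := rfl

theorem laurentRescaleFun_mul {c : F} (hc : c ≠ 0) (f g : LaurentSeries F) :
    laurentRescaleFun c (f * g) = laurentRescaleFun c f * laurentRescaleFun c g := by
  ext n
  rw [coeff_laurentRescaleFun, HahnSeries.coeff_mul, HahnSeries.coeff_mul, Finset.mul_sum]
  refine Finset.sum_congr ?_ ?_
  · ext ij
    simp [coeff_laurentRescaleFun, hc, zpow_ne_zero]
  · intro ij hij
    rw [Finset.mem_antidiagonal] at hij
    rw [coeff_laurentRescaleFun, coeff_laurentRescaleFun, ← hij.2.2, zpow_add₀ hc]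
    ring

/-- The substitution `t ↦ c t` on Laurent series. -/
def laurentRescale (c : F) (hc : c ≠ 0) : LaurentSeries F →+* LaurentSeries F where
  toFun := laurentRescaleFun c
  map_one' := by
    ext n
    by_cases h : n = 0 <;> simp [coeff_laurentRescaleFun, HahnSeries.coeff_one, h]
  map_zero' := by
    ext n
    simp [coeff_laurentRescaleFun]
  map_add' f g := by
    ext n
    simp [coeff_laurentRescaleFun, mul_add]
  map_mul' := laurentRescaleFun_mul hc

theorem coeff_laurentRescale (c : F) (hc : c ≠ 0) (f : LaurentSeries F) (n : ℤ) :
    (laurentRescale c hc f).coeff n = c ^ n * f.coeff n := rfl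

theorem laurentRescale_single (c : F) (hc : c ≠ 0) (n : ℤ) (a : F) :
    laurentRescale c hc (HahnSeries.single n a) = HahnSeries.single n (c ^ n * a) := by
  ext m
  rw [coeff_laurentRescale]
  by_cases h : m = n
  · subst h
    simp
  · simp [HahnSeries.coeff_single_of_ne h]

/-- An inverse expansion at infinity: `P (x₀) = t⁻ʲ` with `x₀ = t⁻¹ + O(t)`. -/
theorem exists_laurent_inverse (P : F[X]) (hP : P.Monic) {j : ℕ} (hj : P.natDegree = j)
    (hj2 : 2 ≤ j) (hjF : (j : F) ≠ 0) (hc : P.coeff (j - 1) = 0) :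
    ∃ x : LaurentSeries F, P.eval₂ HahnSeries.C x = HahnSeries.single (-j : ℤ) 1 ∧
      x.coeff (-1) = 1 ∧ x.coeff 0 = 0 ∧ ∀ n < -1, x.coeff n = 0 := by
  obtain ⟨w, hw0, hw1, hw⟩ := exists_powerSeries_scaleRoots P hP hj hj2 hjF hc
  set ι := HahnSeries.ofPowerSeries ℤ F with hι
  set x := HahnSeries.single (-1 : ℤ) (1 : F) * ι w with hx
  have hX : ι PowerSeries.X * x = ι w := by
    rw [hx, hι, HahnSeries.ofPowerSeries_X, ← mul_assoc, HahnSeries.single_mul_single]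
    simp
  have hco : ∀ n : ℤ, x.coeff n = (ι w).coeff (n + 1) := by
    intro n
    rw [hx, HahnSeries.coeff_single_mul]
    simp
  refine ⟨x, ?_, ?_, ?_, ?_⟩
  · have h1 := congrArg ι hw
    rw [← eval₂_at_apply, ← hX, scaleRoots_eval₂_mul, hP.natDegree_map, hj, map_one,
      eval₂_map] at h1
    have h2 : ι.comp PowerSeries.C = HahnSeries.C := by
      ext1 a
      rw [hι, RingHom.comp_apply, HahnSeries.ofPowerSeries_C]
    rw [h2, hι, HahnSeries.ofPowerSeries_X, HahnSeries.single_pow, one_pow] at h1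
    have h3 : HahnSeries.single (-j : ℤ) (1 : F) * HahnSeries.single (j • (1 : ℤ)) (1 : F) = 1 := by
      rw [HahnSeries.single_mul_single]
      simp
    rw [← mul_one (HahnSeries.single (-j : ℤ) (1 : F)), ← h1, ← mul_assoc, h3, one_mul]
  · rw [hco]
    have := HahnSeries.ofPowerSeries_apply_coeff (Γ := ℤ) w 0
    simpa [hw0] using this
  · rw [hco]
    have := HahnSeries.ofPowerSeries_apply_coeff (Γ := ℤ) w 1
    simpa [hw1] using this
  · intro n hn
    rw [hco, hι, HahnSeries.ofPowerSeries_apply]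
    refine HahnSeries.embDomain_of_notMem_range ?_
    rintro ⟨m, hm⟩
    have : (m : ℤ) = n + 1 := hm
    omega
end puiseux

end

section

open Polynomial

theorem eq_of_sum_mul_stdAddChar_eq_zero {j : ℕ} [hj : Fact j.Prime] (f : ZMod j → ℚ)
    (h : ∑ i, (f i : ℂ) * ZMod.stdAddChar i = 0) (i i' : ZMod j) : f i = f i' := by
  have hω : IsPrimitiveRoot (ZMod.stdAddChar (1 : ZMod j)) j := by
    have h1 := Complex.isPrimitiveRoot_exp j hj.out.ne_zero
    have h2 : ZMod.stdAddChar (1 : ZMod j) = Complex.exp (2 * Real.pi * Complex.I / j) := by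
      have := ZMod.stdAddChar_coe (N := j) 1
      simpa using this
    rwa [h2]
  set ω : ℂ := ZMod.stdAddChar (1 : ZMod j) with hωdef
  have hpow : ∀ i : ZMod j, ZMod.stdAddChar i = ω ^ i.val := by
    intro i
    rw [hωdef, ← AddChar.map_nsmul_eq_pow]
    simp
  set P : ℚ[X] := ∑ i : ZMod j, C (f i) * X ^ i.val with hP
  have hco : ∀ i : ZMod j, P.coeff i.val = f i := by
    intro i
    rw [hP, finsetSum_coeff, Finset.sum_eq_single i]
    · simp
    · intro k _ hk
      rw [coeff_C_mul, coeff_X_pow, if_neg, mul_zero]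
      exact fun h => hk (ZMod.val_injective j h.symm)
    · simp
  have hdeg : P.degree < j := by
    rw [hP]
    refine (degree_sum_le _ _).trans_lt ?_
    rw [Finset.sup_lt_iff (by exact WithBot.bot_lt_coe _)]
    intro i _
    refine (degree_C_mul_X_pow_le _ _).trans_lt ?_
    exact_mod_cast ZMod.val_lt i
  have hroot : aeval ω P = 0 := by
    rw [hP, map_sum, ← h]
    refine Finset.sum_congr rfl fun i _ => ?_
    rw [hpow]
    simp
  have hmin : minpoly ℚ ω = cyclotomic j ℚ := (cyclotomic_eq_minpoly_rat hω hj.out.pos).symm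
  obtain ⟨R, hR⟩ := minpoly.dvd ℚ ω hroot
  rw [hmin] at hR
  have hR0 : R.natDegree = 0 := by
    by_contra hne
    have hRne : R ≠ 0 := fun h => hne (by rw [h, natDegree_zero])
    have h1 : P.natDegree = (cyclotomic j ℚ).natDegree + R.natDegree := by
      rw [hR, natDegree_mul (cyclotomic_ne_zero _ _) hRne]
    have hPne : P ≠ 0 := by
      rw [hR]
      exact mul_ne_zero (cyclotomic_ne_zero _ _) hRne
    have h2 : P.natDegree < j := by
      rwa [← natDegree_lt_iff_degree_lt hPne] at hdeg
    rw [natDegree_cyclotomic, Nat.totient_prime hj.out] at h1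
    have := hj.out.pos
    omega
  obtain ⟨c, hc⟩ := natDegree_eq_zero.1 hR0
  have key : ∀ i : ZMod j, f i = c := by
    intro i
    rw [← hco, hR, ← hc, coeff_mul_C, cyclotomic_prime, finsetSum_coeff,
      Finset.sum_eq_single i.val]
    · simp
    · intro b _ hb
      rw [coeff_X_pow, if_neg (Ne.symm hb)]
    · intro h
      exact absurd (Finset.mem_range.2 (ZMod.val_lt i)) h
  rw [key, key]

/-- A circulant relation on a prime number of points that is affine-linear on a nonconstant
labelling is trivial. -/
theorem circulant_trivial {j : ℕ} [hj : Fact j.Prime] (S : Finset (ZMod j)) (v : ZMod j → ℤ)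
    (hv : ∃ i i', v i ≠ v i') (m c : ℤ) (h : ∀ i, ∑ s ∈ S, v (i + s) = m * v i + c)
    {s s' : ZMod j} (hs : s ≠ 0) (hs' : s' ≠ 0) (hsS : s ∈ S) : s' ∈ S := by
  classical
  set V : ℂ := ∑ i, (v i : ℂ) * ZMod.stdAddChar i with hV
  have hV0 : V ≠ 0 := by
    intro h0
    obtain ⟨i, i', hii⟩ := hv
    refine hii ?_
    have := eq_of_sum_mul_stdAddChar_eq_zero (fun i => (v i : ℚ)) (by simpa using h0) i i'
    exact_mod_cast this
  have h1 : V * (∑ s ∈ S, ZMod.stdAddChar (-s)) = m * V := by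
    have e1 : ∀ s : ZMod j, V * ZMod.stdAddChar (-s) = ∑ i, (v (i + s) : ℂ) * ZMod.stdAddChar i := by
      intro s
      rw [hV, Finset.sum_mul, ← Equiv.sum_comp (Equiv.addRight s)]
      refine Finset.sum_congr rfl fun i _ => ?_
      rw [mul_assoc, ← AddChar.map_add_eq_mul]
      simp
    rw [Finset.mul_sum, Finset.sum_congr rfl fun s _ => e1 s, Finset.sum_comm]
    have e2 : ∀ i : ZMod j, ∑ s ∈ S, (v (i + s) : ℂ) * ZMod.stdAddChar i =
        m * ((v i : ℂ) * ZMod.stdAddChar i) + c * ZMod.stdAddChar i := by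
      intro i
      rw [← Finset.sum_mul]
      have := h i
      have h' : ∑ s ∈ S, (v (i + s) : ℂ) = m * v i + c := by exact_mod_cast this
      rw [h']
      ring
    rw [Finset.sum_congr rfl fun i _ => e2 i, Finset.sum_add_distrib, ← Finset.mul_sum,
      ← Finset.mul_sum, AddChar.sum_eq_zero_of_ne_one, mul_zero, add_zero]
    intro h1
    have := ZMod.isPrimitive_stdAddChar j (one_ne_zero)
    refine this ?_
    rw [h1]
    ext x
    simp [AddChar.mulShift]
  have h2 : ∑ i : ZMod j, ((((if -i ∈ S then 1 else 0) - (if i = 0 then (m : ℚ) else 0) : ℚ)) : ℂ) *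
      ZMod.stdAddChar i = 0 := by
    have e3 : ∑ s ∈ S, (ZMod.stdAddChar (-s) : ℂ) = m := by
      have : V * (∑ s ∈ S, ZMod.stdAddChar (-s)) = V * m := by rw [h1, mul_comm]
      exact mul_left_cancel₀ hV0 this
    have e4 : ∀ i : ZMod j, ((((if -i ∈ S then 1 else 0) - (if i = 0 then (m : ℚ) else 0) : ℚ)) : ℂ)
        * ZMod.stdAddChar i =
        (if -i ∈ S then ZMod.stdAddChar i else 0) - (if i = 0 then (m : ℂ) else 0) := by
      intro i
      by_cases hi : i = 0
      · subst hi
        split_ifs <;> simp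
      · split_ifs <;> simp
    rw [Finset.sum_congr rfl fun i _ => e4 i, Finset.sum_sub_distrib, Finset.sum_ite_eq',
      ← Equiv.sum_comp (Equiv.neg (ZMod j))]
    simp [e3]
  have h3 := eq_of_sum_mul_stdAddChar_eq_zero _ h2 (-s) (-s')
  simp [hs, hs', hsS] at h3
  by_contra hcon
  simp [hcon] at h3

end

section

open Polynomial

section rot
variable {F : Type*} [Field F] {j : ℕ}

theorem AddChar.zmod_apply_ne_zero (χ : AddChar (ZMod j) F) (i : ZMod j) : χ i ≠ 0 := by
  intro h
  have := χ.map_add_eq_mul i (-i)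
  rw [h] at this
  simp at this

/-- The rotation `t ↦ χ(-i) t` of Laurent series. -/
def laurentRot (χ : AddChar (ZMod j) F) (i : ZMod j) : LaurentSeries F →+* LaurentSeries F :=
  laurentRescale (χ (-i)) (χ.zmod_apply_ne_zero _)

variable (χ : AddChar (ZMod j) F)

theorem coeff_laurentRot (i : ZMod j) (f : LaurentSeries F) (n : ℤ) :
    (laurentRot χ i f).coeff n = χ (-i) ^ n * f.coeff n := rfl

theorem coeff_neg_one_laurentRot (i : ZMod j) (f : LaurentSeries F) :
    (laurentRot χ i f).coeff (-1) = χ i * f.coeff (-1) := by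
  rw [coeff_laurentRot, zpow_neg_one]
  congr 1
  refine inv_eq_of_mul_eq_one_left ?_
  rw [← χ.map_add_eq_mul]
  simp

theorem laurentRot_laurentRot (i k : ZMod j) (f : LaurentSeries F) :
    laurentRot χ i (laurentRot χ k f) = laurentRot χ (i + k) f := by
  ext n
  simp only [coeff_laurentRot]
  rw [← mul_assoc, ← mul_zpow, ← χ.map_add_eq_mul]
  congr 3
  ring

theorem laurentRot_C (i : ZMod j) (a : F) :
    laurentRot χ i (HahnSeries.C a) = HahnSeries.C a := by
  rw [HahnSeries.C_apply, laurentRot, laurentRescale_single]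
  simp

theorem laurentRot_comp_C (i : ZMod j) :
    (laurentRot χ i).comp (HahnSeries.C (Γ := ℤ)) = HahnSeries.C :=
  RingHom.ext fun a => laurentRot_C χ i a

theorem laurentRot_single (i : ZMod j) (a : F) :
    laurentRot χ i (HahnSeries.single (-j : ℤ) a) = HahnSeries.single (-j : ℤ) a := by
  rw [laurentRot, laurentRescale_single]
  have : χ (-i) ^ j = 1 := by
    rw [← χ.map_nsmul_eq_pow]
    simp
  simp [this]

theorem eval₂_laurentRot (i : ZMod j) (P : F[X]) {x : LaurentSeries F} {a : F}
    (hx : P.eval₂ HahnSeries.C x = HahnSeries.single (-j : ℤ) a) :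
    P.eval₂ HahnSeries.C (laurentRot χ i x) = HahnSeries.single (-j : ℤ) a := by
  rw [← laurentRot_single χ i a, ← hx, hom_eval₂, laurentRot_comp_C]

theorem laurentRot_injective_of_coeff {x : LaurentSeries F} (hχ : Function.Injective χ)
    (hx : x.coeff (-1) = 1) : Function.Injective fun i => laurentRot χ i x := by
  intro i k h
  have := congrArg (fun f : LaurentSeries F => f.coeff (-1)) h
  simp only [coeff_neg_one_laurentRot, hx, mul_one] at this
  exact hχ this

theorem exists_injective_addChar [NeZero j] [IsAlgClosed F]
    (hj : (j : F) ≠ 0) : ∃ χ : AddChar (ZMod j) F, Function.Injective χ := by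
  have : NeZero (j : F) := ⟨hj⟩
  obtain ⟨ζ, hζ⟩ := HasEnoughRootsOfUnity.exists_primitiveRoot F j
  refine ⟨AddChar.zmodChar j hζ.pow_eq_one, ?_⟩
  intro a b hab
  rw [AddChar.zmodChar_apply, AddChar.zmodChar_apply] at hab
  exact ZMod.val_injective j (hζ.pow_inj (ZMod.val_lt a) (ZMod.val_lt b) hab)

/-- The embedding of rational functions with `X ↦ t⁻ʲ`. -/
theorem exists_ratFunc_hom_infty (j : ℕ) [NeZero j] : ∃ γ : RatFunc F →+* LaurentSeries F,
    (∀ a, γ (algebraMap F[X] (RatFunc F) (C a)) = HahnSeries.C a) ∧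
    γ RatFunc.X = HahnSeries.single (-j : ℤ) 1 := by
  set f : F[X] →+* LaurentSeries F := eval₂RingHom HahnSeries.C (HahnSeries.single (-j : ℤ) 1)
  have hf : Function.Injective f := by
    rw [injective_iff_map_eq_zero]
    intro R hR
    ext n
    have : (f R).coeff (-j * n) = R.coeff n := by
      change (eval₂ (HahnSeries.C (Γ := ℤ)) (HahnSeries.single (-j : ℤ) (1 : F)) R).coeff _ = _
      rw [eval₂_eq_sum_range, HahnSeries.coeff_sum]
      have e : ∀ i, (HahnSeries.C (R.coeff i) * (HahnSeries.single (-j : ℤ) (1 : F)) ^ i).coeff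
          (-j * n : ℤ) = if i = n then R.coeff i else 0 := by
        intro i
        rw [HahnSeries.C_apply, HahnSeries.single_pow, HahnSeries.single_mul_single,
          HahnSeries.coeff_single]
        have : (j : ℤ) ≠ 0 := by exact_mod_cast NeZero.ne j
        by_cases h : i = n
        · subst h
          rw [if_pos rfl, if_pos]
          · simp
          · simp [mul_comm]
        · rw [if_neg h, if_neg]
          intro h'
          apply h
          simp only [nsmul_eq_mul, zero_add] at h'
          have : (j : ℤ) * n = j * i := by linarith
          exact_mod_cast (mul_left_cancel₀ ‹(j : ℤ) ≠ 0› this).symm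
      rw [Finset.sum_congr rfl fun i _ => e i, Finset.sum_ite_eq']
      split_ifs with h
      · rfl
      · rw [Finset.mem_range, not_lt] at h
        rw [coeff_eq_zero_of_natDegree_lt (by omega)]
    rw [← this, hR]
    simp
  refine ⟨IsFractionRing.lift (A := F[X]) hf, fun a => ?_, ?_⟩
  · rw [IsFractionRing.lift_algebraMap]
    simp [f]
  · rw [← RatFunc.algebraMap_X, IsFractionRing.lift_algebraMap]
    simp [f]

theorem exists_ringHom_of_isAlgebraic {K L M : Type*} [Field K] [Field L] [Algebra K L]
    [Algebra.IsAlgebraic K L] [Field M] [IsAlgClosed M] (γ : K →+* M) :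
    ∃ ι : L →+* M, ι.comp (algebraMap K L) = γ := by
  let := γ.toAlgebra
  exact ⟨(IsAlgClosed.lift : L →ₐ[K] M), (IsAlgClosed.lift : L →ₐ[K] M).comp_algebraMap⟩
end rot

end

section

open Polynomial

section
variable {F : Type*} [Field F] {j : ℕ} [NeZero j]
  {E : Type*} [Field E] [Algebra (RatFunc F) E] [FiniteDimensional (RatFunc F) E]
  [IsGalois (RatFunc F) E]

theorem exists_puiseux_embedding (f : (RatFunc F)[X]) [IsSplittingField (RatFunc F) E f]
    (P : F[X]) (hP : P.Monic) (hPj : P.natDegree = j)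
    (hs : ((genericFiber P).map (algebraMap (RatFunc F) E)).Splits)
    (χ : AddChar (ZMod j) F) (hχ : Function.Injective χ) (x : LaurentSeries F)
    (hx : P.eval₂ HahnSeries.C x = HahnSeries.single (-j : ℤ) 1) (hx1 : x.coeff (-1) = 1) :
    ∃ (l : E →+* AlgebraicClosure (LaurentSeries F)) (ξ : ZMod j → E),
      (∀ a : F, l (algebraMap (RatFunc F) E (algebraMap F[X] _ (C a))) =
        algebraMap _ _ (HahnSeries.C (Γ := ℤ) a)) ∧
      l (algebraMap (RatFunc F) E RatFunc.X) = algebraMap _ _ (HahnSeries.single (-j : ℤ) (1 : F)) ∧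
      (∀ i, l (ξ i) = algebraMap _ _ (laurentRot χ i x)) ∧
      (genericFiber P).map (algebraMap (RatFunc F) E) = ∏ i, (X - C (ξ i)) ∧
      ∀ k, ∃ g : E ≃ₐ[RatFunc F] E, ∀ i, g (ξ i) = ξ (i + k) := by
  obtain ⟨γ, hγC, hγX⟩ := exists_ratFunc_hom_infty (F := F) j
  set L := AlgebraicClosure (LaurentSeries F)
  set a := algebraMap (LaurentSeries F) L with ha
  obtain ⟨l, hl⟩ := exists_ringHom_of_splits (E := E) f (a.comp γ) (IsAlgClosed.splits _)
  have hl' : ∀ r, l (algebraMap (RatFunc F) E r) = a (γ r) := fun r => RingHom.congr_fun hl r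
  have hj0 : 0 < P.natDegree := by
    rw [hPj]
    exact Nat.pos_of_ne_zero (NeZero.ne j)
  set g := (genericFiber P).map (algebraMap (RatFunc F) E) with hg
  have hγP : ∀ R : F[X], γ (algebraMap F[X] _ R) = R.eval₂ HahnSeries.C (HahnSeries.single (-j : ℤ) (1:F)) := by
    intro R
    induction R using Polynomial.induction_on' with
    | add R S h1 h2 => rw [map_add, map_add, h1, h2, eval₂_add]
    | monomial n c =>
      rw [← C_mul_X_pow_eq_monomial, map_mul, map_mul, map_pow, map_pow, RatFunc.algebraMap_X, hγC,
        hγX]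
      simp
  have hγ' : γ.comp (algebraMap F (RatFunc F)) = HahnSeries.C := by
    ext1 c
    rw [RingHom.comp_apply, ← hγC, IsScalarTower.algebraMap_apply F F[X] (RatFunc F)]
    rfl
  have hmap : g.map l = (P.map (HahnSeries.C (Γ := ℤ)) - C (HahnSeries.single (-j : ℤ) (1 : F))).map a := by
    rw [hg, Polynomial.map_map, hl, ← Polynomial.map_map, genericFiber, Polynomial.map_sub,
      Polynomial.map_map, hγ', map_C, hγX]
  have hroot : ∀ i, (g.map l).eval (a (laurentRot χ i x)) = 0 := by
    intro i
    rw [hmap, eval_map, eval₂_at_apply, eval_sub, eval_map, eval₂_laurentRot χ i P hx]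
    simp
  have hgm : g.Monic := by
    refine Monic.map _ ?_
    rw [genericFiber]
    refine (hP.map _).sub_of_left ?_
    rw [degree_map]
    exact degree_C_le.trans_lt (natDegree_pos_iff_degree_pos.1 hj0)
  have hex : ∀ i, ∃ r, g.eval r = 0 ∧ l r = a (laurentRot χ i x) := by
    intro i
    have h1 : (g.map l).roots = g.roots.map l := by
      rw [hs.roots_map]
    have h2 : a (laurentRot χ i x) ∈ (g.map l).roots := by
      rw [mem_roots (hgm.map _).ne_zero]
      exact hroot i
    rw [h1, Multiset.mem_map] at h2
    obtain ⟨r, hr, hr'⟩ := h2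
    exact ⟨r, (mem_roots hgm.ne_zero).1 hr, hr'⟩
  choose ξ hξ hξ' using hex
  have hinj : Function.Injective ξ := by
    intro i k hik
    have := hξ' i
    rw [hik, hξ' k] at this
    exact laurentRot_injective_of_coeff χ hχ hx1 (a.injective this.symm)
  refine ⟨l, ξ, fun c => by rw [hl', hγC], by rw [hl', hγX], hξ', ?_, fun k => ?_⟩
  · have hdeg : g.natDegree = j := by
      rw [hg, Polynomial.natDegree_map, genericFiber, natDegree_sub_C, natDegree_map, hPj]
    refine (eq_of_monic_of_dvd_of_natDegree_le (monic_prod_X_sub_C _ _) hgm ?_ ?_)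
    · refine Finset.prod_dvd_of_coprime ?_ fun i _ => dvd_iff_isRoot.2 (hξ i)
      intro i _ k _ hik
      exact pairwise_coprime_X_sub_C hinj hik
    · rw [natDegree_prod_of_monic _ _ fun i _ => monic_X_sub_C _]
      simp [hdeg, ZMod.card]
  · obtain ⟨ρ, hρ⟩ := exists_ringHom_of_isAlgebraic (L := L) (a.comp (laurentRot χ k))
    have hρ' : ∀ y, ρ (a y) = a (laurentRot χ k y) := fun y => RingHom.congr_fun hρ y
    obtain ⟨σ, hσ⟩ := exists_algEquiv_comp_eq (K := RatFunc F) (ρ.comp l) l (by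
      rw [RingHom.comp_assoc, hl, ← RingHom.comp_assoc, hρ, RingHom.comp_assoc]
      congr 1
      apply IsLocalization.ringHom_ext (nonZeroDivisors F[X])
      refine RingHom.ext fun R => ?_
      rw [RingHom.comp_apply, RingHom.comp_apply, RingHom.comp_apply, hγP, hom_eval₂,
        laurentRot_comp_C, laurentRot_single])
    refine ⟨σ, fun i => l.injective ?_⟩
    rw [← hσ, RingHom.comp_apply, hξ', hρ', laurentRot_laurentRot, hξ', add_comm]

end

end

section

open Polynomial

section
variable {F : Type*} [Field F]

/-- The Laurent series `f` has a pole of order at most `m`. -/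
def PoleLe (m : ℤ) (f : LaurentSeries F) : Prop := ∀ k, k < -m → f.coeff k = 0

theorem coeff_single_mul_ofPowerSeries (m : ℤ) (w : PowerSeries F) (k : ℕ) :
    (HahnSeries.single (-m) (1 : F) * HahnSeries.ofPowerSeries ℤ F w).coeff (-m + k) =
      PowerSeries.coeff k w := by
  rw [HahnSeries.coeff_single_mul]
  simp [HahnSeries.ofPowerSeries_apply_coeff]

theorem poleLe_single_mul_ofPowerSeries (m : ℤ) (w : PowerSeries F) :
    PoleLe m (HahnSeries.single (-m) (1 : F) * HahnSeries.ofPowerSeries ℤ F w) := by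
  intro k hk
  rw [HahnSeries.coeff_single_mul, HahnSeries.ofPowerSeries_apply,
    HahnSeries.embDomain_of_notMem_range, mul_zero]
  rintro ⟨n, hn⟩
  have : (n : ℤ) = k - -m := hn
  omega

theorem PoleLe.exists_eq {m : ℤ} {f : LaurentSeries F} (hf : PoleLe m f) :
    ∃ w : PowerSeries F, f = HahnSeries.single (-m) (1 : F) * HahnSeries.ofPowerSeries ℤ F w := by
  refine ⟨PowerSeries.mk fun k => f.coeff (-m + k), ?_⟩
  ext k
  rcases lt_or_ge k (-m) with hk | hk
  · rw [hf k hk, poleLe_single_mul_ofPowerSeries m _ k hk]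
  · obtain ⟨n, rfl⟩ : ∃ n : ℕ, k = -m + n := ⟨(k + m).toNat, by omega⟩
    rw [coeff_single_mul_ofPowerSeries, PowerSeries.coeff_mk]

theorem PoleLe.mono {m n : ℤ} {f : LaurentSeries F} (hf : PoleLe m f) (h : m ≤ n) : PoleLe n f :=
  fun k hk => hf k (by omega)

theorem PoleLe.add {m : ℤ} {f g : LaurentSeries F} (hf : PoleLe m f) (hg : PoleLe m g) :
    PoleLe m (f + g) := fun k hk => by
  rw [HahnSeries.coeff_add, hf k hk, hg k hk, add_zero]

theorem PoleLe.neg {m : ℤ} {f : LaurentSeries F} (hf : PoleLe m f) : PoleLe m (-f) :=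
  fun k hk => by rw [HahnSeries.coeff_neg, hf k hk, neg_zero]

theorem PoleLe.sub {m : ℤ} {f g : LaurentSeries F} (hf : PoleLe m f) (hg : PoleLe m g) :
    PoleLe m (f - g) := by
  rw [sub_eq_add_neg]
  exact hf.add hg.neg

theorem poleLe_zero (m : ℤ) : PoleLe m (0 : LaurentSeries F) := fun k _ => by simp

theorem PoleLe.sum {ι : Type*} {m : ℤ} {f : ι → LaurentSeries F} {s : Finset ι}
    (hf : ∀ i ∈ s, PoleLe m (f i)) : PoleLe m (∑ i ∈ s, f i) := fun k hk => by
  rw [HahnSeries.coeff_sum, Finset.sum_eq_zero fun i hi => hf i hi k hk]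

theorem poleLe_C (c : F) : PoleLe 0 (HahnSeries.C c : LaurentSeries F) := fun k hk => by
  rw [HahnSeries.C_apply, HahnSeries.coeff_single_of_ne (by omega)]

theorem PoleLe.mul_aux {m n : ℤ} {f g : LaurentSeries F} (hf : PoleLe m f) (hg : PoleLe n g) :
    PoleLe (m + n) (f * g) ∧
    (f * g).coeff (-(m + n)) = f.coeff (-m) * g.coeff (-n) ∧
    (f * g).coeff (-(m + n) + 1) =
      f.coeff (-m) * g.coeff (-n + 1) + f.coeff (-m + 1) * g.coeff (-n) := by
  obtain ⟨v, rfl⟩ := hf.exists_eq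
  obtain ⟨w, rfl⟩ := hg.exists_eq
  have h : HahnSeries.single (-m) (1 : F) * HahnSeries.ofPowerSeries ℤ F v *
      (HahnSeries.single (-n) (1 : F) * HahnSeries.ofPowerSeries ℤ F w) =
      HahnSeries.single (-(m + n)) (1 : F) * HahnSeries.ofPowerSeries ℤ F (v * w) := by
    rw [mul_mul_mul_comm, HahnSeries.single_mul_single, one_mul, neg_add,
      map_mul (HahnSeries.ofPowerSeries ℤ F)]
  have h0 : ∀ (m : ℤ) (w : PowerSeries F),
      (HahnSeries.single (-m) (1 : F) * HahnSeries.ofPowerSeries ℤ F w).coeff (-m) =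
      PowerSeries.coeff 0 w := fun m w => by
    simpa using coeff_single_mul_ofPowerSeries m w 0
  have h1 : ∀ (m : ℤ) (w : PowerSeries F),
      (HahnSeries.single (-m) (1 : F) * HahnSeries.ofPowerSeries ℤ F w).coeff (-m + 1) =
      PowerSeries.coeff 1 w := fun m w => by
    simpa using coeff_single_mul_ofPowerSeries m w 1
  rw [h]
  refine ⟨poleLe_single_mul_ofPowerSeries _ _, ?_, ?_⟩
  · rw [h0, h0, h0]
    simp
  · rw [h0, h0, h1, h1, h1, PowerSeries.coeff_mul, Finset.Nat.antidiagonal_succ]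
    simp

theorem PoleLe.mul {m n : ℤ} {f g : LaurentSeries F} (hf : PoleLe m f) (hg : PoleLe n g) :
    PoleLe (m + n) (f * g) := (hf.mul_aux hg).1

theorem PoleLe.coeff_mul {m n : ℤ} {f g : LaurentSeries F} (hf : PoleLe m f) (hg : PoleLe n g) :
    (f * g).coeff (-(m + n)) = f.coeff (-m) * g.coeff (-n) := (hf.mul_aux hg).2.1

theorem PoleLe.pow {m : ℤ} {f : LaurentSeries F} (hf : PoleLe m f) (n : ℕ) :
    PoleLe (n * m) (f ^ n) ∧ (f ^ n).coeff (-(n * m)) = f.coeff (-m) ^ n ∧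
    (f ^ n).coeff (-(n * m) + 1) = n * (f.coeff (-m) ^ (n - 1) * f.coeff (-m + 1)) := by
  induction n with
  | zero =>
    have := poleLe_C (1 : F)
    rw [map_one] at this
    simpa [HahnSeries.coeff_one] using this
  | succ n ih =>
    have e : ((n + 1 : ℕ) : ℤ) * m = n * m + m := by push_cast; ring
    obtain ⟨a, b, c⟩ := ih.1.mul_aux hf
    rw [pow_succ, e]
    refine ⟨a, by rw [b, ih.2.1, pow_succ], ?_⟩
    rw [c, ih.2.1, ih.2.2]
    rcases n with _ | n
    · simp
    · push_cast
      ring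

/-- Values of polynomials on a Laurent series `t⁻¹ + O(t)`. -/
theorem poleLe_eval₂ (R : F[X]) {n : ℕ} (hR : R.natDegree ≤ n) {x : LaurentSeries F}
    (hx : PoleLe 1 x) (hx0 : x.coeff 0 = 0) :
    PoleLe n (R.eval₂ HahnSeries.C x) ∧
    (R.eval₂ HahnSeries.C x).coeff (-n) = R.coeff n * x.coeff (-1) ^ n ∧
    (1 ≤ n → (R.eval₂ HahnSeries.C x).coeff (-n + 1) = R.coeff (n - 1) * x.coeff (-1) ^ (n - 1)) := by
  have e : ∀ (i : ℕ) (k : ℤ), (HahnSeries.C (R.coeff i) * x ^ i).coeff k =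
      R.coeff i * (x ^ i).coeff k := fun i k => by
    rw [HahnSeries.C_mul_eq_smul, HahnSeries.coeff_smul, smul_eq_mul]
  have hp : ∀ i : ℕ, PoleLe i (x ^ i) := fun i => by simpa using (hx.pow i).1
  have hl : ∀ i : ℕ, (x ^ i).coeff (-i) = x.coeff (-1) ^ i := fun i => by simpa using (hx.pow i).2.1
  have hl' : ∀ i : ℕ, (x ^ i).coeff (-i + 1) = 0 := fun i => by simpa [hx0] using (hx.pow i).2.2
  rw [eval₂_eq_sum_range' HahnSeries.C (Nat.lt_succ_of_le hR) x]
  refine ⟨PoleLe.sum fun i hi => fun k hk => ?_, ?_, fun hn => ?_⟩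
  · rw [Finset.mem_range] at hi
    rw [e, hp i k (by omega), mul_zero]
  · rw [HahnSeries.coeff_sum, Finset.sum_eq_single n]
    · rw [e, hl]
    · intro i hi hin
      rw [Finset.mem_range] at hi
      rw [e, hp i _ (by omega), mul_zero]
    · simp
  · obtain ⟨n, rfl⟩ : ∃ k, n = k + 1 := ⟨n - 1, by omega⟩
    rw [HahnSeries.coeff_sum, Finset.sum_eq_single n]
    · have := hl n
      rw [e, Nat.add_sub_cancel, ← this]
      congr 2
      push_cast
      ring
    · intro i hi hin
      rw [Finset.mem_range] at hi
      rw [e]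
      by_cases h : i = n + 1
      · rw [h, hl', mul_zero]
      · rw [hp i _ (by omega), mul_zero]
    · intro h
      simp at h
end

end

section

open Polynomial

section
variable {F : Type*} [Field F]
  {E : Type*} [Field E] [Algebra (RatFunc F) E] [FiniteDimensional (RatFunc F) E]
  [IsGalois (RatFunc F) E] [Algebra F[X] E] [IsScalarTower F[X] (RatFunc F) E] [Algebra F E]
  [IsScalarTower F F[X] E]

/-- An integral element fixed by the stabiliser of a root `ξ` of `P = X` is a polynomial in `ξ`. -/
theorem exists_eq_aeval_of_fixed (P : F[X]) {ξ y : E}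
    (hξ : aeval ξ P = algebraMap (RatFunc F) E RatFunc.X) (hy : IsIntegral F[X] y)
    (hfix : ∀ σ : E ≃ₐ[RatFunc F] E, σ ξ = ξ → σ y = y) : ∃ R : F[X], y = aeval ξ R := by
  have hcomp : ∀ R : F[X], algebraMap F[X] E R = aeval ξ (R.comp P) := by
    intro R
    rw [aeval_comp, hξ, ← RatFunc.algebraMap_X, ← IsScalarTower.algebraMap_apply]
    conv_lhs => rw [← aeval_X_left_apply R]
    rw [← aeval_algebraMap_apply]
  have hinj : Function.Injective (aeval ξ : F[X] →ₐ[F] E) := by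
    rw [← transcendental_iff_injective]
    intro halg
    have h1 : IsAlgebraic F (algebraMap (RatFunc F) E RatFunc.X) := by
      rw [← hξ]
      have h2 : Algebra.adjoin F {ξ} ≤ integralClosure F E := by
        rw [Algebra.adjoin_le_iff, Set.singleton_subset_iff]
        exact IsAlgebraic.isIntegral halg
      exact (h2 (aeval_mem_adjoin_singleton F ξ)).isAlgebraic
    obtain ⟨R, hR, hR0⟩ := h1
    rw [← RatFunc.algebraMap_X, ← IsScalarTower.algebraMap_apply, aeval_algebraMap_apply,
      aeval_X_left_apply] at hR0
    refine hR ((injective_iff_map_eq_zero (algebraMap F[X] E)).1 ?_ R hR0)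
    rw [IsScalarTower.algebraMap_eq F[X] (RatFunc F) E]
    exact (algebraMap (RatFunc F) E).injective.comp (IsFractionRing.injective _ _)
  set Φ : RatFunc F →+* E := IsFractionRing.lift (A := F[X]) (g := (aeval ξ : F[X] →ₐ[F] E).toRingHom) hinj
    with hΦ
  have hΦe : ∀ R : F[X], Φ (algebraMap F[X] _ R) = aeval ξ R := fun R =>
    IsFractionRing.lift_algebraMap _ _
  have hrange : ∀ r : RatFunc F, algebraMap (RatFunc F) E r ∈ Φ.fieldRange := by
    intro r
    rw [← RatFunc.num_div_denom r, map_div₀, ← IsScalarTower.algebraMap_apply,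
      ← IsScalarTower.algebraMap_apply, hcomp, hcomp, ← hΦe, ← hΦe]
    exact div_mem ⟨_, rfl⟩ ⟨_, rfl⟩
  have hmem : y ∈ IntermediateField.adjoin (RatFunc F) {ξ} := by
    rw [← IsGalois.fixedField_fixingSubgroup (IntermediateField.adjoin (RatFunc F) {ξ}),
      IntermediateField.mem_fixedField_iff]
    intro σ hσ
    rw [IntermediateField.mem_fixingSubgroup_iff] at hσ
    exact hfix σ (hσ ξ (IntermediateField.mem_adjoin_simple_self _ ξ))
  have hle : IntermediateField.adjoin (RatFunc F) {ξ} ≤ Φ.fieldRange.toIntermediateField hrange := by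
    rw [IntermediateField.adjoin_simple_le_iff]
    exact ⟨algebraMap F[X] _ X, by rw [hΦe, aeval_X]⟩
  obtain ⟨r, hr⟩ := hle hmem
  have hrint : IsIntegral F[X] r := by
    obtain ⟨q, hq, hq0⟩ := hy
    refine ⟨q.map (compRingHom P), hq.map _, Φ.injective ?_⟩
    rw [eval₂_map, hom_eval₂, map_zero, ← hq0, hr]
    congr 1
    refine RingHom.ext fun R => ?_
    rw [RingHom.comp_apply, RingHom.comp_apply, hΦe, coe_compRingHom_apply, hcomp]
  obtain ⟨R, hR⟩ := (IsIntegrallyClosed.isIntegral_iff (R := F[X])).1 hrint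
  exact ⟨R, by rw [← hr, ← hR, hΦe]⟩

/-- The polynomial `∏_{|k| ≤ h} (X - k)`. -/
noncomputable def centeredPoly (F : Type*) [Field F] (h : ℕ) : F[X] :=
  ∏ k ∈ Finset.Icc (-h : ℤ) h, (X - C (k : F))

theorem exists_int_affine_of_affine (p : ℕ) [CharP F p] {j h : ℕ} [NeZero j]
    (hp : 2 * j * (h + 1) ^ 2 < p) (hh : 1 ≤ h)
    (S : Finset (ZMod j)) (v : ZMod j → ℤ) (hv : ∀ i, |v i| ≤ h) {i₀ i₁ : ZMod j} (h0 : v i₀ = 0)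
    (h1 : v i₁ = 1) (c₁ c₀ : F) (hrel : ∀ i, ∑ s ∈ S, (v (i + s) : F) = c₁ * v i + c₀) :
    ∃ m c : ℤ, ∀ i, ∑ s ∈ S, v (i + s) = m * v i + c := by
  set a : ZMod j → ℤ := fun i => ∑ s ∈ S, v (i + s) with ha
  have haF : ∀ i, (a i : F) = c₁ * v i + c₀ := fun i => by
    rw [← hrel, ha]
    push_cast
    rfl
  have hab : ∀ i, |a i| ≤ j * h := by
    intro i
    refine (Finset.abs_sum_le_sum_abs _ _).trans ((Finset.sum_le_sum fun s _ => hv _).trans ?_)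
    rw [Finset.sum_const, nsmul_eq_mul]
    have : S.card ≤ j := by
      simpa [ZMod.card] using Finset.card_le_univ S
    gcongr
  refine ⟨a i₁ - a i₀, a i₀, fun i => ?_⟩
  have hc0 : c₀ = a i₀ := by
    rw [haF, h0]
    simp
  have hc1 : c₁ = a i₁ - a i₀ := by
    rw [haF, haF, h0, h1]
    simp
  have hz : ((a i - ((a i₁ - a i₀) * v i + a i₀) : ℤ) : F) = 0 := by
    push_cast
    rw [haF i, hc1, hc0]
    ring
  rw [CharP.intCast_eq_zero_iff F p] at hz
  have habs : |a i - ((a i₁ - a i₀) * v i + a i₀)| < p := by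
    have e1 : |(a i₁ - a i₀) * v i| ≤ (j * h + j * h) * h := by
      rw [abs_mul]
      have := abs_sub (a i₁) (a i₀)
      have := hab i₁
      have := hab i₀
      have := hv i
      gcongr
      linarith
    have e2 : |a i - ((a i₁ - a i₀) * v i + a i₀)| ≤ |a i| + (|(a i₁ - a i₀) * v i| + |a i₀|) :=
      (abs_sub _ _).trans (by gcongr; exact abs_add_le _ _)
    have e3 : (2 * j * (h + 1) ^ 2 : ℤ) < p := by exact_mod_cast hp
    have := hab i
    have := hab i₀
    nlinarith
  have := Int.eq_zero_of_abs_lt_dvd hz habs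
  have : a i = (a i₁ - a i₀) * v i + a i₀ := by linarith
  exact this

theorem exists_fixing_of_puiseux (p : ℕ) [CharP F p] {h j : ℕ} [hjp : Fact j.Prime]
    (hj : j = 2 * h + 1) (hp : 2 * j * (h + 1) ^ 2 < p) (hh : 1 ≤ h)
    (e : integralClosure F[X] E →ₐ[F] F) (he : e (algebraMap F[X] _ X) = 0)
    (χ : AddChar (ZMod j) F) {x : LaurentSeries F} (hx1 : x.coeff (-1) = 1) (hx0 : x.coeff 0 = 0)
    (hxp : PoleLe 1 x) {l : E →+* AlgebraicClosure (LaurentSeries F)} {ξ : ZMod j → E}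
    (hlC : ∀ a : F, l (algebraMap F E a) = algebraMap _ _ (HahnSeries.C (Γ := ℤ) a))
    (hlξ : ∀ i, l (ξ i) = algebraMap _ _ (laurentRot χ i x))
    (hprod : (genericFiber (centeredPoly F h)).map (algebraMap (RatFunc F) E) = ∏ i, (X - C (ξ i)))
    (hcyc : ∀ k, ∃ g : E ≃ₐ[RatFunc F] E, ∀ i, g (ξ i) = ξ (i + k)) (hinj : Function.Injective ξ)
    {s₀ s₁ : ZMod j} (hs₀ : s₀ ≠ 0) (hs₁ : s₁ ≠ 0) :
    ∃ σ : E ≃ₐ[RatFunc F] E, σ (ξ 0) = ξ 0 ∧ σ (ξ s₀) = ξ s₁ := by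
  classical
  set P := centeredPoly F h with hP
  have hFR : algebraMap F E = (algebraMap (RatFunc F) E).comp (algebraMap F (RatFunc F)) :=
    RingHom.ext fun c => (IsScalarTower.algebraMap_apply F F[X] E c).trans
        (IsScalarTower.algebraMap_apply F[X] (RatFunc F) E _)
  have hroot_iff : ∀ z, aeval z P = algebraMap (RatFunc F) E RatFunc.X ↔ ∃ i, z = ξ i := by
    intro z
    have h1 := congrArg (eval z) hprod
    rw [eval_prod, eval_map, genericFiber, eval₂_sub, eval₂_map, eval₂_C] at h1
    have h2 : aeval z P = eval₂ ((algebraMap (RatFunc F) E).comp (algebraMap F (RatFunc F))) z P := by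
      rw [aeval_def, hFR]
    rw [← h2] at h1
    rw [← sub_eq_zero, h1, Finset.prod_eq_zero_iff]
    simp [sub_eq_zero]
  have hPm : P.Monic := monic_prod_of_monic _ _ fun i _ => monic_X_sub_C _
  have hPd : 0 < P.natDegree := by
    rw [hP, centeredPoly, natDegree_prod_of_monic _ _ fun i _ => monic_X_sub_C _]
    simp only [natDegree_X_sub_C, Finset.sum_const, Int.card_Icc, smul_eq_mul, mul_one]
    omega
  have hInt : ∀ i, IsIntegral F[X] (ξ i) := by
    intro i
    refine ⟨P.map C - C X, (natDegree_sub_C_pos (hPm.map _) (by rwa [natDegree_map]) _).1, ?_⟩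
    rw [eval₂_sub, eval₂_map, eval₂_C, sub_eq_zero, IsScalarTower.algebraMap_apply F[X] (RatFunc F) E,
      RatFunc.algebraMap_X, ← (hroot_iff _).2 ⟨i, rfl⟩, aeval_def]
    congr 1
    exact (IsScalarTower.algebraMap_eq F F[X] E).symm
  have hsumint : ∀ S : Finset (ZMod j), IsIntegral F[X] (∑ s ∈ S, ξ s) := fun S =>
    sum_mem (S := integralClosure F[X] E) fun s _ => hInt s
  have hgF : ∀ (g : E ≃ₐ[RatFunc F] E) (c : F), g (algebraMap F E c) = algebraMap F E c := by
    intro g c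
    rw [IsScalarTower.algebraMap_apply F F[X] E, IsScalarTower.algebraMap_apply F[X] (RatFunc F) E,
      g.commutes]
  have hperm : ∀ (σ : E ≃ₐ[RatFunc F] E) i, ∃ k, σ (ξ i) = ξ k := by
    intro σ i
    have h1 := congrArg σ ((hroot_iff _).2 ⟨i, rfl⟩)
    rw [σ.commutes] at h1
    refine (hroot_iff _).1 (h1 ▸ ?_)
    rw [aeval_def, aeval_def]
    change _ = (σ : E →+* E) _
    rw [hom_eval₂]
    congr 1
    refine RingHom.ext fun c => (hgF σ c).symm
  set S : Finset (ZMod j) := Finset.univ.filter fun s =>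
    ∃ σ : E ≃ₐ[RatFunc F] E, σ (ξ 0) = ξ 0 ∧ σ (ξ s₀) = ξ s with hS
  have hfix : ∀ τ : E ≃ₐ[RatFunc F] E, τ (ξ 0) = ξ 0 → τ (∑ s ∈ S, ξ s) = ∑ s ∈ S, ξ s := by
    intro τ hτ
    choose π hπ using hperm τ
    have hπi : Function.Injective π := by
      intro i k hik
      apply hinj
      apply τ.injective
      rw [hπ, hπ, hik]
    have himg : S.image π = S := by
      refine Finset.eq_of_subset_of_card_le ?_ (by rw [Finset.card_image_of_injective _ hπi])
      intro k hk
      obtain ⟨s, hs, rfl⟩ := Finset.mem_image.1 hk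
      obtain ⟨σ, hσ0, hσ⟩ := (Finset.mem_filter.1 hs).2
      refine Finset.mem_filter.2 ⟨Finset.mem_univ _, τ * σ, ?_, ?_⟩
      · rw [AlgEquiv.mul_apply, hσ0, hτ]
      · rw [AlgEquiv.mul_apply, hσ, hπ]
    conv_rhs => rw [← himg]
    rw [Finset.sum_image fun a _ b _ hab => hπi hab, map_sum]
    exact Finset.sum_congr rfl fun s _ => hπ s
  obtain ⟨R, hR⟩ := exists_eq_aeval_of_fixed (y := ∑ s ∈ S, ξ s) P ((hroot_iff _).2 ⟨0, rfl⟩)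
    (hsumint S) hfix
  have hRl : ∑ s ∈ S, laurentRot χ s x = R.eval₂ HahnSeries.C (laurentRot χ 0 x) := by
    apply (algebraMap (LaurentSeries F) (AlgebraicClosure (LaurentSeries F))).injective
    have h1 := congrArg l hR
    rw [map_sum, aeval_def, hom_eval₂, hlξ] at h1
    rw [map_sum, hom_eval₂]
    refine (Finset.sum_congr rfl fun s _ => (hlξ s).symm).trans (h1.trans ?_)
    congr 1
    exact RingHom.ext fun a => hlC a
  have hrot0 : laurentRot χ 0 x = x := by
    ext n
    rw [coeff_laurentRot]
    simp
  have hrotp : ∀ s, PoleLe 1 (laurentRot χ s x) := by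
    intro s k hk
    rw [coeff_laurentRot, hxp k hk, mul_zero]
  have hRd : R.natDegree ≤ 1 := by
    by_contra hcon
    have h1 := (poleLe_eval₂ R le_rfl hxp hx0).2.1
    rw [hrot0] at hRl
    rw [← hRl, PoleLe.sum (fun s _ => hrotp s) _ (by omega), hx1, one_pow, mul_one] at h1
    have : R = 0 := leadingCoeff_eq_zero.1 h1.symm
    rw [this] at hcon
    simp at hcon
  have hrel : ∀ i, ∑ s ∈ S, ξ (i + s) = algebraMap F E (R.coeff 1) * ξ i + algebraMap F E (R.coeff 0) := by
    intro i
    obtain ⟨g, hg⟩ := hcyc i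
    have h1 := congrArg g hR
    rw [map_sum, eq_X_add_C_of_natDegree_le_one hRd] at h1
    simp only [map_add, map_mul, aeval_C, aeval_X, hg, hgF, zero_add] at h1
    simpa [add_comm] using h1
  set ξB : ZMod j → (integralClosure F[X] E) := fun i => ⟨ξ i, hInt i⟩ with hξB
  set w : ZMod j → F := fun i => e (ξB i) with hw
  have hBF : ∀ c : F, ((algebraMap F (integralClosure F[X] E) c : (integralClosure F[X] E)) : E) = algebraMap F E c := fun c => rfl
  have hrelw : ∀ i, ∑ s ∈ S, w (i + s) = R.coeff 1 * w i + R.coeff 0 := by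
    intro i
    have h1 : ∑ s ∈ S, ξB (i + s) = algebraMap F (integralClosure F[X] E) (R.coeff 1) * ξB i + algebraMap F (integralClosure F[X] E) (R.coeff 0) := by
      apply Subtype.ext
      push_cast
      exact hrel i
    have := congrArg e h1
    simpa using this
  have heval : ∀ c : F, P.eval c = ∏ i, (c - w i) := by
    intro c
    have h1 : algebraMap F (integralClosure F[X] E) (P.eval c) - algebraMap F[X] (integralClosure F[X] E) X = ∏ i, (algebraMap F (integralClosure F[X] E) c - ξB i) := by
      apply Subtype.ext
      push_cast
      have h2 := congrArg (eval (algebraMap F E c)) hprod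
      rw [eval_prod, eval_map, genericFiber, eval₂_sub, eval₂_map, eval₂_C] at h2
      simp only [eval_sub, eval_X, eval_C] at h2
      refine Eq.trans ?_ h2
      congr 1
      · rw [← hFR, eval₂_at_apply]
      · exact (IsScalarTower.algebraMap_apply F[X] (RatFunc F) E _).trans
          (congrArg _ RatFunc.algebraMap_X)
    have h2 := congrArg e h1
    rw [map_sub, map_prod, AlgHom.commutes] at h2
    refine ((sub_eq_self.2 he).symm.trans h2).trans ?_
    refine Finset.prod_congr rfl fun i _ => ?_
    rw [map_sub, AlgHom.commutes]
    rfl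
  have hex : ∀ i, ∃ k ∈ Finset.Icc (-h : ℤ) h, w i = (k : F) := by
    intro i
    have h1 : P.eval (w i) = 0 := by
      rw [heval]
      exact Finset.prod_eq_zero (Finset.mem_univ i) (sub_self _)
    rw [hP, centeredPoly, eval_prod, Finset.prod_eq_zero_iff] at h1
    obtain ⟨k, hk, hk'⟩ := h1
    exact ⟨k, hk, by simpa [sub_eq_zero] using hk'⟩
  choose v hv hv' using hex
  have hsurj : ∀ k ∈ Finset.Icc (-h : ℤ) h, ∃ i, v i = k := by
    intro k hk
    have h1 : P.eval (k : F) = 0 := by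
      rw [hP, centeredPoly, eval_prod]
      exact Finset.prod_eq_zero hk (by simp)
    rw [heval, Finset.prod_eq_zero_iff] at h1
    obtain ⟨i, _, hi⟩ := h1
    refine ⟨i, ?_⟩
    rw [hv', ← Int.cast_sub, CharP.intCast_eq_zero_iff F p] at hi
    have h2 := hv i
    rw [Finset.mem_Icc] at hk h2
    have h3 : (h : ℤ) * 2 < p := by
      have : h * 2 ≤ 2 * j * (h + 1) ^ 2 := by nlinarith
      exact_mod_cast this.trans_lt hp
    have := Int.eq_zero_of_abs_lt_dvd hi (by rw [abs_lt]; constructor <;> linarith)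
    linarith
  obtain ⟨i₀, hi₀⟩ := hsurj 0 (by simp)
  obtain ⟨i₁, hi₁⟩ := hsurj 1 (by simp; omega)
  obtain ⟨m, c, hmc⟩ := exists_int_affine_of_affine p hp hh S v
    (fun i => by
      have := hv i
      rw [Finset.mem_Icc] at this
      exact abs_le.2 this) hi₀ hi₁ (R.coeff 1) (R.coeff 0) (fun i => by
      rw [← hv' i, ← hrelw]
      exact Finset.sum_congr rfl fun s _ => (hv' _).symm)
  have hmem : s₁ ∈ S := circulant_trivial S v ⟨i₀, i₁, by rw [hi₀, hi₁]; norm_num⟩ m c hmc hs₀ hs₁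
    (Finset.mem_filter.2 ⟨Finset.mem_univ _, 1, rfl, rfl⟩)
  exact (Finset.mem_filter.1 hmem).2
end

end

section

open Polynomial

theorem two_transitive_of_fixing {G α : Type*} [Group G] [MulAction G α] {j : ℕ} {ξ : ZMod j → α}
    (hcyc : ∀ k, ∃ g : G, ∀ i, g • ξ i = ξ (i + k))
    (hst : ∀ s₀ s₁ : ZMod j, s₀ ≠ 0 → s₁ ≠ 0 → ∃ σ : G, σ • ξ 0 = ξ 0 ∧ σ • ξ s₀ = ξ s₁)
    {i k i' k' : ZMod j} (hik : i ≠ k) (hik' : i' ≠ k') :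
    ∃ σ : G, σ • ξ i = ξ i' ∧ σ • ξ k = ξ k' := by
  obtain ⟨g, hg⟩ := hcyc (-i)
  obtain ⟨g', hg'⟩ := hcyc i'
  obtain ⟨σ, hσ0, hσ⟩ := hst (k - i) (k' - i') (sub_ne_zero.2 hik.symm) (sub_ne_zero.2 hik'.symm)
  refine ⟨g' * σ * g, ?_, ?_⟩
  · rw [mul_smul, mul_smul, hg, add_neg_cancel, hσ0, hg', zero_add]
  · rw [mul_smul, mul_smul, hg, ← sub_eq_add_neg, hσ, hg', sub_add_cancel]

section
variable {F : Type*} [Field F]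

theorem pow_sub_ne_of_simple_pole (p : ℕ) (hp : 1 < p) {f y : LaurentSeries F} (hy : PoleLe 1 y)
    (hy1 : y.coeff (-1) ≠ 0) : f ^ p - f ≠ y := by
  intro h
  by_cases hf : PoleLe 0 f
  · have h1 : PoleLe (p * 0) (f ^ p) := (hf.pow p).1
    rw [mul_zero] at h1
    exact hy1 (by rw [← h]; exact h1.sub hf _ (by norm_num))
  · have hf0 : f ≠ 0 := by
      rintro rfl
      exact hf fun k _ => by simp
    have hord : f.order < 0 := by
      by_contra hcon
      refine hf fun k hk => HahnSeries.coeff_eq_zero_of_lt_order (by omega)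
    have hm : PoleLe (-f.order) f := fun k hk =>
      HahnSeries.coeff_eq_zero_of_lt_order (by rwa [neg_neg] at hk)
    have h2 := (hm.pow p).2.1
    have h3 := congrArg (fun g : LaurentSeries F => g.coeff (-(p * -f.order))) h
    have hlt : -((p : ℤ) * -f.order) < f.order ∧ -((p : ℤ) * -f.order) < -1 := by
      have : (2 : ℤ) ≤ p := by exact_mod_cast hp
      constructor <;> nlinarith
    simp only [HahnSeries.coeff_sub] at h3
    rw [h2, hy _ hlt.2, HahnSeries.coeff_eq_zero_of_lt_order hlt.1, sub_zero, neg_neg] at h3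
    exact HahnSeries.coeff_order_eq_zero.not.2 hf0 (eq_zero_of_pow_eq_zero h3)

variable {E : Type*} [Field E] [Algebra (RatFunc F) E] [FiniteDimensional (RatFunc F) E]
  [IsGalois (RatFunc F) E]

theorem exists_moving_of_artinSchreier (p : ℕ) (hp : 1 < p) {j : ℕ} [NeZero j] (hj : 2 < j)
    (χ : AddChar (ZMod j) F) (hχ : Function.Injective χ) {x : LaurentSeries F}
    (hx1 : x.coeff (-1) = 1) (hxp : PoleLe 1 x)
    {l : E →+* AlgebraicClosure (LaurentSeries F)} {ξ : ZMod j → E}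
    (hlC : ∀ a : F, l (algebraMap (RatFunc F) E (algebraMap F[X] _ (C a))) =
      algebraMap _ _ (HahnSeries.C (Γ := ℤ) a))
    (hlX : l (algebraMap (RatFunc F) E RatFunc.X) = algebraMap _ _ (HahnSeries.single (-j : ℤ) (1 : F)))
    (hlξ : ∀ i, l (ξ i) = algebraMap _ _ (laurentRot χ i x))
    (h2t : ∀ i k i' k', i ≠ k → i' ≠ k' → ∃ σ : E ≃ₐ[RatFunc F] E, σ (ξ i) = ξ i' ∧ σ (ξ k) = ξ k')
    {a b : F} (hab : a ≠ 0 ∨ b ≠ 0) {i k : ZMod j} (hik : i ≠ k) {w : E}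
    (hw : w ^ p - w = algebraMap (RatFunc F) E (algebraMap F[X] _ (C a)) * ξ i +
      algebraMap (RatFunc F) E (algebraMap F[X] _ (C b)) * ξ k) :
    ∃ σ : E ≃ₐ[RatFunc F] E, σ (ξ i) = ξ i ∧ σ (ξ k) = ξ k ∧ σ w ≠ w := by
  by_contra! hcon
  obtain ⟨s, hs, hsab⟩ : ∃ s : ZMod j, s ≠ 0 ∧ a + b * χ s ≠ 0 := by
    have h1 : (1 : ZMod j) ≠ 0 := by
      rw [← Nat.cast_one, Ne, ZMod.natCast_eq_zero_iff]
      exact Nat.not_dvd_of_pos_of_lt one_pos (by omega)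
    have h2 : (2 : ZMod j) ≠ 0 := by
      rw [← Nat.cast_two, Ne, ZMod.natCast_eq_zero_iff]
      exact Nat.not_dvd_of_pos_of_lt two_pos (by omega)
    by_contra! hc
    have e1 := hc 1 h1
    have e2 := hc 2 h2
    have e3 : b * (χ 1 - χ 2) = 0 := by linear_combination e1 - e2
    rcases mul_eq_zero.1 e3 with hb | hb
    · rw [hb, zero_mul, add_zero] at e1
      exact hab.elim (fun h => h e1) fun h => h hb
    · have := hχ (sub_eq_zero.1 hb)
      refine h1 ?_
      linear_combination this.symm
  obtain ⟨τ, hτi, hτk⟩ := h2t i k 0 s hik hs.symm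
  have hfix : ∀ σ : E ≃ₐ[RatFunc F] E, σ (ξ 0) = ξ 0 → σ (ξ s) = ξ s → σ (τ w) = τ w := by
    intro σ h0 h1
    have := hcon (τ⁻¹ * σ * τ) (by
      rw [AlgEquiv.mul_apply, AlgEquiv.mul_apply, hτi, h0, ← hτi]
      exact τ.symm_apply_apply _) (by
      rw [AlgEquiv.mul_apply, AlgEquiv.mul_apply, hτk, h1, ← hτk]
      exact τ.symm_apply_apply _)
    rw [AlgEquiv.mul_apply, AlgEquiv.mul_apply] at this
    have h3 := congrArg τ this
    rwa [show τ (τ⁻¹ (σ (τ w))) = σ (τ w) from τ.apply_symm_apply _] at h3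
  set L := (algebraMap (LaurentSeries F) (AlgebraicClosure (LaurentSeries F))).fieldRange.comap l
    with hL
  have hrat : ∀ r : RatFunc F, algebraMap (RatFunc F) E r ∈ L := by
    have hpol : ∀ Q : F[X], algebraMap (RatFunc F) E (algebraMap F[X] _ Q) ∈ L := by
      intro Q
      induction Q using Polynomial.induction_on' with
      | add P Q hP hQ => rw [map_add, map_add]; exact add_mem hP hQ
      | monomial n c =>
        rw [← C_mul_X_pow_eq_monomial, map_mul, map_mul, map_pow, map_pow, RatFunc.algebraMap_X]
        refine mul_mem ?_ (pow_mem ?_ n)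
        · exact ⟨_, (hlC c).symm⟩
        · exact ⟨_, hlX.symm⟩
    intro r
    rw [← RatFunc.num_div_denom r, map_div₀]
    exact div_mem (hpol _) (hpol _)
  have hmem : τ w ∈ IntermediateField.adjoin (RatFunc F) {ξ 0, ξ s} := by
    rw [← IsGalois.fixedField_fixingSubgroup (IntermediateField.adjoin (RatFunc F) {ξ 0, ξ s}),
      IntermediateField.mem_fixedField_iff]
    intro σ hσ
    rw [IntermediateField.mem_fixingSubgroup_iff] at hσ
    exact hfix σ (hσ _ (IntermediateField.subset_adjoin _ _ (by simp)))
      (hσ _ (IntermediateField.subset_adjoin _ _ (by simp)))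
  have hle : IntermediateField.adjoin (RatFunc F) {ξ 0, ξ s} ≤ L.toIntermediateField hrat := by
    rw [IntermediateField.adjoin_le_iff]
    rintro _ (rfl | rfl)
    · exact ⟨_, (hlξ _).symm⟩
    · exact ⟨_, (hlξ _).symm⟩
  obtain ⟨f, hf⟩ := hle hmem
  have hrotp : ∀ s, PoleLe 1 (laurentRot χ s x) := by
    intro s k hk
    rw [coeff_laurentRot, hxp k hk, mul_zero]
  refine pow_sub_ne_of_simple_pole p hp (f := f)
    (y := HahnSeries.C a * laurentRot χ 0 x + HahnSeries.C b * laurentRot χ s x) ?_ ?_ ?_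
  · have h1 := ((poleLe_C a).mul (hrotp 0)).add ((poleLe_C b).mul (hrotp s))
    simpa using h1
  · simpa [coeff_neg_one_laurentRot, hx1] using hsab
  · apply (algebraMap (LaurentSeries F) (AlgebraicClosure (LaurentSeries F))).injective
    have h1 := congrArg (fun z => l (τ z)) hw
    simp only [map_sub, map_pow, map_add, map_mul, AlgEquiv.commutes, hτi, hτk, hlC, hlξ] at h1
    simp only [map_sub, map_pow, map_add, map_mul]
    rw [← h1, ← hf]
end

end

section

open Polynomial

section
variable {K E : Type*} [Field K] [Field E] [Algebra K E] {p : ℕ} [Fact p.Prime] {j : ℕ} [NeZero j]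
  (κ : ZMod p →+* E)

theorem exists_eq_of_pow_eq_self {y : E} (hy : y ^ p = y) : ∃ c, κ c = y := by
  classical
  by_contra! hcon
  have hp := (Fact.out : p.Prime)
  have hne : (X ^ p - X : E[X]) ≠ 0 := FiniteField.X_pow_card_sub_X_ne_zero E hp.one_lt
  have hsub : insert y (Finset.univ.image κ) ⊆ (X ^ p - X : E[X]).roots.toFinset := by
    intro u hu
    rw [Multiset.mem_toFinset, mem_roots hne, IsRoot.def, eval_sub, eval_pow, eval_X, sub_eq_zero]
    rcases Finset.mem_insert.1 hu with rfl | hu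
    · exact hy
    · obtain ⟨c, -, rfl⟩ := Finset.mem_image.1 hu
      rw [← map_pow, ZMod.pow_card]
  have h1 := Finset.card_le_card hsub
  rw [Finset.card_insert_of_notMem (by simpa using hcon), Finset.card_image_of_injective _ κ.injective,
    Finset.card_univ, ZMod.card] at h1
  have h2 := (Multiset.toFinset_card_le _).trans (card_roots' (X ^ p - X : E[X]))
  rw [FiniteField.X_pow_card_sub_X_natDegree_eq E hp.one_lt] at h2
  omega

/-- The element `c` of the prime field with `σ z = z + c`. -/
noncomputable def artinShift (σ : E ≃ₐ[K] E) (z : E) : ZMod p := Function.invFun κ (σ z - z)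

variable {κ}

theorem artinShift_eq {σ : E ≃ₐ[K] E} {z : E} {c : ZMod p} (h : σ z = z + κ c) :
    artinShift κ σ z = c := by
  rw [artinShift, h, add_sub_cancel_left, Function.leftInverse_invFun κ.injective]

theorem algEquiv_primeField (σ : E ≃ₐ[K] E) (c : ZMod p) : σ (κ c) = κ c :=
  congrArg (fun φ : ZMod p →+* E => φ c) (Subsingleton.elim ((σ : E →+* E).comp κ) κ)

theorem exists_artinShift [CharP E p] {σ : E ≃ₐ[K] E} {z ξ : E} (hz : z ^ p - z = ξ)
    (h : σ ξ = ξ) : σ z = z + κ (artinShift κ σ z) := by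
  obtain ⟨c, hc⟩ := exists_eq_of_pow_eq_self κ (y := σ z - z) (by
    rw [sub_pow_char]
    have := congrArg σ hz
    rw [h, map_sub, map_pow] at this
    linear_combination this - hz)
  have h1 : σ z = z + κ c := by rw [hc]; ring
  rw [artinShift_eq h1, h1]

open scoped Classical in
/-- Sum over the fixed ordered pairs of distinct roots of the additive characters of the shifts. -/
noncomputable def pairChar (κ : ZMod p →+* E) (z ξ : ZMod j → E) (a b : ZMod p) (σ : E ≃ₐ[K] E) : ℂ :=
  ∑ i, ∑ k, if i ≠ k ∧ σ (ξ i) = ξ i ∧ σ (ξ k) = ξ k then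
    ZMod.stdAddChar (a * artinShift κ σ (z i) + b * artinShift κ σ (z k)) else 0

variable {z ξ : ZMod j → E}

theorem norm_pairChar_le (a b : ZMod p) (σ : E ≃ₐ[K] E) : ‖pairChar κ z ξ a b σ‖ ≤ (j : ℝ) ^ 2 := by
  classical
  have h0 : ∀ i k : ZMod j, ‖(if i ≠ k ∧ σ (ξ i) = ξ i ∧ σ (ξ k) = ξ k then
    (ZMod.stdAddChar (a * artinShift κ σ (z i) + b * artinShift κ σ (z k)) : ℂ) else 0)‖ ≤ 1 := by
    intro i k
    split_ifs
    · rw [AddChar.norm_apply]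
    · simp
  rw [pairChar]
  refine (norm_sum_le_of_le _ fun i _ => norm_sum_le_of_le _ fun k _ => h0 i k).trans ?_
  simp [ZMod.card, sq]

theorem pairChar_conj [CharP E p] (hz : ∀ i, z i ^ p - z i = ξ i)
    (hinj : Function.Injective ξ) (hperm : ∀ (σ : E ≃ₐ[K] E) i, ∃ k, σ (ξ i) = ξ k)
    (a b : ZMod p) (σ τ : E ≃ₐ[K] E) :
    pairChar κ z ξ a b (τ⁻¹ * σ * τ) = pairChar κ z ξ a b σ := by
  classical
  choose π hπ using hperm τ
  have hπb : Function.Bijective π := Finite.injective_iff_bijective.1 fun i k hik =>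
    hinj (τ.injective (by rw [hπ, hπ, hik]))
  have hfix : ∀ i, (τ⁻¹ * σ * τ) (ξ i) = ξ i ↔ σ (ξ (π i)) = ξ (π i) := by
    intro i
    rw [AlgEquiv.mul_apply, AlgEquiv.mul_apply, hπ]
    constructor
    · intro h
      have h1 := congrArg τ h
      rw [hπ] at h1
      exact (τ.apply_symm_apply _).symm.trans h1
    · intro h
      rw [h, ← hπ]
      exact τ.symm_apply_apply _
  have hshift : ∀ i, σ (ξ (π i)) = ξ (π i) →
      artinShift κ (τ⁻¹ * σ * τ) (z i) = artinShift κ σ (z (π i)) := by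
    intro i hi
    obtain ⟨c, hc⟩ := exists_eq_of_pow_eq_self κ (y := τ (z i) - z (π i)) (by
      rw [sub_pow_char]
      have h1 := congrArg τ (hz i)
      rw [hπ, map_sub, map_pow] at h1
      linear_combination h1 - hz (π i))
    have h1 : τ (z i) = z (π i) + κ c := by rw [hc]; ring
    apply artinShift_eq
    rw [AlgEquiv.mul_apply, AlgEquiv.mul_apply, h1, map_add, algEquiv_primeField,
      exists_artinShift (κ := κ) (hz _) hi]
    apply τ.injective
    rw [show ∀ y, τ (τ⁻¹ y) = y from τ.apply_symm_apply, map_add, algEquiv_primeField, h1]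
    ring
  rw [pairChar, pairChar]
  rw [← hπb.sum_comp (fun i => ∑ k, if i ≠ k ∧ σ (ξ i) = ξ i ∧ σ (ξ k) = ξ k then
    (ZMod.stdAddChar (a * artinShift κ σ (z i) + b * artinShift κ σ (z k)) : ℂ) else 0)]
  refine Finset.sum_congr rfl fun i _ => ?_
  rw [← hπb.sum_comp (fun k => if π i ≠ k ∧ σ (ξ (π i)) = ξ (π i) ∧ σ (ξ k) = ξ k then
    (ZMod.stdAddChar (a * artinShift κ σ (z (π i)) + b * artinShift κ σ (z k)) : ℂ) else 0)]
  refine Finset.sum_congr rfl fun k _ => ?_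
  simp only [hfix, hπb.injective.ne_iff]
  split_ifs with h
  · rw [hshift i h.2.1, hshift k h.2.2]
  · rfl

theorem sum_pairChar_of_moving [CharP E p] (hz : ∀ i, z i ^ p - z i = ξ i)
    [Fintype (E ≃ₐ[K] E)] {a b : ZMod p}
    (hmov : ∀ i k, i ≠ k → ∃ σ : E ≃ₐ[K] E, σ (ξ i) = ξ i ∧ σ (ξ k) = ξ k ∧
      σ (κ a * z i + κ b * z k) ≠ κ a * z i + κ b * z k) :
    ∑ σ : E ≃ₐ[K] E, pairChar κ z ξ a b σ = 0 := by
  classical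
  simp only [pairChar]
  rw [Finset.sum_comm]
  refine Finset.sum_eq_zero fun i _ => ?_
  rw [Finset.sum_comm]
  refine Finset.sum_eq_zero fun k _ => ?_
  by_cases hik : i = k
  · simp [hik]
  obtain ⟨τ, hτi, hτk, hτ⟩ := hmov i k hik
  set f : (E ≃ₐ[K] E) → ℂ := fun σ => if i ≠ k ∧ σ (ξ i) = ξ i ∧ σ (ξ k) = ξ k then
    ZMod.stdAddChar (a * artinShift κ σ (z i) + b * artinShift κ σ (z k)) else 0 with hf
  set c := a * artinShift κ τ (z i) + b * artinShift κ τ (z k) with hc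
  have hc0 : c ≠ 0 := by
    intro h0
    apply hτ
    rw [map_add, map_mul, map_mul, algEquiv_primeField, algEquiv_primeField,
      exists_artinShift (κ := κ) (hz i) hτi, exists_artinShift (κ := κ) (hz k) hτk]
    have := congrArg κ h0
    rw [hc, map_add, map_mul, map_mul, map_zero] at this
    linear_combination this
  have hmul : ∀ σ, f (σ * τ) = ZMod.stdAddChar c * f σ := by
    intro σ
    have e1 : ∀ m, τ (ξ m) = ξ m → ((σ * τ) (ξ m) = ξ m ↔ σ (ξ m) = ξ m) := by
      intro m hm
      rw [AlgEquiv.mul_apply, hm]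
    have e2 : ∀ m, τ (ξ m) = ξ m → σ (ξ m) = ξ m → artinShift κ (σ * τ) (z m) =
        artinShift κ τ (z m) + artinShift κ σ (z m) := by
      intro m hm hm'
      apply artinShift_eq
      rw [AlgEquiv.mul_apply, exists_artinShift (κ := κ) (hz m) hm, map_add, algEquiv_primeField,
        exists_artinShift (κ := κ) (hz m) hm', map_add]
      ring
    simp only [hf]
    rw [e1 i hτi, e1 k hτk]
    split_ifs with h
    · rw [e2 i hτi h.2.1, e2 k hτk h.2.2, ← AddChar.map_add_eq_mul]
      congr 1
      rw [hc]
      ring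
    · rw [mul_zero]
  have hsum : ZMod.stdAddChar c * ∑ σ, f σ = ∑ σ, f σ := by
    rw [Finset.mul_sum, ← Equiv.sum_comp (Equiv.mulRight τ) f]
    exact Finset.sum_congr rfl fun σ _ => (hmul σ).symm
  have h1 : (ZMod.stdAddChar c : ℂ) ≠ 1 := by
    rw [← AddChar.map_zero_eq_one (ZMod.stdAddChar (N := p))]
    exact ZMod.injective_stdAddChar.ne hc0
  have h2 : ((ZMod.stdAddChar c : ℂ) - 1) * ∑ σ, f σ = 0 := by rw [sub_mul, hsum]; ring
  exact (mul_eq_zero.1 h2).resolve_left (sub_ne_zero.2 h1)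

theorem sum_pairChar_zero (hinj : Function.Injective ξ)
    (hperm : ∀ (σ : E ≃ₐ[K] E) i, ∃ k, σ (ξ i) = ξ k) [Fintype (E ≃ₐ[K] E)] (hj : 1 < j)
    (h2t : ∀ i k i' k', i ≠ k → i' ≠ k' → ∃ σ : E ≃ₐ[K] E, σ (ξ i) = ξ i' ∧ σ (ξ k) = ξ k') :
    ∑ σ : E ≃ₐ[K] E, pairChar κ z ξ 0 0 σ = Fintype.card (E ≃ₐ[K] E) := by
  classical
  simp only [pairChar, zero_mul, add_zero, AddChar.map_zero_eq_one]
  have hone : (1 : ZMod j) ≠ 0 := by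
    rw [← Nat.cast_one, Ne, ZMod.natCast_eq_zero_iff]
    exact Nat.not_dvd_of_pos_of_lt one_pos hj
  have hst : ∀ i k, i ≠ k → (∑ σ : E ≃ₐ[K] E, if i ≠ k ∧ σ (ξ i) = ξ i ∧ σ (ξ k) = ξ k then (1 : ℂ) else 0) =
      ∑ σ : E ≃ₐ[K] E, if σ (ξ 0) = ξ i ∧ σ (ξ 1) = ξ k then (1 : ℂ) else 0 := by
    intro i k hik
    obtain ⟨τ, hτ0, hτ1⟩ := h2t 0 1 i k hone.symm hik
    rw [← Equiv.sum_comp (Equiv.mulRight τ) (fun σ : E ≃ₐ[K] E =>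
      if σ (ξ 0) = ξ i ∧ σ (ξ 1) = ξ k then (1 : ℂ) else 0)]
    refine Finset.sum_congr rfl fun σ _ => ?_
    simp only [Equiv.coe_mulRight, AlgEquiv.mul_apply, hτ0, hτ1, hik, ne_eq, not_false_eq_true,
      true_and]
  rw [Finset.sum_comm]
  simp_rw [Finset.sum_comm (s := (Finset.univ : Finset (E ≃ₐ[K] E)))]
  have : ∀ i k, (∑ σ : E ≃ₐ[K] E, if i ≠ k ∧ σ (ξ i) = ξ i ∧ σ (ξ k) = ξ k then (1 : ℂ) else 0) =
      ∑ σ : E ≃ₐ[K] E, if σ (ξ 0) = ξ i ∧ σ (ξ 1) = ξ k then (1 : ℂ) else 0 := by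
    intro i k
    by_cases hik : i = k
    · rw [Finset.sum_eq_zero fun σ _ => if_neg (by simp [hik]), Finset.sum_eq_zero fun σ _ => if_neg ?_]
      rintro ⟨h0, h1⟩
      rw [hik, ← h1] at h0
      exact hone.symm (hinj (σ.injective h0))
    · exact hst i k hik
  simp_rw [this]
  rw [Finset.sum_congr rfl fun i _ => Finset.sum_comm, Finset.sum_comm]
  rw [Finset.sum_congr rfl (g := fun _ => (1 : ℂ)), Finset.sum_const, Finset.card_univ, nsmul_eq_mul,
    mul_one]
  intro σ _
  obtain ⟨m, hm⟩ := hperm σ 0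
  obtain ⟨n, hn⟩ := hperm σ 1
  rw [Finset.sum_eq_single m, Finset.sum_eq_single n]
  · rw [if_pos ⟨hm, hn⟩]
  · intro k _ hk
    rw [if_neg]
    rintro ⟨-, h⟩
    exact hk (hinj (h.symm.trans hn))
  · simp
  · intro i _ hi
    refine Finset.sum_eq_zero fun k _ => if_neg ?_
    rintro ⟨h, -⟩
    exact hi (hinj (h.symm.trans hm))
  · simp
end

end

section

open Polynomial

section
variable {F : Type*} [Field F]

theorem monic_centeredPoly (h : ℕ) : (centeredPoly F h).Monic :=
  monic_prod_of_monic _ _ fun _ _ => monic_X_sub_C _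

theorem natDegree_centeredPoly (h : ℕ) : (centeredPoly F h).natDegree = 2 * h + 1 := by
  rw [centeredPoly, natDegree_prod_of_monic _ _ fun _ _ => monic_X_sub_C _]
  simp only [natDegree_X_sub_C, Finset.sum_const, Int.card_Icc, smul_eq_mul, mul_one]
  omega

theorem coeff_centeredPoly (h : ℕ) : (centeredPoly F h).coeff (2 * h + 1 - 1) = 0 := by
  have h1 := prod_X_sub_C_nextCoeff (s := Finset.Icc (-h : ℤ) h) (fun k : ℤ => (k : F))
  have h2 : ∑ k ∈ Finset.Icc (-h : ℤ) h, k = 0 := by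
    have h3 : ∑ k ∈ Finset.Icc (-h : ℤ) h, k = ∑ k ∈ Finset.Icc (-h : ℤ) h, -k :=
      Finset.sum_nbij' (fun k => -k) (fun k => -k) (by intro k; simp; omega) (by intro k; simp; omega)
        (by simp) (by simp) (by simp)
    rw [Finset.sum_neg_distrib] at h3
    omega
  rw [← Int.cast_sum, h2, Int.cast_zero, neg_zero] at h1
  have h3 : nextCoeff (centeredPoly F h) = 0 := h1
  rwa [nextCoeff_of_natDegree_pos (by rw [natDegree_centeredPoly]; omega), natDegree_centeredPoly] at h3

theorem map_centeredPoly {L : Type*} [Field L] (θ : F →+* L) (h : ℕ) :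
    (centeredPoly F h).map θ = centeredPoly L h := by
  rw [centeredPoly, centeredPoly, Polynomial.map_prod]
  simp

theorem separable_centeredPoly (p : ℕ) [CharP F p] {h : ℕ} (hp : 2 * h < p) :
    (centeredPoly F h).Separable := by
  rw [centeredPoly, separable_prod_X_sub_C_iff']
  intro x hx y hy hxy
  rw [← sub_eq_zero, ← Int.cast_sub, CharP.intCast_eq_zero_iff F p] at hxy
  rw [Finset.mem_Icc] at hx hy
  have := Int.eq_zero_of_abs_lt_dvd hxy (by rw [abs_lt]; constructor <;> linarith)
  linarith

theorem monic_artin {p : ℕ} (hp : 1 < p) : (X ^ p - X : F[X]).Monic :=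
  monic_X_pow_sub (by rw [degree_X]; exact_mod_cast hp)

theorem natDegree_artin {p : ℕ} (hp : 1 < p) : (X ^ p - X : F[X]).natDegree = p :=
  FiniteField.X_pow_card_sub_X_natDegree_eq F hp

theorem monic_comp_artin {P : F[X]} (hP : P.Monic) {p : ℕ} (hp : 1 < p) :
    (P.comp (X ^ p - X)).Monic :=
  hP.comp (monic_artin hp) (by rw [natDegree_artin hp]; omega)

theorem derivative_comp_artin (P : F[X]) (p : ℕ) [CharP F p] :
    derivative (P.comp (X ^ p - X)) = -(derivative P).comp (X ^ p - X) := by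
  rw [derivative_comp, derivative_sub, derivative_X_pow, derivative_X, CharP.cast_eq_zero]
  simp

theorem derivative_comp_artin_ne_zero {P : F[X]} {p : ℕ} [CharP F p] (hp : 1 < p)
    (hP : derivative P ≠ 0) : derivative (P.comp (X ^ p - X)) ≠ 0 := by
  rw [derivative_comp_artin, neg_ne_zero, Ne, comp_eq_zero_iff]
  rintro (h | ⟨-, h⟩)
  · exact hP h
  · have := congrArg natDegree h
    rw [natDegree_artin hp, natDegree_C] at this
    omega

theorem separable_comp_artin_iff [IsAlgClosed F] (P : F[X]) {p : ℕ} [CharP F p] (hp : 1 < p) (u : F) :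
    (P.comp (X ^ p - X) - C u).Separable ↔ (P - C u).Separable := by
  rw [Polynomial.Separable, Polynomial.Separable, derivative_sub, derivative_sub, derivative_C,
    sub_zero, sub_zero, derivative_comp_artin,
    isCoprime_iff_aeval_ne_zero_of_isAlgClosed F F, isCoprime_iff_aeval_ne_zero_of_isAlgClosed F F]
  simp only [coe_aeval_eq_eval, eval_sub, eval_comp, eval_C, eval_neg, neg_ne_zero]
  constructor
  · intro h x
    obtain ⟨z, hz⟩ := IsAlgClosed.exists_root ((X ^ p - X : F[X]) - C x) (by
      rw [degree_eq_natDegree (((natDegree_sub_C_pos (monic_artin hp)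
        (by rw [natDegree_artin hp]; omega) x).1).ne_zero),
        (natDegree_sub_C_pos (monic_artin hp) (by rw [natDegree_artin hp]; omega) x).2,
        natDegree_artin hp]
      exact_mod_cast (by omega : p ≠ 0))
    rw [IsRoot.def, eval_sub, eval_C, sub_eq_zero] at hz
    have := h z
    rwa [← eval_sub, hz] at this
  · intro h z
    exact h _

theorem map_frobenius_comp_artin (p : ℕ) [Fact p.Prime] [CharP F p] (h : ℕ) :
    ((centeredPoly F h).comp (X ^ p - X)).map (frobenius F p) = (centeredPoly F h).comp (X ^ p - X) := by
  rw [Polynomial.map_comp, map_centeredPoly]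
  simp

theorem derivative_centeredPoly_ne_zero (p : ℕ) [CharP F p] {h : ℕ} (hp : 2 * h + 1 < p) :
    derivative (centeredPoly F h) ≠ 0 := by
  intro h0
  have h1 := congrArg (fun P : F[X] => P.coeff (2 * h)) h0
  simp only [coeff_derivative, coeff_zero] at h1
  have h2 : (centeredPoly F h).coeff (2 * h + 1) = 1 := by
    have := (monic_centeredPoly (F := F) h).coeff_natDegree
    rwa [natDegree_centeredPoly] at this
  rw [h2, one_mul] at h1
  have h3 : ((2 * h + 1 : ℕ) : F) = 0 := by exact_mod_cast h1
  rw [CharP.cast_eq_zero_iff F p] at h3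
  exact absurd (Nat.le_of_dvd (by omega) h3) (by omega)

variable {E : Type*} [Field E]

theorem splits_of_comp_artin {f : E[X]} (hf : f.Monic) {p : ℕ} (hp : 1 < p)
    (hs : (f.comp (X ^ p - X)).Splits) :
    f.Splits ∧ ∀ ξ, f.eval ξ = 0 → ∃ z, z ^ p - z = ξ := by
  have key : ∀ {L : Type _} [Field L] {f : L[X]}, f.Monic → (f.comp (X ^ p - X)).Splits →
      ∀ ξ, f.eval ξ = 0 → ∃ z, z ^ p - z = ξ := by
    intro L _ f hf hs ξ hξ
    have hd := natDegree_sub_C_pos (monic_artin (F := L) hp) (by rw [natDegree_artin hp]; omega) ξ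
    have h1 : (X ^ p - X : L[X]) - C ξ ∣ f.comp (X ^ p - X) := by
      obtain ⟨g, hg⟩ := dvd_iff_isRoot.2 hξ
      refine ⟨g.comp (X ^ p - X), ?_⟩
      conv_lhs => rw [hg]
      rw [mul_comp, sub_comp, X_comp, C_comp]
    obtain ⟨z, hz⟩ := (hs.of_dvd (monic_comp_artin hf hp).ne_zero h1).exists_eval_eq_zero (by
      rw [degree_eq_natDegree hd.1.ne_zero, hd.2, natDegree_artin hp]
      exact_mod_cast (by omega : p ≠ 0))
    refine ⟨z, ?_⟩
    simpa [sub_eq_zero] using hz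
  refine ⟨?_, key hf hs⟩
  set i := algebraMap E (AlgebraicClosure E)
  have hsi := hs.map i
  rw [Polynomial.map_comp, Polynomial.map_sub, Polynomial.map_pow, map_X] at hsi
  refine Splits.of_splits_map i (IsAlgClosed.splits _) fun ξ hξ => ?_
  have hξ' := (mem_roots (hf.map i).ne_zero).1 hξ
  obtain ⟨z, hz⟩ := key (hf.map i) hsi ξ hξ'
  obtain ⟨z₀, hz₀⟩ := hs.mem_range_of_isRoot (monic_comp_artin hf hp).ne_zero (i := i) (x := z) (by
    rw [Polynomial.map_comp, Polynomial.map_sub, Polynomial.map_pow, map_X, IsRoot.def, eval_comp,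
      eval_sub, eval_pow, eval_X, hz]
    exact hξ')
  exact ⟨z₀ ^ p - z₀, by rw [map_sub, map_pow, hz₀, hz]⟩
end

end

section

open Polynomial

section
variable {F : Type*} [Field F]
  {E : Type*} [Field E] [Algebra (RatFunc F) E] [Algebra F[X] E]
  [IsScalarTower F[X] (RatFunc F) E] [Algebra F E] [IsScalarTower F F[X] E]

variable (F E) in
theorem algebraMap_eq_ratFunc_comp :
    algebraMap F E = (algebraMap (RatFunc F) E).comp (algebraMap F (RatFunc F)) :=
  RingHom.ext fun c => (IsScalarTower.algebraMap_apply F F[X] E c).trans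
    (IsScalarTower.algebraMap_apply F[X] (RatFunc F) E _)

theorem eval_map_genericFiber (P : F[X]) (z : E) :
    eval z ((genericFiber P).map (algebraMap (RatFunc F) E)) =
      aeval z P - algebraMap (RatFunc F) E RatFunc.X := by
  rw [map_genericFiber, eval_sub, eval_map, eval_C, ← algebraMap_eq_ratFunc_comp, aeval_def]

theorem isIntegral_of_aeval_eq {Q : F[X]} (hQ : Q.Monic) (hd : 0 < Q.natDegree) {z : E}
    (hz : aeval z Q = algebraMap (RatFunc F) E RatFunc.X) : IsIntegral F[X] z := by
  refine ⟨Q.map C - C X, (natDegree_sub_C_pos (hQ.map _) (by rwa [natDegree_map]) _).1, ?_⟩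
  rw [eval₂_sub, eval₂_map, eval₂_C, sub_eq_zero, IsScalarTower.algebraMap_apply F[X] (RatFunc F) E,
    RatFunc.algebraMap_X, ← hz, aeval_def]
  congr 1
  exact (IsScalarTower.algebraMap_eq F F[X] E).symm

theorem mem_rootSet_genericFiber {Q : F[X]} (hQ : Q.Monic) (hd : 0 < Q.natDegree) {z : E}
    (hz : aeval z Q = algebraMap (RatFunc F) E RatFunc.X) : z ∈ (genericFiber Q).rootSet E := by
  have hm : (genericFiber Q).Monic :=
    (natDegree_sub_C_pos (hQ.map _) (by rwa [natDegree_map]) _).1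
  rw [mem_rootSet_of_ne hm.ne_zero, aeval_def, ← eval_map, eval_map_genericFiber, hz, sub_self]

theorem eval_sub_eq_prod {ι : Type*} [Fintype ι] {P : F[X]} {ξ : ι → E}
    (hprod : (genericFiber P).map (algebraMap (RatFunc F) E) = ∏ i, (X - C (ξ i)))
    (hInt : ∀ i, IsIntegral F[X] (ξ i)) (e : integralClosure F[X] E →ₐ[F] F) {u : F}
    (he : e (algebraMap F[X] _ X) = u) (c : F) :
    P.eval c - u = ∏ i, (c - e ⟨ξ i, hInt i⟩) := by
  have h1 : algebraMap F (integralClosure F[X] E) (P.eval c) - algebraMap F[X] _ X =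
      ∏ i, (algebraMap F (integralClosure F[X] E) c - ⟨ξ i, hInt i⟩) := by
    apply Subtype.ext
    push_cast
    have h2 := congrArg (eval (algebraMap F E c)) hprod
    rw [eval_prod, eval_map_genericFiber] at h2
    simp only [eval_sub, eval_X, eval_C] at h2
    refine Eq.trans ?_ h2
    congr 1
    · rw [aeval_def, eval₂_at_apply]
    · exact (IsScalarTower.algebraMap_apply F[X] (RatFunc F) E _).trans
        (congrArg _ RatFunc.algebraMap_X)
  have h2 := congrArg e h1
  rw [map_sub, map_prod, AlgHom.commutes, he] at h2
  refine h2.trans (Finset.prod_congr rfl fun i _ => ?_)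
  rw [map_sub, AlgHom.commutes]
  rfl

theorem sum_pow_artin {p : ℕ} [Fact p.Prime] [CharP F p] (w : F) (n : ℕ) :
    ∑ m ∈ Finset.range n, (w ^ p - w) ^ p ^ m = w ^ p ^ n - w := by
  rw [← pow_one w, Finset.sum_congr rfl (g := fun m => w ^ p ^ (m + 1) - w ^ p ^ m) fun m _ => ?_,
    Finset.sum_range_sub (fun m => w ^ p ^ m)]
  · simp
  · rw [pow_one, sub_pow_char_pow, ← pow_mul, ← pow_succ']

variable [FiniteDimensional (RatFunc F) E] [IsGalois (RatFunc F) E]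

theorem sum_pairs_eq_pairChar {p : ℕ} [Fact p.Prime] [CharP F p] [CharP E p] [Infinite F]
    {j : ℕ} [NeZero j]
    (κ : ZMod p →+* F) {P : F[X]} (hP : P.Monic) (hPd : 0 < P.natDegree) {z ξ : ZMod j → E}
    (hz : ∀ i, z i ^ p - z i = ξ i)
    (hprod : (genericFiber P).map (algebraMap (RatFunc F) E) = ∏ i, (X - C (ξ i)))
    (hperm : ∀ (σ : E ≃ₐ[RatFunc F] E) i, ∃ k, σ (ξ i) = ξ k)
    {n : ℕ} {u : F} (hu : (P - C u).Separable) {σ : E ≃ₐ[RatFunc F] E}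
    {e : integralClosure F[X] E →ₐ[F] F} (he : e (algebraMap F[X] _ X) = u)
    (hσ : ∀ y : integralClosure F[X] E, (y : E) ∈ (genericFiber (P.comp (X ^ p - X))).rootSet E →
            (e y) ^ p ^ n = e (galInt σ y))
    (T : Finset (F × F)) (hT : ∀ x y, (x, y) ∈ T ↔
      x ^ p ^ n = x ∧ y ^ p ^ n = y ∧ x ≠ y ∧ P.eval x = u ∧ P.eval y = u) (a b : ZMod p) :
    ∑ t ∈ T, (ZMod.stdAddChar (Function.invFun κ
      (∑ m ∈ Finset.range n, (κ a * t.1 + κ b * t.2) ^ p ^ m)) : ℂ) =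
      pairChar ((algebraMap F E).comp κ) z ξ a b σ := by
  classical
  have hp := (Fact.out : p.Prime)
  have hξX : ∀ i, aeval (ξ i) P = algebraMap (RatFunc F) E RatFunc.X := by
    intro i
    have h1 := congrArg (eval (ξ i)) hprod
    rw [eval_map_genericFiber, eval_prod, Finset.prod_eq_zero (Finset.mem_univ i) (by simp),
      sub_eq_zero] at h1
    exact h1
  have hInt : ∀ i, IsIntegral F[X] (ξ i) := fun i => isIntegral_of_aeval_eq hP hPd (hξX i)
  have hQm := monic_comp_artin hP hp.one_lt
  have hQd : 0 < (P.comp (X ^ p - X)).natDegree := by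
    rw [natDegree_comp, natDegree_artin hp.one_lt]
    exact Nat.mul_pos hPd hp.pos
  have hzX : ∀ i, aeval (z i) (P.comp (X ^ p - X)) = algebraMap (RatFunc F) E RatFunc.X := by
    intro i
    rw [aeval_comp, map_sub, map_pow, aeval_X, hz, hξX]
  have hzint : ∀ i, IsIntegral F[X] (z i) := fun i => isIntegral_of_aeval_eq hQm hQd (hzX i)
  set x : ZMod j → F := fun i => e ⟨ξ i, hInt i⟩ with hx
  set w : ZMod j → F := fun i => e ⟨z i, hzint i⟩ with hw
  have hwx : ∀ i, w i ^ p - w i = x i := by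
    intro i
    rw [hw, hx]
    simp only
    rw [← map_pow, ← map_sub]
    congr 1
    exact Subtype.ext (hz i)
  have heval : ∀ c, P.eval c - u = ∏ i, (c - x i) := eval_sub_eq_prod hprod hInt e he
  have hroot : ∀ c, P.eval c = u ↔ ∃ i, c = x i := by
    intro c
    rw [← sub_eq_zero, heval, Finset.prod_eq_zero_iff]
    simp [sub_eq_zero]
  have hxinj : Function.Injective x := by
    have h1 : P - C u = ∏ i, (X - C (x i)) := by
      refine Polynomial.funext fun c => ?_
      rw [eval_prod, eval_sub, eval_C, heval]
      simp
    rw [h1] at hu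
    exact separable_prod_X_sub_C_iff.1 hu
  have hwq : ∀ i (y : E) (hy : IsIntegral F[X] y), σ (z i) = y → w i ^ p ^ n = e ⟨y, hy⟩ := by
    intro i y hy hyz
    rw [hw]
    simp only
    rw [hσ ⟨z i, hzint i⟩ (mem_rootSet_genericFiber hQm hQd (hzX i))]
    congr 1
    apply Subtype.ext
    rw [coe_galInt]
    exact hyz
  have hxq : ∀ i k, σ (ξ i) = ξ k → x i ^ p ^ n = x k := by
    intro i k hik
    have h0 : IsIntegral F[X] (σ (z i)) :=
      isIntegral_of_aeval_eq hQm hQd (by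
        have h1 := congrArg σ (hzX i)
        rw [σ.commutes] at h1
        rw [← h1, ← eval_map_algebraMap, ← eval_map_algebraMap]
        rw [eval_map, eval_map]
        change _ = (σ : E →+* E) _
        rw [hom_eval₂]
        congr 1
        rw [algebraMap_eq_ratFunc_comp F E]
        exact RingHom.ext fun c => (σ.commutes _).symm)
    rw [← hwx, sub_pow_char_pow, ← pow_mul, mul_comm p, pow_mul, hwq i _ h0 rfl, hx]
    simp only
    rw [← map_pow, ← map_sub]
    congr 1
    apply Subtype.ext
    push_cast
    rw [← map_pow, ← map_sub, hz, hik]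
  have hfix : ∀ i, x i ^ p ^ n = x i ↔ σ (ξ i) = ξ i := by
    intro i
    constructor
    · intro h
      obtain ⟨k, hk⟩ := hperm σ i
      rw [hxq i k hk] at h
      rw [hk, hxinj h]
    · exact hxq i i
  set κE := (algebraMap F E).comp κ with hκE
  have htr : ∀ i, σ (ξ i) = ξ i →
      ∑ m ∈ Finset.range n, x i ^ p ^ m = κ (artinShift κE σ (z i)) := by
    intro i hi
    have h1 := exists_artinShift (κ := κE) (hz i) hi
    have h2 : IsIntegral F[X] (z i + κE (artinShift κE σ (z i))) := by
      refine (integralClosure F[X] E).add_mem (hzint i) ?_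
      rw [hκE, RingHom.comp_apply, IsScalarTower.algebraMap_apply F F[X] E]
      exact isIntegral_algebraMap
    rw [Finset.sum_congr rfl fun m _ => by rw [← hwx i], sum_pow_artin, hwq i _ h2 h1, sub_eq_iff_eq_add]
    have h3 : (⟨_, h2⟩ : integralClosure F[X] E) = algebraMap F _ (κ (artinShift κE σ (z i))) +
        ⟨z i, hzint i⟩ := by
      apply Subtype.ext
      push_cast
      rw [add_comm]
      rfl
    rw [h3, map_add, AlgHom.commutes]
    rfl
  have hTimg : T = ((Finset.univ ×ˢ Finset.univ : Finset (ZMod j × ZMod j)).filter fun t =>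
      t.1 ≠ t.2 ∧ σ (ξ t.1) = ξ t.1 ∧ σ (ξ t.2) = ξ t.2).image fun t => (x t.1, x t.2) := by
    ext ⟨y, y'⟩
    rw [hT, Finset.mem_image, hroot, hroot]
    constructor
    · rintro ⟨h1, h2, h3, ⟨i, rfl⟩, ⟨k, rfl⟩⟩
      refine ⟨(i, k), ?_, rfl⟩
      rw [Finset.mem_filter]
      exact ⟨by simp, fun h => h3 (congrArg x h), (hfix i).1 h1, (hfix k).1 h2⟩
    · rintro ⟨⟨i, k⟩, h, hik⟩
      rw [Prod.mk.injEq] at hik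
      obtain ⟨rfl, rfl⟩ := hik
      obtain ⟨-, h1, h2, h3⟩ := Finset.mem_filter.1 h
      exact ⟨(hfix i).2 h2, (hfix k).2 h3, hxinj.ne h1, ⟨i, rfl⟩, ⟨k, rfl⟩⟩
  rw [hTimg, Finset.sum_image, Finset.sum_filter, Finset.sum_product, pairChar]
  · refine Finset.sum_congr rfl fun i _ => Finset.sum_congr rfl fun k _ => ?_
    simp only
    split_ifs with h
    · congr 1
      have h1 : ∑ m ∈ Finset.range n, (κ a * x i + κ b * x k) ^ p ^ m =
          κ (a * artinShift κE σ (z i) + b * artinShift κE σ (z k)) := by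
        rw [map_add, map_mul, map_mul, ← htr i h.2.1, ← htr k h.2.2, Finset.mul_sum, Finset.mul_sum,
          ← Finset.sum_add_distrib]
        refine Finset.sum_congr rfl fun m _ => ?_
        rw [add_pow_char_pow, mul_pow, mul_pow, ← map_pow κ a, ← map_pow κ b, ZMod.pow_card_pow,
          ZMod.pow_card_pow]
      rw [h1, Function.leftInverse_invFun κ.injective]
    · rfl
  · rintro ⟨i, k⟩ _ ⟨i', k'⟩ _ hik
    rw [Prod.mk.injEq] at hik
    exact Prod.ext (hxinj hik.1) (hxinj hik.2)
end

end

section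

open Polynomial

section
variable {F : Type*} [Field F] [IsAlgClosed F]

theorem exists_two_transitive_roots (p : ℕ) [Fact p.Prime] [CharP F p]
    {h j : ℕ} [Fact j.Prime] (hj : j = 2 * h + 1) (hh : 1 ≤ h) (hp : 2 * j * (h + 1) ^ 2 < p)
    (E : Type*) [Field E] [Algebra (RatFunc F) E] [Algebra F[X] E]
    [IsScalarTower F[X] (RatFunc F) E] [Algebra F E] [IsScalarTower F F[X] E]
    [IsSplittingField (RatFunc F) E (genericFiber ((centeredPoly F h).comp (X ^ p - X)))] :
    ∃ (χ : AddChar (ZMod j) F) (x : LaurentSeries F)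
      (l : E →+* AlgebraicClosure (LaurentSeries F)) (ξ : ZMod j → E),
      Function.Injective χ ∧
      (centeredPoly F h).eval₂ HahnSeries.C x = HahnSeries.single (-j : ℤ) 1 ∧
      x.coeff (-1) = 1 ∧ x.coeff 0 = 0 ∧ (∀ n < -1, x.coeff n = 0) ∧
      (∀ a : F, l (algebraMap (RatFunc F) E (algebraMap F[X] _ (C a))) =
        algebraMap _ _ (HahnSeries.C (Γ := ℤ) a)) ∧
      l (algebraMap (RatFunc F) E RatFunc.X) = algebraMap _ _ (HahnSeries.single (-j : ℤ) (1 : F)) ∧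
      (∀ i, l (ξ i) = algebraMap _ _ (laurentRot χ i x)) ∧
      (genericFiber (centeredPoly F h)).map (algebraMap (RatFunc F) E) = ∏ i, (X - C (ξ i)) ∧
      (∀ i, ∃ z, z ^ p - z = ξ i) ∧
      ∀ i k i' k', i ≠ k → i' ≠ k' → ∃ σ : E ≃ₐ[RatFunc F] E, σ (ξ i) = ξ i' ∧ σ (ξ k) = ξ k' := by
  classical
  have hpp := (Fact.out : p.Prime)
  have hjp := (Fact.out : j.Prime)
  have hj1 : 2 < j := by omega
  have hjp' : 2 * h + 1 < p := by
    rw [← hj]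
    refine lt_of_le_of_lt ?_ hp
    nlinarith [Nat.one_le_pow 2 (h + 1) (by omega)]
  have hjF : (j : F) ≠ 0 := by
    rw [Ne, CharP.cast_eq_zero_iff F p]
    exact Nat.not_dvd_of_pos_of_lt hjp.pos (by omega)
  set P := centeredPoly F h with hP
  have hPm : P.Monic := monic_centeredPoly h
  have hPd : P.natDegree = j := by rw [hP, natDegree_centeredPoly, hj]
  have hPd0 : 0 < P.natDegree := by rw [hPd]; exact hjp.pos
  have hP' : derivative P ≠ 0 := derivative_centeredPoly_ne_zero p hjp'
  set Q := P.comp (X ^ p - X) with hQ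
  have hQm : Q.Monic := monic_comp_artin hPm hpp.one_lt
  have hQ' : derivative Q ≠ 0 := derivative_comp_artin_ne_zero hpp.one_lt hP'
  have hQd : 0 < Q.natDegree := by
    rw [hQ, natDegree_comp, natDegree_artin hpp.one_lt]
    exact Nat.mul_pos hPd0 hpp.pos
  have := IsSplittingField.finiteDimensional E (genericFiber Q)
  have := isGalois_genericFiber hQ' E
  have : CharP E p := charP_of_injective_algebraMap (algebraMap F E).injective p
  have hcomp : (genericFiber Q).map (algebraMap (RatFunc F) E) =
      ((genericFiber P).map (algebraMap (RatFunc F) E)).comp (X ^ p - X) := by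
    rw [map_genericFiber, map_genericFiber, hQ, Polynomial.map_comp, sub_comp, C_comp]
    simp
  have hPmap : ((genericFiber P).map (algebraMap (RatFunc F) E)).Monic :=
    ((natDegree_sub_C_pos (hPm.map _) (by rwa [natDegree_map]) _).1).map _
  obtain ⟨hsplit, hart⟩ := splits_of_comp_artin hPmap hpp.one_lt
    (hcomp ▸ IsSplittingField.splits E (genericFiber Q))
  obtain ⟨x, hx, hx1, hx0, hxp⟩ := exists_laurent_inverse P hPm hPd hjp.two_le hjF
    (by rw [hj]; exact coeff_centeredPoly h)
  obtain ⟨χ, hχ⟩ := exists_injective_addChar (j := j) hjF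
  obtain ⟨l, ξ, hlC, hlX, hlξ, hprod, hcyc⟩ := exists_puiseux_embedding (E := E) (genericFiber Q) P hPm
    hPd hsplit χ hχ x hx hx1
  have hroot : ∀ y, aeval y P = algebraMap (RatFunc F) E RatFunc.X ↔ ∃ i, y = ξ i := by
    intro y
    rw [← sub_eq_zero, ← eval_map_genericFiber, hprod, eval_prod, Finset.prod_eq_zero_iff]
    simp [sub_eq_zero]
  have hinj : Function.Injective ξ := by
    intro i k hik
    have h1 := congrArg l hik
    rw [hlξ, hlξ] at h1
    exact laurentRot_injective_of_coeff χ hχ hx1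
      ((algebraMap (LaurentSeries F) (AlgebraicClosure (LaurentSeries F))).injective h1)
  have hz : ∀ i, ∃ z, z ^ p - z = ξ i := fun i => hart _ (by
    rw [eval_map_genericFiber, (hroot _).2 ⟨i, rfl⟩, sub_self])
  have hQ0 : (Q - C 0).Separable := (separable_comp_artin_iff P hpp.one_lt 0).2 (by
    rw [map_zero, sub_zero]
    exact separable_centeredPoly p (by omega))
  obtain ⟨φ, -, hφ⟩ := exists_integral_expansion (E := E) 0 Q hQm hQd hQ0
  set e₀ : integralClosure F[X] E →ₐ[F] F :=
    { (PowerSeries.constantCoeff (R := F)).comp (φ : integralClosure F[X] E →+* PowerSeries F) with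
      commutes' := fun c => by
        change PowerSeries.constantCoeff (φ (algebraMap F _ c)) = c
        rw [AlgHom.commutes]
        exact PowerSeries.constantCoeff_C c } with he₀
  have he₀X : e₀ (algebraMap F[X] _ X) = 0 := by
    change PowerSeries.constantCoeff (φ _) = 0
    rw [hφ, constantCoeff_expandAt, eval_X]
  have hF : ∀ c : F, algebraMap F E c = algebraMap (RatFunc F) E (algebraMap F[X] _ (C c)) := fun c => by
    rw [IsScalarTower.algebraMap_apply F F[X] E, IsScalarTower.algebraMap_apply F[X] (RatFunc F) E]
    rfl
  exact ⟨χ, x, l, ξ, hχ, hx, hx1, hx0, hxp, hlC, hlX, hlξ, hprod, hz, fun i k i' k' hik hik' => two_transitive_of_fixing (G := E ≃ₐ[RatFunc F] E) hcyc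
      (fun s₀ s₁ hs₀ hs₁ => exists_fixing_of_puiseux p hj hp hh e₀ he₀X χ hx1 hx0 hxp
        (fun c => (congrArg l (hF c)).trans (hlC c)) hlξ hprod hcyc hinj hs₀ hs₁) hik hik'⟩

theorem exists_equidistribution_of_splittingField (p : ℕ) [Fact p.Prime] [CharP F p] (κ : ZMod p →+* F)
    {h j : ℕ} [Fact j.Prime] (hj : j = 2 * h + 1) (hh : 1 ≤ h) (hp : 2 * j * (h + 1) ^ 2 < p)
    (E : Type*) [Field E] [Algebra (RatFunc F) E] [Algebra F[X] E]
    [IsScalarTower F[X] (RatFunc F) E] [Algebra F E] [IsScalarTower F F[X] E]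
    [IsSplittingField (RatFunc F) E (genericFiber ((centeredPoly F h).comp (X ^ p - X)))] :
    ∃ N₀ : ℕ, 1 ≤ N₀ ∧ ∃ B : ℝ, 0 ≤ B ∧ ∀ n, n ≠ 0 → N₀ ∣ n → ∀ T : Finset (F × F),
      (∀ x y, (x, y) ∈ T ↔ x ^ p ^ n = x ∧ y ^ p ^ n = y ∧ x ≠ y ∧
        (centeredPoly F h).eval x = (centeredPoly F h).eval y ∧
        (centeredPoly F h - C ((centeredPoly F h).eval x)).Separable) → ∀ a b : ZMod p,
      ‖∑ t ∈ T, (ZMod.stdAddChar (Function.invFun κ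
          (∑ m ∈ Finset.range n, (κ a * t.1 + κ b * t.2) ^ p ^ m)) : ℂ) -
        (if a = 0 ∧ b = 0 then (p : ℂ) ^ n else 0)‖ ≤ B * √((p : ℝ) ^ n) := by
  classical
  have hpp := (Fact.out : p.Prime)
  have hjp := (Fact.out : j.Prime)
  have hj1 : 2 < j := by omega
  have hjp' : 2 * h + 1 < p := by
    rw [← hj]
    refine lt_of_le_of_lt ?_ hp
    nlinarith [Nat.one_le_pow 2 (h + 1) (by omega)]
  have hjF : (j : F) ≠ 0 := by
    rw [Ne, CharP.cast_eq_zero_iff F p]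
    exact Nat.not_dvd_of_pos_of_lt hjp.pos (by omega)
  set P := centeredPoly F h with hP
  have hPm : P.Monic := monic_centeredPoly h
  have hPd : P.natDegree = j := by rw [hP, natDegree_centeredPoly, hj]
  have hPd0 : 0 < P.natDegree := by rw [hPd]; exact hjp.pos
  have hP' : derivative P ≠ 0 := derivative_centeredPoly_ne_zero p hjp'
  set Q := P.comp (X ^ p - X) with hQ
  have hQm : Q.Monic := monic_comp_artin hPm hpp.one_lt
  have hQ' : derivative Q ≠ 0 := derivative_comp_artin_ne_zero hpp.one_lt hP'
  have hQd : 0 < Q.natDegree := by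
    rw [hQ, natDegree_comp, natDegree_artin hpp.one_lt]
    exact Nat.mul_pos hPd0 hpp.pos
  have := IsSplittingField.finiteDimensional E (genericFiber Q)
  have := isGalois_genericFiber hQ' E
  have : CharP E p := charP_of_injective_algebraMap (algebraMap F E).injective p
  obtain ⟨N₀, hN₀, B, hB, hmain⟩ := exists_frobenius_equidistribution (E := E) p Q hQm hQ'
    (map_frobenius_comp_artin p h)
  obtain ⟨χ, x, l, ξ, hχ, hx, hx1, hx0, hxp, hlC, hlX, hlξ, hprod, hz, h2t⟩ :=
    exists_two_transitive_roots (F := F) p hj hh hp E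
  have hroot : ∀ y, aeval y P = algebraMap (RatFunc F) E RatFunc.X ↔ ∃ i, y = ξ i := by
    intro y
    rw [← sub_eq_zero, ← eval_map_genericFiber, hprod, eval_prod, Finset.prod_eq_zero_iff]
    simp [sub_eq_zero]
  have hinj : Function.Injective ξ := by
    intro i k hik
    have h1 := congrArg l hik
    rw [hlξ, hlξ] at h1
    exact laurentRot_injective_of_coeff χ hχ hx1
      ((algebraMap (LaurentSeries F) (AlgebraicClosure (LaurentSeries F))).injective h1)
  have hperm : ∀ (σ : E ≃ₐ[RatFunc F] E) i, ∃ k, σ (ξ i) = ξ k := by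
    intro σ i
    have h1 := congrArg σ ((hroot _).2 ⟨i, rfl⟩)
    rw [σ.commutes] at h1
    refine (hroot _).1 (h1 ▸ ?_)
    rw [aeval_def, aeval_def]
    change _ = (σ : E →+* E) _
    rw [hom_eval₂]
    congr 1
    rw [algebraMap_eq_ratFunc_comp F E]
    exact RingHom.ext fun c => (σ.commutes _).symm
  choose z hz using hz
  have hF : ∀ c : F, algebraMap F E c = algebraMap (RatFunc F) E (algebraMap F[X] _ (C c)) := fun c => by
    rw [IsScalarTower.algebraMap_apply F F[X] E, IsScalarTower.algebraMap_apply F[X] (RatFunc F) E]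
    rfl
  set κE := (algebraMap F E).comp κ with hκE
  have hmov : ∀ a b : ZMod p, ¬ (a = 0 ∧ b = 0) → ∀ i k, i ≠ k → ∃ σ : E ≃ₐ[RatFunc F] E,
      σ (ξ i) = ξ i ∧ σ (ξ k) = ξ k ∧ σ (κE a * z i + κE b * z k) ≠ κE a * z i + κE b * z k := by
    intro a b hab i k hik
    refine exists_moving_of_artinSchreier p hpp.one_lt hj1 χ hχ hx1 hxp hlC hlX hlξ h2t
      (a := κ a) (b := κ b) ?_ hik ?_
    · simpa [or_iff_not_and_not] using hab
    · have hκp : ∀ c, κE c ^ p = κE c := fun c => by rw [← map_pow, ZMod.pow_card]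
      rw [add_pow_char, mul_pow, mul_pow, hκp, hκp, ← hF, ← hF, ← hz i, ← hz k]
      simp only [hκE, RingHom.comp_apply]
      ring
  refine ⟨N₀, hN₀, B * (j : ℝ) ^ 2, by positivity, fun n hn hNn T hT a b => ?_⟩
  have hqp : 1 < p ^ n := Nat.one_lt_pow hn hpp.one_lt
  set S : Finset F := ((X ^ p ^ n - X : F[X]).roots.toFinset).filter fun u => (Q - C u).Separable with hS
  have hSmem : ∀ u, u ∈ S ↔ u ^ p ^ n = u ∧ (Q - C u).Separable := by
    intro u
    rw [hS, Finset.mem_filter, (card_fixed_roots p hn).2]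
  obtain ⟨f, e, he, hdist⟩ := hmain n hn hNn S hSmem
  have hsum : ∑ t ∈ T, (ZMod.stdAddChar (Function.invFun κ
      (∑ m ∈ Finset.range n, (κ a * t.1 + κ b * t.2) ^ p ^ m)) : ℂ) =
      ∑ u ∈ S, pairChar κE z ξ a b (f u) := by
    have hmaps : ∀ t ∈ T, P.eval t.1 ∈ S := by
      rintro ⟨x, y⟩ ht
      obtain ⟨h1, -, -, -, h5⟩ := (hT x y).1 ht
      refine (hSmem _).2 ⟨?_, (separable_comp_artin_iff P hpp.one_lt _).2 h5⟩
      have h6 : (P.eval x) ^ p ^ n = P.eval (x ^ p ^ n) := by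
        have h8 : P.map (iterateFrobenius F p n) = P := map_centeredPoly _ h
        change iterateFrobenius F p n _ = _
        conv_rhs => rw [← h8]
        exact (eval_map_apply (iterateFrobenius F p n) x).symm
      rw [h6, h1]
    rw [← Finset.sum_fiberwise_of_maps_to hmaps]
    refine Finset.sum_congr rfl fun u hu => ?_
    obtain ⟨hu1, hu2⟩ := (hSmem u).1 hu
    obtain ⟨he1, he2⟩ := he u hu
    have hu3 := (separable_comp_artin_iff P hpp.one_lt u).1 hu2
    refine sum_pairs_eq_pairChar κ hPm hPd0 hz hprod hperm hu3 he1 he2 _ (fun x y => ?_) a b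
    rw [Finset.mem_filter, hT]
    constructor
    · rintro ⟨⟨h1, h2, h3, h4, -⟩, h5⟩
      exact ⟨h1, h2, h3, h5, h4 ▸ h5⟩
    · rintro ⟨h1, h2, h3, h4, h5⟩
      exact ⟨⟨h1, h2, h3, h4.trans h5.symm, h4.symm ▸ hu3⟩, h4⟩
  have havg : (p : ℂ) ^ n * ((∑ σ : E ≃ₐ[RatFunc F] E, pairChar κE z ξ a b σ) / Fintype.card (E ≃ₐ[RatFunc F] E)) =
      if a = 0 ∧ b = 0 then (p : ℂ) ^ n else 0 := by
    split_ifs with hab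
    · rw [hab.1, hab.2, sum_pairChar_zero hinj hperm hjp.one_lt h2t, div_self, mul_one]
      exact_mod_cast Fintype.card_ne_zero
    · rw [sum_pairChar_of_moving hz (hmov a b hab), zero_div, mul_zero]
  have hfin := hdist (pairChar κE z ξ a b) (fun σ τ => pairChar_conj hz hinj hperm a b σ τ) _
    (fun σ => norm_pairChar_le a b σ)
  rw [← hsum] at hfin
  push_cast at hfin
  rw [havg] at hfin
  linarith

/-- Square-root equidistribution on the curve `P x = P y`, `x ≠ y`, over large finite fields. -/
theorem exists_curve_equidistribution (p : ℕ) [Fact p.Prime] [CharP F p] (κ : ZMod p →+* F)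
    {h j : ℕ} [Fact j.Prime] (hj : j = 2 * h + 1) (hh : 1 ≤ h) (hp : 2 * j * (h + 1) ^ 2 < p) :
    ∃ N₀ : ℕ, 1 ≤ N₀ ∧ ∃ B : ℝ, 0 ≤ B ∧ ∀ n, n ≠ 0 → N₀ ∣ n → ∀ T : Finset (F × F),
      (∀ x y, (x, y) ∈ T ↔ x ^ p ^ n = x ∧ y ^ p ^ n = y ∧ x ≠ y ∧
        (centeredPoly F h).eval x = (centeredPoly F h).eval y ∧
        (centeredPoly F h - C ((centeredPoly F h).eval x)).Separable) → ∀ a b : ZMod p,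
      ‖∑ t ∈ T, (ZMod.stdAddChar (Function.invFun κ
          (∑ m ∈ Finset.range n, (κ a * t.1 + κ b * t.2) ^ p ^ m)) : ℂ) -
        (if a = 0 ∧ b = 0 then (p : ℂ) ^ n else 0)‖ ≤ B * √((p : ℝ) ^ n) := by
  set E := (genericFiber ((centeredPoly F h).comp (X ^ p - X))).SplittingField
  have : IsScalarTower F F[X] E := IsScalarTower.of_algebraMap_eq fun c => by
    rw [IsScalarTower.algebraMap_apply F (RatFunc F) E,
      IsScalarTower.algebraMap_apply F[X] (RatFunc F) E]
    rfl
  exact exists_equidistribution_of_splittingField p κ hj hh hp E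
end

end

section

open Polynomial

section
variable {F : Type*} [Field F]

/-- The roots `x_s`, `s ≠ 0`, of `P Y = P x` other than `x` itself are conjugate over `F(x)`. -/
theorem exists_conjugate_laurent_roots [IsAlgClosed F] (p : ℕ) [Fact p.Prime] [CharP F p]
    {h j : ℕ} [Fact j.Prime] (hj : j = 2 * h + 1) (hh : 1 ≤ h) (hp : 2 * j * (h + 1) ^ 2 < p) :
    ∃ (χ : AddChar (ZMod j) F) (x : LaurentSeries F), Function.Injective χ ∧
      (centeredPoly F h).eval₂ HahnSeries.C x = HahnSeries.single (-j : ℤ) 1 ∧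
      x.coeff (-1) = 1 ∧ x.coeff 0 = 0 ∧ (∀ n < -1, x.coeff n = 0) ∧
      ∀ (R : F[X][X]) (s s' : ZMod j), s ≠ 0 → s' ≠ 0 →
        R.eval₂ (eval₂RingHom HahnSeries.C x) (laurentRot χ s x) = 0 →
        R.eval₂ (eval₂RingHom HahnSeries.C x) (laurentRot χ s' x) = 0 := by
  set E := (genericFiber ((centeredPoly F h).comp (X ^ p - X))).SplittingField
  have : IsScalarTower F F[X] E := IsScalarTower.of_algebraMap_eq fun c => by
    rw [IsScalarTower.algebraMap_apply F (RatFunc F) E,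
      IsScalarTower.algebraMap_apply F[X] (RatFunc F) E]
    rfl
  obtain ⟨χ, x, l, ξ, hχ, hx, hx1, hx0, hxp, hlC, -, hlξ, -, -, h2t⟩ :=
    exists_two_transitive_roots (F := F) p hj hh hp E
  refine ⟨χ, x, hχ, hx, hx1, hx0, hxp, fun R s s' hs hs' hR => ?_⟩
  set ρ : F[X] →+* E := eval₂RingHom (algebraMap F E) (ξ 0) with hρ
  set am := algebraMap (LaurentSeries F) (AlgebraicClosure (LaurentSeries F))
  have hF : ∀ c : F, algebraMap F E c = algebraMap (RatFunc F) E (algebraMap F[X] _ (C c)) := fun c => by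
    rw [IsScalarTower.algebraMap_apply F F[X] E, IsScalarTower.algebraMap_apply F[X] (RatFunc F) E]
    rfl
  have h0 : laurentRot χ 0 x = x := by
    ext n
    simp [coeff_laurentRot]
  have hlρ : l.comp ρ = am.comp (eval₂RingHom HahnSeries.C x) := by
    refine Polynomial.ringHom_ext (fun c => ?_) ?_
    · simp only [RingHom.comp_apply, hρ, coe_eval₂RingHom, eval₂_C]
      rw [hF, hlC]
    · simp only [RingHom.comp_apply, hρ, coe_eval₂RingHom, eval₂_X]
      rw [hlξ, h0]
  have hl : ∀ s, l (R.eval₂ ρ (ξ s)) = am (R.eval₂ (eval₂RingHom HahnSeries.C x) (laurentRot χ s x)) := by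
    intro s
    rw [hom_eval₂, hom_eval₂, hlρ, hlξ]
  obtain ⟨σ, hσ0, hσ⟩ := h2t 0 s 0 s' hs.symm hs'.symm
  have hσρ : (σ : E →+* E).comp ρ = ρ := by
    refine Polynomial.ringHom_ext (fun c => ?_) ?_
    · simp only [RingHom.comp_apply, hρ, coe_eval₂RingHom, eval₂_C]
      rw [hF]
      exact σ.commutes _
    · simp only [RingHom.comp_apply, hρ, coe_eval₂RingHom, eval₂_X]
      exact hσ0
  have h1 : R.eval₂ ρ (ξ s) = 0 := l.injective (by rw [hl, hR, map_zero, map_zero])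
  have h2 : (σ : E →+* E) (R.eval₂ ρ (ξ s)) = R.eval₂ ρ (ξ s') := by
    rw [hom_eval₂, hσρ]
    exact congrArg (fun z => R.eval₂ ρ z) hσ
  refine am.injective ?_
  rw [map_zero, ← hl, ← h2, h1, map_zero, map_zero]
end

end

section

open Polynomial

/-- The expansions at infinity of a ring `A` over `k[X]`, for a cover which is totally split at
infinity. -/
structure LaurentFamily (k F A S : Type*) [Field k] [Field F] [Algebra k F] [CommRing A]
    [Algebra k[X] A] [Fintype S] where
  x : LaurentSeries F
  x_pole : PoleLe 1 x
  x_coeff : x.coeff (-1) = 1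
  x_coeff_zero : x.coeff 0 = 0
  ι : S → A →+* LaurentSeries F
  ι_algebraMap : ∀ s r, ι s (algebraMap k[X] A r) = (r.map (algebraMap k F)).eval₂ HahnSeries.C x
  y : A
  y_pole : ∀ s, PoleLe 1 (ι s y)
  ζ : S → F
  ζ_injective : Function.Injective ζ
  y_coeff : ∀ s, (ι s y).coeff (-1) = ζ s
  exists_denominator : ∀ g : A, ∃ D : k[X], D ≠ 0 ∧ ∃ r : Fin (Fintype.card S) → k[X],
    D • g = ∑ i, r i • y ^ (i : ℕ)
  eq_zero_of_pole : ∀ g : A, (∀ s, PoleLe (-1) (ι s g)) → g = 0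

namespace LaurentFamily

variable {k F A S : Type*} [Field k] [Field F] [Algebra k F] [CommRing A]
    [Algebra k[X] A] [Fintype S] (L : LaurentFamily k F A S)

theorem vandermonde {c : Fin (Fintype.card S) → F}
    (h : ∀ s, ∑ i, c i * L.ζ s ^ (i : ℕ) = 0) : c = 0 := by
  let e := (Fintype.equivFin S).symm
  have hdet : (Matrix.vandermonde fun i => L.ζ (e i)).det ≠ 0 := by
    rw [Matrix.det_vandermonde_ne_zero_iff]
    exact L.ζ_injective.comp e.injective
  apply Matrix.eq_zero_of_mulVec_eq_zero hdet
  ext i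
  rw [Matrix.mulVec, dotProduct]
  simp only [Matrix.vandermonde_apply]
  rw [Pi.zero_apply, ← h (e i)]
  exact Finset.sum_congr rfl fun _ _ => mul_comm _ _

theorem vandermonde_dual {c : S → F}
    (h : ∀ i : Fin (Fintype.card S), ∑ s, c s * L.ζ s ^ (i : ℕ) = 0) : c = 0 := by
  let e := (Fintype.equivFin S).symm
  have hdet : (Matrix.vandermonde fun i => L.ζ (e i)).det ≠ 0 := by
    rw [Matrix.det_vandermonde_ne_zero_iff]
    exact L.ζ_injective.comp e.injective
  have : (fun i => c (e i)) = 0 := by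
    apply Matrix.eq_zero_of_vecMul_eq_zero hdet
    ext i
    rw [Matrix.vecMul, dotProduct]
    simp only [Matrix.vandermonde_apply]
    rw [Pi.zero_apply, ← h i]
    exact e.sum_comp fun s => c s * L.ζ s ^ (i : ℕ)
  ext s
  have h2 := congrFun this (e.symm s)
  simpa using h2

variable [Algebra k A] [IsScalarTower k k[X] A]

theorem ι_smul (s : S) (c : k) (g : A) :
    L.ι s (c • g) = HahnSeries.C (algebraMap k F c) * L.ι s g := by
  have : c • g = algebraMap k[X] A (C c) * g := by
    rw [← Algebra.smul_def, ← Polynomial.algebraMap_eq, algebraMap_smul]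
  rw [this, map_mul, L.ι_algebraMap, Polynomial.map_C, Polynomial.eval₂_C]

theorem coeff_ι_smul (s : S) (c : k) (g : A) (n : ℤ) :
    (L.ι s (c • g)).coeff n = c • (L.ι s g).coeff n := by
  rw [L.ι_smul, HahnSeries.C_mul_eq_smul, HahnSeries.coeff_smul, smul_eq_mul, Algebra.smul_def]

/-- The elements with poles of order at most `m` at infinity. -/
noncomputable def V (m : ℤ) : Submodule k A where
  carrier := {g | ∀ s, PoleLe m (L.ι s g)}
  add_mem' := fun ha hb s => by rw [map_add]; exact (ha s).add (hb s)
  zero_mem' := fun s => by rw [map_zero]; exact poleLe_zero m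
  smul_mem' := fun c a ha s n hn => by rw [L.coeff_ι_smul, ha s n hn, smul_zero]

/-- The vector of coefficients of order `-m` at infinity. -/
noncomputable def lead (m : ℤ) : A →ₗ[k] (S → F) where
  toFun g s := (L.ι s g).coeff (-m)
  map_add' a b := by ext s; simp
  map_smul' c a := by ext s; exact L.coeff_ι_smul s c a _

theorem lead_apply (m : ℤ) (g : A) (s : S) : L.lead m g s = (L.ι s g).coeff (-m) := rfl

theorem V_mono {m n : ℤ} (h : m ≤ n) : L.V m ≤ L.V n := fun _ hg s => (hg s).mono h

theorem mem_V_sub_one {m : ℤ} {g : A} : g ∈ L.V (m - 1) ↔ g ∈ L.V m ∧ L.lead m g = 0 := by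
  constructor
  · intro h
    refine ⟨L.V_mono (by omega) h, ?_⟩
    ext s
    exact h s _ (by omega)
  · rintro ⟨h, h0⟩ s n hn
    rcases lt_or_eq_of_le (show n ≤ -m by omega) with h1 | rfl
    · exact h s n h1
    · exact congrFun h0 s

theorem lead_eq_zero {m n : ℤ} (h : m < n) {g : A} (hg : g ∈ L.V m) : L.lead n g = 0 := by
  ext s
  exact hg s _ (by omega)

theorem V_eq_bot {m : ℤ} (hm : m < 0) : L.V m = ⊥ := by
  rw [eq_bot_iff]
  intro g hg
  exact L.eq_zero_of_pole g fun s => (hg s).mono (by omega)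

theorem exists_mem_V (g : A) : ∃ m : ℕ, g ∈ L.V m := by
  classical
  have h : ∀ s, ∃ m : ℕ, PoleLe m (L.ι s g) := by
    intro s
    refine ⟨(-(L.ι s g).order).toNat, fun n hn => ?_⟩
    apply HahnSeries.coeff_eq_zero_of_lt_order
    omega
  choose m hm using h
  exact ⟨Finset.univ.sup m, fun s => (hm s).mono
    (by exact_mod_cast Finset.le_sup (f := m) (Finset.mem_univ s))⟩

theorem smul_mem_V {m : ℤ} {g : A} (hg : g ∈ L.V m) {r : k[X]} {a : ℕ} (hr : r.natDegree ≤ a) :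
    r • g ∈ L.V (m + a) ∧ L.lead (m + a) (r • g) = r.coeff a • L.lead m g := by
  have h1 : ∀ s, L.ι s (r • g) = (r.map (algebraMap k F)).eval₂ HahnSeries.C L.x * L.ι s g := by
    intro s
    rw [Algebra.smul_def, map_mul, L.ι_algebraMap]
  obtain ⟨h2, h3, -⟩ := poleLe_eval₂ (r.map (algebraMap k F)) (Polynomial.natDegree_map_le.trans hr)
    L.x_pole L.x_coeff_zero
  constructor
  · intro s
    rw [h1, add_comm]
    exact h2.mul (hg s)
  · ext s
    rw [lead_apply, h1, add_comm, h2.coeff_mul (hg s), h3, L.x_coeff, one_pow, mul_one,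
      Polynomial.coeff_map, Pi.smul_apply, Algebra.smul_def, lead_apply]

theorem mul_pow_mem_V {m : ℤ} {g : A} (hg : g ∈ L.V m) (i : ℕ) :
    g * L.y ^ i ∈ L.V (m + i) ∧ L.lead (m + i) (g * L.y ^ i) = fun s => L.lead m g s * L.ζ s ^ i := by
  have h := fun s => (L.y_pole s).pow i
  constructor
  · intro s
    rw [map_mul, map_pow]
    have := (hg s).mul (h s).1
    rwa [mul_one] at this
  · ext s
    have := (hg s).coeff_mul (h s).1
    rw [mul_one] at this
    rw [lead_apply, map_mul, map_pow, this, lead_apply]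
    have h2 := (h s).2.1
    rw [mul_one] at h2
    rw [h2, L.y_coeff]

theorem one_mem_V : (1 : A) ∈ L.V 0 ∧ L.lead 0 (1 : A) = 1 := by
  constructor
  · intro s
    rw [map_one]
    exact poleLe_C 1
  · ext s
    rw [lead_apply, map_one]
    simp

/-- The vectors which occur as leading vectors. -/
noncomputable def Λ : Submodule k (S → F) :=
  Submodule.span k (Set.range fun (i : Fin (Fintype.card S)) (s : S) => L.ζ s ^ (i : ℕ))

theorem pow_mem_V (i : ℕ) : L.y ^ i ∈ L.V i ∧ L.lead i (L.y ^ i) = fun s => L.ζ s ^ i := by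
  have := L.mul_pow_mem_V L.one_mem_V.1 i
  rw [L.one_mem_V.2] at this
  simpa using this

theorem sum_mem_V {N : ℤ} {r : Fin (Fintype.card S) → k[X]}
    (h : ∀ i : Fin (Fintype.card S), ∀ n : ℕ, N < n + (i : ℕ) → (r i).coeff n = 0) :
    (∑ i, r i • L.y ^ (i : ℕ)) ∈ L.V N ∧ L.lead N (∑ i, r i • L.y ^ (i : ℕ)) =
      ∑ i : Fin (Fintype.card S), (if ((i : ℕ) : ℤ) ≤ N then (r i).coeff (N - (i : ℕ)).toNat else 0) •
        fun s => L.ζ s ^ (i : ℕ) := by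
  have key : ∀ i, r i • L.y ^ (i : ℕ) ∈ L.V N ∧ L.lead N (r i • L.y ^ (i : ℕ)) =
      (if ((i : ℕ) : ℤ) ≤ N then (r i).coeff (N - (i : ℕ)).toNat else 0) • fun s => L.ζ s ^ (i : ℕ) := by
    intro i
    split_ifs with hi
    · have hdeg : (r i).natDegree ≤ (N - (i : ℕ)).toNat := by
        rw [Polynomial.natDegree_le_iff_coeff_eq_zero]
        intro n hn
        exact h i n (by omega)
      have := L.smul_mem_V (L.pow_mem_V i).1 hdeg
      rw [show ((i : ℕ) : ℤ) + ((N - (i : ℕ)).toNat : ℕ) = N by omega] at this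
      rw [(L.pow_mem_V i).2] at this
      exact this
    · have hz : r i = 0 := by
        ext n
        rw [h i n (by omega), Polynomial.coeff_zero]
      rw [hz]
      simp
  refine ⟨Submodule.sum_mem _ fun i _ => (key i).1, ?_⟩
  rw [map_sum]
  exact Finset.sum_congr rfl fun i _ => (key i).2

theorem coeff_eq_zero_of_sum_mem_V {m : ℤ} {r : Fin (Fintype.card S) → k[X]}
    (hm : (∑ i, r i • L.y ^ (i : ℕ)) ∈ L.V m) (i : Fin (Fintype.card S)) (n : ℕ)
    (hn : m < n + (i : ℕ)) : (r i).coeff n = 0 := by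
  obtain ⟨M, hM⟩ : ∃ M : ℕ, ∀ i : Fin (Fintype.card S), (r i).natDegree + i ≤ M :=
    ⟨Finset.univ.sup fun i => (r i).natDegree + i, fun i =>
      Finset.le_sup (f := fun i => (r i).natDegree + (i : ℕ)) (Finset.mem_univ i)⟩
  have key : ∀ t : ℕ, m ≤ (M : ℤ) - t → ∀ i : Fin (Fintype.card S), ∀ n : ℕ, (M : ℤ) - t < n + (i : ℕ) → (r i).coeff n = 0 := by
    intro t
    induction t with
    | zero =>
      intro _ i n hn
      apply Polynomial.coeff_eq_zero_of_natDegree_lt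
      have := hM i
      omega
    | succ t ih =>
      intro ht
      have ih := ih (by push_cast at ht ⊢; omega)
      have h1 := (L.sum_mem_V ih).2
      rw [L.lead_eq_zero (by push_cast at ht ⊢; omega) hm] at h1
      intro i n hn
      rcases lt_or_eq_of_le (show (M : ℤ) - t ≤ n + (i : ℕ) by push_cast at hn; omega) with h2 | h2
      · exact ih i n h2
      · have h3 : (fun i : Fin (Fintype.card S) => algebraMap k F
            (if ((i : ℕ) : ℤ) ≤ (M : ℤ) - t then (r i).coeff ((M : ℤ) - t - (i : ℕ)).toNat else 0)) = 0 := by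
          apply L.vandermonde
          intro s
          have h4 := congrFun h1 s
          rw [Finset.sum_apply] at h4
          rw [Pi.zero_apply] at h4
          rw [h4]
          exact Finset.sum_congr rfl fun i _ => (Algebra.smul_def _ _).symm
        have h4 := congrFun h3 i
        simp only [Pi.zero_apply, map_eq_zero] at h4
        rw [if_pos (by omega), h2] at h4
        rwa [show ((n : ℤ) + (i : ℕ) - (i : ℕ)).toNat = n by omega] at h4
  by_cases h : m ≤ M
  · exact key ((M : ℤ) - m).toNat (by omega) i n (by omega)
  · apply Polynomial.coeff_eq_zero_of_natDegree_lt
    have := hM i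
    omega

end LaurentFamily

end

section

open Polynomial

theorem LinearIndependent.update_of_sum {R M ι : Type*} [CommRing R] [IsDomain R] [AddCommGroup M]
    [Module R M] [Fintype ι] [DecidableEq ι] {f : ι → M} (hf : LinearIndependent R f) (a : ι → R)
    {i₀ : ι} (ha : a i₀ ≠ 0) : LinearIndependent R (Function.update f i₀ (∑ i, a i • f i)) := by
  rw [Fintype.linearIndependent_iff] at hf ⊢
  intro g hg
  have h1 : ∑ i, ((if i = i₀ then 0 else g i) + g i₀ * a i) • f i = 0 := by
    rw [← hg, ← Finset.add_sum_erase Finset.univ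
      (fun i => g i • Function.update f i₀ (∑ i, a i • f i) i) (Finset.mem_univ i₀),
      Function.update_self, Finset.smul_sum, add_comm]
    simp_rw [add_smul, Finset.sum_add_distrib, mul_smul]
    rw [← Finset.add_sum_erase _ (fun i => (if i = i₀ then 0 else g i) • f i) (Finset.mem_univ i₀)]
    rw [if_pos rfl, zero_smul, zero_add]
    congr 1
    refine Finset.sum_congr rfl fun i hi => ?_
    rw [if_neg (Finset.ne_of_mem_erase hi), Function.update_of_ne (Finset.ne_of_mem_erase hi)]
  have h2 := hf _ h1
  have h3 : g i₀ = 0 := by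
    have := h2 i₀
    rw [if_pos rfl, zero_add] at this
    exact (mul_eq_zero.1 this).resolve_right ha
  intro i
  by_cases hi : i = i₀
  · rw [hi, h3]
  · have := h2 i
    rwa [if_neg hi, h3, zero_mul, add_zero] at this

namespace LaurentFamily

variable {k F A S : Type*} [Field k] [Field F] [Algebra k F] [CommRing A]
    [Algebra k[X] A] [Fintype S] (L : LaurentFamily k F A S)

instance : FiniteDimensional k L.Λ := FiniteDimensional.span_of_finite k (Set.finite_range _)

theorem finrank_Λ : Module.finrank k L.Λ = Fintype.card S := by
  rw [Λ, finrank_span_eq_card, Fintype.card_fin]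
  rw [Fintype.linearIndependent_iff]
  intro g hg i
  have h : (fun i => algebraMap k F (g i)) = 0 := by
    apply L.vandermonde
    intro s
    have := congrFun hg s
    rw [Finset.sum_apply, Pi.zero_apply] at this
    rw [← this]
    exact Finset.sum_congr rfl fun i _ => (Algebra.smul_def _ _).symm
  simpa using congrFun h i

variable [Algebra k A] [IsScalarTower k k[X] A]

theorem lead_mem {m : ℤ} {g : A} (hg : g ∈ L.V m) : L.lead m g ∈ L.Λ := by
  obtain ⟨D, hD, r, hr⟩ := L.exists_denominator g
  obtain ⟨h1, h2⟩ := L.smul_mem_V hg (le_refl D.natDegree)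
  rw [hr] at h1 h2
  rw [(L.sum_mem_V fun i n hn => L.coeff_eq_zero_of_sum_mem_V h1 i n hn).2] at h2
  have h3 : D.coeff D.natDegree • L.lead m g ∈ L.Λ := by
    rw [← h2]
    exact Submodule.sum_mem _ fun i _ => Submodule.smul_mem _ _ (Submodule.subset_span ⟨i, rfl⟩)
  exact (Submodule.smul_mem_iff _ (by simpa using hD)).1 h3

theorem inf_ker (W : Submodule k A) (m : ℤ) :
    (W ⊓ L.V m) ⊓ LinearMap.ker (L.lead m) = W ⊓ L.V (m - 1) := by
  ext g
  simp only [Submodule.mem_inf, LinearMap.mem_ker, L.mem_V_sub_one, and_assoc]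

theorem map_lead_le (W : Submodule k A) (m : ℤ) : (W ⊓ L.V m).map (L.lead m) ≤ L.Λ := by
  rintro _ ⟨g, hg, rfl⟩
  exact L.lead_mem hg.2

instance finite_V (m : ℤ) : FiniteDimensional k (L.V m) := by
  have key : ∀ t : ℕ, (L.V ((t : ℤ) - 1)).FG := by
    intro t
    induction t with
    | zero => rw [L.V_eq_bot (by simp)]; exact Submodule.fg_bot
    | succ t ih =>
      refine Submodule.fg_of_fg_map_of_fg_inf_ker (L.lead (((t + 1 : ℕ) : ℤ) - 1)) ?_ ?_
      · have h := L.map_lead_le ⊤ (((t + 1 : ℕ) : ℤ) - 1)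
        rw [top_inf_eq] at h
        have := Submodule.finiteDimensional_of_le h
        exact Module.Finite.iff_fg.1 this
      · have h := L.inf_ker ⊤ (((t + 1 : ℕ) : ℤ) - 1)
        rw [top_inf_eq, top_inf_eq] at h
        rw [h, show (((t + 1 : ℕ) : ℤ) - 1) - 1 = (t : ℤ) - 1 by push_cast; ring]
        exact ih
  have h1 : FiniteDimensional k (L.V (((m + 1).toNat : ℤ) - 1)) := Module.Finite.iff_fg.2 (key _)
  exact Submodule.finiteDimensional_of_le
    (L.V_mono (show m ≤ (((m + 1).toNat : ℤ) - 1) by omega))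

theorem finrank_inf_V (W : Submodule k A) (m : ℤ) :
    Module.finrank k ↥(W ⊓ L.V m) =
      Module.finrank k ↥((W ⊓ L.V m).map (L.lead m)) + Module.finrank k ↥(W ⊓ L.V (m - 1)) := by
  have : FiniteDimensional k ↥(W ⊓ L.V m) := Submodule.finiteDimensional_of_le inf_le_right
  rw [← ((L.lead m).domRestrict (W ⊓ L.V m)).finrank_range_add_finrank_ker, LinearMap.range_domRestrict]
  congr 1
  rw [LinearMap.ker_domRestrict, ← L.inf_ker W m]
  rw [← LinearEquiv.finrank_eq (Submodule.comapSubtypeEquivOfLe (p := (W ⊓ L.V m) ⊓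
    LinearMap.ker (L.lead m)) (q := W ⊓ L.V m) inf_le_left)]
  have h : Submodule.comap (W ⊓ L.V m).subtype ((W ⊓ L.V m) ⊓ LinearMap.ker (L.lead m)) =
      Submodule.comap (W ⊓ L.V m).subtype (LinearMap.ker (L.lead m)) := by
    rw [Submodule.comap_inf, Submodule.comap_subtype_self, top_inf_eq]
  rw [h]

theorem Λ_le_map_lead {m : ℤ} (hm : (Fintype.card S : ℤ) - 1 ≤ m) :
    L.Λ ≤ (L.V m).map (L.lead m) := by
  rw [Λ, Submodule.span_le]
  rintro _ ⟨i, rfl⟩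
  have hi := i.2
  obtain ⟨h1, h2⟩ := L.smul_mem_V (L.pow_mem_V i).1
    (r := X ^ (m - (i : ℕ)).toNat) (Polynomial.natDegree_X_pow_le _)
  rw [show ((i : ℕ) : ℤ) + ((m - (i : ℕ)).toNat : ℕ) = m by omega, (L.pow_mem_V i).2,
    Polynomial.coeff_X_pow_self, one_smul] at h2
  rw [show ((i : ℕ) : ℤ) + ((m - (i : ℕ)).toNat : ℕ) = m by omega] at h1
  exact ⟨_, h1, h2⟩

theorem finrank_V_ge (t : ℕ) :
    Fintype.card S * t ≤ Module.finrank k (L.V ((Fintype.card S : ℤ) - 2 + t)) := by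
  induction t with
  | zero => simp
  | succ t ih =>
    have h := L.finrank_inf_V ⊤ ((Fintype.card S : ℤ) - 2 + (t + 1 : ℕ))
    have h2 := Submodule.finrank_mono (L.Λ_le_map_lead
      (m := (Fintype.card S : ℤ) - 2 + (t + 1 : ℕ)) (by push_cast; omega))
    rw [L.finrank_Λ] at h2
    rw [top_inf_eq, top_inf_eq, show (Fintype.card S : ℤ) - 2 + (t + 1 : ℕ) - 1 =
      (Fintype.card S : ℤ) - 2 + t by push_cast; ring] at h
    rw [h]
    rw [mul_add]
    omega

theorem linearIndependent_pow : LinearIndependent k[X]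
    fun i : Fin (Fintype.card S) => L.y ^ (i : ℕ) := by
  rw [Fintype.linearIndependent_iff]
  intro r hr i
  ext n
  exact L.coeff_eq_zero_of_sum_mem_V (m := -1) (by rw [hr]; exact Submodule.zero_mem _) i n (by omega)

theorem exists_mem_inf_of_independent (I : Ideal A) {M : ℕ} {f : Fin (Fintype.card S) → A}
    (hI : ∀ i, f i ∈ I) (hM : ∀ i, f i ∈ L.V M) (hf : LinearIndependent k[X] f) {m : ℤ}
    (hm : M ≤ m) : L.Λ ≤ (I.restrictScalars k ⊓ L.V m).map (L.lead m) := by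
  classical
  let Q : ℕ → Prop := fun σ => ∃ (f : Fin (Fintype.card S) → A) (w : Fin (Fintype.card S) → ℕ),
    (∀ i, f i ∈ I ∧ f i ∈ L.V (w i) ∧ w i ≤ M) ∧ LinearIndependent k[X] f ∧ ∑ i, w i = σ
  have hQ : ∃ σ, Q σ := ⟨_, f, fun _ => M, fun i => ⟨hI i, hM i, le_rfl⟩, hf, rfl⟩
  obtain ⟨f, w, h1, h2, h3⟩ := Nat.find_spec hQ
  have hmin := fun σ (hσ : σ < Nat.find hQ) => Nat.find_min hQ hσ
  have hli : LinearIndependent k fun i => L.lead (w i) (f i) := by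
    rw [Fintype.linearIndependent_iff]
    by_contra! hcon
    obtain ⟨c, hc, i₁, hi₁⟩ := hcon
    obtain ⟨i₀, hi₀, hmax⟩ := Finset.exists_max_image (Finset.univ.filter fun i => c i ≠ 0) w
      ⟨i₁, by simpa using hi₁⟩
    have hci₀ : c i₀ ≠ 0 := by simpa using hi₀
    have hmax : ∀ i, c i ≠ 0 → w i ≤ w i₀ := fun i hi => hmax i (by simpa using hi)
    let a : Fin (Fintype.card S) → k[X] := fun i => C (c i) * X ^ (w i₀ - w i)
    have ha0 : a i₀ ≠ 0 := by
      simp only [a, tsub_self, pow_zero, mul_one]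
      exact C_ne_zero.2 hci₀
    have hadd : ∀ i, a i • f i ∈ L.V (w i₀) ∧ L.lead (w i₀) (a i • f i) = c i • L.lead (w i) (f i) := by
      intro i
      by_cases hi : c i = 0
      · simp [a, hi]
      · have := L.smul_mem_V (h1 i).2.1 (r := a i) (a := w i₀ - w i)
          (Polynomial.natDegree_C_mul_X_pow_le _ _)
        have hle := hmax i hi
        rw [show (w i : ℤ) + (w i₀ - w i : ℕ) = w i₀ by omega] at this
        refine ⟨this.1, this.2.trans ?_⟩
        simp [a]
    set g := ∑ i, a i • f i with hg
    have hgV : g ∈ L.V ((w i₀ : ℤ) - 1) := by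
      rw [L.mem_V_sub_one]
      refine ⟨Submodule.sum_mem _ fun i _ => (hadd i).1, ?_⟩
      rw [hg, map_sum, ← hc]
      exact Finset.sum_congr rfl fun i _ => (hadd i).2
    have hgI : g ∈ I := Submodule.sum_mem _ fun i _ => by
      rw [Algebra.smul_def]; exact I.mul_mem_left _ (h1 i).1
    have hind := h2.update_of_sum a ha0
    have hw : w i₀ ≠ 0 := by
      intro hw
      rw [hw, L.V_eq_bot (by simp), Submodule.mem_bot] at hgV
      apply hind.ne_zero i₀
      rw [Function.update_self, ← hg, hgV]
    refine hmin (∑ i, Function.update w i₀ (w i₀ - 1) i) ?_ ⟨_, _, ?_, hind, rfl⟩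
    · rw [← h3]
      refine Finset.sum_lt_sum (fun i _ => ?_) ⟨i₀, Finset.mem_univ _, ?_⟩
      · by_cases hi : i = i₀
        · subst hi; simp
        · simp [hi]
      · simp; omega
    · intro i
      by_cases hi : i = i₀
      · subst hi
        rw [Function.update_self, Function.update_self]
        refine ⟨hgI, ?_, by have := (h1 i).2.2; omega⟩
        rwa [show ((w i - 1 : ℕ) : ℤ) = (w i : ℤ) - 1 by omega]
      · rw [Function.update_of_ne hi, Function.update_of_ne hi]
        exact h1 i
  have hsub : Set.range (fun i => L.lead (w i) (f i)) ⊆ L.Λ := by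
    rintro _ ⟨i, rfl⟩
    exact L.lead_mem (h1 i).2.1
  have heq : Submodule.span k (Set.range fun i => L.lead (w i) (f i)) = L.Λ := by
    apply Submodule.eq_of_le_of_finrank_eq (Submodule.span_le.2 hsub)
    rw [finrank_span_eq_card hli, L.finrank_Λ, Fintype.card_fin]
  rw [← heq, Submodule.span_le]
  rintro _ ⟨i, rfl⟩
  have hw := (h1 i).2.2
  have := L.smul_mem_V (h1 i).2.1 (r := X ^ (m - w i).toNat) (Polynomial.natDegree_X_pow_le _)
  rw [show (w i : ℤ) + ((m - w i).toNat : ℕ) = m by omega, Polynomial.coeff_X_pow_self,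
    one_smul] at this
  refine ⟨_, ⟨?_, this.1⟩, this.2⟩
  show _ ∈ I
  rw [Algebra.smul_def]
  exact I.mul_mem_left _ (h1 i).1

end LaurentFamily

end

section

open Polynomial

namespace LaurentFamily

variable {k F A S : Type*} [Field k] [Field F] [Algebra k F] [CommRing A]
    [Algebra k[X] A] [Fintype S] (L : LaurentFamily k F A S)

theorem one_mem_Λ [Nonempty S] : (1 : S → F) ∈ L.Λ :=
  Submodule.subset_span ⟨⟨0, Fintype.card_pos⟩, by ext; simp⟩

variable [Algebra k A] [IsScalarTower k k[X] A]

theorem Λ_le_map_lead_ideal [IsDomain A] [Nonempty S] (I : Ideal A) [FiniteDimensional k (A ⧸ I)]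
    {m : ℤ} (hm : Module.finrank k (A ⧸ I) / Fintype.card S + 2 * Fintype.card S ≤ m + 2) :
    L.Λ ≤ (I.restrictScalars k ⊓ L.V m).map (L.lead m) := by
  set d := Fintype.card S with hd
  have hd0 : 0 < d := Fintype.card_pos
  set n := Module.finrank k (A ⧸ I) with hn
  have hlt : n < Module.finrank k (L.V ((d : ℤ) - 2 + (n / d + 1 : ℕ))) :=
    lt_of_lt_of_le (Nat.lt_mul_div_succ n hd0) (L.finrank_V_ge (n / d + 1))
  obtain ⟨u, hu, hu0⟩ := Submodule.exists_mem_ne_zero_of_ne_bot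
    (LinearMap.ker_ne_bot_of_finrank_lt (f := (Ideal.Quotient.mkₐ k I).toLinearMap.comp
      (L.V ((d : ℤ) - 2 + (n / d + 1 : ℕ))).subtype) hlt)
  have huI : (u : A) ∈ I := by
    rw [LinearMap.mem_ker] at hu
    exact Ideal.Quotient.eq_zero_iff_mem.1 hu
  have hu0' : (u : A) ≠ 0 := fun h => hu0 (Subtype.ext h)
  have hu2 : (u : A) ∈ L.V ((d : ℤ) - 1 + (n / d : ℕ)) := by
    exact L.V_mono (by push_cast; omega) u.2
  refine L.exists_mem_inf_of_independent I (M := 2 * d - 2 + n / d)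
    (f := fun i => (u : A) * L.y ^ (i : ℕ)) (fun i => I.mul_mem_right _ huI) (fun i => ?_) ?_ ?_
  · refine L.V_mono ?_ (L.mul_pow_mem_V hu2 i).1
    have := i.2
    omega
  · have hL := L.linearIndependent_pow
    rw [Fintype.linearIndependent_iff] at hL ⊢
    intro g hg
    apply hL
    have : (u : A) * ∑ i, g i • L.y ^ (i : ℕ) = 0 := by
      rw [← hg, Finset.mul_sum]
      exact Finset.sum_congr rfl fun i _ => mul_smul_comm _ _ _
    exact (mul_eq_zero.1 this).resolve_left hu0'
  · omega

theorem finrank_V_eq_of_surjective (I : Ideal A) {m₀ : ℤ}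
    (h : ∀ m, m₀ ≤ m → L.Λ ≤ (I.restrictScalars k ⊓ L.V m).map (L.lead m)) {m : ℤ}
    (hm : m₀ ≤ m + 1) : Module.finrank k (L.V m) =
      Module.finrank k ↥(I.restrictScalars k ⊓ L.V m) + Module.finrank k (A ⧸ I) := by
  have key : ∀ t : ℕ, ∀ g ∈ L.V (m + t), ∃ u ∈ I, g - u ∈ L.V m := by
    intro t
    induction t with
    | zero => intro g hg; exact ⟨0, I.zero_mem, by simpa using hg⟩
    | succ t ih =>
      intro g hg
      obtain ⟨u, hu, hgu⟩ := h (m + (t + 1 : ℕ)) (by push_cast; omega) (L.lead_mem hg)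
      obtain ⟨v, hv, hgv⟩ := ih (g - u) (by
        rw [show m + (t : ℤ) = m + (t + 1 : ℕ) - 1 by push_cast; ring, L.mem_V_sub_one]
        exact ⟨Submodule.sub_mem _ hg hu.2, by rw [map_sub, hgu, sub_self]⟩)
      exact ⟨u + v, I.add_mem hu.1 hv, by rwa [← sub_sub]⟩
  let f : L.V m →ₗ[k] A ⧸ I := (Ideal.Quotient.mkₐ k I).toLinearMap.comp (L.V m).subtype
  have hf : Function.Surjective f := by
    intro z
    obtain ⟨g, rfl⟩ := Ideal.Quotient.mk_surjective z
    obtain ⟨t, ht⟩ := L.exists_mem_V g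
    obtain ⟨u, hu, hgu⟩ := key ((t : ℤ) - m).toNat g (L.V_mono (by omega) ht)
    refine ⟨⟨g - u, hgu⟩, ?_⟩
    exact Ideal.Quotient.eq.2 (by simpa using I.neg_mem hu)
  rw [← f.finrank_range_add_finrank_ker, LinearMap.range_eq_top.2 hf, finrank_top, add_comm]
  congr 1
  have hk : LinearMap.ker f = Submodule.comap (L.V m).subtype (I.restrictScalars k ⊓ L.V m) := by
    ext g
    rw [LinearMap.mem_ker, Submodule.mem_comap]
    exact Ideal.Quotient.eq_zero_iff_mem.trans ⟨fun hg => ⟨hg, g.2⟩, fun hg => hg.1⟩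
  rw [hk]
  exact LinearEquiv.finrank_eq (Submodule.comapSubtypeEquivOfLe inf_le_right)

theorem mem_of_ideal_monic (I : Ideal A) {m : ℤ} {g u : A} (hg : g ∈ I ∧ g ∈ L.V m ∧ L.lead m g = 1)
    (hu : u ∈ I.restrictScalars k ⊓ L.V (m - 1)) :
    u + g ∈ I ∧ u + g ∈ L.V m ∧ L.lead m (u + g) = 1 := by
  have h := (L.mem_V_sub_one).1 hu.2
  exact ⟨I.add_mem hu.1 hg.1, Submodule.add_mem _ h.1 hg.2.1, by rw [map_add, h.2, hg.2.2, zero_add]⟩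

theorem finite_monic [Finite k] (m : ℤ) : {g : A | g ∈ L.V m ∧ L.lead m g = 1}.Finite := by
  have : Finite (L.V m) := Module.finite_of_finite k
  exact (Set.toFinite (L.V m : Set A)).subset fun g hg => hg.1

theorem card_monic_ideal [Fintype k] [Nonempty S] (I : Ideal A) [FiniteDimensional k (A ⧸ I)] {m₀ : ℤ}
    (h : ∀ m, m₀ ≤ m → L.Λ ≤ (I.restrictScalars k ⊓ L.V m).map (L.lead m)) {m : ℤ}
    (hm : m₀ ≤ m) (T : Finset A) (hT : ∀ g, g ∈ T ↔ g ∈ I ∧ g ∈ L.V m ∧ L.lead m g = 1) :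
    T.card * Fintype.card k ^ Module.finrank k (A ⧸ I) =
      Fintype.card k ^ Module.finrank k (L.V (m - 1)) := by
  obtain ⟨g, hg, hg1⟩ := h m hm L.one_mem_Λ
  have hg := (hT g).2 ⟨hg.1, hg.2, hg1⟩
  have hfin : FiniteDimensional k ↥(I.restrictScalars k ⊓ L.V (m - 1)) :=
    Submodule.finiteDimensional_of_le inf_le_right
  rw [L.finrank_V_eq_of_surjective I h (show m₀ ≤ m - 1 + 1 by omega), pow_add]
  congr 1
  rw [← Nat.card_eq_fintype_card, ← Module.natCard_eq_pow_finrank (K := k),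
    ← Nat.card_eq_finsetCard T]
  symm
  refine Nat.card_eq_of_bijective
    (fun u : ↥(I.restrictScalars k ⊓ L.V (m - 1)) => (⟨u + g, (hT _).2
      (L.mem_of_ideal_monic I ((hT g).1 hg) u.2)⟩ : T)) ⟨fun u v huv => ?_, fun v => ?_⟩
  · exact Subtype.ext (add_right_cancel (congrArg Subtype.val huv))
  · have hv := (hT v).1 v.2
    have hg' := (hT g).1 hg
    refine ⟨⟨v - g, I.sub_mem hv.1 hg'.1, ?_⟩, Subtype.ext (sub_add_cancel _ _)⟩
    show (v : A) - g ∈ L.V (m - 1)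
    rw [L.mem_V_sub_one]
    exact ⟨Submodule.sub_mem _ hv.2.1 hg'.2.1, by rw [map_sub, hv.2.2, hg'.2.2, sub_self]⟩

theorem sum_monic_ideal [Finite k] [Nonempty S] (I : Ideal A) {m₀ : ℤ}
    (h : ∀ m, m₀ ≤ m → L.Λ ≤ (I.restrictScalars k ⊓ L.V m).map (L.lead m)) {m : ℤ}
    (hm : m₀ ≤ m - 1) (T : Finset A) (hT : ∀ g, g ∈ T ↔ g ∈ I ∧ g ∈ L.V m ∧ L.lead m g = 1)
    (ψ : AddChar k ℂ) (hψ : ψ 1 ≠ 1) (θ : (S → F) →ₗ[k] k) (hθ : ∃ v ∈ L.Λ, θ v ≠ 0) :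
    ∑ g ∈ T, ψ (θ (L.lead (m - 1) g)) = 0 := by
  obtain ⟨v, hv, hθv⟩ := hθ
  obtain ⟨u, hu, huv⟩ := h (m - 1) hm (Submodule.smul_mem _ (θ v)⁻¹ hv)
  have hval : θ (L.lead (m - 1) u) = 1 := by
    rw [huv, map_smul, smul_eq_mul, inv_mul_cancel₀ hθv]
  have hshift : ∑ g ∈ T, ψ (θ (L.lead (m - 1) g)) = ψ 1 * ∑ g ∈ T, ψ (θ (L.lead (m - 1) g)) := by
    conv_lhs => rw [← Finset.sum_equiv (s := T) (t := T) (Equiv.addLeft u)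
      (f := fun g => ψ (θ (L.lead (m - 1) (u + g)))) (by
        intro g
        rw [Equiv.coe_addLeft, hT, hT]
        refine ⟨fun hg => L.mem_of_ideal_monic I hg hu, fun hg => ?_⟩
        have := L.mem_of_ideal_monic I hg (Submodule.neg_mem _ hu)
        rwa [neg_add_cancel_left] at this) (fun g _ => rfl)]
    rw [Finset.mul_sum]
    refine Finset.sum_congr rfl fun g _ => ?_
    rw [map_add, map_add, hval, AddChar.map_add_eq_mul]
  have h2 : (ψ 1 - 1) * ∑ g ∈ T, ψ (θ (L.lead (m - 1) g)) = 0 := by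
    rw [sub_mul, one_mul, ← hshift, sub_self]
  exact (mul_eq_zero.1 h2).resolve_left (sub_ne_zero.2 hψ)

end LaurentFamily

end

section

open Polynomial

namespace LaurentFamily

variable {k F A S : Type*} [Field k] [Field F] [Algebra k F] [CommRing A]
    [Algebra k[X] A] [Fintype S] (L : LaurentFamily k F A S)
    [Algebra k A] [IsScalarTower k k[X] A]

/-- The elements of an ideal with all leading coefficients `1`. -/
noncomputable def monicFinset [Finite k] (m : ℤ) (I : Ideal A) : Finset A :=
  ((L.finite_monic m).inter_of_left (I : Set A)).toFinset

theorem mem_monicFinset [Finite k] {m : ℤ} {I : Ideal A} {g : A} :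
    g ∈ L.monicFinset m I ↔ g ∈ I ∧ g ∈ L.V m ∧ L.lead m g = 1 := by
  rw [monicFinset, Set.Finite.mem_toFinset, Set.mem_inter_iff, and_comm]
  rfl

open Classical in
theorem monicFinset_eq_filter [Finite k] (m : ℤ) (I : Ideal A) :
    L.monicFinset m I = (L.finite_monic m).toFinset.filter fun g => g ∈ I := by
  ext g
  rw [Finset.mem_filter, Set.Finite.mem_toFinset, mem_monicFinset, and_comm]
  rfl

open Classical in
theorem sum_mul_card_monic [Finite k] [IsDedekindDomain A] [Nonempty S] (deg : Ideal A → ℕ)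
    (hmul : ∀ I J : Ideal A, I ≠ ⊥ → J ≠ ⊥ → deg (I * J) = deg I + deg J)
    (D : ℕ → Finset (Ideal A)) (hD : ∀ n I, I ∈ D n ↔ I ≠ ⊥ ∧ deg I = n)
    (hg : ∀ (m : ℕ) (g : A), g ∈ L.V m → L.lead m g = 1 →
      deg (Ideal.span {g}) = Fintype.card S * m)
    (χ : Ideal A → ℂ) (hχ : ∀ I J : Ideal A, I ≠ ⊥ → J ≠ ⊥ → χ (I * J) = χ I * χ J)
    (hχ0 : ∀ I, χ I ≠ 0) {𝔞 : Ideal A} (h𝔞 : 𝔞 ≠ ⊥) {n e m : ℕ}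
    (hm : n + e + deg 𝔞 = Fintype.card S * m) :
    ∑ I ∈ D n, χ I * (L.monicFinset m (I * 𝔞)).card =
      ∑ J ∈ D e, (χ J * χ 𝔞)⁻¹ * ∑ g ∈ L.monicFinset m (J * 𝔞), χ (Ideal.span {g}) := by
  set T := (L.finite_monic (m : ℤ)).toFinset with hT
  have hTmem : ∀ g ∈ T, g ∈ L.V m ∧ L.lead m g = 1 := fun g hg => by
    rwa [hT, Set.Finite.mem_toFinset] at hg
  have hL : ∑ I ∈ D n, χ I * (L.monicFinset m (I * 𝔞)).card =
      ∑ g ∈ T, ∑ I ∈ D n with g ∈ I * 𝔞, χ I := by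
    simp_rw [monicFinset_eq_filter, Finset.card_filter, Nat.cast_sum, Finset.mul_sum, Finset.sum_filter]
    rw [Finset.sum_comm]
    refine Finset.sum_congr rfl fun g _ => Finset.sum_congr rfl fun I _ => ?_
    split_ifs <;> simp
  have hR : ∑ J ∈ D e, (χ J * χ 𝔞)⁻¹ * ∑ g ∈ L.monicFinset m (J * 𝔞), χ (Ideal.span {g}) =
      ∑ g ∈ T, ∑ J ∈ D e with g ∈ J * 𝔞, (χ J * χ 𝔞)⁻¹ * χ (Ideal.span {g}) := by
    simp_rw [monicFinset_eq_filter, Finset.mul_sum, Finset.sum_filter]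
    rw [Finset.sum_comm]
  rw [hL, hR]
  refine Finset.sum_congr rfl fun g hgT => ?_
  obtain ⟨hgV, hg1⟩ := hTmem g hgT
  have hg0 : g ≠ 0 := by
    rintro rfl
    obtain ⟨s⟩ := ‹Nonempty S›
    have := congrFun hg1 s
    simp at this
  have hspan : Ideal.span {g} ≠ (⊥ : Ideal A) := by simpa using hg0
  have hex : ∀ I : Ideal A, g ∈ I * 𝔞 → ∃ J, Ideal.span {g} = I * 𝔞 * J := by
    intro I hI
    exact Ideal.dvd_iff_le.2 ((Ideal.span_singleton_le_iff_mem _).2 hI)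
  have hdeg : ∀ I J : Ideal A, Ideal.span {g} = I * 𝔞 * J → I ≠ ⊥ ∧ J ≠ ⊥ ∧
      deg I + deg J = n + e ∧ g ∈ J * 𝔞 ∧ χ I = (χ J * χ 𝔞)⁻¹ * χ (Ideal.span {g}) := by
    intro I J h
    have h0 := hspan
    rw [h] at h0
    have hI : I ≠ ⊥ := left_ne_zero_of_mul (left_ne_zero_of_mul h0)
    have hJ : J ≠ ⊥ := right_ne_zero_of_mul h0
    have h1 := hg m g hgV hg1
    rw [h, hmul _ _ (mul_ne_zero hI h𝔞) hJ, hmul _ _ hI h𝔞] at h1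
    refine ⟨hI, hJ, by omega, ?_, ?_⟩
    · rw [← Ideal.span_singleton_le_iff_mem, h, mul_assoc I, mul_comm 𝔞]
      exact Ideal.mul_le_right (I := I) (J := J * 𝔞)
    · rw [h, hχ _ _ (mul_ne_zero hI h𝔞) hJ, hχ _ _ hI h𝔞]
      field_simp [hχ0 J, hχ0 𝔞]
  choose! J hJ using hex
  refine Finset.sum_bij (fun I _ => J I) ?_ ?_ ?_ ?_
  · intro I hI
    rw [Finset.mem_filter, hD] at hI ⊢
    obtain ⟨-, h1, h2, h3, -⟩ := hdeg _ _ (hJ I hI.2)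
    exact ⟨⟨h1, by omega⟩, h3⟩
  · intro I hI I' hI' h
    rw [Finset.mem_filter] at hI hI'
    have h1 := (hJ I hI.2).symm.trans (hJ I' hI'.2)
    obtain ⟨-, h0, -⟩ := hdeg _ _ (hJ I hI.2)
    rw [← h] at h1
    exact mul_right_cancel₀ h𝔞 (mul_right_cancel₀ (show J I ≠ 0 from h0) h1)
  · intro K hK
    rw [Finset.mem_filter, hD] at hK
    obtain ⟨I, hI⟩ : ∃ I, Ideal.span {g} = K * 𝔞 * I :=
      Ideal.dvd_iff_le.2 ((Ideal.span_singleton_le_iff_mem _).2 hK.2)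
    obtain ⟨-, h1, h2, h3, -⟩ := hdeg _ _ hI
    refine ⟨I, by rw [Finset.mem_filter, hD]; exact ⟨⟨h1, by omega⟩, h3⟩, ?_⟩
    have h4 := (hJ I h3).symm.trans hI
    rw [show K * 𝔞 * I = I * 𝔞 * K by ring] at h4
    exact mul_left_cancel₀ (mul_ne_zero (show I ≠ 0 from h1) (show 𝔞 ≠ 0 from h𝔞)) h4
  · intro I hI
    rw [Finset.mem_filter] at hI
    exact (hdeg _ _ (hJ I hI.2)).2.2.2.2

theorem card_monicFinset [Fintype k] [IsDomain A] [Nonempty S] {I : Ideal A}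
    [FiniteDimensional k (A ⧸ I)] {m : ℤ}
    (hm : Module.finrank k (A ⧸ I) / Fintype.card S + 2 * Fintype.card S ≤ m + 2) :
    ((L.monicFinset m I).card : ℂ) * Fintype.card k ^ Module.finrank k (A ⧸ I) =
      Fintype.card k ^ Module.finrank k (L.V (m - 1)) := by
  have := L.card_monic_ideal I (m₀ := m) (fun m' hm' => L.Λ_le_map_lead_ideal I (by omega)) le_rfl
    _ (fun g => L.mem_monicFinset)
  exact_mod_cast this

section

variable [Fintype k] [IsDedekindDomain A] [Nonempty S]

theorem sum_ideals_eq_zero (deg : Ideal A → ℕ)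
    (hmul : ∀ I J : Ideal A, I ≠ ⊥ → J ≠ ⊥ → deg (I * J) = deg I + deg J)
    (hfin : ∀ I : Ideal A, I ≠ ⊥ → FiniteDimensional k (A ⧸ I))
    (hdeg : ∀ I : Ideal A, I ≠ ⊥ → Module.finrank k (A ⧸ I) = deg I)
    (D : ℕ → Finset (Ideal A)) (hD : ∀ n I, I ∈ D n ↔ I ≠ ⊥ ∧ deg I = n)
    (hg : ∀ (m : ℕ) (g : A), g ∈ L.V m → L.lead m g = 1 →
      deg (Ideal.span {g}) = Fintype.card S * m)
    (χ : Ideal A → ℂ)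
    (hχ : ∀ I J : Ideal A, I ≠ ⊥ → J ≠ ⊥ → χ (I * J) = χ I * χ J)
    (hχ0 : ∀ I, χ I ≠ 0) (ψ : AddChar k ℂ) (hψ : ψ 1 ≠ 1) (θ : (S → F) →ₗ[k] k)
    (hθ : ∃ v ∈ L.Λ, θ v ≠ 0)
    (hgχ : ∀ (m : ℕ) (g : A), g ∈ L.V m → L.lead m g = 1 →
      χ (Ideal.span {g}) = ψ (θ (L.lead ((m : ℤ) - 1) g)))
    {n : ℕ} (hn : 2 * Fintype.card S ^ 2 ≤ n) : ∑ I ∈ D n, χ I = 0 := by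
  set d := Fintype.card S with hd
  have hd0 : 0 < d := Fintype.card_pos
  set m : ℕ := n / d + 2 * d + 1 with hm
  set e : ℕ := d * m - n with he
  have h1 := Nat.div_add_mod n d
  have h2 := Nat.mod_lt n hd0
  have h3 : d * m = d * (n / d) + 2 * d ^ 2 + d := by rw [hm]; ring
  have hone : deg 1 = 0 := by
    have := hmul 1 1 one_ne_zero one_ne_zero
    rw [mul_one] at this; omega
  have hne : n + e + deg 1 = d * m := by rw [hone]; omega
  have hed : e / d + 2 * d ≤ m + 1 := by
    have h4 : e ≤ d * (2 * d + 1) := by rw [mul_add, mul_one, ← mul_assoc, mul_comm d 2, mul_assoc, ← sq]; omega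
    have h5 : e / d ≤ 2 * d + 1 := Nat.div_le_of_le_mul h4
    have h6 : 2 * d ≤ n / d := by
      rw [Nat.le_div_iff_mul_le hd0]; rw [mul_assoc, ← sq]; exact hn
    omega
  have key := L.sum_mul_card_monic deg hmul D hD hg χ hχ hχ0 (𝔞 := 1) one_ne_zero hne
  rw [Finset.sum_eq_zero (s := D e)] at key
  · have hq : (Fintype.card k : ℂ) ≠ 0 := by exact_mod_cast Fintype.card_ne_zero
    have h7 : (∑ I ∈ D n, χ I) * Fintype.card k ^ Module.finrank k (L.V ((m : ℤ) - 1)) = 0 := by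
      rw [Finset.sum_mul, ← zero_mul ((Fintype.card k : ℂ) ^ n), ← key, Finset.sum_mul]
      refine Finset.sum_congr rfl fun I hI => ?_
      obtain ⟨hI0, hIn⟩ := (hD _ _).1 hI
      have := hfin I hI0
      have h8 := hdeg I hI0
      rw [mul_one, mul_assoc, ← L.card_monicFinset (m := m) (I := I) (by rw [h8, hIn, ← hd]; omega), h8, hIn]
    exact (mul_eq_zero.1 h7).resolve_right (pow_ne_zero _ hq)
  · intro J hJ
    obtain ⟨hJ0, hJe⟩ := (hD _ _).1 hJ
    have := hfin J hJ0
    have h8 := hdeg J hJ0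
    rw [mul_one]
    have h9 := L.sum_monic_ideal J (m₀ := (m : ℤ) - 1) (fun m' hm' => L.Λ_le_map_lead_ideal J (by
      rw [h8, hJe, ← hd]; omega)) le_rfl (L.monicFinset m J) (fun g => L.mem_monicFinset) ψ hψ θ hθ
    rw [Finset.sum_congr rfl fun g hg' => hgχ m g (L.mem_monicFinset.1 hg').2.1
      (L.mem_monicFinset.1 hg').2.2, h9, mul_zero]

theorem card_ideals_mul (deg : Ideal A → ℕ)
    (hmul : ∀ I J : Ideal A, I ≠ ⊥ → J ≠ ⊥ → deg (I * J) = deg I + deg J)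
    (hfin : ∀ I : Ideal A, I ≠ ⊥ → FiniteDimensional k (A ⧸ I))
    (hdeg : ∀ I : Ideal A, I ≠ ⊥ → Module.finrank k (A ⧸ I) = deg I)
    (D : ℕ → Finset (Ideal A)) (hD : ∀ n I, I ∈ D n ↔ I ≠ ⊥ ∧ deg I = n)
    (hg : ∀ (m : ℕ) (g : A), g ∈ L.V m → L.lead m g = 1 →
      deg (Ideal.span {g}) = Fintype.card S * m)
    {𝔞 : Ideal A} (h𝔞 : 𝔞 ≠ ⊥) {n e m : ℕ}
    (hne : n + e + deg 𝔞 = Fintype.card S * m) (hn : 2 * Fintype.card S ^ 2 ≤ n)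
    (he : 2 * Fintype.card S ^ 2 ≤ e) :
    ((D n).card : ℂ) * Fintype.card k ^ e = (D e).card * Fintype.card k ^ n := by
  set d := Fintype.card S with hd
  have hd0 : 0 < d := Fintype.card_pos
  have hq : (Fintype.card k : ℂ) ≠ 0 := by exact_mod_cast Fintype.card_ne_zero
  have key := L.sum_mul_card_monic deg hmul D hD hg (fun _ => 1) (fun _ _ _ _ => by simp)
    (fun _ => one_ne_zero) h𝔞 hne
  simp only [one_mul, mul_one, inv_one, Finset.sum_const, nsmul_eq_mul] at key
  have hcard : ∀ a b : ℕ, a + b + deg 𝔞 = d * m → 2 * d ^ 2 ≤ b → 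
      (∑ I ∈ D a, ((L.monicFinset m (I * 𝔞)).card : ℂ)) * Fintype.card k ^ (a + deg 𝔞) =
      (D a).card * Fintype.card k ^ Module.finrank k (L.V ((m : ℤ) - 1)) := by
    intro a b hab hb
    rw [Finset.sum_mul, ← nsmul_eq_mul, ← Finset.sum_const]
    refine Finset.sum_congr rfl fun I hI => ?_
    obtain ⟨hI0, hIn⟩ := (hD _ _).1 hI
    have hI1 : I * 𝔞 ≠ ⊥ := mul_ne_zero hI0 h𝔞
    have := hfin _ hI1
    have h8 := hdeg _ hI1
    rw [hmul _ _ hI0 h𝔞, hIn] at h8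
    rw [← L.card_monicFinset (m := m) (I := I * 𝔞), h8]
    rw [h8]
    have h9 : (a + deg 𝔞) / d + 2 * d ≤ m := by
      have h10 : (a + deg 𝔞) + d * (2 * d) ≤ d * m := by
        rw [← hab, ← mul_assoc, mul_comm d 2, mul_assoc, ← sq]; omega
      have h11 := Nat.div_le_div_right (c := d) h10
      rwa [Nat.add_mul_div_left _ _ hd0, Nat.mul_div_cancel_left _ hd0] at h11
    rw [← hd]
    omega
  have h1 := hcard n e hne he
  have h2 := hcard e n (by omega) hn
  rw [key] at h1
  have hv : (Fintype.card k : ℂ) ^ Module.finrank k (L.V ((m : ℤ) - 1)) ≠ 0 := pow_ne_zero _ hq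
  have ha : (Fintype.card k : ℂ) ^ deg 𝔞 ≠ 0 := pow_ne_zero _ hq
  rw [pow_add] at h1 h2
  apply mul_right_cancel₀ hv
  apply mul_right_cancel₀ ha
  linear_combination (-(Fintype.card k : ℂ) ^ e * (Fintype.card k : ℂ) ^ deg 𝔞) * h1 +
    ((Fintype.card k : ℂ) ^ n * (Fintype.card k : ℂ) ^ deg 𝔞) * h2

theorem card_ideals_succ (deg : Ideal A → ℕ)
    (hmul : ∀ I J : Ideal A, I ≠ ⊥ → J ≠ ⊥ → deg (I * J) = deg I + deg J)
    (hfin : ∀ I : Ideal A, I ≠ ⊥ → FiniteDimensional k (A ⧸ I))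
    (hdeg : ∀ I : Ideal A, I ≠ ⊥ → Module.finrank k (A ⧸ I) = deg I)
    (D : ℕ → Finset (Ideal A)) (hD : ∀ n I, I ∈ D n ↔ I ≠ ⊥ ∧ deg I = n)
    (hg : ∀ (m : ℕ) (g : A), g ∈ L.V m → L.lead m g = 1 →
      deg (Ideal.span {g}) = Fintype.card S * m)
    {𝔞 : Ideal A} (h𝔞 : 𝔞 ≠ ⊥) (h𝔞1 : deg 𝔞 = 1) {n : ℕ}
    (hn : 2 * Fintype.card S ^ 2 ≤ n) :
    ((D (n + 1)).card : ℂ) = Fintype.card k * (D n).card := by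
  set d := Fintype.card S with hd
  have hd0 : 0 < d := Fintype.card_pos
  have hq : (Fintype.card k : ℂ) ≠ 0 := by exact_mod_cast Fintype.card_ne_zero
  have hone : deg 1 = 0 := by
    have := hmul 1 1 one_ne_zero one_ne_zero
    rw [mul_one] at this; omega
  obtain ⟨e, he, m, hm⟩ : ∃ e, 2 * d ^ 2 ≤ e ∧ ∃ m, n + 1 + e = d * m := by
    refine ⟨d * (n + 1 + 2 * d ^ 2) - (n + 1), ?_, n + 1 + 2 * d ^ 2, ?_⟩
    · have : 1 * (n + 1 + 2 * d ^ 2) ≤ d * (n + 1 + 2 * d ^ 2) := Nat.mul_le_mul_right _ hd0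
      omega
    · have : 1 * (n + 1 + 2 * d ^ 2) ≤ d * (n + 1 + 2 * d ^ 2) := Nat.mul_le_mul_right _ hd0
      omega
  have h1 := L.card_ideals_mul deg hmul hfin hdeg D hD hg (𝔞 := 1) one_ne_zero
    (n := n + 1) (e := e) (m := m) (by rw [hone, ← hd]; omega) (by rw [← hd]; omega) he
  have h2 := L.card_ideals_mul deg hmul hfin hdeg D hD hg h𝔞
    (n := n) (e := e) (m := m) (by rw [← hd]; omega) hn he
  have he : (Fintype.card k : ℂ) ^ e ≠ 0 := pow_ne_zero _ hq
  apply mul_right_cancel₀ he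
  rw [h1, mul_assoc, h2]
  ring

end

end LaurentFamily

end

section

open Polynomial

namespace Polynomial

variable {k A : Type*} [Field k] [CommRing A] [IsDedekindDomain A] [Algebra k[X] A]
    [Module.Finite k[X] A] [Module.IsTorsionFree k[X] A]

/-- The monic generator of the relative norm of an ideal. -/
noncomputable def normPoly (I : Ideal A) : k[X] := by
  classical exact normalize (Submodule.IsPrincipal.generator (Ideal.relNorm k[X] I))

theorem span_normPoly (I : Ideal A) : Ideal.span {normPoly I} = Ideal.relNorm k[X] I := by
  classical
  rw [normPoly, Ideal.span_singleton_eq_span_singleton.2 (normalize_associated _),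
    Ideal.span_singleton_generator]

theorem normPoly_ne_zero {I : Ideal A} (hI : I ≠ ⊥) : (normPoly I : k[X]) ≠ 0 := by
  intro h
  have := span_normPoly (k := k) I
  rw [h, Ideal.span_singleton_eq_bot.2 rfl, eq_comm, Ideal.relNorm_eq_bot_iff] at this
  exact hI this

theorem monic_normPoly {I : Ideal A} (hI : I ≠ ⊥) : (normPoly I : k[X]).Monic := by
  classical
  rw [normPoly]
  apply Polynomial.monic_normalize
  intro h
  apply normPoly_ne_zero (k := k) hI
  rw [normPoly, h, normalize_zero]

theorem normPoly_eq_of_span {I : Ideal A} {G : k[X]} (hG : G.Monic)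
    (h : Ideal.relNorm k[X] I = Ideal.span {G}) : normPoly I = G := by
  have hI : I ≠ ⊥ := by
    rintro rfl
    rw [Ideal.relNorm_bot, eq_comm, Ideal.span_singleton_eq_bot] at h
    exact hG.ne_zero h
  rw [← span_normPoly, Ideal.span_singleton_eq_span_singleton] at h
  exact eq_of_monic_of_associated (monic_normPoly hI) hG h

theorem normPoly_mul {I J : Ideal A} (hI : I ≠ ⊥) (hJ : J ≠ ⊥) :
    (normPoly (I * J) : k[X]) = normPoly I * normPoly J := by
  apply normPoly_eq_of_span ((monic_normPoly hI).mul (monic_normPoly hJ))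
  rw [map_mul, ← Ideal.span_singleton_mul_span_singleton, span_normPoly, span_normPoly]

theorem normPoly_top : (normPoly (⊤ : Ideal A) : k[X]) = 1 := by
  apply normPoly_eq_of_span monic_one
  rw [Ideal.relNorm_top, Ideal.span_singleton_one]

theorem normPoly_pow {I : Ideal A} (hI : I ≠ ⊥) (n : ℕ) :
    (normPoly (I ^ n) : k[X]) = normPoly I ^ n := by
  induction n with
  | zero => rw [pow_zero, pow_zero, Ideal.one_eq_top, normPoly_top]
  | succ n ih =>
    rw [pow_succ, pow_succ, normPoly_mul (pow_ne_zero n hI) hI, ih]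

theorem normPoly_span {g : A} {G : k[X]} (hG : G.Monic) (h : Algebra.norm k[X] g = G) :
    (normPoly (Ideal.span {g}) : k[X]) = G := by
  apply normPoly_eq_of_span hG
  rw [Ideal.relNorm_singleton, Algebra.intNorm_eq_norm, h]

theorem associated_normPoly_span (g : A) :
    Associated (normPoly (Ideal.span {g}) : k[X]) (Algebra.norm k[X] g) := by
  rw [← Ideal.span_singleton_eq_span_singleton, span_normPoly, Ideal.relNorm_singleton,
    Algebra.intNorm_eq_norm]

variable [Algebra k A] [IsScalarTower k k[X] A]

theorem finiteDimensional_quotient {I : Ideal A} (hI : I ≠ ⊥) : FiniteDimensional k (A ⧸ I) := by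
  classical
  let b := Module.Free.chooseBasis k[X] A
  exact Module.Finite.equiv (Ideal.quotientEquivDirectSum k b hI).symm

theorem natDegree_normPoly_span {g : A} (hg : g ≠ 0) :
    (normPoly (Ideal.span {g}) : k[X]).natDegree = Module.finrank k (A ⧸ Ideal.span {g}) := by
  rw [finrank_quotient_span_eq_natDegree_norm (Module.Free.chooseBasis k[X] A) hg]
  exact natDegree_eq_of_degree_eq (degree_eq_degree_of_associated (associated_normPoly_span g))

theorem cardQuot_eq [Fintype k] {I : Ideal A} (hI : I ≠ ⊥) :
    Submodule.cardQuot I = Fintype.card k ^ Module.finrank k (A ⧸ I) := by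
  have := finiteDimensional_quotient (k := k) hI
  rw [Submodule.cardQuot_apply, ← Nat.card_eq_fintype_card]
  exact Module.natCard_eq_pow_finrank

theorem natDegree_normPoly_prime [Fintype k] [Finite (ClassGroup A)] {P : Ideal A} (hP : P ≠ ⊥)
    [P.IsPrime] : (normPoly P : k[X]).natDegree = Module.finrank k (A ⧸ P) := by
  obtain ⟨n, hn, g, hg⟩ : ∃ n, n ≠ 0 ∧ ∃ g, P ^ n = Ideal.span {g} := by
    have h0 : P ∈ nonZeroDivisors (Ideal A) := mem_nonZeroDivisors_of_ne_zero hP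
    refine ⟨Nat.card (ClassGroup A), Nat.card_pos.ne', ?_⟩
    have h1 : ClassGroup.mk0 (⟨P, h0⟩ ^ Nat.card (ClassGroup A)) = 1 := by
      rw [map_pow, pow_card_eq_one']
    rw [ClassGroup.mk0_eq_one_iff] at h1
    obtain ⟨g, hg⟩ := h1.principal
    exact ⟨g, hg⟩
  have hPn : P ^ n ≠ ⊥ := pow_ne_zero n hP
  have hg0 : g ≠ 0 := by
    rintro rfl
    rw [Ideal.span_singleton_eq_bot.2 rfl] at hg
    exact hPn hg
  have h1 := natDegree_normPoly_span (k := k) hg0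
  rw [← hg, normPoly_pow hP, (monic_normPoly hP).natDegree_pow] at h1
  have h2 := cardQuot_pow_of_prime hP (i := n)
  rw [cardQuot_eq (k := k) hPn, cardQuot_eq (k := k) hP, ← pow_mul] at h2
  have h3 := Nat.pow_right_injective (Fintype.one_lt_card (α := k)) h2
  rw [← h1, mul_comm] at h3
  exact Nat.eq_of_mul_eq_mul_right (Nat.pos_of_ne_zero hn) h3

theorem natDegree_normPoly [Fintype k] [Finite (ClassGroup A)] {I : Ideal A} (hI : I ≠ ⊥) :
    (normPoly I : k[X]).natDegree = Module.finrank k (A ⧸ I) := by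
  apply Nat.pow_right_injective (Fintype.one_lt_card (α := k))
  simp only
  rw [← cardQuot_eq hI]
  induction I using UniqueFactorizationMonoid.induction_on_coprime with
  | h0 => exact absurd rfl hI
  | @h1 I h =>
    rw [Ideal.isUnit_iff.1 h, normPoly_top, natDegree_one, pow_zero, Submodule.cardQuot_top]
  | @hpr P i hp =>
    have hP := (Ideal.prime_iff_isPrime hp.ne_zero).1 hp
    have h0 : P ≠ ⊥ := hp.ne_zero
    rw [normPoly_pow h0, (monic_normPoly h0).natDegree_pow, cardQuot_pow_of_prime h0,
      cardQuot_eq (k := k) h0, natDegree_normPoly_prime h0, ← pow_mul, mul_comm]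
  | @hcp I J h hI' hJ' =>
    have h1 : I ≠ ⊥ := left_ne_zero_of_mul hI
    have h2 : J ≠ ⊥ := right_ne_zero_of_mul hI
    rw [normPoly_mul h1 h2, (monic_normPoly h1).natDegree_mul (monic_normPoly h2), pow_add,
      hI' h1, hJ' h2, cardQuot_mul_of_coprime (Ideal.isCoprime_iff_sup_eq.2 (Ideal.isUnit_iff.1
        (h (Ideal.dvd_iff_le.2 le_sup_left) (Ideal.dvd_iff_le.2 le_sup_right))))]

end Polynomial

end

section

open Polynomial

namespace Polynomial

variable {k A : Type*} [Field k] [Fintype k] [CommRing A] [IsDedekindDomain A] [Algebra k[X] A]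
    [Module.Finite k[X] A] [Module.IsTorsionFree k[X] A] [Algebra k A] [IsScalarTower k k[X] A]
    [Finite (ClassGroup A)]

theorem nextCoeff_normPoly_prime {P : Ideal A} (hP : P ≠ ⊥) [P.IsPrime] :
    Algebra.trace k (A ⧸ P) (Ideal.Quotient.mk P (algebraMap k[X] A X)) =
      -(normPoly P : k[X]).nextCoeff := by
  have hmax : P.IsMaximal := Ring.DimensionLEOne.maximalOfPrime hP ‹_›
  let _ : Field (A ⧸ P) := Ideal.Quotient.field P
  have hfd : FiniteDimensional k (A ⧸ P) := finiteDimensional_quotient (k := k) hP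
  set x : A ⧸ P := Ideal.Quotient.mk P (algebraMap k[X] A X) with hx
  have hInt : IsIntegral k x := Algebra.IsIntegral.isIntegral x
  have haev : ∀ r : k[X], aeval x r = Ideal.Quotient.mk P (algebraMap k[X] A r) := by
    intro r
    have : (aeval x : k[X] →ₐ[k] A ⧸ P) =
        (Ideal.Quotient.mkₐ k P).comp (IsScalarTower.toAlgHom k k[X] A) := by
      apply Polynomial.algHom_ext
      simp [hx]
    rw [this]; rfl
  have hcomap : P.under k[X] = Ideal.span {minpoly k x} := by
    ext r
    rw [Ideal.mem_span_singleton, ← minpoly.isIntegrallyClosed_dvd_iff hInt, haev,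
      Ideal.Quotient.eq_zero_iff_mem, Ideal.mem_comap]
  obtain ⟨s, hs⟩ := Ideal.exists_relNorm_eq_pow_of_isPrime P (P.under k[X])
  have hmon := minpoly.monic hInt
  have hG : (normPoly P : k[X]) = minpoly k x ^ s := by
    apply normPoly_eq_of_span (hmon.pow s)
    rw [hs, hcomap, Ideal.span_singleton_pow]
  have hdeg := natDegree_normPoly_prime (k := k) hP
  rw [hG, hmon.natDegree_pow] at hdeg
  have h1 := Module.finrank_mul_finrank k (IntermediateField.adjoin k {x}) (A ⧸ P)
  rw [IntermediateField.adjoin.finrank hInt] at h1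
  have h2 : s = Module.finrank (IntermediateField.adjoin k {x}) (A ⧸ P) := by
    have := h1.trans hdeg.symm
    rw [mul_comm s] at this
    exact (Nat.eq_of_mul_eq_mul_left (minpoly.natDegree_pos hInt) this).symm
  rw [trace_eq_finrank_mul_minpoly_nextCoeff, hG, hmon.nextCoeff_pow, ← h2, nsmul_eq_mul]
  ring

end Polynomial

end

section

open Polynomial

theorem PoleLe.prod {F ι : Type*} [Field F] (T : Finset ι) {f : ι → LaurentSeries F} {m : ℤ}
    (hf : ∀ i ∈ T, PoleLe m (f i)) :
    PoleLe (T.card * m) (∏ i ∈ T, f i) ∧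
    (∏ i ∈ T, f i).coeff (-(T.card * m)) = ∏ i ∈ T, (f i).coeff (-m) ∧
    ((∀ i ∈ T, (f i).coeff (-m) ≠ 0) → (∏ i ∈ T, f i).coeff (-(T.card * m) + 1) =
      (∏ i ∈ T, (f i).coeff (-m)) * ∑ i ∈ T, (f i).coeff (-m + 1) / (f i).coeff (-m)) := by
  classical
  induction T using Finset.induction_on with
  | empty =>
    simp only [Finset.card_empty, Nat.cast_zero, zero_mul, Finset.prod_empty, neg_zero, zero_add,
      Finset.sum_empty, mul_zero]
    refine ⟨?_, ?_, fun _ => ?_⟩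
    · simpa using poleLe_C (1 : F)
    · simp [HahnSeries.coeff_one]
    · simp [HahnSeries.coeff_one]
  | @insert a T ha ih =>
    obtain ⟨h1, h2, h3⟩ := ih fun i hi => hf i (Finset.mem_insert_of_mem hi)
    obtain ⟨g1, g2, g3⟩ := (hf a (Finset.mem_insert_self a T)).mul_aux h1
    have hc : ((insert a T).card : ℤ) * m = m + T.card * m := by
      rw [Finset.card_insert_of_notMem ha]; push_cast; ring
    rw [hc, Finset.prod_insert ha, Finset.prod_insert ha, Finset.sum_insert ha]
    refine ⟨g1, by rw [g2, h2], fun h => ?_⟩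
    have := h a (Finset.mem_insert_self a T)
    rw [g3, h3 fun i hi => h i (Finset.mem_insert_of_mem hi), h2]
    field_simp
    ring

theorem monic_of_eval₂_coeff {F : Type*} [Field F] {R : F[X]} {x f : LaurentSeries F}
    (hx : PoleLe 1 x) (hx1 : x.coeff (-1) = 1) (hx0 : x.coeff 0 = 0) {N : ℕ} (hf : PoleLe N f)
    (hf1 : f.coeff (-N) = 1) (hR : R.eval₂ HahnSeries.C x = f) :
    R.Monic ∧ R.natDegree = N ∧ R.nextCoeff = f.coeff (-N + 1) := by
  have hR0 : R ≠ 0 := by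
    rintro rfl
    rw [eval₂_zero] at hR
    rw [← hR] at hf1
    simp at hf1
  obtain ⟨h1, h2, h3⟩ := poleLe_eval₂ R le_rfl hx hx0
  rw [hR, hx1, one_pow, mul_one] at h2
  rw [hR] at h1 h3
  have hlead : R.coeff R.natDegree ≠ 0 := by simpa using hR0
  have hle : R.natDegree ≤ N := by
    by_contra h
    rw [← h2] at hlead
    exact hlead (hf _ (by omega))
  have hge : N ≤ R.natDegree := by
    by_contra h
    have := h1 (-N) (by omega)
    rw [hf1] at this
    exact one_ne_zero this
  have hN : R.natDegree = N := le_antisymm hle hge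
  rw [hN, hf1] at h2
  have hmon : R.Monic := by rw [Monic, leadingCoeff, hN, ← h2]
  refine ⟨hmon, hN, ?_⟩
  rcases Nat.eq_zero_or_pos N with h0 | h0
  · have h4 : R = 1 := by
      rw [eq_C_of_natDegree_eq_zero (hN.trans h0), ← h0, ← hN, coeff_natDegree, hmon.leadingCoeff, C_1]
    rw [← hR, h4, h0]
    simp [HahnSeries.coeff_one, nextCoeff]
  · rw [nextCoeff_of_natDegree_pos (by omega)]
    rw [hN] at h3 ⊢
    rw [h3 h0, hx1, one_pow, mul_one]

theorem eq_zero_of_eval₂_poleLe {F : Type*} [Field F] {R : F[X]} {x : LaurentSeries F}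
    (hx : PoleLe 1 x) (hx1 : x.coeff (-1) = 1) (hx0 : x.coeff 0 = 0)
    (h : PoleLe (-1) (R.eval₂ HahnSeries.C x)) : R = 0 := by
  by_contra hR0
  obtain ⟨h1, h2, h3⟩ := poleLe_eval₂ R le_rfl hx hx0
  rw [hx1, one_pow, mul_one, h _ (by omega)] at h2
  have hlead : R.coeff R.natDegree ≠ 0 := by simpa using hR0
  exact hlead h2.symm

end

section

section IdealRecursion

variable {A : Type*} [CommRing A] [IsDedekindDomain A]

open Classical in
theorem degree_eq_sum_dvd (deg : Ideal A → ℕ)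
    (hmul : ∀ I J : Ideal A, I ≠ ⊥ → J ≠ ⊥ → deg (I * J) = deg I + deg J)
    (hpos : ∀ P : Ideal A, P ≠ ⊥ → P.IsPrime → 0 < deg P) (S : Finset (Ideal A)) {n : ℕ}
    (hS : ∀ P, P ∈ S ↔ P ≠ ⊥ ∧ P.IsPrime ∧ deg P ≤ n) {I : Ideal A} (hI : I ≠ ⊥)
    (hn : deg I = n) :
    n = ∑ P ∈ S, ∑ k ∈ Finset.Icc 1 n, if P ^ k ∣ I then deg P else 0 := by
  have hone : deg ⊤ = 0 := by
    have := hmul ⊤ ⊤ top_ne_bot top_ne_bot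
    simp at this
    exact this
  have hprod : ∀ s : Multiset (Ideal A), (∀ P ∈ s, P ≠ ⊥) → s.prod ≠ ⊥ ∧
      deg s.prod = (s.map deg).sum := by
    intro s
    induction s using Multiset.induction_on with
    | empty => intro _; simpa [Ideal.one_eq_top] using hone
    | cons P s ih =>
      intro h
      obtain ⟨h1, h2⟩ := ih fun Q hQ => h Q (Multiset.mem_cons_of_mem hQ)
      have hP := h P (Multiset.mem_cons_self P s)
      rw [Multiset.prod_cons, Multiset.map_cons, Multiset.sum_cons, hmul _ _ hP h1, h2]
      exact ⟨mul_ne_zero hP h1, rfl⟩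
  have hle : ∀ J : Ideal A, J ∣ I → deg J ≤ n := by
    rintro J ⟨K, rfl⟩
    have hJ : J ≠ ⊥ := left_ne_zero_of_mul hI
    have hK : K ≠ ⊥ := right_ne_zero_of_mul hI
    rw [← hn, hmul _ _ hJ hK]; omega
  set s := UniqueFactorizationMonoid.normalizedFactors I with hs
  have hsI : s.prod = I := by
    have := UniqueFactorizationMonoid.prod_normalizedFactors hI
    exact associated_iff_eq.mp this
  have hsP : ∀ P ∈ s, P ≠ ⊥ ∧ P.IsPrime := by
    intro P hP
    have h1 := UniqueFactorizationMonoid.prime_of_normalized_factor P hP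
    exact ⟨h1.ne_zero, Ideal.isPrime_of_prime h1⟩
  have hdeg : n = (s.map deg).sum := by
    rw [← (hprod s fun P hP => (hsP P hP).1).2, hsI, hn]
  have hsub : s.toFinset ⊆ S := by
    intro P hP
    rw [Multiset.mem_toFinset] at hP
    exact (hS P).2 ⟨(hsP P hP).1, (hsP P hP).2,
      hle P (UniqueFactorizationMonoid.dvd_of_mem_normalizedFactors hP)⟩
  conv_lhs => rw [hdeg, Finset.sum_multiset_map_count]
  rw [Finset.sum_subset hsub (by
    intro P _ hP
    rw [Multiset.mem_toFinset] at hP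
    rw [Multiset.count_eq_zero_of_notMem hP, zero_smul])]
  refine Finset.sum_congr rfl fun P hP => ?_
  obtain ⟨hP0, hPp, -⟩ := (hS P).1 hP
  have hirr : Irreducible P := (Ideal.prime_of_isPrime hP0 hPp).irreducible
  have hpow : ∀ k, deg (P ^ k) = k * deg P := by
    intro k
    induction k with
    | zero => simpa [Ideal.one_eq_top] using hone
    | succ k ih => rw [pow_succ, hmul _ _ (pow_ne_zero k hP0) hP0, ih]; ring
  have hdvd : ∀ k, P ^ k ∣ I ↔ k ≤ s.count P := by
    intro k
    rw [pow_dvd_iff_le_emultiplicity,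
      UniqueFactorizationMonoid.emultiplicity_eq_count_normalizedFactors hirr hI,
      normalize_eq]
    exact Nat.cast_le
  have hcount : s.count P ≤ n := by
    have h1 := hle _ ((hdvd _).2 le_rfl)
    rw [hpow] at h1
    have := hpos P hP0 hPp
    nlinarith
  simp only [hdvd]
  rw [← Finset.sum_filter, Finset.sum_const]
  congr 1
  rw [show (Finset.Icc 1 n).filter (fun k => k ≤ s.count P) = Finset.Icc 1 (s.count P) by
    ext k; simp only [Finset.mem_filter, Finset.mem_Icc]; omega]
  simp

open Classical in
/-- The recursion equivalent to the Euler product of an `L`-series over ideals. -/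
theorem ideal_sum_recursion (deg : Ideal A → ℕ)
    (hmul : ∀ I J : Ideal A, I ≠ ⊥ → J ≠ ⊥ → deg (I * J) = deg I + deg J)
    (hpos : ∀ P : Ideal A, P ≠ ⊥ → P.IsPrime → 0 < deg P) (D S : ℕ → Finset (Ideal A))
    (hD : ∀ n I, I ∈ D n ↔ I ≠ ⊥ ∧ deg I = n)
    (hS : ∀ n P, P ∈ S n ↔ P ≠ ⊥ ∧ P.IsPrime ∧ deg P ≤ n)
    (χ : Ideal A → ℂ) (hχ : ∀ I J : Ideal A, I ≠ ⊥ → J ≠ ⊥ → χ (I * J) = χ I * χ J)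
    (hχ1 : χ ⊤ = 1) (n : ℕ) :
    (n : ℂ) * ∑ I ∈ D n, χ I =
      ∑ x ∈ Finset.HasAntidiagonal.antidiagonal n with x.1 < n, (∑ I ∈ D x.1, χ I) *
        ∑ P ∈ S x.2 with deg P ∣ x.2, (deg P : ℂ) * χ P ^ (x.2 / deg P) := by
  have hone : deg ⊤ = 0 := by
    have := hmul ⊤ ⊤ top_ne_bot top_ne_bot
    simp at this
    exact this
  have hpow : ∀ P : Ideal A, P ≠ ⊥ → ∀ k, deg (P ^ k) = k * deg P ∧ χ (P ^ k) = χ P ^ k := by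
    intro P hP0 k
    induction k with
    | zero => simpa [Ideal.one_eq_top] using ⟨hone, hχ1⟩
    | succ k ih =>
      rw [pow_succ, hmul _ _ (pow_ne_zero k hP0) hP0, hχ _ _ (pow_ne_zero k hP0) hP0, ih.1, ih.2]
      exact ⟨by ring, by ring⟩
  have hfib : ∀ P ∈ S n, ∀ k, ∑ I ∈ D n with P ^ k ∣ I, χ I =
      if k * deg P ≤ n then χ P ^ k * ∑ I ∈ D (n - k * deg P), χ I else 0 := by
    intro P hP k
    have hP0 := ((hS n P).1 hP).1
    have hPk : P ^ k ≠ ⊥ := pow_ne_zero k hP0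
    split_ifs with hk
    · rw [Finset.mul_sum]
      symm
      refine Finset.sum_bij (fun I _ => P ^ k * I) ?_ ?_ ?_ ?_
      · intro I hI
        obtain ⟨h0, h1⟩ := (hD _ _).1 hI
        rw [Finset.mem_filter, hD]
        refine ⟨⟨mul_ne_zero hPk h0, ?_⟩, dvd_mul_right _ _⟩
        rw [hmul _ _ hPk h0, (hpow P hP0 k).1, h1]; omega
      · intro I _ J _ h
        exact mul_left_cancel₀ (show P ^ k ≠ 0 from hPk) h
      · intro I hI
        obtain ⟨h, J, rfl⟩ := Finset.mem_filter.1 hI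
        obtain ⟨h0, h1⟩ := (hD _ _).1 h
        have hJ : J ≠ ⊥ := right_ne_zero_of_mul h0
        rw [hmul _ _ hPk hJ, (hpow P hP0 k).1] at h1
        exact ⟨J, (hD _ _).2 ⟨hJ, by omega⟩, rfl⟩
      · intro I hI
        rw [hχ _ _ hPk ((hD _ _).1 hI).1, (hpow P hP0 k).2]
    · refine Finset.sum_eq_zero fun I hI => ?_
      obtain ⟨h, J, rfl⟩ := Finset.mem_filter.1 hI
      obtain ⟨h0, h1⟩ := (hD _ _).1 h
      rw [hmul _ _ hPk (right_ne_zero_of_mul h0), (hpow P hP0 k).1] at h1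
      omega
  have hL : (n : ℂ) * ∑ I ∈ D n, χ I =
      ∑ P ∈ S n, ∑ k ∈ Finset.Icc 1 n, (deg P : ℂ) *
        if k * deg P ≤ n then χ P ^ k * ∑ I ∈ D (n - k * deg P), χ I else 0 := by
    have h1 : (n : ℂ) * ∑ I ∈ D n, χ I = ∑ I ∈ D n, ∑ P ∈ S n, ∑ k ∈ Finset.Icc 1 n,
        if P ^ k ∣ I then (deg P : ℂ) * χ I else 0 := by
      rw [Finset.mul_sum]
      refine Finset.sum_congr rfl fun I hI => ?_
      obtain ⟨h0, h1⟩ := (hD _ _).1 hI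
      have := congrArg (Nat.cast : ℕ → ℂ) (degree_eq_sum_dvd deg hmul hpos (S n) (hS n) h0 h1)
      rw [this]
      push_cast
      rw [Finset.sum_mul]
      refine Finset.sum_congr rfl fun P _ => ?_
      rw [Finset.sum_mul]
      refine Finset.sum_congr rfl fun k _ => ?_
      split_ifs <;> simp
    rw [h1, Finset.sum_comm]
    refine Finset.sum_congr rfl fun P hP => ?_
    rw [Finset.sum_comm]
    refine Finset.sum_congr rfl fun k _ => ?_
    rw [← hfib P hP k, Finset.mul_sum, Finset.sum_filter]
  have hR : ∀ m, 1 ≤ m → m ≤ n →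
      ∑ P ∈ S m with deg P ∣ m, (deg P : ℂ) * χ P ^ (m / deg P) =
      ∑ P ∈ S n, ∑ k ∈ Finset.Icc 1 n, if k * deg P = m then (deg P : ℂ) * χ P ^ k else 0 := by
    intro m hm hmn
    have hsub : S m ⊆ S n := by
      intro P hP
      rw [hS] at hP ⊢
      exact ⟨hP.1, hP.2.1, hP.2.2.trans hmn⟩
    rw [Finset.sum_filter, ← Finset.sum_subset hsub]
    · refine Finset.sum_congr rfl fun P hP => ?_
      obtain ⟨h0, h1, h2⟩ := (hS _ _).1 hP
      have hd := hpos P h0 h1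
      split_ifs with hdvd
      · obtain ⟨k, rfl⟩ := hdvd
        have hk : 1 ≤ k := Nat.pos_of_ne_zero (by rintro rfl; simp at hm)
        rw [Nat.mul_div_cancel_left _ hd, Finset.sum_eq_single k]
        · rw [if_pos (mul_comm _ _)]
        · intro l _ hl
          rw [if_neg]
          intro h
          exact hl (Nat.eq_of_mul_eq_mul_right hd (h.trans (mul_comm _ _)))
        · intro h
          exfalso
          apply h
          rw [Finset.mem_Icc]
          refine ⟨hk, le_trans ?_ hmn⟩
          nlinarith
      · symm
        refine Finset.sum_eq_zero fun k _ => if_neg ?_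
        rintro rfl
        exact hdvd (dvd_mul_left _ _)
    · intro P hP hP'
      refine Finset.sum_eq_zero fun k hk => if_neg ?_
      rintro rfl
      obtain ⟨h0, h1, -⟩ := (hS _ _).1 hP
      refine hP' ((hS _ _).2 ⟨h0, h1, ?_⟩)
      have := (Finset.mem_Icc.1 hk).1
      nlinarith
  rw [hL]
  have hR2 : ∑ x ∈ Finset.HasAntidiagonal.antidiagonal n with x.1 < n, (∑ I ∈ D x.1, χ I) *
        ∑ P ∈ S x.2 with deg P ∣ x.2, (deg P : ℂ) * χ P ^ (x.2 / deg P) =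
      ∑ x ∈ Finset.HasAntidiagonal.antidiagonal n with x.1 < n, ∑ P ∈ S n,
        ∑ k ∈ Finset.Icc 1 n, if k * deg P = x.2 then
          (deg P : ℂ) * (χ P ^ k * ∑ I ∈ D x.1, χ I) else 0 := by
    refine Finset.sum_congr rfl fun x hx => ?_
    obtain ⟨h1, h2⟩ := Finset.mem_filter.1 hx
    rw [Finset.HasAntidiagonal.mem_antidiagonal] at h1
    rw [hR x.2 (by omega) (by omega), Finset.mul_sum]
    refine Finset.sum_congr rfl fun P _ => ?_
    rw [Finset.mul_sum]
    refine Finset.sum_congr rfl fun k _ => ?_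
    split_ifs
    · ring
    · simp
  rw [hR2]
  symm
  rw [Finset.sum_comm]
  refine Finset.sum_congr rfl fun P hP => ?_
  rw [Finset.sum_comm]
  refine Finset.sum_congr rfl fun k hk => ?_
  obtain ⟨h0, h1, -⟩ := (hS _ _).1 hP
  have hd := hpos P h0 h1
  have hk1 := (Finset.mem_Icc.1 hk).1
  have hkd : 1 ≤ k * deg P := Nat.mul_pos hk1 hd
  split_ifs with hkn
  · rw [Finset.sum_eq_single (n - k * deg P, k * deg P)]
    · rw [if_pos rfl]
    · rintro ⟨u, v⟩ hx hne
      rw [if_neg]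
      rintro rfl
      have := (Finset.mem_filter.1 hx).1
      rw [Finset.HasAntidiagonal.mem_antidiagonal] at this
      exact hne (by ext <;> simp; simp at this; omega)
    · intro h
      exfalso
      apply h
      rw [Finset.mem_filter, Finset.HasAntidiagonal.mem_antidiagonal]
      simp only
      omega
  · rw [mul_zero]
    refine Finset.sum_eq_zero fun x hx => if_neg ?_
    have := (Finset.mem_filter.1 hx).1
    rw [Finset.HasAntidiagonal.mem_antidiagonal] at this
    omega

end IdealRecursion

end

open Finset Polynomial in
theorem exists_powerSums_of_recursion {c W : ℕ → ℂ} (hc0 : c 0 = 1)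
    (hrec : ∀ n : ℕ, (n : ℂ) * c n = ∑ x ∈ Finset.HasAntidiagonal.antidiagonal n with x.1 < n, c x.1 * W x.2)
    {D : ℕ} (hc : ∀ d, D < d → c d = 0) :
    ∃ ω : Fin D → ℂ, ∀ n, 1 ≤ n → W n = -∑ i, ω i ^ n := by
  set g : ℂ[X] := ∑ k ∈ range (D + 1), C (c (D - k)) * X ^ k with hg
  have hcoeff : ∀ k, k ≤ D → g.coeff k = c (D - k) := by
    intro k hk
    simp only [hg, finsetSum_coeff, coeff_C_mul, coeff_X_pow, mul_ite, mul_one, mul_zero]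
    rw [Finset.sum_ite_eq]
    simp [Nat.lt_succ_of_le hk]
  have hdeg : g.natDegree ≤ D := by
    refine natDegree_sum_le_of_forall_le _ _ fun i hi => ?_
    exact (natDegree_C_mul_X_pow_le _ _).trans (Nat.lt_succ_iff.1 (mem_range.1 hi))
  have hD1 : g.coeff D = 1 := by rw [hcoeff D le_rfl]; simp [hc0]
  have hmonic : g.Monic := monic_of_natDegree_le_of_coeff_eq_one D hdeg hD1
  have hnat : g.natDegree = D :=
    le_antisymm hdeg (le_natDegree_of_ne_zero (by rw [hD1]; exact one_ne_zero))
  have hcard : g.roots.card = g.natDegree :=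
    (splits_iff_card_roots.1 (IsAlgClosed.splits g))
  obtain ⟨ω, hω⟩ : ∃ ω : Fin D → ℂ, univ.val.map ω = g.roots := by
    have h1 : ∀ (l : List ℂ) (D : ℕ), l.length = D → ∃ ω : Fin D → ℂ, univ.val.map ω = (l : Multiset ℂ) := by
      rintro l _ rfl
      exact ⟨l.get, by simp [Fin.univ_def]⟩
    obtain ⟨ω, hω⟩ := h1 g.roots.toList D (by simp [hcard, hnat])
    exact ⟨ω, by rw [hω, Multiset.coe_toList]⟩
  have hes : ∀ k, MvPolynomial.aeval ω (MvPolynomial.esymm (Fin D) ℂ k) = (-1) ^ k * c k := by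
    intro k
    rw [MvPolynomial.aeval_esymm_eq_multiset_esymm, hω]
    rcases le_or_gt k D with hk | hk
    · have h := coeff_eq_esymm_roots_of_card hcard (k := D - k) (by omega)
      rw [hcoeff _ (by omega), hmonic.leadingCoeff, hnat, Nat.sub_sub_self hk] at h
      rw [h, one_mul, ← mul_assoc, ← mul_pow]
      simp
    · rw [hc k hk, Multiset.esymm, Multiset.powersetCard_eq_empty]
      · simp
      · rw [hcard, hnat]; exact hk
  refine ⟨ω, fun n => ?_⟩
  induction n using Nat.strong_induction_on with
  | _ n ih =>
    intro hn
    have hN := congrArg (MvPolynomial.aeval ω) (MvPolynomial.mul_esymm_eq_sum (Fin D) ℂ n)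
    simp only [map_mul, map_sum, map_pow, map_neg, map_one, map_natCast, hes,
      MvPolynomial.psum, MvPolynomial.aeval_X] at hN
    have h2 : (n : ℂ) * c n
        = -∑ x ∈ Finset.HasAntidiagonal.antidiagonal n with x.1 < n, c x.1 * ∑ i, ω i ^ x.2 := by
      have h3 : ∀ x : ℕ × ℕ, (-1 : ℂ) ^ x.1 * ((-1) ^ x.1 * c x.1) * ∑ i, ω i ^ x.2
          = c x.1 * ∑ i, ω i ^ x.2 := by
        intro x
        rw [← mul_assoc, ← mul_pow]; simp
      simp only [h3] at hN
      have h4 : (-1 : ℂ) ^ n * (-1) ^ n = 1 := by rw [← mul_pow]; simp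
      linear_combination (-1 : ℂ) ^ n * hN + (-(n : ℂ) * c n
        - ∑ x ∈ Finset.HasAntidiagonal.antidiagonal n with x.1 < n, c x.1 * ∑ i, ω i ^ x.2) * h4
    rw [hrec n] at h2
    have hmem : ((0, n) : ℕ × ℕ) ∈ (Finset.HasAntidiagonal.antidiagonal n).filter fun x => x.1 < n := by
      simp; omega
    rw [← add_sum_erase _ _ hmem, ← add_sum_erase _ (fun x => c x.1 * ∑ i, ω i ^ x.2) hmem] at h2
    have h5 : ∑ x ∈ ((Finset.HasAntidiagonal.antidiagonal n).filter fun x => x.1 < n).erase (0, n), c x.1 * W x.2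
        = -∑ x ∈ ((Finset.HasAntidiagonal.antidiagonal n).filter fun x => x.1 < n).erase (0, n),
          c x.1 * ∑ i, ω i ^ x.2 := by
      rw [← sum_neg_distrib]
      refine sum_congr rfl fun x hx => ?_
      simp only [mem_erase, mem_filter, Finset.HasAntidiagonal.mem_antidiagonal, ne_eq] at hx
      have : x.1 ≠ 0 := fun h => hx.1 (Prod.ext h (by simp; omega))
      rw [ih x.2 (by omega) (by omega)]; ring
    simp only [hc0, one_mul] at h2
    linear_combination h2 - h5

open Finset Polynomial in
theorem norm_le_of_norm_powerSum_le {D : ℕ} (α : Fin D → ℂ) {B R : ℝ} (hR : 0 < R)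
    (h : ∀ k, 1 ≤ k → ‖∑ i, α i ^ k‖ ≤ B * R ^ k) (i₀ : Fin D) : ‖α i₀‖ ≤ R := by
  classical
  set L : ℂ[X] := ∏ β ∈ (univ.image α).erase (α i₀), (X - C β) with hL
  have hL0 : L.eval (α i₀) ≠ 0 := by
    rw [hL, eval_prod, prod_ne_zero_iff]
    intro β hβ
    simp only [eval_sub, eval_X, eval_C]
    exact sub_ne_zero.2 (mem_erase.1 hβ).1.symm
  have hL1 : ∀ i, α i ≠ α i₀ → L.eval (α i) = 0 := by
    intro i hi
    rw [hL, eval_prod]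
    exact prod_eq_zero (mem_erase.2 ⟨hi, mem_image_of_mem _ (mem_univ _)⟩) (by simp)
  set M : ℝ := ((univ.filter fun i => α i = α i₀).card : ℝ) * ‖L.eval (α i₀)‖ with hM
  have hMpos : 0 < M := by
    have : 0 < (univ.filter fun i => α i = α i₀).card := card_pos.2 ⟨i₀, by simp⟩
    have := norm_pos_iff.2 hL0
    positivity
  have key : ∀ k, 1 ≤ k → M * ‖α i₀‖ ^ k ≤ (∑ j ∈ L.support, ‖L.coeff j‖ * B * R ^ j) * R ^ k := by
    intro k hk
    have e1 : ∑ i, α i ^ k * L.eval (α i) = ∑ j ∈ L.support, L.coeff j * ∑ i, α i ^ (k + j) := by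
      simp only [eval_eq_sum, Polynomial.sum, mul_sum]
      rw [sum_comm]
      refine sum_congr rfl fun j _ => sum_congr rfl fun i _ => ?_
      ring
    have e2 : ∑ i, α i ^ k * L.eval (α i)
        = ((univ.filter fun i => α i = α i₀).card : ℂ) * (α i₀ ^ k * L.eval (α i₀)) := by
      rw [← sum_filter_add_sum_filter_not univ (fun i => α i = α i₀)]
      rw [sum_congr rfl (g := fun _ => α i₀ ^ k * L.eval (α i₀))
        (fun i hi => by rw [(mem_filter.1 hi).2]),
        sum_eq_zero (s := univ.filter fun i => ¬ α i = α i₀)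
        (fun i hi => by rw [hL1 i (mem_filter.1 hi).2, mul_zero])]
      simp
    calc M * ‖α i₀‖ ^ k = ‖∑ i, α i ^ k * L.eval (α i)‖ := by
          rw [e2]; simp [hM]; ring
      _ = ‖∑ j ∈ L.support, L.coeff j * ∑ i, α i ^ (k + j)‖ := by rw [e1]
      _ ≤ ∑ j ∈ L.support, ‖L.coeff j * ∑ i, α i ^ (k + j)‖ := norm_sum_le _ _
      _ ≤ ∑ j ∈ L.support, ‖L.coeff j‖ * (B * R ^ (k + j)) := by
          refine sum_le_sum fun j _ => ?_
          rw [norm_mul]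
          exact mul_le_mul_of_nonneg_left (h _ (by omega)) (norm_nonneg _)
      _ = _ := by
          rw [sum_mul]; refine sum_congr rfl fun j _ => ?_
          ring
  by_contra hlt
  push Not at hlt
  have hq : 1 < ‖α i₀‖ / R := (one_lt_div hR).2 hlt
  obtain ⟨k, hk⟩ := pow_unbounded_of_one_lt ((∑ j ∈ L.support, ‖L.coeff j‖ * B * R ^ j) / M) hq
  have hk' := key (k + 1) (by omega)
  have : ((∑ j ∈ L.support, ‖L.coeff j‖ * B * R ^ j) / M) < (‖α i₀‖ / R) ^ (k + 1) :=
    hk.trans_le (pow_le_pow_right₀ hq.le (by omega))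
  rw [div_pow, div_lt_div_iff₀ hMpos (by positivity)] at this
  linarith

theorem norm_le_of_recursion {c W : ℕ → ℂ} (hc0 : c 0 = 1)
    (hrec : ∀ n : ℕ, (n : ℂ) * c n
      = ∑ x ∈ Finset.HasAntidiagonal.antidiagonal n with x.1 < n, c x.1 * W x.2)
    {D : ℕ} (hc : ∀ d, D < d → c d = 0) {N : ℕ} (hN : 1 ≤ N) {B r : ℝ} (hr : 0 < r)
    (hB : ∀ k, 1 ≤ k → ‖W (N * k)‖ ≤ B * r ^ (N * k)) : ‖W 1‖ ≤ D * r := by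
  obtain ⟨ω, hω⟩ := exists_powerSums_of_recursion hc0 hrec hc
  have h1 : ∀ i, ‖ω i‖ ≤ r := by
    intro i
    have := norm_le_of_norm_powerSum_le (fun i => ω i ^ N) (B := B) (R := r ^ N) (by positivity)
      (fun k hk => by
        have h := hB k hk
        rw [hω _ (Nat.mul_pos hN hk), norm_neg] at h
        simpa only [pow_mul] using h) i
    rw [norm_pow] at this
    exact le_of_pow_le_pow_left₀ (by omega) hr.le this
  rw [hω 1 le_rfl, norm_neg]
  calc ‖∑ i, ω i ^ 1‖ ≤ ∑ i, ‖ω i ^ 1‖ := norm_sum_le _ _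
    _ ≤ ∑ _i : Fin D, r := Finset.sum_le_sum fun i _ => by simpa using h1 i
    _ = D * r := by simp

open PowerSeries in
theorem norm_sub_le_of_recursion {c W : ℕ → ℂ} (hc0 : c 0 = 1)
    (hrec : ∀ n : ℕ, (n : ℂ) * c n
      = ∑ x ∈ Finset.HasAntidiagonal.antidiagonal n with x.1 < n, c x.1 * W x.2)
    {D : ℕ} {a : ℂ} (hc : ∀ d, D ≤ d → c (d + 1) = a * c d) {N : ℕ} (hN : 1 ≤ N) {B r : ℝ}
    (hr : 0 < r)
    (hB : ∀ k, 1 ≤ k → ‖W (N * k) - a ^ (N * k)‖ ≤ B * r ^ (N * k)) : ‖W 1 - a‖ ≤ D * r := by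
  have key : ∀ c W : ℕ → ℂ, (∀ n : ℕ, (n : ℂ) * c n
      = ∑ x ∈ Finset.HasAntidiagonal.antidiagonal n with x.1 < n, c x.1 * W x.2) ↔
      X * derivative ℂ (PowerSeries.mk c)
        = PowerSeries.mk c * PowerSeries.mk (fun n => if n = 0 then 0 else W n) := by
    intro c W
    rw [PowerSeries.ext_iff]
    refine forall_congr' fun n => ?_
    have e1 : coeff n (X * derivative ℂ (PowerSeries.mk c)) = n * c n := by
      cases n with
      | zero => simp
      | succ n => rw [coeff_succ_X_mul, coeff_derivative]; simp [mul_comm]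
    rw [e1, coeff_mul]
    have e2 : ∑ x ∈ Finset.HasAntidiagonal.antidiagonal n with x.1 < n, c x.1 * W x.2
        = ∑ p ∈ Finset.HasAntidiagonal.antidiagonal n, coeff p.1 (PowerSeries.mk c) *
          coeff p.2 (PowerSeries.mk fun n => if n = 0 then 0 else W n) := by
      rw [Finset.sum_filter]
      refine Finset.sum_congr rfl fun x hx => ?_
      rw [Finset.HasAntidiagonal.mem_antidiagonal] at hx
      simp only [coeff_mk]
      by_cases h : x.2 = 0
      · rw [if_neg (by omega), if_pos h, mul_zero]
      · rw [if_pos (by omega), if_neg h]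
    rw [e2]
  set c' : ℕ → ℂ := fun n => if n = 0 then 1 else c n - a * c (n - 1) with hc'
  have hmk : PowerSeries.mk c' = PowerSeries.mk c * (1 - C a * X) := by
    ext n
    cases n with
    | zero => simp [hc', hc0, mul_sub, ← mul_assoc]
    | succ n =>
      rw [mul_sub, mul_one, ← mul_assoc, map_sub, coeff_succ_mul_X, mul_comm _ (C a),
        coeff_C_mul]
      simp [hc']
  set G : PowerSeries ℂ := PowerSeries.mk (fun n => if n = 0 then 0 else a ^ n) with hG
  have hGe : G * (1 - C a * X) = C a * X := by
    ext n
    cases n with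
    | zero => simp [hG, mul_sub, ← mul_assoc]
    | succ n =>
      rw [mul_sub, mul_one, ← mul_assoc, map_sub, coeff_succ_mul_X, mul_comm _ (C a),
        coeff_C_mul, coeff_succ_mul_X, coeff_C, hG, coeff_mk, coeff_mk]
      cases n with
      | zero => simp
      | succ n => simp; ring
  have hrec' := (key c' (fun n => W n - a ^ n)).2 (by
    have h := (key c W).1 hrec
    have e : PowerSeries.mk (fun n => if n = 0 then 0 else W n - a ^ n)
        = PowerSeries.mk (fun n => if n = 0 then 0 else W n) - G := by
      ext n
      by_cases hn : n = 0 <;> simp [hG, hn]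
    have hd : derivative ℂ (1 - C a * X) = - (C a) := by
      rw [map_sub, Derivation.leibniz]; simp
    rw [e, hmk, Derivation.leibniz, hd, smul_eq_mul, smul_eq_mul]
    linear_combination (1 - C a * X) * h + PowerSeries.mk c * hGe)
  have := norm_le_of_recursion (c := c') (W := fun n => W n - a ^ n) (by simp [hc']) hrec'
    (D := D) (fun d hd => by
      have := hc (d - 1) (by omega)
      rw [Nat.sub_add_cancel (by omega)] at this
      simp [hc', this]; omega) hN hr hB
  simpa using this

section

open Polynomial

namespace LaurentFamily

variable {k F A S : Type*} [Field k] [Field F] [Algebra k F] [CommRing A]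
    [Algebra k[X] A] [Fintype S] (L : LaurentFamily k F A S)
    [Algebra k A] [IsScalarTower k k[X] A]

theorem norm_of_lead_eq_one
    (hnorm : ∀ g, ((Algebra.norm k[X] g).map (algebraMap k F)).eval₂ HahnSeries.C L.x =
      ∏ s, L.ι s g)
    {m : ℕ} {g g' : A} (hg : g ∈ L.V m) (hg1 : L.lead m g = 1)
    {ω : S → F} (hω : ∀ s, ω s ≠ 0) (hω1 : ∏ s, ω s = 1) (σ : Equiv.Perm S)
    (hκ : ∀ s n, (L.ι s g').coeff n = ω s ^ n * (L.ι (σ s) g).coeff n) :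
    (Algebra.norm k[X] g').Monic ∧ (Algebra.norm k[X] g').natDegree = Fintype.card S * m ∧
      algebraMap k F (Algebra.norm k[X] g').nextCoeff =
        ∑ s, ω (σ.symm s) * L.lead ((m : ℤ) - 1) g s := by
  have hlead : ∀ s, (L.ι s g').coeff (-m) = ω s ^ (-m : ℤ) := by
    intro s
    rw [hκ, ← L.lead_apply, hg1, Pi.one_apply, mul_one]
  have hprod : ∏ s, (L.ι s g').coeff (-m) = 1 := by
    simp_rw [hlead, Finset.prod_zpow, hω1, one_zpow]
  obtain ⟨h1, h2, h3⟩ := PoleLe.prod Finset.univ (m := m) (f := fun s => L.ι s g')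
    (fun s _ n hn => by rw [hκ, hg _ n hn, mul_zero])
  rw [hprod] at h2 h3
  specialize h3 fun s _ => by rw [hlead]; exact zpow_ne_zero _ (hω s)
  rw [Finset.card_univ, ← hnorm] at h1 h2 h3
  have h4 := monic_of_eval₂_coeff (N := Fintype.card S * m) L.x_pole L.x_coeff L.x_coeff_zero
    (by exact_mod_cast h1) (by exact_mod_cast h2) rfl
  refine ⟨?_, ?_, ?_⟩
  · exact Polynomial.monic_of_injective (algebraMap k F).injective h4.1
  · rw [← h4.2.1, natDegree_map]
  · rw [← nextCoeff_map (algebraMap k F).injective, h4.2.2]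
    push_cast
    rw [h3, one_mul,
      ← Equiv.sum_comp σ fun s => ω (σ.symm s) * L.lead ((m : ℤ) - 1) g s]
    refine Finset.sum_congr rfl fun s _ => ?_
    rw [hlead, hκ, σ.symm_apply_apply, L.lead_apply, zpow_add₀ (hω s), zpow_one,
      show -((m : ℤ) - 1) = -m + 1 by ring]
    have := zpow_ne_zero (-m : ℤ) (hω s)
    field_simp

/-- The condition under which a ring automorphism acts on the expansions at infinity by permuting
them and rescaling the parameter. -/
def IsRotation (L : LaurentFamily k F A S) (κ : A ≃+* A) (ω : S → F) (σ : Equiv.Perm S) : Prop :=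
  ∀ s g n, (L.ι s (κ g)).coeff n = ω s ^ n * (L.ι (σ s) g).coeff n

variable [IsDedekindDomain A] [Module.Finite k[X] A] [Module.IsTorsionFree k[X] A]

theorem normPoly_map_of_isRotation
    (hnorm : ∀ g, ((Algebra.norm k[X] g).map (algebraMap k F)).eval₂ HahnSeries.C L.x =
      ∏ s, L.ι s g) {κ : A ≃+* A} {ω : S → F} {σ : Equiv.Perm S} (hκ : L.IsRotation κ ω σ)
    (hω : ∀ s, ω s ≠ 0) (hω1 : ∏ s, ω s = 1) (a b : k) {m : ℕ} {g : A} (hg : g ∈ L.V m)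
    (hg1 : L.lead m g = 1) :
    (normPoly (Ideal.span {g}) : k[X]).natDegree = Fintype.card S * m ∧
    algebraMap k F (a * (normPoly (Ideal.span {g}) : k[X]).nextCoeff +
      b * (normPoly ((Ideal.span {g}).map κ) : k[X]).nextCoeff) =
      ∑ s, (algebraMap k F a + algebraMap k F b * ω (σ.symm s)) * L.lead ((m : ℤ) - 1) g s := by
  obtain ⟨h1, h2, h3⟩ := L.norm_of_lead_eq_one hnorm hg hg1 (g' := g) (ω := 1)
    (fun _ => one_ne_zero) (by simp) 1 (fun s n => by simp)
  obtain ⟨g1, g2, g3⟩ := L.norm_of_lead_eq_one hnorm hg hg1 hω hω1 σ (hκ · g)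
  have hmap : (Ideal.span {g}).map κ = Ideal.span {κ g} := by
    rw [Ideal.map_span, Set.image_singleton]
  rw [hmap, normPoly_span h1 rfl, normPoly_span g1 rfl, map_add, map_mul, map_mul, h3, g3,
    Finset.mul_sum, Finset.mul_sum, ← Finset.sum_add_distrib]
  refine ⟨h2, Finset.sum_congr rfl fun s _ => ?_⟩
  simp only [Pi.one_apply]
  ring

theorem exists_linearMap
    (hnorm : ∀ g, ((Algebra.norm k[X] g).map (algebraMap k F)).eval₂ HahnSeries.C L.x =
      ∏ s, L.ι s g) {κ : A ≃+* A} {ω : S → F} {σ : Equiv.Perm S} (hκ : L.IsRotation κ ω σ)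
    (hω : ∀ s, ω s ≠ 0) (hω1 : ∏ s, ω s = 1) {a b : k}
    (hab : ∃ s, algebraMap k F a + algebraMap k F b * ω s ≠ 0) :
    ∃ θ : (S → F) →ₗ[k] k, (∃ v ∈ L.Λ, θ v ≠ 0) ∧
      ∀ (m : ℕ) (g : A), g ∈ L.V m → L.lead m g = 1 →
        θ (L.lead ((m : ℤ) - 1) g) = -(a * (normPoly (Ideal.span {g}) : k[X]).nextCoeff +
          b * (normPoly ((Ideal.span {g}).map κ) : k[X]).nextCoeff) := by
  obtain ⟨ρ, hρ⟩ := (Algebra.linearMap k F).exists_leftInverse_of_injective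
    (LinearMap.ker_eq_bot.2 (algebraMap k F).injective)
  have hρ' : ∀ c, ρ (algebraMap k F c) = c := fun c => LinearMap.congr_fun hρ c
  set c : S → F := fun s => algebraMap k F a + algebraMap k F b * ω (σ.symm s) with hc
  let ℓ : (S → F) →ₗ[k] F := ∑ s, (LinearMap.mulLeft k (c s)).comp (LinearMap.proj s)
  have hℓ : ∀ v, ℓ v = ∑ s, c s * v s := fun v => by simp [ℓ]
  have key : ∀ (m : ℕ) (g : A), g ∈ L.V m → L.lead m g = 1 →
      algebraMap k F (a * (normPoly (Ideal.span {g}) : k[X]).nextCoeff +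
        b * (normPoly ((Ideal.span {g}).map κ) : k[X]).nextCoeff) =
        ℓ (L.lead ((m : ℤ) - 1) g) := fun m g hg hg1 => by
    rw [hℓ, (L.normPoly_map_of_isRotation hnorm hκ hω hω1 a b hg hg1).2]
  refine ⟨-(ρ.comp ℓ), ?_, fun m g hg hg1 => ?_⟩
  · have hcne : c ≠ 0 := by
      obtain ⟨s, hs⟩ := hab
      intro h
      apply hs
      have := congrFun h (σ s)
      simpa [hc] using this
    obtain ⟨i, hi⟩ : ∃ i : Fin (Fintype.card S), ∑ s, c s * L.ζ s ^ (i : ℕ) ≠ 0 := by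
      by_contra! h
      exact hcne (L.vandermonde_dual h)
    obtain ⟨hy1, hy2⟩ := L.pow_mem_V i
    have hX : algebraMap k[X] A (X ^ ((i : ℕ) + 1)) ∈ L.V ((i : ℕ) + 1 : ℕ) ∧
        L.lead ((i : ℕ) + 1 : ℕ) (algebraMap k[X] A (X ^ ((i : ℕ) + 1))) = 1 := by
      have h := L.x_pole.pow ((i : ℕ) + 1)
      rw [mul_one, L.x_coeff, one_pow] at h
      have h5 : ∀ s, L.ι s (algebraMap k[X] A (X ^ ((i : ℕ) + 1))) = L.x ^ ((i : ℕ) + 1) := by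
        intro s; rw [L.ι_algebraMap]; simp
      constructor
      · intro s; rw [h5]; exact h.1
      · ext s; rw [L.lead_apply, h5]; exact h.2.1
    set g := algebraMap k[X] A (X ^ ((i : ℕ) + 1)) with hg
    have h1 := key _ g hX.1 hX.2
    have hlt : ((i : ℕ) : ℤ) < ((i : ℕ) + 1 : ℕ) := by push_cast; omega
    have h2 := key ((i : ℕ) + 1) (g + L.y ^ (i : ℕ))
      ((L.V _).add_mem hX.1 (L.V_mono hlt.le hy1))
      (by rw [map_add, hX.2, L.lead_eq_zero hlt hy1, add_zero])
    have h3 : ((((i : ℕ) + 1 : ℕ) : ℤ) - 1) = (i : ℕ) := by push_cast; ring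
    rw [h3] at h1 h2
    rw [map_add (L.lead _), map_add ℓ, ← h1, hy2, ← sub_eq_iff_eq_add', ← map_sub] at h2
    refine ⟨fun s => L.ζ s ^ (i : ℕ), Submodule.subset_span ⟨i, rfl⟩, ?_⟩
    rw [LinearMap.neg_apply, LinearMap.comp_apply, ← h2, hρ', neg_ne_zero]
    intro h0
    rw [h0, map_zero, hℓ] at h2
    exact hi h2.symm
  · rw [LinearMap.neg_apply, LinearMap.comp_apply, ← key m g hg hg1, hρ']

end LaurentFamily

end

section

open Polynomial

namespace Polynomial

variable {k A : Type*} [Field k] [Fintype k] [CommRing A] [IsDedekindDomain A] [Algebra k[X] A]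
    [Module.Finite k[X] A] [Module.IsTorsionFree k[X] A]

theorem finite_ideals (n : ℕ) :
    {I : Ideal A | I ≠ ⊥ ∧ (normPoly I : k[X]).natDegree ≤ n}.Finite := by
  have hfin : {G : k[X] | G.natDegree ≤ n ∧ G ≠ 0}.Finite := by
    refine Set.Finite.subset (s := {G : k[X] | G ∈ degreeLT k (n + 1)}) ?_ ?_
    · have : Finite (degreeLT k (n + 1)) := Finite.of_equiv _ (degreeLTEquiv k (n + 1)).symm.toEquiv
      exact Set.toFinite ((degreeLT k (n + 1) : Submodule k k[X]) : Set k[X])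
    · rintro G ⟨hG, -⟩
      exact mem_degreeLT.2 (degree_le_natDegree.trans_lt (by exact_mod_cast Nat.lt_succ_of_le hG))
  refine Set.Finite.subset (hfin.biUnion (t := fun G =>
    {I : Ideal A | I ∣ Ideal.span {algebraMap k[X] A G}}) fun G hG => ?_) ?_
  · have hne : Ideal.span {algebraMap k[X] A G} ≠ 0 := by
      rw [Ideal.zero_eq_bot, Ne, Ideal.span_singleton_eq_bot]
      exact (map_ne_zero_iff _ (FaithfulSMul.algebraMap_injective k[X] A)).2 hG.2
    have := UniqueFactorizationMonoid.fintypeSubtypeDvd _ hne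
    exact Set.finite_coe_iff.1 (Finite.of_fintype {I : Ideal A // I ∣ _})
  · rintro I ⟨hI, hn⟩
    rw [Set.mem_iUnion₂]
    refine ⟨normPoly I, ⟨hn, normPoly_ne_zero hI⟩, ?_⟩
    refine Ideal.dvd_iff_le.2 ?_
    rw [Ideal.span_singleton_le_iff_mem]
    apply Ideal.relNorm_le_comap k[X] I
    rw [← span_normPoly]
    exact Ideal.mem_span_singleton_self _

end Polynomial

namespace LaurentFamily

variable {k F A S : Type*} [Field k] [Field F] [Algebra k F] [CommRing A]
    [Algebra k[X] A] [Fintype S] (L : LaurentFamily k F A S)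
    [IsDedekindDomain A] [Module.Finite k[X] A] [Module.IsTorsionFree k[X] A]

/-- The character of the ideals of `A` attached to the function `a x + b κ(x)`. -/
noncomputable def idealChar (ψ : AddChar k ℂ) (κ : A ≃+* A) (a b : k) (I : Ideal A) : ℂ :=
  ψ (-(a * (normPoly I : k[X]).nextCoeff + b * (normPoly (I.map κ) : k[X]).nextCoeff))

theorem idealChar_mul (ψ : AddChar k ℂ) (κ : A ≃+* A) (a b : k) {I J : Ideal A} (hI : I ≠ ⊥)
    (hJ : J ≠ ⊥) : idealChar ψ κ a b (I * J) = idealChar ψ κ a b I * idealChar ψ κ a b J := by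
  have hmap : ∀ {I : Ideal A}, I ≠ ⊥ → I.map κ ≠ ⊥ := fun hI h =>
    hI ((Ideal.map_eq_bot_iff_of_injective κ.injective).1 h)
  rw [idealChar, idealChar, idealChar, ← AddChar.map_add_eq_mul, Ideal.map_mul,
    normPoly_mul hI hJ, normPoly_mul (hmap hI) (hmap hJ),
    (monic_normPoly hI).nextCoeff_mul (monic_normPoly hJ),
    (monic_normPoly (hmap hI)).nextCoeff_mul (monic_normPoly (hmap hJ))]
  congr 1
  ring

variable [Algebra k A] [IsScalarTower k k[X] A] [Fintype k] [Finite (ClassGroup A)] [Nonempty S]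

open Classical in
theorem norm_primeSum_le
    (hnorm : ∀ g, ((Algebra.norm k[X] g).map (algebraMap k F)).eval₂ HahnSeries.C L.x =
      ∏ s, L.ι s g) {κ : A ≃+* A} {ω : S → F} {σ : Equiv.Perm S} (hκ : L.IsRotation κ ω σ)
    (hω : ∀ s, ω s ≠ 0) (hω1 : ∏ s, ω s = 1) {a b : k}
    (hab : (a = 0 ∧ b = 0) ∨ ∃ s, algebraMap k F a + algebraMap k F b * ω s ≠ 0)
    (ψ : AddChar k ℂ) (hψ : ψ 1 ≠ 1) (T : ℕ → Finset (Ideal A))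
    (hT : ∀ n P, P ∈ T n ↔ P ≠ ⊥ ∧ P.IsPrime ∧ (normPoly P : k[X]).natDegree ≤ n) (W : ℕ → ℂ)
    (hW : ∀ n, 1 ≤ n → W n = ∑ P ∈ T n with (normPoly P : k[X]).natDegree ∣ n,
      ((normPoly P : k[X]).natDegree : ℂ) *
        idealChar ψ κ a b P ^ (n / (normPoly P : k[X]).natDegree))
    {N : ℕ} (hN : 1 ≤ N) {B r : ℝ} (hr : 0 < r)
    (hB : ∀ n, 1 ≤ n → ‖W (N * n) - if a = 0 ∧ b = 0 then (Fintype.card k : ℂ) ^ (N * n) else 0‖ ≤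
      B * r ^ (N * n)) :
    ‖W 1 - if a = 0 ∧ b = 0 then (Fintype.card k : ℂ) else 0‖ ≤ 2 * Fintype.card S ^ 2 * r ∨
      a = 0 ∧ b = 0 ∧ W 1 = 0 := by
  set deg : Ideal A → ℕ := fun I => (normPoly I : k[X]).natDegree with hdegdef
  have hmul : ∀ I J : Ideal A, I ≠ ⊥ → J ≠ ⊥ → deg (I * J) = deg I + deg J := fun I J hI hJ => by
    simp only [hdegdef]
    rw [normPoly_mul hI hJ, (monic_normPoly hI).natDegree_mul (monic_normPoly hJ)]
  have hfin : ∀ I : Ideal A, I ≠ ⊥ → FiniteDimensional k (A ⧸ I) := fun I hI =>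
    finiteDimensional_quotient hI
  have hdeg : ∀ I : Ideal A, I ≠ ⊥ → Module.finrank k (A ⧸ I) = deg I := fun I hI =>
    (natDegree_normPoly hI).symm
  have htop : ∀ I : Ideal A, I ≠ ⊥ → (deg I = 0 ↔ I = ⊤) := fun I hI => by
    have := hfin I hI
    rw [← hdeg I hI, Module.finrank_zero_iff, Ideal.Quotient.subsingleton_iff]
  have hpos : ∀ P : Ideal A, P ≠ ⊥ → P.IsPrime → 0 < deg P := fun P hP hP' =>
    Nat.pos_of_ne_zero fun h => hP'.ne_top ((htop P hP).1 h)
  have hDfin : ∀ n, {I : Ideal A | I ≠ ⊥ ∧ deg I = n}.Finite := fun n =>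
    (finite_ideals (k := k) n).subset fun I hI => ⟨hI.1, hI.2.le⟩
  set D : ℕ → Finset (Ideal A) := fun n => (hDfin n).toFinset with hDdef
  have hD : ∀ n I, I ∈ D n ↔ I ≠ ⊥ ∧ deg I = n := fun n I => by simp [hDdef]
  set χ := idealChar (A := A) ψ κ a b with hχdef
  have hχmul : ∀ I J : Ideal A, I ≠ ⊥ → J ≠ ⊥ → χ (I * J) = χ I * χ J := fun I J hI hJ =>
    idealChar_mul ψ κ a b hI hJ
  have hχ0 : ∀ I, χ I ≠ 0 := fun I => by
    rw [hχdef, idealChar]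
    intro h
    have h1 := ψ.map_add_eq_mul (-(a * (normPoly I : k[X]).nextCoeff +
      b * (normPoly (I.map κ) : k[X]).nextCoeff)) (a * (normPoly I : k[X]).nextCoeff +
      b * (normPoly (I.map κ) : k[X]).nextCoeff)
    rw [h, zero_mul, neg_add_cancel, AddChar.map_zero_eq_one] at h1
    exact one_ne_zero h1
  have hχ1 : χ ⊤ = 1 := by
    have := hχmul ⊤ ⊤ top_ne_bot top_ne_bot
    rw [← Ideal.one_eq_top, mul_one] at this
    rw [← Ideal.one_eq_top]
    exact (mul_eq_left₀ (hχ0 1)).1 this.symm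
  have hg : ∀ (m : ℕ) (g : A), g ∈ L.V m → L.lead m g = 1 →
      deg (Ideal.span {g}) = Fintype.card S * m := fun m g hg hg1 =>
    (L.normPoly_map_of_isRotation hnorm hκ hω hω1 a b hg hg1).1
  have hrec : ∀ n : ℕ, (n : ℂ) * ∑ I ∈ D n, χ I =
      ∑ x ∈ Finset.HasAntidiagonal.antidiagonal n with x.1 < n, (∑ I ∈ D x.1, χ I) * W x.2 := by
    intro n
    rw [ideal_sum_recursion deg hmul hpos D T hD hT χ hχmul hχ1 n]
    refine Finset.sum_congr rfl fun x hx => ?_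
    rw [Finset.mem_filter, Finset.HasAntidiagonal.mem_antidiagonal] at hx
    rw [hW x.2 (by omega)]
  have hc0 : ∑ I ∈ D 0, χ I = 1 := by
    have : D 0 = {⊤} := by
      ext I
      rw [hD, Finset.mem_singleton]
      constructor
      · rintro ⟨h1, h2⟩
        exact (htop I h1).1 h2
      · rintro rfl
        exact ⟨top_ne_bot, (htop ⊤ top_ne_bot).2 rfl⟩
    rw [this, Finset.sum_singleton, hχ1]
  by_cases h0 : a = 0 ∧ b = 0
  · simp only [h0, and_self, if_true, true_and] at hB ⊢
    by_cases hex : ∃ P : Ideal A, P ≠ ⊥ ∧ P.IsPrime ∧ deg P = 1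
    · left
      obtain ⟨P, hP, -, hP1⟩ := hex
      have hχone : ∀ I, χ I = 1 := fun I => by
        rw [hχdef, idealChar, h0.1, h0.2]; simp
      have hcard : ∀ n, ∑ I ∈ D n, χ I = (D n).card := fun n => by simp [hχone]
      have := norm_sub_le_of_recursion (c := fun n => ∑ I ∈ D n, χ I) hc0 hrec
        (D := 2 * Fintype.card S ^ 2) (a := Fintype.card k) (fun n hn => by
          simp only [hcard]
          exact L.card_ideals_succ deg hmul hfin hdeg D hD hg hP hP1 hn) hN hr hB
      exact_mod_cast this
    · right
      rw [hW 1 le_rfl]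
      apply Finset.sum_eq_zero
      intro P hP
      rw [Finset.mem_filter, hT] at hP
      exact absurd ⟨P, hP.1.1, hP.1.2.1, Nat.dvd_one.1 hP.2⟩ hex
  · left
    simp only [h0, if_false, sub_zero] at hB ⊢
    obtain ⟨θ, hθ, hθg⟩ := L.exists_linearMap hnorm hκ hω hω1 (hab.resolve_left h0)
    have := norm_le_of_recursion (c := fun n => ∑ I ∈ D n, χ I) hc0 hrec
        (D := 2 * Fintype.card S ^ 2) (fun n hn =>
          L.sum_ideals_eq_zero deg hmul hfin hdeg D hD hg χ hχmul hχ0 ψ hψ θ hθ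
            (fun m g hg hg1 => by rw [hθg m g hg hg1]; rfl) hn.le) hN hr hB
    exact_mod_cast this

end LaurentFamily

end

section

open Polynomial

section
variable {R : Type*} [CommRing R]

/-- The polynomial `(P Y - P X) / (Y - X)`. -/
noncomputable def diffQuot (P : R[X]) : R[X][X] := (P.map C - C P) /ₘ (X - C X)

theorem X_sub_mul_diffQuot (P : R[X]) : (X - C X) * diffQuot P = P.map C - C P := by
  refine mul_divByMonic_eq_iff_isRoot.2 ?_
  rw [IsRoot.def, eval_sub, eval_C, eval_map, eval₂_C_X, sub_self]

theorem monic_diffQuot {P : R[X]} (hP : P.Monic) (hd : 0 < P.natDegree) : (diffQuot P).Monic := by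
  refine (monic_X_sub_C (X : R[X])).of_mul_monic_left ?_
  rw [X_sub_mul_diffQuot]
  nontriviality R
  refine (hP.map C).sub_of_left ?_
  rw [degree_eq_natDegree ((hP.map C).ne_zero), natDegree_map_eq_of_injective C_injective]
  exact degree_C_le.trans_lt (by exact_mod_cast hd)

theorem natDegree_diffQuot [Nontrivial R] {P : R[X]} (hP : P.Monic) (hd : 0 < P.natDegree) :
    (diffQuot P).natDegree = P.natDegree - 1 := by
  have h := congrArg natDegree (X_sub_mul_diffQuot P)
  rw [(monic_X_sub_C _).natDegree_mul (monic_diffQuot hP hd), natDegree_X_sub_C,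
    natDegree_sub_C, natDegree_map_eq_of_injective C_injective] at h
  omega

theorem sub_mul_eval₂_diffQuot {M : Type*} [CommRing M] (P : R[X]) (φ : R[X] →+* M) (y : M) :
    (y - φ X) * (diffQuot P).eval₂ φ y = P.eval₂ (φ.comp C) y - P.eval₂ (φ.comp C) (φ X) := by
  have h := congrArg (fun Q => Q.eval₂ φ y) (X_sub_mul_diffQuot P)
  simp only [eval₂_mul, eval₂_sub, eval₂_X, eval₂_C, eval₂_map] at h
  rw [h]
  congr 1
  rw [← hom_eval₂, eval₂_C_X]
end

theorem irreducible_of_conjugate_roots {K M S : Type*} [Field K] [Field M] [Fintype S] [Nonempty S]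
    (γ : K →+* M) {μ : K[X]} {r : S → M} (hr : Function.Injective r)
    (hcard : μ.natDegree = Fintype.card S) (hroot : ∀ s, μ.eval₂ γ (r s) = 0)
    (hconj : ∀ (f : K[X]) (s s' : S), f.eval₂ γ (r s) = 0 → f.eval₂ γ (r s') = 0) :
    Irreducible μ := by
  have hpos : 0 < Fintype.card S := Fintype.card_pos
  have hμ : μ ≠ 0 := by
    rintro rfl
    rw [natDegree_zero] at hcard
    omega
  have key : ∀ f g : K[X], f * g = μ → ∀ s, f.eval₂ γ (r s) = 0 → IsUnit g := by
    intro f g hfg s hf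
    have hf0 : f ≠ 0 := left_ne_zero_of_mul (hfg ▸ hμ)
    have hg0 : g ≠ 0 := right_ne_zero_of_mul (hfg ▸ hμ)
    have hdeg : f.natDegree + g.natDegree = Fintype.card S := by
      rw [← natDegree_mul hf0 hg0, hfg, hcard]
    have h1 : Fintype.card S ≤ f.natDegree := by
      classical
      rw [← natDegree_map γ, ← Finset.card_univ, ← Finset.card_image_of_injective _ hr]
      refine (Finset.card_le_card (t := (f.map γ).roots.toFinset) fun z hz => ?_).trans
        ((Multiset.toFinset_card_le _).trans (card_roots' _))
      obtain ⟨s', -, rfl⟩ := Finset.mem_image.1 hz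
      rw [Multiset.mem_toFinset, mem_roots (p := f.map γ) ((Polynomial.map_ne_zero_iff γ.injective).2 hf0),
        IsRoot.def, eval_map]
      exact hconj f s s' hf
    exact isUnit_iff_degree_eq_zero.2 (by
      rw [degree_eq_natDegree hg0]
      exact_mod_cast (by omega : g.natDegree = 0))
  obtain ⟨s⟩ := ‹Nonempty S›
  refine ⟨fun hu => ?_, fun f g hfg => ?_⟩
  · rw [natDegree_eq_zero_of_isUnit hu] at hcard
    omega
  · have h := hroot s
    rw [hfg, eval₂_mul, mul_eq_zero] at h
    rcases h with h | h
    · exact Or.inr (key f g hfg.symm s h)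
    · exact Or.inl (key g f ((mul_comm g f).trans hfg.symm) s h)

theorem eval₂_conj_of_polynomial {k M : Type*} [Field k] [Field M] (γ : RatFunc k →+* M) {y y' : M}
    (h : ∀ R : k[X][X], R.eval₂ (γ.comp (algebraMap k[X] (RatFunc k))) y = 0 →
      R.eval₂ (γ.comp (algebraMap k[X] (RatFunc k))) y' = 0) (f : (RatFunc k)[X])
    (hf : f.eval₂ γ y = 0) : f.eval₂ γ y' = 0 := by
  obtain ⟨b, hbm, hb⟩ := IsLocalization.integerNormalization_spec (nonZeroDivisors k[X]) f
  have hb0 : γ (algebraMap k[X] (RatFunc k) b) ≠ 0 :=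
    (map_ne_zero γ).2 (IsLocalization.to_map_ne_zero_of_mem_nonZeroDivisors _ le_rfl hbm)
  have key : ∀ z, (IsLocalization.integerNormalization (nonZeroDivisors k[X]) f).eval₂
      (γ.comp (algebraMap k[X] (RatFunc k))) z = γ (algebraMap k[X] (RatFunc k) b) * f.eval₂ γ z := by
    intro z
    rw [← eval₂_map, hb, ← algebraMap_smul (RatFunc k) b f, eval₂_smul]
  have h1 := h _ ((key y).trans (by rw [hf, mul_zero]))
  rw [key] at h1
  exact (mul_eq_zero.1 h1).resolve_left hb0

end

section

open Polynomial

theorem map_norm_eq_prod {k K M S : Type*} [Field k] [Field K] [Algebra k K] [FiniteDimensional k K]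
    [Algebra.IsSeparable k K] [Field M] [Fintype S] (γ : k →+* M) (ι : S → K →+* M)
    (hι : ∀ s, (ι s).comp (algebraMap k K) = γ) (hinj : Function.Injective ι)
    (hcard : Module.finrank k K = Fintype.card S) (g : K) :
    γ (Algebra.norm k g) = ∏ s, ι s g := by
  set am := algebraMap M (AlgebraicClosure M)
  let _ : Algebra k (AlgebraicClosure M) := (am.comp γ).toAlgebra
  refine am.injective ?_
  have h1 := Algebra.norm_eq_prod_embeddings k (AlgebraicClosure M) g
  rw [map_prod]
  refine h1.trans (Eq.symm ?_)
  let e : S → (K →ₐ[k] AlgebraicClosure M) := fun s =>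
    { am.comp (ι s) with
      commutes' := fun r => congrArg am (RingHom.congr_fun (hι s) r) }
  have he : Function.Injective e := fun s s' h => hinj (RingHom.ext fun z =>
    am.injective (AlgHom.congr_fun h z))
  exact Fintype.prod_bijective e ((Fintype.bijective_iff_injective_and_card e).2
    ⟨he, by rw [AlgHom.card, hcard]⟩) _ _ fun s => rfl

section
variable {k F K S : Type*} [Field k] [Field F] [Algebra k F] [Field K] [Algebra k[X] K]
  [Algebra (RatFunc k) K] [IsScalarTower k[X] (RatFunc k) K]

variable (k K) in
theorem isTorsionFree_integralClosure : Module.IsTorsionFree k[X] (integralClosure k[X] K) := by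
  refine Module.isTorsionFree_iff_algebraMap_injective.2 fun r s h => ?_
  have h1 : algebraMap k[X] K r = algebraMap k[X] K s := congrArg Subtype.val h
  rw [IsScalarTower.algebraMap_apply k[X] (RatFunc k) K,
    IsScalarTower.algebraMap_apply k[X] (RatFunc k) K] at h1
  exact IsFractionRing.injective k[X] (RatFunc k) ((algebraMap (RatFunc k) K).injective h1)

variable [FiniteDimensional (RatFunc k) K] [Algebra.IsSeparable (RatFunc k) K] [Fintype S]

theorem map_norm_integralClosure {x : LaurentSeries F} (ι : S → K →+* LaurentSeries F)
    (hι : ∀ s (r : k[X]), ι s (algebraMap k[X] K r) = (r.map (algebraMap k F)).eval₂ HahnSeries.C x)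
    (hinj : Function.Injective ι) (hcard : Module.finrank (RatFunc k) K = Fintype.card S) [Nonempty S]
    (g : integralClosure k[X] K) :
    ((Algebra.norm k[X] g).map (algebraMap k F)).eval₂ HahnSeries.C x = ∏ s, ι s g := by
  have := IsIntegralClosure.finite k[X] (RatFunc k) K (integralClosure k[X] K)
  have := isTorsionFree_integralClosure k K
  have := IsIntegralClosure.isLocalization k[X] (RatFunc k) K (integralClosure k[X] K)
  obtain ⟨s₀⟩ := ‹Nonempty S›
  have h1 := map_norm_eq_prod ((ι s₀).comp (algebraMap (RatFunc k) K)) ι (fun s => by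
    refine IsLocalization.ringHom_ext (nonZeroDivisors k[X]) (RingHom.ext fun r => ?_)
    simp only [RingHom.comp_apply]
    rw [← IsScalarTower.algebraMap_apply, hι, hι]) hinj hcard (g : K)
  have h2 := Algebra.norm_localization k[X] (Rₘ := RatFunc k) (Sₘ := K) (nonZeroDivisors k[X]) g
  rw [← h1, RingHom.comp_apply]
  refine Eq.trans ?_ (congrArg (fun z => ι s₀ (algebraMap (RatFunc k) K z)) h2.symm)
  change _ = ι s₀ (algebraMap (RatFunc k) K (algebraMap k[X] (RatFunc k) _))
  rw [← IsScalarTower.algebraMap_apply, hι]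

/-- The Laurent family attached to a power basis of a function field. -/
noncomputable def laurentFamilyOfPowerBasis [Nonempty S] (x : LaurentSeries F) (hx : PoleLe 1 x)
    (hx1 : x.coeff (-1) = 1) (hx0 : x.coeff 0 = 0) (ι : S → K →+* LaurentSeries F)
    (hι : ∀ s (r : k[X]), ι s (algebraMap k[X] K r) = (r.map (algebraMap k F)).eval₂ HahnSeries.C x)
    (pb : PowerBasis (RatFunc k) K) (hpb : pb.dim = Fintype.card S)
    (hy : IsIntegral k[X] pb.gen) (hyp : ∀ s, PoleLe 1 (ι s pb.gen)) (ζ : S → F)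
    (hζ : Function.Injective ζ) (hyζ : ∀ s, (ι s pb.gen).coeff (-1) = ζ s) :
    LaurentFamily k F (integralClosure k[X] K) S where
  x := x
  x_pole := hx
  x_coeff := hx1
  x_coeff_zero := hx0
  ι s := (ι s).comp (algebraMap (integralClosure k[X] K) K)
  ι_algebraMap s r := hι s r
  y := ⟨pb.gen, hy⟩
  y_pole := hyp
  ζ := ζ
  ζ_injective := hζ
  y_coeff := hyζ
  exists_denominator g := by
    obtain ⟨b, hb⟩ := IsLocalization.exist_integer_multiples_of_finite (nonZeroDivisors k[X])
      fun i : Fin (Fintype.card S) => pb.basis.repr (g : K) (Fin.cast hpb.symm i)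
    choose r hr using hb
    refine ⟨b, nonZeroDivisors.ne_zero b.2, r, Subtype.ext ?_⟩
    have h1 := pb.basis.sum_repr (g : K)
    rw [← (finCongr hpb.symm).sum_comp] at h1
    change (b : k[X]) • (g : K) = _
    rw [AddSubmonoidClass.coe_finsetSum, ← h1, Finset.smul_sum]
    refine Finset.sum_congr rfl fun i _ => ?_
    rw [pb.basis_eq_pow, ← smul_assoc]
    change _ = r i • pb.gen ^ (i : ℕ)
    rw [← algebraMap_smul (RatFunc k) (r i), hr]
    rfl
  eq_zero_of_pole g hg := by
    have := IsIntegralClosure.finite k[X] (RatFunc k) K (integralClosure k[X] K)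
    have := isTorsionFree_integralClosure k K
    have hinj : Function.Injective ι := fun s s' h => hζ (by rw [← hyζ, ← hyζ, h])
    have h1 := map_norm_integralClosure ι hι hinj (by rw [pb.finrank, hpb]) g
    have h2 := (PoleLe.prod Finset.univ fun s _ => hg s).1
    have h3 : (Algebra.norm k[X] g).map (algebraMap k F) = 0 := by
      refine eq_zero_of_eval₂_poleLe hx hx1 hx0 ?_
      rw [h1]
      refine h2.mono ?_
      have : 1 ≤ (Finset.univ : Finset S).card := Finset.card_pos.2 Finset.univ_nonempty
      omega
    exact Algebra.norm_eq_zero_iff.1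
      ((Polynomial.map_eq_zero_iff (algebraMap k F).injective).1 h3)
end

end

section

open Polynomial

section
variable {k : Type*} [Field k] (P : k[X])

/-- The generic fibre of the projection of the curve `(P Y - P X) / (Y - X) = 0`. -/
noncomputable def curvePoly : (RatFunc k)[X] := (diffQuot P).map (algebraMap k[X] (RatFunc k))

/-- The function field of the curve `(P Y - P X) / (Y - X) = 0`. -/
abbrev CurveField : Type _ := AdjoinRoot (curvePoly P)

variable {P} [Fact (Irreducible (curvePoly P))]

theorem eval₂_diffQuot_root :
    (diffQuot P).eval₂ (algebraMap k[X] (CurveField P)) (AdjoinRoot.root (curvePoly P)) = 0 := by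
  have h := AdjoinRoot.eval₂_root (curvePoly P)
  rw [curvePoly, eval₂_map] at h
  exact h

theorem isIntegral_root (hP : P.Monic) (hd : 0 < P.natDegree) :
    IsIntegral k[X] (AdjoinRoot.root (curvePoly P)) :=
  ⟨diffQuot P, monic_diffQuot hP hd, eval₂_diffQuot_root⟩

theorem ringHom_ext_curveField {M : Type*} [Field M] {f g : CurveField P →+* M}
    (hC : ∀ c : k, f (algebraMap k[X] _ (C c)) = g (algebraMap k[X] _ (C c)))
    (hX : f (algebraMap k[X] _ X) = g (algebraMap k[X] _ X))
    (hy : f (AdjoinRoot.root _) = g (AdjoinRoot.root _)) : f = g := by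
  refine AdjoinRoot.ringHom_ext ?_ hy
  refine IsLocalization.ringHom_ext (nonZeroDivisors k[X]) ?_
  exact Polynomial.ringHom_ext hC hX

theorem exists_ringHom_curveField {M : Type*} [Field M] (φ : k[X] →+* M)
    (hφ : Function.Injective φ) {y : M} (hyx : y ≠ φ X)
    (hy : P.eval₂ (φ.comp C) y = P.eval₂ (φ.comp C) (φ X)) :
    ∃ f : CurveField P →+* M, (∀ r, f (algebraMap k[X] _ r) = φ r) ∧ f (AdjoinRoot.root _) = y := by
  have h1 : (diffQuot P).eval₂ φ y = 0 := by
    have := sub_mul_eval₂_diffQuot P φ y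
    rw [hy, sub_self, mul_eq_zero, sub_eq_zero] at this
    exact this.resolve_left hyx
  have hcomp : (IsFractionRing.lift (K := RatFunc k) hφ).comp (algebraMap k[X] (RatFunc k)) = φ :=
    RingHom.ext fun r => IsFractionRing.lift_algebraMap hφ r
  refine ⟨AdjoinRoot.lift (IsFractionRing.lift (K := RatFunc k) hφ) y (by
    rw [curvePoly, eval₂_map, hcomp, h1]), fun r => ?_, AdjoinRoot.lift_root _⟩
  rw [IsScalarTower.algebraMap_apply k[X] (RatFunc k) (CurveField P)]
  exact (AdjoinRoot.lift_of _).trans (IsFractionRing.lift_algebraMap hφ r)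

theorem exists_curveField_swap {M : Type*} [Field M] (f : CurveField P →+* M)
    (hf : Function.Injective (eval₂RingHom (f.comp (algebraMap k (CurveField P)))
      (f (AdjoinRoot.root _)))) (hne : f (AdjoinRoot.root _) ≠ f (algebraMap k[X] _ X)) :
    ∃ κ : CurveField P ≃+* CurveField P,
      (∀ c : k, κ (algebraMap k _ c) = algebraMap k _ c) ∧
      κ (algebraMap k[X] _ X) = AdjoinRoot.root _ ∧ κ (AdjoinRoot.root _) = algebraMap k[X] _ X := by
  set y : CurveField P := AdjoinRoot.root _ with hy
  have hC : ∀ c : k, algebraMap k[X] (CurveField P) (C c) = algebraMap k _ c := fun c => rfl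
  have hCr : (algebraMap k[X] (CurveField P)).comp C = algebraMap k _ := rfl
  have hyx : y ≠ algebraMap k[X] _ X := fun h => hne (congrArg f h)
  have hPy := sub_mul_eval₂_diffQuot P (algebraMap k[X] (CurveField P)) y
  rw [eval₂_diffQuot_root, mul_zero, eq_comm, sub_eq_zero, hCr] at hPy
  obtain ⟨κ, h1, h2⟩ := exists_ringHom_curveField (P := P) (eval₂RingHom (algebraMap k (CurveField P)) y)
    (fun r s h => hf (by
      have := congrArg f h
      simpa [hom_eval₂] using this)) (y := algebraMap k[X] _ X) (by simpa using hyx.symm) (by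
      have h3 : (eval₂RingHom (algebraMap k (CurveField P)) y).comp C = algebraMap k _ :=
        RingHom.ext fun c => by simp
      rw [h3, coe_eval₂RingHom, eval₂_X, hPy])
  have hκC : ∀ c : k, κ (algebraMap k _ c) = algebraMap k _ c := fun c =>
    (congrArg κ (hC c).symm).trans ((h1 _).trans (eval₂_C _ _))
  have hκX : κ (algebraMap k[X] _ X) = y := by
    rw [h1]
    simp
  have hκκ : κ.comp κ = RingHom.id _ := by
    refine ringHom_ext_curveField (fun c => ?_) ?_ ?_
    · simp [hC, hκC]
    · simp only [RingHom.comp_apply, RingHom.id_apply]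
      rw [hκX, h2]
    · simp only [RingHom.comp_apply, RingHom.id_apply]
      rw [h2, hκX]
  exact ⟨RingEquiv.ofRingHom κ κ hκκ hκκ, hκC, hκX, h2⟩
end

end

section

open Polynomial

theorem derivative_mul_mem_adjoin {R K L : Type*} [CommRing R] [IsDomain R] [IsIntegrallyClosed R]
    [Field K] [Field L] [Algebra R K] [IsFractionRing R K] [Algebra K L] [Algebra R L]
    [IsScalarTower R K L] [FiniteDimensional K L] [Algebra.IsSeparable K L] {y : L}
    (hy : Algebra.adjoin K {y} = ⊤) (hi : IsIntegral R y) {z : L} (hz : IsIntegral R z) :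
    ∃ Q : R[X], aeval y (derivative (minpoly K y)) * z = aeval y Q := by
  have hδ : aeval y (derivative (minpoly K y)) ≠ 0 :=
    (Algebra.IsSeparable.isSeparable K y).aeval_derivative_ne_zero (minpoly.aeval K y)
  have h1 : z ∈ (Algebra.traceForm K L).dualSubmodule (Subalgebra.toSubmodule (Algebra.adjoin R {y})) := by
    rw [LinearMap.BilinForm.mem_dualSubmodule]
    intro w hw
    rw [Algebra.traceForm_apply]
    have hw' : IsIntegral R w :=
      (adjoin_le_integralClosure hi : Algebra.adjoin R {y} ≤ integralClosure R L) hw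
    obtain ⟨r, hr⟩ := IsIntegrallyClosed.isIntegral_iff.1 (Algebra.isIntegral_trace (L := K) (hz.mul hw'))
    exact Submodule.mem_one.2 ⟨r, hr⟩
  rw [traceForm_dualSubmodule_adjoin R K hy hi] at h1
  obtain ⟨w, hw, hwz⟩ := h1
  rw [SetLike.mem_coe, Subalgebra.mem_toSubmodule, Algebra.adjoin_singleton_eq_range_aeval] at hw
  obtain ⟨Q, hQ⟩ := hw
  refine ⟨Q, ?_⟩
  rw [← hwz]
  change _ * (_ * w) = _
  rw [mul_inv_cancel_left₀ hδ]
  exact hQ.symm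

section
variable {k K : Type*} [Field k] [Field K] [Algebra k[X] K] [Algebra k K] [IsScalarTower k k[X] K]

theorem isIntegral_map_ringEquiv (κ : K →+* K) (hC : ∀ c : k, κ (algebraMap k K c) = algebraMap k K c)
    (hX : IsIntegral k[X] (κ (algebraMap k[X] K X))) {z : K} (hz : IsIntegral k[X] z) :
    IsIntegral k[X] (κ z) := by
  have h1 : IsIntegral (integralClosure k[X] K) (κ z) := by
    refine hz.map_of_comp_eq (eval₂RingHom (algebraMap k (integralClosure k[X] K))
      ⟨κ (algebraMap k[X] K X), hX⟩) κ ?_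
    refine Polynomial.ringHom_ext (fun c => ?_) ?_
    · simp only [RingHom.comp_apply, coe_eval₂RingHom, eval₂_C]
      exact (hC c).symm.trans (congrArg κ (IsScalarTower.algebraMap_apply k k[X] K c))
    · simp only [RingHom.comp_apply, coe_eval₂RingHom, eval₂_X]
      rfl
  exact isIntegral_trans _ h1

theorem exists_ringEquiv_integralClosure (κ : K ≃+* K)
    (hC : ∀ c : k, κ (algebraMap k K c) = algebraMap k K c) {y : K} (hy : IsIntegral k[X] y)
    (hX : κ (algebraMap k[X] K X) = y) (hyX : κ y = algebraMap k[X] K X) :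
    ∃ e : integralClosure k[X] K ≃+* integralClosure k[X] K, ∀ z, (e z : K) = κ z := by
  have hsX : κ.symm (algebraMap k[X] K X) = y := by rw [← hyX, κ.symm_apply_apply]
  have h1 : ∀ z : K, IsIntegral k[X] z → IsIntegral k[X] (κ z) := fun z =>
    isIntegral_map_ringEquiv (κ : K →+* K) hC (by
      change IsIntegral k[X] (κ _)
      rwa [hX])
  have h2 : ∀ z : K, IsIntegral k[X] z → IsIntegral k[X] (κ.symm z) := fun z =>
    isIntegral_map_ringEquiv (κ.symm : K →+* K) (fun c => by
      change κ.symm _ = _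
      rw [← hC c, κ.symm_apply_apply, hC]) (by
      change IsIntegral k[X] (κ.symm _)
      rwa [hsX])
  exact ⟨{ toFun := fun z => ⟨κ z, h1 z z.2⟩
           invFun := fun z => ⟨κ.symm z, h2 z z.2⟩
           left_inv := fun z => Subtype.ext (κ.symm_apply_apply _)
           right_inv := fun z => Subtype.ext (κ.apply_symm_apply _)
           map_mul' := fun z w => Subtype.ext (map_mul κ _ _)
           map_add' := fun z w => Subtype.ext (map_add κ _ _) }, fun z => rfl⟩
end

end

section

open Polynomial

/-- The data on the affine ring `A` of the curve `(P Y - P X) / (Y - X) = 0` over `k` which enter the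
estimation of its exponential sums. -/
structure SwapCurve {k : Type*} [Field k] (P : k[X]) (F A S : Type*) [Field F] [Algebra k F] [CommRing A]
    [Algebra k[X] A] [Fintype S] extends LaurentFamily k F A S where
  finrank_eq : Module.finrank k[X] A = Fintype.card S
  norm_eq : ∀ g : A, ((Algebra.norm k[X] g).map (algebraMap k F)).eval₂ HahnSeries.C x = ∏ s, ι s g
  κ : A ≃+* A
  κ_C : ∀ c : k, κ (algebraMap k[X] A (C c)) = algebraMap k[X] A (C c)
  κ_X : κ (algebraMap k[X] A X) = y
  κ_y : κ y = algebraMap k[X] A X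
  ω : S → F
  σ : Equiv.Perm S
  isRotation : toLaurentFamily.IsRotation κ ω σ
  ω_ne_zero : ∀ s, ω s ≠ 0
  prod_ω : ∏ s, ω s = 1
  exists_ω : ∀ a b : k, ¬(a = 0 ∧ b = 0) → ∃ s, algebraMap k F a + algebraMap k F b * ω s ≠ 0
  relation : (diffQuot P).eval₂ (algebraMap k[X] A) y = 0
  derivative_mul : ∀ z : A, ∃ Q : k[X][X],
    (derivative (diffQuot P)).eval₂ (algebraMap k[X] A) y * z = Q.eval₂ (algebraMap k[X] A) y

theorem AddChar.prod_neg_ne_zero {F : Type*} [Field F] {j : ℕ} [Fact j.Prime] (hj : j ≠ 2)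
    (χ : AddChar (ZMod j) F) : ∏ s : {s : ZMod j // s ≠ 0}, χ (-(s : ZMod j)) = 1 := by
  classical
  have h2 : (2 : ZMod j) ≠ 0 := by
    intro h
    have h3 : ((2 : ℕ) : ZMod j) = 0 := by exact_mod_cast h
    rw [ZMod.natCast_eq_zero_iff] at h3
    exact hj ((Nat.prime_dvd_prime_iff_eq Fact.out Nat.prime_two).1 h3)
  have h0 : ∑ s : ZMod j, s = 0 := by
    have h1 : ∑ s : ZMod j, s = ∑ s : ZMod j, -s := (Equiv.sum_comp (Equiv.neg (ZMod j)) fun s => s).symm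
    rw [Finset.sum_neg_distrib] at h1
    have h4 : 2 * ∑ s : ZMod j, s = 0 := by linear_combination h1
    exact (mul_eq_zero.1 h4).resolve_left h2
  have h3 : ∏ s : ZMod j, χ (-s) = 1 := by
    have h4 : ∀ T : Finset (ZMod j), ∏ s ∈ T, χ (-s) = χ (∑ s ∈ T, -s) := by
      intro T
      induction T using Finset.induction_on with
      | empty => simp
      | insert a T ha ih => rw [Finset.prod_insert ha, Finset.sum_insert ha, χ.map_add_eq_mul, ih]
    rw [h4, Finset.sum_neg_distrib, h0]
    simp
  rw [Fintype.prod_eq_mul_prod_subtype_ne (fun s : ZMod j => χ (-s)) 0] at h3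
  simpa using h3

section
variable {k F : Type*} [Field k] [Field F] [Algebra k F] {P : k[X]} {j : ℕ} [Fact j.Prime]

theorem exists_ringHom_ratFunc {M : Type*} [Field M] {φ : k[X] →+* M} (hφ : Function.Injective φ) :
    ∃ γ : RatFunc k →+* M, γ.comp (algebraMap k[X] (RatFunc k)) = φ :=
  ⟨IsFractionRing.lift hφ, RingHom.ext fun r => IsFractionRing.lift_algebraMap hφ r⟩

theorem irreducible_curvePoly (hPm : P.Monic) (hPd : P.natDegree = j) (hj : 2 < j)
    {χ : AddChar (ZMod j) F} (hχ : Function.Injective χ) {x : LaurentSeries F}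
    (hx : (P.map (algebraMap k F)).eval₂ HahnSeries.C x = HahnSeries.single (-j : ℤ) 1)
    (hx1 : x.coeff (-1) = 1) {φ : k[X] →+* LaurentSeries F} (hφ : Function.Injective φ)
    (hφC : φ.comp C = (HahnSeries.C (Γ := ℤ)).comp (algebraMap k F)) (hφX : φ X = x)
    (hR : ∀ (R : F[X][X]) (s s' : ZMod j), s ≠ 0 → s' ≠ 0 →
        R.eval₂ (eval₂RingHom HahnSeries.C x) (laurentRot χ s x) = 0 →
        R.eval₂ (eval₂RingHom HahnSeries.C x) (laurentRot χ s' x) = 0) :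
    Irreducible (curvePoly P) := by
  obtain ⟨γ, hγφ⟩ : ∃ γ : RatFunc k →+* LaurentSeries F,
      γ.comp (algebraMap k[X] (RatFunc k)) = φ := exists_ringHom_ratFunc hφ
  have hinj := laurentRot_injective_of_coeff χ hχ hx1
  have h0 : laurentRot χ 0 x = x := by
    ext n
    simp [coeff_laurentRot]
  have hPF : ∀ z : LaurentSeries F,
      P.eval₂ (φ.comp C) z = (P.map (algebraMap k F)).eval₂ HahnSeries.C z := by
    intro z
    rw [eval₂_map, hφC]
  have hcard : Fintype.card {s : ZMod j // s ≠ 0} = j - 1 := by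
    rw [Fintype.card_subtype_compl, ZMod.card, Fintype.card_subtype_eq]
  have : Nonempty {s : ZMod j // s ≠ 0} := Fintype.card_pos_iff.1 (by omega)
  refine irreducible_of_conjugate_roots γ (S := {s : ZMod j // s ≠ 0})
    (r := fun s => laurentRot χ s x) (fun s s' hs => Subtype.ext (hinj hs)) ?_ (fun s => ?_)
    (fun f s s' hs => ?_)
  · rw [curvePoly, (monic_diffQuot hPm (by omega)).natDegree_map, natDegree_diffQuot hPm (by omega), hPd,
      hcard]
  · have h1 := sub_mul_eval₂_diffQuot P φ (laurentRot χ s x)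
    rw [hφX, hPF, hPF, eval₂_laurentRot χ (s : ZMod j) _ hx, hx, sub_self, mul_eq_zero, sub_eq_zero] at h1
    rw [curvePoly, eval₂_map, hγφ]
    refine h1.resolve_left fun h3 => s.2 (hinj (h3.trans h0.symm))
  · refine eval₂_conj_of_polynomial γ (fun R hRs => ?_) f hs
    rw [hγφ] at hRs ⊢
    have h3 : (eval₂RingHom (HahnSeries.C (Γ := ℤ)) x).comp (mapRingHom (algebraMap k F)) = φ := by
      refine Polynomial.ringHom_ext (fun c => ?_) ?_
      · simpa using (RingHom.congr_fun hφC c).symm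
      · simpa using hφX.symm
    rw [← h3, ← eval₂_map] at hRs ⊢
    exact hR _ s s' s.2 s'.2 hRs
end

end

section

open Polynomial

section
variable {k : Type*} [Field k] {P : k[X]}

theorem monic_curvePoly (hP : P.Monic) (hd : 0 < P.natDegree) : (curvePoly P).Monic :=
  (monic_diffQuot hP hd).map _

theorem natDegree_curvePoly (hP : P.Monic) (hd : 0 < P.natDegree) :
    (curvePoly P).natDegree = P.natDegree - 1 := by
  rw [curvePoly, (monic_diffQuot hP hd).natDegree_map, natDegree_diffQuot hP hd]

variable [Fact (Irreducible (curvePoly P))]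

theorem finiteDimensional_curveField : FiniteDimensional (RatFunc k) (CurveField P) :=
  (AdjoinRoot.powerBasis (Fact.out : Irreducible (curvePoly P)).ne_zero).finite

theorem isSeparable_curveField (hP : P.Monic) (hd : 1 < P.natDegree)
    (hd1 : ((P.natDegree - 1 : ℕ) : k) ≠ 0) : Algebra.IsSeparable (RatFunc k) (CurveField P) := by
  have h1 : (minpoly (RatFunc k) (AdjoinRoot.root (curvePoly P))).Separable := by
    rw [AdjoinRoot.minpoly_root (Fact.out : Irreducible (curvePoly P)).ne_zero,
      (monic_curvePoly hP (by omega)).leadingCoeff, inv_one, C_1, mul_one,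
      separable_iff_derivative_ne_zero Fact.out]
    intro h
    have h2 := congrArg (fun f => f.coeff (P.natDegree - 2)) h
    have h3 : P.natDegree - 2 + 1 = (curvePoly P).natDegree := by
      rw [natDegree_curvePoly hP (by omega)]
      omega
    simp only [coeff_derivative, coeff_zero] at h2
    rw [h3, (monic_curvePoly hP (by omega)).coeff_natDegree, one_mul] at h2
    refine hd1 ((algebraMap k (RatFunc k)).injective ?_)
    rw [map_zero, map_natCast, ← h2, show P.natDegree - 1 = P.natDegree - 2 + 1 by omega]
    push_cast
    ring
  have h2 := (IntermediateField.isSeparable_adjoin_simple_iff_isSeparable _ _).2 h1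
  rw [IntermediateField.adjoin_root_eq_top] at h2
  exact AlgEquiv.Algebra.isSeparable IntermediateField.topEquiv

theorem exists_derivative_mul_curveField (hP : P.Monic) (hd : 1 < P.natDegree)
    [Algebra.IsSeparable (RatFunc k) (CurveField P)] {z : CurveField P} (hz : IsIntegral k[X] z) :
    ∃ Q : k[X][X],
      (derivative (diffQuot P)).eval₂ (algebraMap k[X] (CurveField P)) (AdjoinRoot.root _) * z =
        Q.eval₂ (algebraMap k[X] (CurveField P)) (AdjoinRoot.root _) := by
  have := finiteDimensional_curveField (P := P)
  obtain ⟨Q, hQ⟩ := derivative_mul_mem_adjoin (R := k[X]) (K := RatFunc k) AdjoinRoot.adjoinRoot_eq_top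
    (isIntegral_root hP (by omega)) hz
  refine ⟨Q, Eq.trans ?_ hQ⟩
  rw [AdjoinRoot.minpoly_root (Fact.out : Irreducible (curvePoly P)).ne_zero,
    (monic_curvePoly hP (by omega)).leadingCoeff, inv_one, C_1, mul_one]
  have h1 : derivative (curvePoly P) = (derivative (diffQuot P)).map (algebraMap k[X] (RatFunc k)) :=
    derivative_map _ _
  rw [h1, aeval_map_algebraMap]
  rfl

end

end

section

open Polynomial

section
variable {k F : Type*} [Field k] [Field F] [Algebra k F] {P : k[X]} {j : ℕ} [Fact j.Prime]

theorem exists_laurent_embeddings [Fact (Irreducible (curvePoly P))]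
    {χ : AddChar (ZMod j) F} (hχ : Function.Injective χ) {x : LaurentSeries F}
    (hx : (P.map (algebraMap k F)).eval₂ HahnSeries.C x = HahnSeries.single (-j : ℤ) 1)
    (hx1 : x.coeff (-1) = 1) {φ : k[X] →+* LaurentSeries F} (hφ : Function.Injective φ)
    (hφC : φ.comp C = (HahnSeries.C (Γ := ℤ)).comp (algebraMap k F)) (hφX : φ X = x) :
    ∃ ι : {s : ZMod j // s ≠ 0} → CurveField P →+* LaurentSeries F,
      (∀ s r, ι s (algebraMap k[X] _ r) = φ r) ∧
      ∀ s, ι s (AdjoinRoot.root _) = laurentRot χ s x := by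
  have hinj := laurentRot_injective_of_coeff χ hχ hx1
  have h0 : laurentRot χ 0 x = x := by
    ext n
    simp [coeff_laurentRot]
  have hPF : ∀ z : LaurentSeries F,
      P.eval₂ (φ.comp C) z = (P.map (algebraMap k F)).eval₂ HahnSeries.C z := by
    intro z
    rw [eval₂_map, hφC]
  have h : ∀ s : {s : ZMod j // s ≠ 0}, ∃ f : CurveField P →+* LaurentSeries F,
      (∀ r, f (algebraMap k[X] _ r) = φ r) ∧ f (AdjoinRoot.root _) = laurentRot χ s x := by
    intro s
    refine exists_ringHom_curveField φ hφ ?_ ?_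
    · rw [hφX]
      exact fun h => s.2 (hinj (h.trans h0.symm))
    · rw [hφX, hPF, hPF, eval₂_laurentRot χ (s : ZMod j) _ hx, hx]
  choose ι h1 h2 using h
  exact ⟨ι, h1, h2⟩

theorem exists_swap_of_laurent_embeddings [Fact (Irreducible (curvePoly P))] (hj : 2 < j)
    {χ : AddChar (ZMod j) F} (hχ : Function.Injective χ) {x : LaurentSeries F}
    (hx1 : x.coeff (-1) = 1) {φ : k[X] →+* LaurentSeries F} (hφ : Function.Injective φ)
    (hφC : φ.comp C = (HahnSeries.C (Γ := ℤ)).comp (algebraMap k F)) (hφX : φ X = x)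
    {ι : {s : ZMod j // s ≠ 0} → CurveField P →+* LaurentSeries F}
    (hι : ∀ s r, ι s (algebraMap k[X] _ r) = φ r)
    (hιy : ∀ s, ι s (AdjoinRoot.root _) = laurentRot χ s x) :
    ∃ κ : CurveField P ≃+* CurveField P,
      (∀ c : k, κ (algebraMap k _ c) = algebraMap k _ c) ∧
      κ (algebraMap k[X] _ X) = AdjoinRoot.root _ ∧ κ (AdjoinRoot.root _) = algebraMap k[X] _ X := by
  have hinj := laurentRot_injective_of_coeff χ hχ hx1
  have h0 : laurentRot χ 0 x = x := by
    ext n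
    simp [coeff_laurentRot]
  have : Fact (1 < j) := ⟨by omega⟩
  obtain ⟨s⟩ : Nonempty {s : ZMod j // s ≠ 0} := ⟨⟨1, one_ne_zero⟩⟩
  refine exists_curveField_swap (ι s) ?_ ?_
  · have h1 : eval₂RingHom ((ι s).comp (algebraMap k (CurveField P))) (ι s (AdjoinRoot.root _)) =
        (laurentRot χ (s : ZMod j)).comp φ := by
      refine Polynomial.ringHom_ext (fun c => ?_) ?_
      · have h2 : ι s (algebraMap k (CurveField P) c) = φ (C c) := hι s (C c)
        have h3 := RingHom.congr_fun hφC c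
        simp only [RingHom.comp_apply] at h3
        simp only [coe_eval₂RingHom, eval₂_C, RingHom.comp_apply]
        rw [h2, h3, laurentRot_C]
      · simp only [coe_eval₂RingHom, eval₂_X, RingHom.comp_apply]
        rw [hιy, hφX]
    rw [h1]
    exact (laurentRot χ (s : ZMod j)).injective.comp hφ
  · rw [hι, hφX, hιy]
    exact fun h => s.2 (hinj (h.trans h0.symm))

theorem laurentRot_comp_embedding [Fact (Irreducible (curvePoly P))]
    {χ : AddChar (ZMod j) F} {x : LaurentSeries F}
    {φ : k[X] →+* LaurentSeries F}
    (hφC : φ.comp C = (HahnSeries.C (Γ := ℤ)).comp (algebraMap k F)) (hφX : φ X = x)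
    {ι : {s : ZMod j // s ≠ 0} → CurveField P →+* LaurentSeries F}
    (hι : ∀ s r, ι s (algebraMap k[X] _ r) = φ r)
    (hιy : ∀ s, ι s (AdjoinRoot.root _) = laurentRot χ s x)
    {κ : CurveField P ≃+* CurveField P}
    (hκ : ∀ c : k, κ (algebraMap k _ c) = algebraMap k _ c)
    (hκX : κ (algebraMap k[X] _ X) = AdjoinRoot.root _)
    (hκy : κ (AdjoinRoot.root _) = algebraMap k[X] _ X)
    (s s' : {s : ZMod j // s ≠ 0}) (hs : (s' : ZMod j) = -s) (g : CurveField P) :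
    ι s (κ g) = laurentRot χ (s : ZMod j) (ι s' g) := by
  have h0 : laurentRot χ 0 x = x := by
    ext n
    simp [coeff_laurentRot]
  have h1 : (ι s).comp (κ : CurveField P →+* CurveField P) = (laurentRot χ (s : ZMod j)).comp (ι s') := by
    refine ringHom_ext_curveField (fun c => ?_) ?_ ?_
    · have h2 : κ (algebraMap k[X] (CurveField P) (C c)) = algebraMap k[X] (CurveField P) (C c) := hκ c
      have h3 := RingHom.congr_fun hφC c
      simp only [RingHom.comp_apply] at h3
      simp only [RingHom.comp_apply, RingHom.coe_coe]
      rw [h2, hι, hι, h3, laurentRot_C]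
    · simp only [RingHom.comp_apply, RingHom.coe_coe]
      rw [hκX, hιy, hι, hφX]
    · simp only [RingHom.comp_apply, RingHom.coe_coe]
      rw [hκy, hιy, hι, hφX, laurentRot_laurentRot, hs, add_neg_cancel, h0]
  exact RingHom.congr_fun h1 g

theorem exists_swapCurve [Fact (Irreducible (curvePoly P))] (hPm : P.Monic) (hPd : P.natDegree = j)
    (hj : 2 < j) (hjk : ((j - 1 : ℕ) : k) ≠ 0)
    {χ : AddChar (ZMod j) F} (hχ : Function.Injective χ) {x : LaurentSeries F}
    (hx : (P.map (algebraMap k F)).eval₂ HahnSeries.C x = HahnSeries.single (-j : ℤ) 1)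
    (hx1 : x.coeff (-1) = 1) (hx0 : x.coeff 0 = 0) (hxp : PoleLe 1 x)
    {φ : k[X] →+* LaurentSeries F} (hφ : Function.Injective φ)
    (hφC : φ.comp C = (HahnSeries.C (Γ := ℤ)).comp (algebraMap k F)) (hφX : φ X = x) :
    Nonempty (SwapCurve P F (integralClosure k[X] (CurveField P)) {s : ZMod j // s ≠ 0}) := by
  have := isSeparable_curveField hPm (by omega) (by rwa [hPd])
  have := finiteDimensional_curveField (P := P)
  have : Fact (1 < j) := ⟨by omega⟩
  have : Nonempty {s : ZMod j // s ≠ 0} := ⟨⟨1, one_ne_zero⟩⟩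
  obtain ⟨ι, hι, hιy⟩ := exists_laurent_embeddings hχ hx hx1 hφ hφC hφX
  obtain ⟨κ, hκ, hκX, hκy⟩ := exists_swap_of_laurent_embeddings hj hχ hx1 hφ hφC hφX hι hιy
  have hrot := fun s s' hs g => laurentRot_comp_embedding hφC hφX hι hιy hκ hκX hκy s s' hs g
  obtain ⟨e, he⟩ := exists_ringEquiv_integralClosure κ hκ
    (isIntegral_root hPm (by omega)) hκX hκy
  have hφr : ∀ r, φ r = (r.map (algebraMap k F)).eval₂ HahnSeries.C x := by
    intro r
    rw [eval₂_map, ← hφC, ← hφX]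
    exact (RingHom.congr_fun (Polynomial.ringHom_ext (f := φ) (g := eval₂RingHom (φ.comp C) (φ X))
      (fun c => by simp) (by simp)) r)
  have hcard : Fintype.card {s : ZMod j // s ≠ 0} = j - 1 := by
    rw [Fintype.card_subtype_compl, ZMod.card, Fintype.card_subtype_eq]
  let pb := AdjoinRoot.powerBasis (Fact.out : Irreducible (curvePoly P)).ne_zero
  have hιr : ∀ s r, ι s (algebraMap k[X] _ r) = (r.map (algebraMap k F)).eval₂ HahnSeries.C x :=
    fun s r => (hι s r).trans (hφr r)
  have hζ : ∀ s, (ι s (AdjoinRoot.root _)).coeff (-1) = χ (s : ZMod j) := by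
    intro s
    rw [hιy, coeff_neg_one_laurentRot, hx1, mul_one]
  have hιinj : Function.Injective ι := fun s s' h => Subtype.ext (hχ (by rw [← hζ, ← hζ, h]))
  have hpb : pb.dim = Fintype.card {s : ZMod j // s ≠ 0} := by
    rw [hcard, ← hPd, ← natDegree_curvePoly hPm (by omega)]
    exact AdjoinRoot.powerBasis_dim _
  let L : LaurentFamily k F (integralClosure k[X] (CurveField P)) {s : ZMod j // s ≠ 0} :=
    laurentFamilyOfPowerBasis x hxp hx1 hx0 ι hιr pb hpb
    (isIntegral_root hPm (by omega)) (fun s => by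
      change PoleLe 1 (ι s (AdjoinRoot.root _))
      rw [hιy]
      intro n hn
      rw [coeff_laurentRot, hxp n hn, mul_zero]) (fun s => χ (s : ZMod j))
      (fun s s' h => Subtype.ext (hχ h)) hζ
  have hval : ∀ R : k[X][X], ((R.eval₂ (algebraMap k[X] (integralClosure k[X] (CurveField P))) L.y :
      integralClosure k[X] (CurveField P)) : CurveField P) =
      R.eval₂ (algebraMap k[X] (CurveField P)) (AdjoinRoot.root _) := fun R =>
    hom_eval₂ R _ (algebraMap (integralClosure k[X] (CurveField P)) (CurveField P)) L.y
  refine ⟨{ L with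
    finrank_eq := by
      have : Module.IsTorsionFree k[X] (CurveField P) :=
        Module.isTorsionFree_iff_algebraMap_injective.2 (by
          rw [IsScalarTower.algebraMap_eq k[X] (RatFunc k) (CurveField P)]
          exact (algebraMap (RatFunc k) (CurveField P)).injective.comp
            (IsFractionRing.injective k[X] (RatFunc k)))
      rw [IsIntegralClosure.rank k[X] (RatFunc k) (CurveField P), pb.finrank, hpb]
    norm_eq := map_norm_integralClosure ι hιr hιinj (by rw [pb.finrank, hpb])
    κ := e
    κ_C := fun c => Subtype.ext ((he _).trans (hκ c))
    κ_X := Subtype.ext ((he _).trans hκX)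
    κ_y := Subtype.ext ((he _).trans hκy)
    ω := fun s => χ (-(s : ZMod j))
    σ := (Equiv.neg (ZMod j)).subtypeEquiv fun s => by simp
    isRotation := fun s g n => ?_
    ω_ne_zero := fun s => AddChar.zmod_apply_ne_zero χ _
    prod_ω := AddChar.prod_neg_ne_zero (by omega) χ
    exists_ω := fun a b hab => ?_
    relation := Subtype.ext ?_
    derivative_mul := fun z => ?_ }⟩
  · change (ι s (e g : CurveField P)).coeff n = _ * (ι _ (g : CurveField P)).coeff n
    rw [he, hrot s ((Equiv.neg (ZMod j)).subtypeEquiv (fun s => by simp) s) rfl, coeff_laurentRot]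
  · by_contra! h
    have h2 : (2 : ZMod j) ≠ 0 := by
      intro h
      have h3 : ((2 : ℕ) : ZMod j) = 0 := by exact_mod_cast h
      rw [ZMod.natCast_eq_zero_iff] at h3
      exact absurd (Nat.le_of_dvd two_pos h3) (by omega)
    have h3 := h ⟨1, one_ne_zero⟩
    have h4 := h ⟨2, h2⟩
    have h5 : algebraMap k F b * (χ (-1) - χ (-2)) = 0 := by linear_combination h3 - h4
    rw [mul_eq_zero, sub_eq_zero, map_eq_zero] at h5
    have hb : b = 0 := h5.resolve_right fun h6 => by
      have h7 := hχ h6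
      rw [neg_inj] at h7
      exact one_ne_zero (by linear_combination -h7 : (1 : ZMod j) = 0)
    rw [hb, map_zero, zero_mul, add_zero, map_eq_zero] at h3
    exact hab ⟨h3, hb⟩
  · exact (hval _).trans eval₂_diffQuot_root
  · obtain ⟨Q, hQ⟩ := exists_derivative_mul_curveField hPm (by omega) z.2
    refine ⟨Q, Subtype.ext (Eq.trans ?_ (hQ.trans (hval _).symm))⟩
    exact congrArg (· * (z : CurveField P)) (hval _)
end

end

section

open Polynomial

section
variable {R A F : Type*} [CommRing R] [CommRing A] [Field F] {e : R →+* A} {δ : R}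

theorem exists_ringHom_of_denominator {e₀ : R →+* F} (hker : ∀ r, e r = 0 → e₀ r = 0)
    (hδ : e₀ δ ≠ 0) (h : ∀ z, ∃ Q, e δ * z = e Q) : ∃ θ : A →+* F, ∀ r, θ (e r) = e₀ r := by
  choose Q hQ using h
  have hker' : ∀ r s, e r = e s → e₀ r = e₀ s := fun r s hrs => by
    rw [← sub_eq_zero, ← map_sub]
    exact hker _ (by rw [map_sub, hrs, sub_self])
  have hθ : ∀ z r, e δ * z = e r → e₀ (Q z) / e₀ δ = e₀ r / e₀ δ := fun z r hr => by
    rw [hker' (Q z) r (by rw [← hQ, hr])]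
  have hθe : ∀ r, e₀ (Q (e r)) / e₀ δ = e₀ r := fun r => by
    rw [hθ _ (δ * r) (by rw [map_mul]), map_mul, mul_div_cancel_left₀ _ hδ]
  exact ⟨{ toFun := fun z => e₀ (Q z) / e₀ δ
           map_zero' := by simpa using hθe 0
           map_one' := by simpa using hθe 1
           map_add' := fun z w => by
            rw [hθ (z + w) (Q z + Q w) (by rw [map_add, ← hQ, ← hQ, mul_add]), map_add, add_div]
           map_mul' := fun z w => by
            have h1 : e₀ (δ * Q (z * w)) = e₀ (Q z * Q w) := hker' _ _ (by
              rw [map_mul, map_mul, ← hQ, ← hQ, ← hQ]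
              ring)
            rw [map_mul, map_mul] at h1
            rw [div_mul_div_comm, ← h1, mul_div_mul_left _ _ hδ] }, hθe⟩

theorem ringHom_ext_of_denominator {θ θ' : A →+* F} (hδ : θ (e δ) ≠ 0)
    (h : ∀ z, ∃ Q, e δ * z = e Q) (he : ∀ r, θ (e r) = θ' (e r)) : θ = θ' := by
  refine RingHom.ext fun z => ?_
  obtain ⟨Q, hQ⟩ := h z
  have h1 := he Q
  rw [← hQ, map_mul, map_mul, ← he] at h1
  exact mul_left_cancel₀ hδ h1
end

section
variable {k F A S : Type*} [Field k] [Field F] [Algebra k F] [CommRing A]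
    [Algebra k[X] A] [Fintype S]

theorem LaurentFamily.eq_zero_of_eval₂_eq_zero (L : LaurentFamily k F A S) {R : k[X][X]}
    (hd : R.degree < Fintype.card S) (hR : R.eval₂ (algebraMap k[X] A) L.y = 0) : R = 0 := by
  have hx : Function.Injective (eval₂RingHom ((HahnSeries.C (Γ := ℤ)).comp (algebraMap k F)) L.x) := by
    rw [injective_iff_map_eq_zero]
    intro r hr
    rw [coe_eval₂RingHom, ← eval₂_map] at hr
    have := eq_zero_of_eval₂_poleLe L.x_pole L.x_coeff L.x_coeff_zero
      (by rw [hr]; exact poleLe_zero _)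
    exact (Polynomial.map_eq_zero_iff (algebraMap k F).injective).1 this
  refine Polynomial.map_injective _ hx ?_
  rw [Polynomial.map_zero]
  refine eq_zero_of_degree_lt_of_eval_index_eq_zero (s := Finset.univ)
    (v := fun s => L.ι s L.y) ?_ ?_ ?_
  · intro s _ s' _ h
    refine L.ζ_injective ?_
    rw [← L.y_coeff, ← L.y_coeff]
    exact congrArg (fun f : LaurentSeries F => f.coeff (-1)) h
  · rw [Finset.card_univ]
    exact degree_map_le.trans_lt hd
  · intro s _
    have h1 := congrArg (L.ι s) hR
    rw [hom_eval₂, map_zero] at h1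
    rw [eval_map, ← h1]
    congr 1
    refine RingHom.ext fun r => ?_
    rw [RingHom.comp_apply, L.ι_algebraMap, eval₂_map, coe_eval₂RingHom]

namespace SwapCurve
variable {P : k[X]} (L : SwapCurve P F A S)

theorem eval₂_eq_zero_of_eval₂_eq_zero (hP : P.Monic) (hd : P.natDegree = Fintype.card S + 1)
    {R : k[X][X]} (hR : R.eval₂ (algebraMap k[X] A) L.y = 0) {M : Type*} [CommRing M]
    (φ : k[X] →+* M) {v : M} (hv : (diffQuot P).eval₂ φ v = 0) : R.eval₂ φ v = 0 := by
  have hm := monic_diffQuot hP (by omega)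
  have h1 := modByMonic_add_div R (diffQuot P)
  have h2 : R %ₘ diffQuot P = 0 := by
    refine L.eq_zero_of_eval₂_eq_zero ?_ ?_
    · refine (degree_modByMonic_lt R hm).trans_le ?_
      rw [degree_eq_natDegree hm.ne_zero, natDegree_diffQuot hP (by omega), hd]
      simp
    · have := hR
      rw [← h1, eval₂_add, eval₂_mul, L.relation, zero_mul, add_zero] at this
      exact this
  rw [← h1, h2, zero_add, eval₂_mul, hv, zero_mul]
end SwapCurve

theorem eval₂_derivative_diffQuot {M : Type*} [CommRing M] (P : k[X]) (φ : k[X] →+* M) {v : M}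
    (hv : (diffQuot P).eval₂ φ v = 0) :
    (v - φ X) * (derivative (diffQuot P)).eval₂ φ v = (derivative P).eval₂ (φ.comp C) v := by
  have h := congrArg (fun Q => (derivative Q).eval₂ φ v) (X_sub_mul_diffQuot P)
  simp only [derivative_mul, derivative_sub, derivative_X, derivative_C, sub_zero, one_mul,
    derivative_map, eval₂_add, eval₂_mul, eval₂_sub, eval₂_X, eval₂_C, eval₂_map, hv, zero_add] at h
  exact h
end

end

section

open Polynomial

namespace SwapCurve
variable {k F A S : Type*} [Field k] [Field F] [Algebra k F] [CommRing A]
    [Algebra k[X] A] [Fintype S] [Algebra k A] [IsScalarTower k k[X] A] {P : k[X]}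
    (L : SwapCurve P F A S)

theorem algHom_comp_algebraMap (θ : A →ₐ[k] F) : (θ : A →+* F).comp (algebraMap k[X] A) =
    eval₂RingHom (algebraMap k F) (θ (algebraMap k[X] A X)) := by
  refine Polynomial.ringHom_ext (fun c => ?_) (by simp)
  rw [RingHom.comp_apply, coe_eval₂RingHom, eval₂_C, RingHom.coe_coe, ← θ.commutes c,
    IsScalarTower.algebraMap_apply k k[X] A]
  rfl

theorem algHom_eval₂ (θ : A →ₐ[k] F) (R : k[X][X]) : θ (R.eval₂ (algebraMap k[X] A) L.y) =
    R.eval₂ (eval₂RingHom (algebraMap k F) (θ (algebraMap k[X] A X))) (θ L.y) := by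
  rw [← algHom_comp_algebraMap]
  exact hom_eval₂ R _ (θ : A →+* F) _

theorem eval₂_diffQuot_algHom (θ : A →ₐ[k] F) :
    (diffQuot P).eval₂ (eval₂RingHom (algebraMap k F) (θ (algebraMap k[X] A X))) (θ L.y) = 0 := by
  rw [← algHom_eval₂, L.relation, map_zero]

theorem eval₂RingHom_comp_C (u : F) :
    (eval₂RingHom (algebraMap k F) u).comp C = algebraMap k F := RingHom.ext fun c => by simp

theorem eval_algHom_eq (θ : A →ₐ[k] F) : (P.map (algebraMap k F)).eval (θ (algebraMap k[X] A X)) =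
    (P.map (algebraMap k F)).eval (θ L.y) := by
  have h := sub_mul_eval₂_diffQuot P (eval₂RingHom (algebraMap k F) (θ (algebraMap k[X] A X))) (θ L.y)
  rw [L.eval₂_diffQuot_algHom, mul_zero, eq_comm, sub_eq_zero, eval₂RingHom_comp_C, coe_eval₂RingHom,
    eval₂_X] at h
  rw [eval_map, eval_map, h]

theorem eval₂_derivative_diffQuot_ne_zero {u v : F}
    (hu : (P.map (algebraMap k F) - C ((P.map (algebraMap k F)).eval u)).Separable)
    (huv : (P.map (algebraMap k F)).eval u = (P.map (algebraMap k F)).eval v)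
    (hΦ : (diffQuot P).eval₂ (eval₂RingHom (algebraMap k F) u) v = 0) :
    u ≠ v ∧ (derivative (diffQuot P)).eval₂ (eval₂RingHom (algebraMap k F) u) v ≠ 0 := by
  have h1 := hu.eval₂_derivative_ne_zero (RingHom.id F) (x := v) (by simp [huv])
  have h2 := eval₂_derivative_diffQuot P (eval₂RingHom (algebraMap k F) u) hΦ
  rw [eval₂RingHom_comp_C] at h2
  rw [derivative_sub, derivative_C, sub_zero, derivative_map, eval₂_map, RingHom.id_comp, ← h2] at h1
  simp only [coe_eval₂RingHom, eval₂_X] at h1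
  exact ⟨fun h => left_ne_zero_of_mul h1 (by rw [h, sub_self]), right_ne_zero_of_mul h1⟩

theorem algHom_ne (θ : A →ₐ[k] F) (hu : (P.map (algebraMap k F) -
      C ((P.map (algebraMap k F)).eval (θ (algebraMap k[X] A X)))).Separable) :
    θ (algebraMap k[X] A X) ≠ θ L.y :=
  (eval₂_derivative_diffQuot_ne_zero hu (L.eval_algHom_eq θ) (L.eval₂_diffQuot_algHom θ)).1

theorem ringHom_ext_algHom (θ : A →ₐ[k] F) (hu : (P.map (algebraMap k F) -
      C ((P.map (algebraMap k F)).eval (θ (algebraMap k[X] A X)))).Separable) {θ' : A →+* F}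
    (hC : ∀ c : k, θ' (algebraMap k A c) = algebraMap k F c)
    (hX : θ (algebraMap k[X] A X) = θ' (algebraMap k[X] A X)) (hy : θ L.y = θ' L.y) :
    (θ : A →+* F) = θ' := by
  let φ : A →ₐ[k] F := { θ' with commutes' := hC }
  refine ringHom_ext_of_denominator (e := eval₂RingHom (algebraMap k[X] A) L.y)
    (δ := derivative (diffQuot P)) ?_ L.derivative_mul fun r => ?_
  · rw [RingHom.coe_coe, coe_eval₂RingHom, L.algHom_eval₂]
    exact (eval₂_derivative_diffQuot_ne_zero hu (L.eval_algHom_eq θ) (L.eval₂_diffQuot_algHom θ)).2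
  · rw [RingHom.coe_coe, coe_eval₂RingHom, L.algHom_eval₂, hX, hy]
    exact (L.algHom_eval₂ φ r).symm

theorem exists_algHom (hP : P.Monic) (hd : P.natDegree = Fintype.card S + 1) {u v : F} (hne : u ≠ v)
    (huv : (P.map (algebraMap k F)).eval u = (P.map (algebraMap k F)).eval v)
    (hu : (P.map (algebraMap k F) - C ((P.map (algebraMap k F)).eval u)).Separable) :
    ∃ θ : A →ₐ[k] F, θ (algebraMap k[X] A X) = u ∧ θ L.y = v := by
  have hΦ : (diffQuot P).eval₂ (eval₂RingHom (algebraMap k F) u) v = 0 := by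
    have h := sub_mul_eval₂_diffQuot P (eval₂RingHom (algebraMap k F) u) v
    rw [eval₂RingHom_comp_C, coe_eval₂RingHom, eval₂_X, ← eval_map (algebraMap k F),
      ← eval_map (algebraMap k F), huv, sub_self,
      mul_eq_zero, sub_eq_zero] at h
    exact h.resolve_left hne.symm
  obtain ⟨θ, hθ⟩ := exists_ringHom_of_denominator (e := eval₂RingHom (algebraMap k[X] A) L.y)
    (e₀ := eval₂RingHom (eval₂RingHom (algebraMap k F) u) v) (δ := derivative (diffQuot P))
    (fun r hr => L.eval₂_eq_zero_of_eval₂_eq_zero hP hd hr _ hΦ)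
    (eval₂_derivative_diffQuot_ne_zero hu huv hΦ).2 L.derivative_mul
  refine ⟨{ θ with commutes' := fun c => ?_ }, ?_, ?_⟩
  · have := hθ (C (C c))
    simp only [coe_eval₂RingHom, eval₂_C] at this
    rw [← this]
    exact congrArg θ (IsScalarTower.algebraMap_apply k k[X] A c)
  · have := hθ (C X)
    simp only [coe_eval₂RingHom, eval₂_C, eval₂_X] at this
    exact this
  · have := hθ X
    simp only [coe_eval₂RingHom, eval₂_X] at this
    exact this
end SwapCurve

end

section

open Polynomial

section
variable {k E F : Type*} [Field k] [Fintype k] [Field E] [Finite E] [Algebra k E] [Field F] [Algebra k F]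

theorem FiniteField.pow_card_pow_finrank (w : E) : w ^ Fintype.card k ^ Module.finrank k E = w := by
  have := Fintype.ofFinite E
  rw [← Module.card_eq_pow_finrank, FiniteField.pow_card]

theorem FiniteField.sum_pow_eq_trace (θ : E →ₐ[k] F) (w : E) {n : ℕ} (h : Module.finrank k E ∣ n) :
    ∑ m ∈ Finset.range n, θ w ^ Fintype.card k ^ m =
      algebraMap k F ((n / Module.finrank k E) • Algebra.trace k E w) := by
  obtain ⟨e, rfl⟩ := h
  rw [Nat.mul_div_cancel_left _ Module.finrank_pos]
  have h0 : ∑ m ∈ Finset.range (Module.finrank k E), θ w ^ Fintype.card k ^ m =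
      algebraMap k F (Algebra.trace k E w) := by
    rw [← θ.commutes, FiniteField.algebraMap_trace_eq_sum_pow, map_sum, Nat.card_eq_fintype_card]
    simp only [map_pow]
  induction e with
  | zero => simp
  | succ e ih =>
    rw [mul_add, mul_one, Finset.sum_range_add, ih, add_smul, one_smul, map_add, ← h0]
    congr 1
    refine Finset.sum_congr rfl fun m _ => ?_
    rw [pow_add, pow_mul, ← map_pow θ]
    congr 2
    clear ih
    induction e with
    | zero => simp
    | succ e ih => rw [mul_add, mul_one, pow_add, pow_mul, ih, pow_card_pow_finrank]

theorem FiniteField.finrank_dvd_iff {n : ℕ} :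
    Module.finrank k E ∣ n ↔ ∀ w : E, w ^ Fintype.card k ^ n = w := by
  rw [← FiniteField.orderOf_frobeniusAlgHom k E, orderOf_dvd_iff_pow_eq_one, DFunLike.ext_iff]
  refine forall_congr' fun w => ?_
  rw [AlgHom.coe_pow, FiniteField.coe_frobeniusAlgHom, pow_iterate, AlgHom.one_apply]
end

theorem trace_map_ringEquiv {k A : Type*} [Field k] [CommRing A] [Algebra k A] (κ : A ≃+* A)
    (hκ : ∀ c : k, κ (algebraMap k A c) = algebraMap k A c) (Q : Ideal A) (w : A) :
    Algebra.trace k (A ⧸ Q) (Ideal.Quotient.mk Q w) =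
      Algebra.trace k (A ⧸ Q.map κ) (Ideal.Quotient.mk (Q.map κ) (κ w)) :=
  (Algebra.trace_eq_of_algEquiv (Ideal.quotientEquivAlg Q (Q.map κ)
    (AlgEquiv.ofRingEquiv (f := κ) hκ) rfl) (Ideal.Quotient.mk Q w)).symm

section
variable {k F A : Type*} [Field k] [Fintype k] [Field F] [Algebra k F] [CommRing A]
    [IsDedekindDomain A] [Algebra k[X] A] [Module.IsTorsionFree k[X] A] [Algebra k A]

theorem ker_ne_bot_of_pow_card {θ : A →ₐ[k] F} {n : ℕ} (hn : 1 ≤ n)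
    (h : ∀ g, θ g ^ Fintype.card k ^ n = θ g) : RingHom.ker θ ≠ ⊥ := by
  intro hbot
  have h1 : algebraMap k[X] A (X ^ Fintype.card k ^ n - X) ∈ RingHom.ker θ := by
    rw [RingHom.mem_ker, map_sub, map_sub, map_pow, map_pow, h, sub_self]
  rw [hbot, Ideal.mem_bot, map_eq_zero_iff _
    (Module.isTorsionFree_iff_algebraMap_injective.1 ‹Module.IsTorsionFree k[X] A›)] at h1
  exact FiniteField.X_pow_card_pow_sub_X_ne_zero k (by omega) (Fintype.one_lt_card (α := k)) h1

variable [Module.Finite k[X] A] [IsScalarTower k k[X] A]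

theorem algHom_mem_iff_finrank_dvd {Q : Ideal A} (hQ : Q ≠ ⊥) [Q.IsPrime] {θ : A →ₐ[k] F}
    (hθ : RingHom.ker θ = Q) {n : ℕ} :
    (∀ g, θ g ^ Fintype.card k ^ n = θ g) ↔ Module.finrank k (A ⧸ Q) ∣ n := by
  have hmax : Q.IsMaximal := Ring.DimensionLEOne.maximalOfPrime hQ ‹_›
  let _ : Field (A ⧸ Q) := Ideal.Quotient.field Q
  have hfd : FiniteDimensional k (A ⧸ Q) := finiteDimensional_quotient (k := k) hQ
  have : Finite (A ⧸ Q) := Module.finite_of_finite k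
  rw [FiniteField.finrank_dvd_iff, (Ideal.Quotient.mk_surjective (I := Q)).forall]
  refine forall_congr' fun g => ?_
  rw [← map_pow, ← map_pow, Ideal.Quotient.eq, ← hθ, RingHom.mem_ker, map_sub, sub_eq_zero]

theorem sum_pow_algHom_eq_trace {Q : Ideal A} (hQ : Q ≠ ⊥) [Q.IsPrime] {θ : A →ₐ[k] F}
    (hθ : RingHom.ker θ = Q) {n : ℕ} (hn : Module.finrank k (A ⧸ Q) ∣ n) (w : A) :
    ∑ m ∈ Finset.range n, θ w ^ Fintype.card k ^ m =
      algebraMap k F ((n / Module.finrank k (A ⧸ Q)) • Algebra.trace k (A ⧸ Q) (Ideal.Quotient.mk Q w)) := by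
  have hmax : Q.IsMaximal := Ring.DimensionLEOne.maximalOfPrime hQ ‹_›
  let _ : Field (A ⧸ Q) := Ideal.Quotient.field Q
  have hfd : FiniteDimensional k (A ⧸ Q) := finiteDimensional_quotient (k := k) hQ
  have : Finite (A ⧸ Q) := Module.finite_of_finite k
  exact FiniteField.sum_pow_eq_trace (Ideal.Quotient.liftₐ Q θ fun a ha => by rwa [← hθ] at ha)
    (Ideal.Quotient.mk Q w) hn

theorem card_filter_ker_eq [IsAlgClosed F] {Q : Ideal A} (hQ : Q ≠ ⊥) [Q.IsPrime] {n : ℕ}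
    {H : Finset (A →ₐ[k] F)} (hH : ∀ θ, θ ∈ H ↔ ∀ g, θ g ^ Fintype.card k ^ n = θ g)
    (hn : Module.finrank k (A ⧸ Q) ∣ n) [DecidablePred fun θ : A →ₐ[k] F => RingHom.ker θ = Q] :
    (H.filter fun θ => RingHom.ker θ = Q).card = Module.finrank k (A ⧸ Q) := by
  have hmax : Q.IsMaximal := Ring.DimensionLEOne.maximalOfPrime hQ ‹_›
  let _ : Field (A ⧸ Q) := Ideal.Quotient.field Q
  have hfd : FiniteDimensional k (A ⧸ Q) := finiteDimensional_quotient (k := k) hQ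
  have : Finite (A ⧸ Q) := Module.finite_of_finite k
  rw [← AlgHom.card k (A ⧸ Q) F, ← Finset.card_univ]
  symm
  refine Finset.card_bij (fun θ _ => θ.comp (Ideal.Quotient.mkₐ k Q)) (fun θ _ => ?_)
    (fun θ _ θ' _ h => ?_) fun θ hθ => ?_
  · have hk : RingHom.ker (θ.comp (Ideal.Quotient.mkₐ k Q)) = Q := by
      ext g
      rw [RingHom.mem_ker, AlgHom.comp_apply, map_eq_zero]
      exact Ideal.Quotient.eq_zero_iff_mem
    rw [Finset.mem_filter, hH]
    exact ⟨(algHom_mem_iff_finrank_dvd hQ hk).2 hn, hk⟩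
  · exact Ideal.Quotient.algHom_ext _ h
  · rw [Finset.mem_filter] at hθ
    exact ⟨Ideal.Quotient.liftₐ Q θ fun a ha => by rwa [← hθ.2] at ha, Finset.mem_univ _,
      AlgHom.ext fun g => rfl⟩
end

end

section

open Polynomial

namespace SwapCurve
variable {k F A S : Type*} [Field k] [Fintype k] [Field F] [Algebra k F] [CommRing A]
    [IsDedekindDomain A] [Algebra k[X] A] [Module.Finite k[X] A] [Module.IsTorsionFree k[X] A]
    [Algebra k A] [IsScalarTower k k[X] A] [Finite (ClassGroup A)] [Fintype S] {P : k[X]}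
    (L : SwapCurve P F A S)

theorem idealChar_eq (ψ : AddChar k ℂ) (a b : k) {Q : Ideal A} (hQ : Q ≠ ⊥) [Q.IsPrime] :
    LaurentFamily.idealChar ψ L.κ a b Q = ψ (Algebra.trace k (A ⧸ Q) (Ideal.Quotient.mk Q
      (algebraMap k A a * algebraMap k[X] A X + algebraMap k A b * L.y))) := by
  have hκC : ∀ c : k, L.κ (algebraMap k A c) = algebraMap k A c := fun c => by
    rw [IsScalarTower.algebraMap_apply k k[X] A]
    exact L.κ_C c
  have hQ' : Q.map L.κ ≠ ⊥ := fun h =>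
    hQ ((Ideal.map_eq_bot_iff_of_injective L.κ.injective).1 h)
  have : (Q.map L.κ).IsPrime := Ideal.map_isPrime_of_equiv L.κ
  have h1 : ∀ c w, Algebra.trace k (A ⧸ Q) (Ideal.Quotient.mk Q (algebraMap k A c * w)) =
      c * Algebra.trace k (A ⧸ Q) (Ideal.Quotient.mk Q w) := by
    intro c w
    rw [← Algebra.smul_def, ← smul_eq_mul, ← map_smul]
    rfl
  rw [LaurentFamily.idealChar, map_add, map_add, h1, h1, nextCoeff_normPoly_prime hQ,
    trace_map_ringEquiv L.κ hκC Q L.y, L.κ_y, nextCoeff_normPoly_prime hQ']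
  congr 1
  ring

open Classical in
theorem sum_algHom_eq_primeSum [IsAlgClosed F] (ψ : AddChar k ℂ) (a b : k) {T : ℕ → Finset (Ideal A)}
    (hT : ∀ n P, P ∈ T n ↔ P ≠ ⊥ ∧ P.IsPrime ∧ (normPoly P : k[X]).natDegree ≤ n) {n : ℕ} (hn : 1 ≤ n)
    {H : Finset (A →ₐ[k] F)} (hH : ∀ θ, θ ∈ H ↔ ∀ g, θ g ^ Fintype.card k ^ n = θ g) :
    ∑ θ ∈ H, ψ (Function.invFun (algebraMap k F) (∑ m ∈ Finset.range n,
      (algebraMap k F a * θ (algebraMap k[X] A X) + algebraMap k F b * θ L.y) ^ Fintype.card k ^ m)) =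
    ∑ Q ∈ T n with (normPoly Q : k[X]).natDegree ∣ n, ((normPoly Q : k[X]).natDegree : ℂ) *
      LaurentFamily.idealChar ψ L.κ a b Q ^ (n / (normPoly Q : k[X]).natDegree) := by
  rw [← Finset.sum_fiberwise_of_maps_to
    (t := (T n).filter fun Q => (normPoly Q : k[X]).natDegree ∣ n) (g := fun θ => RingHom.ker θ)]
  · refine Finset.sum_congr rfl fun Q hQ => ?_
    rw [Finset.mem_filter, hT] at hQ
    obtain ⟨⟨hQ0, hQp, -⟩, hQn⟩ := hQ
    rw [natDegree_normPoly hQ0] at hQn ⊢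
    rw [← card_filter_ker_eq (F := F) hQ0 hH hQn, ← nsmul_eq_mul]
    refine Finset.sum_eq_card_nsmul fun θ hθ => ?_
    rw [Finset.mem_filter] at hθ
    have h1 := sum_pow_algHom_eq_trace hQ0 hθ.2 hQn
      (algebraMap k A a * algebraMap k[X] A X + algebraMap k A b * L.y)
    rw [map_add, map_mul, map_mul, θ.commutes, θ.commutes] at h1
    rw [h1, Function.leftInverse_invFun (algebraMap k F).injective, AddChar.map_nsmul_eq_pow,
      L.idealChar_eq ψ a b hQ0, card_filter_ker_eq hQ0 hH hQn]
  · intro θ hθ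
    rw [hH] at hθ
    have hp : (RingHom.ker θ).IsPrime := RingHom.ker_isPrime _
    have hb := ker_ne_bot_of_pow_card hn hθ
    have hd := (algHom_mem_iff_finrank_dvd hb rfl).1 hθ
    rw [Finset.mem_filter, hT, natDegree_normPoly hb]
    exact ⟨⟨hb, hp, Nat.le_of_dvd (by omega) hd⟩, hd⟩
end SwapCurve

end

section

open Polynomial

/-- Only a bounded number of points lie on an inseparable fibre of a polynomial map. -/
theorem Polynomial.exists_finset_inseparable_fiber {F : Type*} [Field F] [IsAlgClosed F] {P : F[X]}
    (hP : derivative P ≠ 0) : ∃ B : Finset F, B.card ≤ P.natDegree ^ 2 ∧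
      ∀ u, ¬(P - C (P.eval u)).Separable → u ∈ B := by
  classical
  refine ⟨(derivative P).roots.toFinset.biUnion fun c => (P - C (P.eval c)).roots.toFinset, ?_,
    fun u hu => ?_⟩
  · refine (Finset.card_biUnion_le_card_mul _ _ P.natDegree fun c _ => ?_).trans ?_
    · refine (Multiset.toFinset_card_le _).trans ((card_roots' _).trans ?_)
      rw [natDegree_sub_C]
    · rw [sq]
      refine Nat.mul_le_mul_right _ ((Multiset.toFinset_card_le _).trans ((card_roots' _).trans ?_))
      exact (natDegree_derivative_le P).trans (Nat.sub_le _ _)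
  · obtain ⟨c, hc, hc'⟩ : ∃ c, (P - C (P.eval u)).eval c = 0 ∧ (derivative P).eval c = 0 := by
      by_contra! h
      refine hu ?_
      rw [Polynomial.Separable, derivative_sub, derivative_C, sub_zero]
      refine (isCoprime_iff_aeval_ne_zero_of_isAlgClosed F F _ _).2 fun c => ?_
      simp only [coe_aeval_eq_eval]
      exact or_iff_not_imp_left.2 fun hc => h c (not_not.1 hc)
    rw [eval_sub, eval_C, sub_eq_zero] at hc
    have h1 : P - C (P.eval c) ≠ 0 := fun h => hP (by
      rw [sub_eq_zero.1 h, derivative_C])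
    refine Finset.mem_biUnion.2 ⟨c, ?_, ?_⟩
    · rw [Multiset.mem_toFinset, mem_roots hP]
      exact hc'
    · rw [Multiset.mem_toFinset, mem_roots h1]
      simp [hc]

namespace SwapCurve
variable {k F A S : Type*} [Field k] [Field F] [Algebra k F] [CommRing A]
    [Algebra k[X] A] [Module.Finite k[X] A] [Module.Free k[X] A] [Algebra k A] [IsScalarTower k k[X] A]

theorem finite_algHom_fiber (u : F) : {θ : A →ₐ[k] F | θ (algebraMap k[X] A X) = u}.Finite ∧
    {θ : A →ₐ[k] F | θ (algebraMap k[X] A X) = u}.ncard ≤ Module.finrank k[X] A := by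
  let alg : Algebra k[X] F := (eval₂RingHom (algebraMap k F) u).toAlgebra
  let f : {θ : A →ₐ[k] F | θ (algebraMap k[X] A X) = u} → (A →ₐ[k[X]] F) := fun θ =>
    { (θ.1 : A →+* F) with
      commutes' := fun r => by
        have h := RingHom.congr_fun (algHom_comp_algebraMap θ.1) r
        rw [θ.2] at h
        exact h }
  have hf : Function.Injective f := fun θ θ' h => Subtype.ext (AlgHom.ext fun a => congrArg (fun g => g a) h)
  have hfin : Finite (A →ₐ[k[X]] F) := inferInstance
  exact ⟨Set.finite_coe_iff.1 (Finite.of_injective f hf), by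
    rw [← Nat.card_coe_set_eq]
    exact (Nat.card_le_card_of_injective f hf).trans (card_algHom_le_finrank _ _ _)⟩

theorem finite_algHom_pow_card [Fintype k] {n : ℕ} (hn : n ≠ 0) :
    {θ : A →ₐ[k] F | ∀ g, θ g ^ Fintype.card k ^ n = θ g}.Finite := by
  have hX : (X ^ Fintype.card k ^ n - X : F[X]) ≠ 0 := by
    exact FiniteField.X_pow_card_pow_sub_X_ne_zero F hn Fintype.one_lt_card
  refine ((rootSet_finite (X ^ Fintype.card k ^ n - X : F[X]) F).biUnion
    fun u _ => (finite_algHom_fiber (A := A) u).1).subset fun θ hθ => ?_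
  simp only [Set.mem_iUnion]
  exact ⟨θ (algebraMap k[X] A X), by simp [mem_rootSet, hX, hθ _], rfl⟩

variable [Fintype k] [Fintype S] {P : k[X]} (L : SwapCurve P F A S)

/-- Points of the affine ring correspond to points of the plane curve, up to boundedly many. -/
theorem norm_sum_algHom_sub_le [IsAlgClosed F] (hP : P.Monic) (hd : P.natDegree = Fintype.card S + 1)
    (hP' : derivative (P.map (algebraMap k F)) ≠ 0) {n : ℕ} {H : Finset (A →ₐ[k] F)}
    (hH : ∀ θ, θ ∈ H ↔ ∀ g, θ g ^ Fintype.card k ^ n = θ g) {T : Finset (F × F)}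
    (hT : ∀ x y, (x, y) ∈ T ↔ x ^ Fintype.card k ^ n = x ∧ y ^ Fintype.card k ^ n = y ∧ x ≠ y ∧
      (P.map (algebraMap k F)).eval x = (P.map (algebraMap k F)).eval y ∧
      (P.map (algebraMap k F) - C ((P.map (algebraMap k F)).eval x)).Separable)
    (f : F × F → ℂ) (hf : ∀ t, ‖f t‖ ≤ 1) :
    ‖∑ θ ∈ H, f (θ (algebraMap k[X] A X), θ L.y) - ∑ t ∈ T, f t‖ ≤ P.natDegree ^ 3 := by
  classical
  obtain ⟨B, hBc, hB⟩ := exists_finset_inseparable_fiber hP'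
  set PF := P.map (algebraMap k F) with hPF
  have hd' : PF.natDegree = P.natDegree := natDegree_map _
  set good : (A →ₐ[k] F) → Prop := fun θ => (PF - C (PF.eval (θ (algebraMap k[X] A X)))).Separable
    with hgood
  have h1 : ∑ θ ∈ H with good θ, f (θ (algebraMap k[X] A X), θ L.y) = ∑ t ∈ T, f t := by
    refine Finset.sum_bij (fun θ _ => (θ (algebraMap k[X] A X), θ L.y)) (fun θ hθ => ?_)
      (fun θ hθ θ' _ h => ?_) (fun t ht => ?_) fun _ _ => rfl
    · rw [Finset.mem_filter, hH] at hθ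
      rw [hT]
      exact ⟨hθ.1 _, hθ.1 _, L.algHom_ne θ hθ.2, L.eval_algHom_eq θ, hθ.2⟩
    · rw [Finset.mem_filter] at hθ
      rw [Prod.mk.injEq] at h
      exact AlgHom.ext fun a => RingHom.congr_fun
        (L.ringHom_ext_algHom θ hθ.2 (θ' := (θ' : A →+* F)) θ'.commutes h.1 h.2) a
    · obtain ⟨u, v⟩ := t
      rw [hT] at ht
      obtain ⟨hu, hv, hne, huv, hs⟩ := ht
      obtain ⟨θ, hθu, hθv⟩ := L.exists_algHom hP hd hne huv hs
      have hs' : good θ := by rw [hgood]; simpa only [hθu] using hs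
      have hφ : ∀ w : F, (FiniteField.frobeniusAlgHom k F ^ n) w = w ^ Fintype.card k ^ n := fun w => by
        rw [AlgHom.coe_pow, FiniteField.coe_frobeniusAlgHom, pow_iterate]
      have hfix := L.ringHom_ext_algHom θ hs'
        (θ' := ((FiniteField.frobeniusAlgHom k F ^ n : F →ₐ[k] F) : F →+* F).comp (θ : A →+* F))
        (fun c => by
          rw [RingHom.comp_apply, RingHom.coe_coe, RingHom.coe_coe, θ.commutes]
          exact AlgHom.commutes _ _)
        (by rw [RingHom.comp_apply, RingHom.coe_coe, RingHom.coe_coe, hφ, hθu, hu])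
        (by rw [RingHom.comp_apply, RingHom.coe_coe, RingHom.coe_coe, hφ, hθv, hv])
      refine ⟨θ, Finset.mem_filter.2 ⟨(hH _).2 fun g => ?_, hs'⟩, by rw [hθu, hθv]⟩
      exact ((RingHom.congr_fun hfix g).trans (hφ _)).symm
  have h2 : (H.filter fun θ => ¬good θ).card ≤ P.natDegree ^ 3 := by
    calc _ ≤ B.card * P.natDegree := by
          refine Finset.card_le_mul_card_image_of_maps_to
            (f := fun θ : A →ₐ[k] F => θ (algebraMap k[X] A X)) (fun θ hθ => ?_) _ (fun u _ => ?_)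
            |>.trans_eq (mul_comm _ _)
          · exact hB _ (Finset.mem_filter.1 hθ).2
          · obtain ⟨h3, h4⟩ := finite_algHom_fiber (A := A) (k := k) u
            rw [L.finrank_eq] at h4
            rw [← Set.ncard_coe_finset]
            refine (Set.ncard_le_ncard (fun θ hθ => ?_) h3).trans (h4.trans (by omega))
            exact (Finset.mem_filter.1 (Finset.mem_coe.1 hθ)).2
      _ ≤ _ := by
          rw [pow_succ]
          exact Nat.mul_le_mul_right _ (hd' ▸ hBc)
  rw [← Finset.sum_filter_add_sum_filter_not H good, h1, add_sub_cancel_left]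
  refine (norm_sum_le _ _).trans ((Finset.sum_le_card_nsmul _ _ 1 fun θ _ => hf _).trans ?_)
  rw [nsmul_eq_mul, mul_one]
  exact_mod_cast h2
end SwapCurve

end

section

open Polynomial

theorem FiniteField.mem_range_algebraMap {k F : Type*} [Field k] [Fintype k] [Field F] [Algebra k F] {u : F}
    (hu : u ^ Fintype.card k = u) : ∃ c : k, algebraMap k F c = u := by
  have h1 := FiniteField.X_pow_card_sub_X_natDegree_eq k (Fintype.one_lt_card (α := k))
  have h0 := FiniteField.X_pow_card_sub_X_ne_zero k (Fintype.one_lt_card (α := k))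
  have hs : (X ^ Fintype.card k - X : k[X]).Splits := by
    rw [splits_iff_card_roots, FiniteField.roots_X_pow_card_sub_X, h1]
    rfl
  exact hs.mem_range_of_isRoot h0 (by simp [hu])

namespace SwapCurve
variable {k F A S : Type*} [Field k] [Fintype k] [Field F] [IsAlgClosed F] [Algebra k F] [CommRing A]
    [IsDedekindDomain A] [Algebra k[X] A] [Module.Finite k[X] A] [Module.IsTorsionFree k[X] A]
    [Algebra k A] [IsScalarTower k k[X] A] [Finite (ClassGroup A)] [Fintype S] [Nonempty S] {P : k[X]}

open Classical in
/-- An estimate for exponential sums over the points of the curve in large extensions of `k` implies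
an estimate over `k` with a constant depending only on the degree. -/
theorem norm_sum_pairs_le (L : SwapCurve P F A S) (hP : P.Monic) (hd : P.natDegree = Fintype.card S + 1)
    (hP' : derivative (P.map (algebraMap k F)) ≠ 0) {ψ : AddChar k ℂ} (hψ : ψ 1 ≠ 1) (a b : k)
    {N : ℕ} (hN : 1 ≤ N) {B : ℝ}
    (hB : ∀ n : ℕ, n ≠ 0 → N ∣ n → ∀ T : Finset (F × F), (∀ x y, (x, y) ∈ T ↔
      x ^ Fintype.card k ^ n = x ∧ y ^ Fintype.card k ^ n = y ∧ x ≠ y ∧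
      (P.map (algebraMap k F)).eval x = (P.map (algebraMap k F)).eval y ∧
      (P.map (algebraMap k F) - C ((P.map (algebraMap k F)).eval x)).Separable) →
      ‖∑ t ∈ T, ψ (Function.invFun (algebraMap k F) (∑ m ∈ Finset.range n,
        (algebraMap k F a * t.1 + algebraMap k F b * t.2) ^ Fintype.card k ^ m)) -
        (if a = 0 ∧ b = 0 then (Fintype.card k : ℂ) ^ n else 0)‖ ≤ B * √((Fintype.card k : ℝ) ^ n))
    {D : Finset (k × k)} (hD : ∀ z, z ∈ D ↔ z.1 ≠ z.2 ∧ P.eval z.1 = P.eval z.2) :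
    ‖∑ z ∈ D, ψ (a * z.1 + b * z.2) - if a = 0 ∧ b = 0 then (Fintype.card k : ℂ) else 0‖ ≤
      2 * Fintype.card S ^ 2 * √(Fintype.card k) + 2 * P.natDegree ^ 3 ∨
    a = 0 ∧ b = 0 ∧ ‖∑ z ∈ D, ψ (a * z.1 + b * z.2)‖ ≤ 2 * P.natDegree ^ 3 := by
  set q := Fintype.card k with hq
  have hq1 : 1 < q := Fintype.one_lt_card
  have hinj := (algebraMap k F).injective
  set PF := P.map (algebraMap k F) with hPF
  set f : ℕ → F × F → ℂ := fun n t => ψ (Function.invFun (algebraMap k F) (∑ m ∈ Finset.range n,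
        (algebraMap k F a * t.1 + algebraMap k F b * t.2) ^ q ^ m)) with hf
  have hf1 : ∀ n t, ‖f n t‖ ≤ 1 := fun n t => (AddChar.norm_apply ψ _).le
  have hHfin : ∀ n, {θ : A →ₐ[k] F | n ≠ 0 ∧ ∀ g, θ g ^ q ^ n = θ g}.Finite := fun n => by
    by_cases hn : n = 0
    · simp [hn]
    · exact (finite_algHom_pow_card hn).subset fun θ hθ => hθ.2
  set H : ℕ → Finset (A →ₐ[k] F) := fun n => (hHfin n).toFinset with hHdef
  have hH : ∀ n, n ≠ 0 → ∀ θ, θ ∈ H n ↔ ∀ g, θ g ^ q ^ n = θ g := fun n hn θ => by simp [hHdef, hn]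
  have hTfin : ∀ n, {t : F × F | n ≠ 0 ∧ t.1 ^ q ^ n = t.1 ∧ t.2 ^ q ^ n = t.2 ∧ t.1 ≠ t.2 ∧
      PF.eval t.1 = PF.eval t.2 ∧ (PF - C (PF.eval t.1)).Separable}.Finite := fun n => by
    by_cases hn : n = 0
    · simp [hn]
    · have hX : (X ^ q ^ n - X : F[X]) ≠ 0 := FiniteField.X_pow_card_pow_sub_X_ne_zero F hn hq1
      have h1 : {u : F | u ^ q ^ n = u}.Finite :=
        (rootSet_finite (X ^ q ^ n - X : F[X]) F).subset fun u hu => by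
          simp only [Set.mem_ofPred_eq] at hu
          simp [mem_rootSet, hX, hu]
      exact (h1.prod h1).subset fun t ht => ⟨ht.2.1, ht.2.2.1⟩
  set T : ℕ → Finset (F × F) := fun n => (hTfin n).toFinset with hTdef
  have hT : ∀ n, n ≠ 0 → ∀ x y, (x, y) ∈ T n ↔ x ^ q ^ n = x ∧ y ^ q ^ n = y ∧ x ≠ y ∧
      PF.eval x = PF.eval y ∧ (PF - C (PF.eval x)).Separable := fun n hn x y => by simp [hTdef, hn]
  set W : ℕ → ℂ := fun n => ∑ θ ∈ H n, f n (θ (algebraMap k[X] A X), θ L.y) with hW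
  have hWT : ∀ n, n ≠ 0 → ‖W n - ∑ t ∈ T n, f n t‖ ≤ P.natDegree ^ 3 := fun n hn =>
    L.norm_sum_algHom_sub_le hP hd hP' (hH n hn) (hT n hn) (f n) (hf1 n)
  have hIfin : ∀ n, {I : Ideal A | I ≠ ⊥ ∧ I.IsPrime ∧ (normPoly I : k[X]).natDegree ≤ n}.Finite :=
    fun n => (Polynomial.finite_ideals (k := k) n).subset fun I hI => ⟨hI.1, hI.2.2⟩
  set T' : ℕ → Finset (Ideal A) := fun n => (hIfin n).toFinset with hT'def
  have hT' : ∀ n Q, Q ∈ T' n ↔ Q ≠ ⊥ ∧ Q.IsPrime ∧ (normPoly Q : k[X]).natDegree ≤ n := fun n Q => by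
    simp [hT'def]
  have hmain := L.norm_primeSum_le L.norm_eq L.isRotation L.ω_ne_zero L.prod_ω (a := a) (b := b)
    (or_iff_not_imp_left.2 (L.exists_ω a b)) ψ hψ T' hT'
    W (fun n hn => L.sum_algHom_eq_primeSum ψ a b hT' hn (hH n (by omega))) hN
    (B := B + P.natDegree ^ 3) (r := √q) (by positivity) (fun n hn => ?_)
  · have hDT : ‖∑ z ∈ D, ψ (a * z.1 + b * z.2) - ∑ t ∈ T 1, f 1 t‖ ≤ P.natDegree ^ 3 := by
      obtain ⟨E, hEc, hE⟩ := exists_finset_inseparable_fiber hP'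
      have hev : ∀ c : k, PF.eval (algebraMap k F c) = algebraMap k F (P.eval c) := fun c => by
        rw [hPF, eval_map, eval₂_at_apply]
      set good : k × k → Prop := fun z => (PF - C (PF.eval (algebraMap k F z.1))).Separable
      have h1 : ∑ z ∈ D with good z, ψ (a * z.1 + b * z.2) = ∑ t ∈ T 1, f 1 t := by
        refine Finset.sum_bij (fun z _ => (algebraMap k F z.1, algebraMap k F z.2)) (fun z hz => ?_)
          (fun z _ z' _ h => ?_) (fun t ht => ?_) fun z _ => ?_
        · rw [Finset.mem_filter, hD] at hz
          rw [hT 1 one_ne_zero, pow_one, ← map_pow, ← map_pow, FiniteField.pow_card,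
            FiniteField.pow_card, hev, hev, hz.1.2]
          refine ⟨rfl, rfl, hinj.ne hz.1.1, rfl, ?_⟩
          have := hz.2
          rwa [← hz.1.2, ← hev]
        · rw [Prod.mk.injEq] at h
          exact Prod.ext (hinj h.1) (hinj h.2)
        · obtain ⟨u, v⟩ := t
          rw [hT 1 one_ne_zero, pow_one] at ht
          obtain ⟨hu, hv, hne, huv, hs⟩ := ht
          obtain ⟨u, rfl⟩ := FiniteField.mem_range_algebraMap hu
          obtain ⟨v, rfl⟩ := FiniteField.mem_range_algebraMap hv
          rw [hev, hev] at huv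
          exact ⟨(u, v), Finset.mem_filter.2 ⟨(hD _).2 ⟨fun h => hne (congrArg _ h), hinj huv⟩, hs⟩, rfl⟩
        · simp only [hf, Finset.sum_range_one, pow_zero, pow_one]
          rw [← map_mul, ← map_mul, ← map_add, Function.leftInverse_invFun hinj]
      have h2 : (D.filter fun z => ¬good z).card ≤ P.natDegree ^ 3 := by
        calc _ ≤ P.natDegree * E.card := by
              refine Finset.card_le_mul_card_image_of_maps_to (f := fun z : k × k => algebraMap k F z.1)
                (fun z hz => hE _ (Finset.mem_filter.1 hz).2) _ fun u _ => ?_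
              have hne : PF - C (PF.eval u) ≠ 0 := fun h => hP' (by rw [sub_eq_zero.1 h, derivative_C])
              calc _ ≤ (PF - C (PF.eval u)).roots.toFinset.card := by
                    refine Finset.card_le_card_of_injOn (fun z => algebraMap k F z.2) (fun z hz => ?_)
                      fun z hz z' hz' h => ?_
                    · simp only [Finset.coe_filter, Set.mem_ofPred_eq, Finset.mem_filter, hD] at hz
                      rw [Finset.mem_coe, Multiset.mem_toFinset, mem_roots hne, IsRoot.def, eval_sub,
                        eval_C, sub_eq_zero, hev, ← hz.1.1.2, ← hev, hz.2]
                    · simp only [Finset.coe_filter, Set.mem_ofPred_eq] at hz hz'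
                      exact Prod.ext (hinj (hz.2.trans hz'.2.symm)) (hinj h)
                _ ≤ P.natDegree := (Multiset.toFinset_card_le _).trans ((card_roots' _).trans (by
                    rw [natDegree_sub_C, hPF, natDegree_map]))
          _ ≤ _ := by
              rw [pow_succ, mul_comm]
              exact Nat.mul_le_mul_right _ (natDegree_map (algebraMap k F) (p := P) ▸ hEc)
      rw [← Finset.sum_filter_add_sum_filter_not D good, h1, add_sub_cancel_left]
      refine (norm_sum_le _ _).trans
        ((Finset.sum_le_card_nsmul _ _ 1 fun z _ => (AddChar.norm_apply ψ _).le).trans ?_)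
      rw [nsmul_eq_mul, mul_one]
      exact_mod_cast h2
    have h2 : ‖∑ z ∈ D, ψ (a * z.1 + b * z.2) - W 1‖ ≤ 2 * P.natDegree ^ 3 := by
      have := norm_sub_le_norm_sub_add_norm_sub (∑ z ∈ D, ψ (a * z.1 + b * z.2)) (∑ t ∈ T 1, f 1 t) (W 1)
      have h3 := hWT 1 one_ne_zero
      rw [norm_sub_rev] at h3
      linarith
    refine hmain.imp (fun h => ?_) fun ⟨ha, hb, h⟩ => ⟨ha, hb, by simpa only [h, sub_zero] using h2⟩
    have := norm_sub_le_norm_sub_add_norm_sub (∑ z ∈ D, ψ (a * z.1 + b * z.2)) (W 1)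
      (if a = 0 ∧ b = 0 then (q : ℂ) else 0)
    linarith
  · have hn' : N * n ≠ 0 := by positivity
    have h1 := hB (N * n) hn' (dvd_mul_right _ _) (T (N * n)) (hT _ hn')
    have h2 := norm_sub_le_norm_sub_add_norm_sub (W (N * n)) (∑ t ∈ T (N * n), f (N * n) t)
      (if a = 0 ∧ b = 0 then (q : ℂ) ^ (N * n) else 0)
    have h3 := hWT (N * n) hn'
    have h4 : √((q : ℝ) ^ (N * n)) = √q ^ (N * n) := by
      rw [Real.sqrt_eq_iff_mul_self_eq (by positivity) (by positivity), ← mul_pow,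
        Real.mul_self_sqrt (by positivity)]
    have h5 : (1 : ℝ) ≤ √q ^ (N * n) := one_le_pow₀ (Real.one_le_sqrt.2 (by exact_mod_cast hq1.le))
    rw [h4] at h1
    nlinarith [pow_nonneg (Nat.cast_nonneg (α := ℝ) P.natDegree) 3]
end SwapCurve

end

section

open Polynomial

section
variable {k F : Type*} [Field k] [Fintype k] [Field F] [IsAlgClosed F] [Algebra k F] {P : k[X]}
  {j : ℕ} [Fact j.Prime]

open Classical in
/-- The bound for exponential sums over pairs of points with the same image under `P`. -/
theorem norm_sum_pairs_le_of_conjugate_roots (hPm : P.Monic) (hPd : P.natDegree = j) (hj : 2 < j)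
    (hjk : ((j - 1 : ℕ) : k) ≠ 0) (hP' : derivative (P.map (algebraMap k F)) ≠ 0)
    {χ : AddChar (ZMod j) F} (hχ : Function.Injective χ) {x : LaurentSeries F}
    (hx : (P.map (algebraMap k F)).eval₂ HahnSeries.C x = HahnSeries.single (-j : ℤ) 1)
    (hx1 : x.coeff (-1) = 1) (hx0 : x.coeff 0 = 0) (hxp : PoleLe 1 x)
    (hR : ∀ (R : F[X][X]) (s s' : ZMod j), s ≠ 0 → s' ≠ 0 →
        R.eval₂ (eval₂RingHom HahnSeries.C x) (laurentRot χ s x) = 0 →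
        R.eval₂ (eval₂RingHom HahnSeries.C x) (laurentRot χ s' x) = 0)
    {ψ : AddChar k ℂ} (hψ : ψ 1 ≠ 1) (a b : k) {N : ℕ} (hN : 1 ≤ N) {B : ℝ}
    (hB : ∀ n : ℕ, n ≠ 0 → N ∣ n → ∀ T : Finset (F × F), (∀ x y, (x, y) ∈ T ↔
      x ^ Fintype.card k ^ n = x ∧ y ^ Fintype.card k ^ n = y ∧ x ≠ y ∧
      (P.map (algebraMap k F)).eval x = (P.map (algebraMap k F)).eval y ∧
      (P.map (algebraMap k F) - C ((P.map (algebraMap k F)).eval x)).Separable) →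
      ‖∑ t ∈ T, ψ (Function.invFun (algebraMap k F) (∑ m ∈ Finset.range n,
        (algebraMap k F a * t.1 + algebraMap k F b * t.2) ^ Fintype.card k ^ m)) -
        (if a = 0 ∧ b = 0 then (Fintype.card k : ℂ) ^ n else 0)‖ ≤ B * √((Fintype.card k : ℝ) ^ n))
    {D : Finset (k × k)} (hD : ∀ z, z ∈ D ↔ z.1 ≠ z.2 ∧ P.eval z.1 = P.eval z.2) :
    ‖∑ z ∈ D, ψ (a * z.1 + b * z.2) - if a = 0 ∧ b = 0 then (Fintype.card k : ℂ) else 0‖ ≤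
      2 * (j - 1 : ℕ) ^ 2 * √(Fintype.card k) + 2 * j ^ 3 ∨
    a = 0 ∧ b = 0 ∧ ‖∑ z ∈ D, ψ (a * z.1 + b * z.2)‖ ≤ 2 * j ^ 3 := by
  set φ : k[X] →+* LaurentSeries F := eval₂RingHom ((HahnSeries.C (Γ := ℤ)).comp (algebraMap k F)) x
    with hφdef
  have hφ : Function.Injective φ := by
    rw [injective_iff_map_eq_zero]
    intro r hr
    rw [hφdef, coe_eval₂RingHom, ← eval₂_map] at hr
    have := eq_zero_of_eval₂_poleLe hxp hx1 hx0 (by rw [hr]; exact poleLe_zero _)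
    exact (Polynomial.map_eq_zero_iff (algebraMap k F).injective).1 this
  have hφC : φ.comp C = (HahnSeries.C (Γ := ℤ)).comp (algebraMap k F) := RingHom.ext fun c => by
    rw [RingHom.comp_apply, hφdef, coe_eval₂RingHom, eval₂_C]
  have hφX : φ X = x := by rw [hφdef, coe_eval₂RingHom, eval₂_X]
  have : Fact (Irreducible (curvePoly P)) :=
    ⟨irreducible_curvePoly hPm hPd hj hχ hx hx1 hφ hφC hφX hR⟩
  have hfd : FiniteDimensional (RatFunc k) (CurveField P) := finiteDimensional_curveField
  have hsep : Algebra.IsSeparable (RatFunc k) (CurveField P) :=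
    isSeparable_curveField hPm (by omega) (by rwa [hPd])
  obtain ⟨L⟩ := exists_swapCurve hPm hPd hj hjk hχ hx hx1 hx0 hxp hφ hφC hφX
  have : Module.Finite k[X] (integralClosure k[X] (CurveField P)) :=
    IsIntegralClosure.finite k[X] (RatFunc k) (CurveField P) (integralClosure k[X] (CurveField P))
  have : IsDedekindDomain (integralClosure k[X] (CurveField P)) :=
    integralClosure.isDedekindDomain k[X] (RatFunc k) (CurveField P)
  have : Module.IsTorsionFree k[X] (integralClosure k[X] (CurveField P)) :=
    isTorsionFree_integralClosure k (CurveField P)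
  have : Finite (ClassGroup (integralClosure k[X] (CurveField P))) :=
    @Finite.of_fintype _ (ClassGroup.fintypeOfAdmissibleOfFinite (RatFunc k) (CurveField P)
      (Polynomial.cardPowDegreeIsAdmissible :
        AbsoluteValue.IsAdmissible (Polynomial.cardPowDegree : AbsoluteValue k[X] ℤ)))
  have hcard : Fintype.card {s : ZMod j // s ≠ 0} = j - 1 := by
    rw [Fintype.card_subtype_compl, ZMod.card, Fintype.card_subtype_eq]
  have : Nonempty {s : ZMod j // s ≠ 0} := Fintype.card_pos_iff.1 (by omega)
  have h := L.norm_sum_pairs_le hPm (by omega) hP' hψ a b hN hB hD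
  rwa [hcard, hPd] at h
end

theorem norm_sum_centeredPoly_pairs_le (p : ℕ) [Fact p.Prime] {h j : ℕ} (hjp : j.Prime)
    (hj : j = 2 * h + 1) (hh : 1 ≤ h) (hp : 2 * j * (h + 1) ^ 2 < p) (a b : ZMod p)
    {D : Finset (ZMod p × ZMod p)} (hD : ∀ z, z ∈ D ↔ z.1 ≠ z.2 ∧
      (centeredPoly (ZMod p) h).eval z.1 = (centeredPoly (ZMod p) h).eval z.2) :
    ‖∑ z ∈ D, (ZMod.stdAddChar (a * z.1 + b * z.2) : ℂ) - if a = 0 ∧ b = 0 then (p : ℂ) else 0‖ ≤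
      2 * (j - 1 : ℕ) ^ 2 * √p + 2 * j ^ 3 ∨
    a = 0 ∧ b = 0 ∧ ‖∑ z ∈ D, (ZMod.stdAddChar (a * z.1 + b * z.2) : ℂ)‖ ≤ 2 * j ^ 3 := by
  have : Fact j.Prime := ⟨hjp⟩
  have hjlt : j < p := lt_of_le_of_lt (by nlinarith [sq_nonneg h]) hp
  set F := AlgebraicClosure (ZMod p)
  have : CharP F p := charP_of_injective_algebraMap (algebraMap (ZMod p) F).injective p
  obtain ⟨N, hN, B, -, hB⟩ := exists_curve_equidistribution (F := F) p (algebraMap (ZMod p) F) hj hh hp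
  obtain ⟨χ, x, hχ, hx, hx1, hx0, hxp, hR⟩ := exists_conjugate_laurent_roots (F := F) p hj hh hp
  have hmap := map_centeredPoly (algebraMap (ZMod p) F) h
  have hψ : (ZMod.stdAddChar (1 : ZMod p) : ℂ) ≠ 1 := by
    intro h1
    exact one_ne_zero (ZMod.injective_stdAddChar (h1.trans (AddChar.map_zero_eq_one _).symm))
  have := norm_sum_pairs_le_of_conjugate_roots (F := F) (monic_centeredPoly (F := ZMod p) h)
    ((natDegree_centeredPoly h).trans hj.symm) (by omega) (fun h0 => ?_)
    (by rw [hmap]; exact derivative_centeredPoly_ne_zero p (by omega)) hχ (by rwa [hmap]) hx1 hx0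
    hxp hR hψ a b hN (B := B)
    (by simpa only [hmap, ZMod.card] using fun n hn hd T hT => hB n hn hd T hT a b)
    hD
  · rw [ZMod.card] at this
    convert this
  · rw [ZMod.natCast_eq_zero_iff] at h0
    exact absurd (Nat.le_of_dvd (by omega) h0) (by omega)

end

open Finset in
set_option maxHeartbeats 400000 in
theorem card_box_le_of_charSum_le {p : ℕ} [Fact p.Prime] (Cv : Finset (ZMod p × ZMod p)) {K : ℝ}
    (hK : ∀ a b : ZMod p, (a, b) ≠ 0 →
      ‖∑ z ∈ Cv, ZMod.stdAddChar (a * z.1 + b * z.2)‖ ≤ K)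
    (s : ZMod p) {r : ZMod p} (hr : r ≠ 0) {N : ℕ} (hN : 1 ≤ N) (hNp : N ≤ p)
    {I : Finset (ZMod p)} (hI : I ⊆ (range N).image fun i : ℕ => s + (i : ZMod p) * r) :
    ((Cv.filter fun z => z.1 ∈ I ∧ z.2 ∈ I).card : ℝ)
      ≤ 16 * (N : ℝ) ^ 2 * Cv.card / (p : ℝ) ^ 2 + 16 * K := by
  classical
  have hp : (0 : ℝ) < p := by exact_mod_cast (Fact.out : p.Prime).pos
  have hpC : (p : ℂ) ≠ 0 := by exact_mod_cast hp.ne'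
  set ψ : AddChar (ZMod p) ℂ := ZMod.stdAddChar with hψ
  have horth : ∀ b : ZMod p, ∑ a, ψ (a * b) = if b = 0 then (p : ℂ) else 0 := by
    intro b
    have := AddChar.sum_mulShift b (ZMod.isPrimitive_stdAddChar p)
    simpa [ZMod.card] using this
  set D : ZMod p → ℂ := fun a => ∑ u ∈ range (2 * N), ψ (-(a * ((u : ZMod p) * r))) with hD
  have hDsq : ∀ a, ((‖D a‖ ^ 2 : ℝ) : ℂ) = ∑ w ∈ range (2 * N) ×ˢ range (2 * N),
      ψ (-(a * (((w.1 : ZMod p) - (w.2 : ZMod p)) * r))) := by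
    intro a
    rw [← Complex.normSq_eq_norm_sq, ← Complex.mul_conj, hD, map_sum, sum_mul_sum, sum_product]
    refine sum_congr rfl fun u _ => sum_congr rfl fun v _ => ?_
    rw [← AddChar.map_neg_eq_conj, ← AddChar.map_add_eq_mul]
    congr 1; ring
  set F : ZMod p → ℕ := fun x => ((range (2 * N) ×ˢ range (2 * N)).filter
    fun w : ℕ × ℕ => x = s + ((w.1 : ZMod p) - (w.2 : ZMod p)) * r).card with hF
  have hFourier : ∀ x, (p : ℂ) * F x = ∑ a, ((‖D a‖ ^ 2 : ℝ) : ℂ) * ψ (a * (x - s)) := by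
    intro x
    have e1 : ∀ a, ((‖D a‖ ^ 2 : ℝ) : ℂ) * ψ (a * (x - s))
        = ∑ w ∈ range (2 * N) ×ˢ range (2 * N),
          ψ (a * (x - (s + ((w.1 : ZMod p) - (w.2 : ZMod p)) * r))) := by
      intro a
      rw [hDsq, sum_mul]
      refine sum_congr rfl fun w _ => ?_
      rw [← AddChar.map_add_eq_mul]; congr 1; ring
    simp only [e1]
    rw [sum_comm]
    simp only [horth, sub_eq_zero]
    rw [← sum_filter, sum_const, hF]
    simp [mul_comm]
  have hsumD : ∑ a, ‖D a‖ ^ 2 ≤ 4 * N * p := by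
    have h0 : ((∑ a, ‖D a‖ ^ 2 : ℝ) : ℂ) = (p : ℂ) * F s := by
      rw [hFourier]; simp
    have h1 : (∑ a, ‖D a‖ ^ 2 : ℝ) = p * F s := by exact_mod_cast h0
    have h2 : F s ≤ 4 * N := by
      have hsub : ((range (2 * N) ×ˢ range (2 * N)).filter
          fun w : ℕ × ℕ => s = s + ((w.1 : ZMod p) - (w.2 : ZMod p)) * r)
          ⊆ (range (2 * N) ×ˢ range 2).image fun w => (w.1, w.1 % p + p * w.2) := by
        intro w hw
        simp only [mem_filter, mem_product, mem_range, left_eq_add, mul_eq_zero, hr, or_false,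
          sub_eq_zero] at hw
        have hm := (ZMod.natCast_eq_natCast_iff _ _ _).1 hw.2
        simp only [mem_image, mem_product, mem_range]
        refine ⟨(w.1, w.2 / p), ⟨hw.1.1, ?_⟩, ?_⟩
        · exact Nat.div_lt_of_lt_mul (by nlinarith [hw.1.2])
        · ext
          · rfl
          · simp only
            rw [show w.1 % p = w.2 % p from hm, Nat.mod_add_div]
      calc F s ≤ _ := card_le_card hsub
        _ ≤ _ := card_image_le
        _ = 4 * N := by simp; ring
    rw [h1]
    have : (F s : ℝ) ≤ 4 * N := by exact_mod_cast h2
    nlinarith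
  have hD0 : ‖D 0‖ ^ 2 = 4 * (N : ℝ) ^ 2 := by
    simp [hD]; ring
  have hFI : ∀ x ∈ I, N ≤ F x := by
    intro x hx
    obtain ⟨i, hi, rfl⟩ := mem_image.1 (hI hx)
    rw [mem_range] at hi
    have : (range N).image (fun v => (i + v, v)) ⊆ ((range (2 * N) ×ˢ range (2 * N)).filter
        fun w : ℕ × ℕ => s + (i : ZMod p) * r = s + ((w.1 : ZMod p) - (w.2 : ZMod p)) * r) := by
      intro w hw
      obtain ⟨v, hv, rfl⟩ := mem_image.1 hw
      rw [mem_range] at hv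
      simp only [mem_filter, mem_product, mem_range]
      exact ⟨⟨by omega, by omega⟩, by push_cast; ring⟩
    calc N = ((range N).image (fun v => (i + v, v))).card := by
          rw [card_image_of_injective, card_range]
          intro a b h
          simpa using h
      _ ≤ _ := card_le_card this
  clear_value D F ψ
  have hlow : ((Cv.filter fun z => z.1 ∈ I ∧ z.2 ∈ I).card : ℝ) * (N : ℝ) ^ 2
      ≤ ∑ z ∈ Cv, (F z.1 : ℝ) * F z.2 := by
    calc ((Cv.filter fun z => z.1 ∈ I ∧ z.2 ∈ I).card : ℝ) * (N : ℝ) ^ 2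
        = ∑ z ∈ Cv.filter (fun z => z.1 ∈ I ∧ z.2 ∈ I), (N : ℝ) ^ 2 := by simp
      _ ≤ ∑ z ∈ Cv.filter (fun z => z.1 ∈ I ∧ z.2 ∈ I), (F z.1 : ℝ) * F z.2 := by
          refine sum_le_sum fun z hz => ?_
          have h1 : (N : ℝ) ≤ F z.1 := by exact_mod_cast hFI _ (mem_filter.1 hz).2.1
          have h2 : (N : ℝ) ≤ F z.2 := by exact_mod_cast hFI _ (mem_filter.1 hz).2.2
          rw [sq]
          exact mul_le_mul h1 h2 (by positivity) (by positivity)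
      _ ≤ _ := sum_le_sum_of_subset_of_nonneg (filter_subset _ _) fun _ _ _ => by positivity
  have hup : (p : ℝ) ^ 2 * ∑ z ∈ Cv, (F z.1 : ℝ) * F z.2
      ≤ 16 * (N : ℝ) ^ 4 * Cv.card + 16 * (N : ℝ) ^ 2 * (p : ℝ) ^ 2 * K := by
    have hcz : (0, 0) ∈ (univ : Finset (ZMod p × ZMod p)) := mem_univ _
    have hexp : (((p : ℝ) ^ 2 * ∑ z ∈ Cv, (F z.1 : ℝ) * F z.2 : ℝ) : ℂ)
        = ∑ w : ZMod p × ZMod p, ((‖D w.1‖ ^ 2 : ℝ) : ℂ) * ((‖D w.2‖ ^ 2 : ℝ) : ℂ) *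
          (ψ (-((w.1 + w.2) * s)) * ∑ z ∈ Cv, ψ (w.1 * z.1 + w.2 * z.2)) := by
      calc (((p : ℝ) ^ 2 * ∑ z ∈ Cv, (F z.1 : ℝ) * F z.2 : ℝ) : ℂ)
          = ∑ z ∈ Cv, ((p : ℂ) * F z.1) * ((p : ℂ) * F z.2) := by
            push_cast; rw [mul_sum]; refine sum_congr rfl fun z _ => ?_; ring
        _ = ∑ z ∈ Cv, ∑ w : ZMod p × ZMod p, ((‖D w.1‖ ^ 2 : ℝ) : ℂ) * ((‖D w.2‖ ^ 2 : ℝ) : ℂ) *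
            (ψ (-((w.1 + w.2) * s)) * ψ (w.1 * z.1 + w.2 * z.2)) := by
            refine sum_congr rfl fun z _ => ?_
            rw [hFourier, hFourier, sum_mul_sum, ← univ_product_univ, sum_product]
            refine sum_congr rfl fun a _ => sum_congr rfl fun b _ => ?_
            have : ψ (-((a + b) * s)) * ψ (a * z.1 + b * z.2)
                = ψ (a * (z.1 - s)) * ψ (b * (z.2 - s)) := by
              rw [← AddChar.map_add_eq_mul, ← AddChar.map_add_eq_mul]; congr 1; ring
            simp only
            rw [this]; ring
        _ = _ := by
            rw [sum_comm]
            refine sum_congr rfl fun w _ => ?_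
            simp only [mul_sum]
    have hnorm : ∀ w : ZMod p × ZMod p, ‖((‖D w.1‖ ^ 2 : ℝ) : ℂ) * ((‖D w.2‖ ^ 2 : ℝ) : ℂ) *
          (ψ (-((w.1 + w.2) * s)) * ∑ z ∈ Cv, ψ (w.1 * z.1 + w.2 * z.2))‖
        = ‖D w.1‖ ^ 2 * ‖D w.2‖ ^ 2 * ‖∑ z ∈ Cv, ψ (w.1 * z.1 + w.2 * z.2)‖ := by
      intro w
      rw [norm_mul, norm_mul, norm_mul, AddChar.norm_apply, one_mul, Complex.norm_real,
        Complex.norm_real, Real.norm_of_nonneg (by positivity), Real.norm_of_nonneg (by positivity)]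
    have hKn : 0 ≤ K := (norm_nonneg _).trans (hK 1 0 fun h => one_ne_zero (congrArg Prod.fst h))
    calc (p : ℝ) ^ 2 * ∑ z ∈ Cv, (F z.1 : ℝ) * F z.2
        = ‖(((p : ℝ) ^ 2 * ∑ z ∈ Cv, (F z.1 : ℝ) * F z.2 : ℝ) : ℂ)‖ := by
          rw [Complex.norm_real, Real.norm_of_nonneg]
          exact mul_nonneg (sq_nonneg _) (sum_nonneg fun z _ => mul_nonneg (Nat.cast_nonneg _) (Nat.cast_nonneg _))
      _ ≤ ∑ w : ZMod p × ZMod p, ‖D w.1‖ ^ 2 * ‖D w.2‖ ^ 2 *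
          ‖∑ z ∈ Cv, ψ (w.1 * z.1 + w.2 * z.2)‖ := by
          rw [hexp]
          refine (norm_sum_le _ _).trans (le_of_eq (sum_congr rfl fun w _ => hnorm w))
      _ ≤ 16 * (N : ℝ) ^ 4 * Cv.card
          + ∑ w : ZMod p × ZMod p, ‖D w.1‖ ^ 2 * ‖D w.2‖ ^ 2 * K := by
          rw [← add_sum_erase _ _ hcz]
          refine add_le_add ?_ ?_
          · simp only [hD0]
            have : ‖∑ z ∈ Cv, ψ (0 * z.1 + 0 * z.2)‖ = Cv.card := by
              simp only [zero_mul, add_zero, AddChar.map_zero_eq_one, sum_const, nsmul_eq_mul, mul_one,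
                Complex.norm_natCast]
            rw [this]; apply le_of_eq; ring
          · refine (sum_le_sum fun w hw => ?_).trans
              (sum_le_sum_of_subset_of_nonneg (erase_subset _ _) fun _ _ _ => by positivity)
            exact mul_le_mul_of_nonneg_left (hK _ _ (mem_erase.1 hw).1) (by positivity)
      _ = 16 * (N : ℝ) ^ 4 * Cv.card + (∑ a, ‖D a‖ ^ 2) ^ 2 * K := by
          rw [sq (∑ a, ‖D a‖ ^ 2), sum_mul_sum, ← sum_mul, ← univ_product_univ, sum_product]
      _ ≤ 16 * (N : ℝ) ^ 4 * Cv.card + (4 * N * p) ^ 2 * K := by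
          exact add_le_add le_rfl (mul_le_mul_of_nonneg_right
            (pow_le_pow_left₀ (sum_nonneg fun _ _ => sq_nonneg _) hsumD 2) hKn)
      _ = _ := by ring
  have hN0 : (0 : ℝ) < N := by exact_mod_cast hN
  have h3 : ((Cv.filter fun z => z.1 ∈ I ∧ z.2 ∈ I).card : ℝ) * ((N : ℝ) ^ 2 * (p : ℝ) ^ 2)
      ≤ (16 * (N : ℝ) ^ 2 * Cv.card / (p : ℝ) ^ 2 + 16 * K) * ((N : ℝ) ^ 2 * (p : ℝ) ^ 2) := by
    have : (16 * (N : ℝ) ^ 2 * Cv.card / (p : ℝ) ^ 2 + 16 * K) * ((N : ℝ) ^ 2 * (p : ℝ) ^ 2)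
        = 16 * (N : ℝ) ^ 4 * Cv.card + 16 * (N : ℝ) ^ 2 * (p : ℝ) ^ 2 * K := by
      field_simp
    rw [this]
    nlinarith [mul_le_mul_of_nonneg_left hlow (sq_nonneg (p : ℝ))]
  exact le_of_mul_le_mul_right h3 (by positivity)

theorem Finset.card_le_card_image_add_card_collisions {α β : Type*} [DecidableEq α] [DecidableEq β]
    (I : Finset α) (f : α → β) :
    I.card ≤ (I.image f).card + ((I ×ˢ I).filter fun z => z.1 ≠ z.2 ∧ f z.1 = f z.2).card := by
  rcases I.eq_empty_or_nonempty with rfl | ⟨x₀, -⟩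
  · simp
  have : Nonempty α := ⟨x₀⟩
  have h : ∀ b ∈ I.image f, ∃ a ∈ I, f a = b := fun b hb => Finset.mem_image.1 hb
  choose! g hgI hg using h
  have h1 : ∀ x ∈ I, g (f x) ∈ I ∧ f (g (f x)) = f x := fun x hx =>
    ⟨hgI _ (Finset.mem_image_of_mem f hx), hg _ (Finset.mem_image_of_mem f hx)⟩
  rw [← Finset.card_filter_add_card_filter_not (s := I) (fun x => g (f x) = x)]
  refine add_le_add (Finset.card_le_card_of_injOn f (fun x hx => ?_) fun x hx y hy hxy => ?_)
    (Finset.card_le_card_of_injOn (fun x => (g (f x), x)) (fun x hx => ?_) fun x _ y _ hxy => ?_)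
  · exact Finset.mem_image_of_mem f (Finset.mem_filter.1 hx).1
  · rw [← (Finset.mem_filter.1 hx).2, ← (Finset.mem_filter.1 hy).2, hxy]
  · obtain ⟨hx1, hx2⟩ := Finset.mem_filter.1 hx
    exact Finset.mem_filter.2 ⟨Finset.mem_product.2 ⟨(h1 x hx1).1, hx1⟩, hx2, (h1 x hx1).2⟩
  · exact (Prod.mk.inj hxy).2

theorem apImage_min_card (p : ℕ) [Fact p.Prime] (s : ZMod p) {r : ZMod p} (hr : r ≠ 0) (m : ℕ) :
    apImage p s r m = apImage p s r (min m p) ∧ (apImage p s r m).card = min m p := by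
  have h : apImage p s r m = apImage p s r (min m p) := by
    rcases le_total m p with hm | hm
    · rw [min_eq_left hm]
    · rw [min_eq_right hm]
      refine Finset.Subset.antisymm (fun x hx => ?_)
        (Finset.image_subset_image (Finset.range_subset_range.2 hm))
      obtain ⟨i, -, rfl⟩ := Finset.mem_image.1 hx
      refine Finset.mem_image.2 ⟨i % p, Finset.mem_range.2 (Nat.mod_lt _ (Fact.out : p.Prime).pos), ?_⟩
      rw [ZMod.natCast_mod]
  refine ⟨h, ?_⟩
  rw [h, apImage, Finset.card_image_of_injOn, Finset.card_range]
  intro i hi i' hi' hii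
  have h1 : (i : ZMod p) = i' := mul_right_cancel₀ hr (add_left_cancel hii)
  have hi1 := (Finset.mem_range.1 hi).trans_le (min_le_right _ _)
  have hi2 := (Finset.mem_range.1 hi').trans_le (min_le_right _ _)
  exact ((ZMod.natCast_eq_natCast_iff' _ _ _).1 h1 |>.symm.trans (Nat.mod_eq_of_lt hi1)).symm.trans
    (Nat.mod_eq_of_lt hi2) |> fun h => by simpa [Nat.mod_eq_of_lt hi1, Nat.mod_eq_of_lt hi2] using h

theorem eval_Pfact (p : ℕ) [Fact p.Prime] (h : ℕ) (x : ZMod p) :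
    (Pfact p (2 * h + 1)).eval x = (centeredPoly (ZMod p) h).eval (x + (h + 1 : ℕ)) := by
  rw [Pfact, centeredPoly, Polynomial.eval_prod, Polynomial.eval_prod]
  refine Finset.prod_bij (fun i _ => (h + 1 : ℤ) - i) (fun i hi => ?_) (fun i _ i' _ hii => ?_)
    (fun k hk => ?_) fun i _ => ?_
  · rw [Finset.mem_Icc] at hi ⊢
    omega
  · omega
  · rw [Finset.mem_Icc] at hk
    exact ⟨((h : ℤ) + 1 - k).toNat, by rw [Finset.mem_Icc]; omega, by omega⟩
  · simp
    ring

/-- The number of collisions of `centeredPoly` on an arithmetic progression. -/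
theorem card_collisions_centeredPoly_le {p : ℕ} [Fact p.Prime] {h j : ℕ} (hjp : j.Prime)
    (hj : j = 2 * h + 1) (hh : 1 ≤ h) (hp : j ^ 4 ≤ p) (s : ZMod p) {r : ZMod p} (hr : r ≠ 0)
    {N : ℕ} (hN : 1 ≤ N) (hNp : N ≤ p) :
    (((apImage p s r N ×ˢ apImage p s r N).filter fun z => z.1 ≠ z.2 ∧
      (centeredPoly (ZMod p) h).eval z.1 = (centeredPoly (ZMod p) h).eval z.2).card : ℝ) ≤
      128 * ((N : ℝ) ^ 2 / p + j ^ 2 * √p) := by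
  classical
  set D : Finset (ZMod p × ZMod p) := Finset.univ.filter fun z => z.1 ≠ z.2 ∧
    (centeredPoly (ZMod p) h).eval z.1 = (centeredPoly (ZMod p) h).eval z.2
  have hD : ∀ z, z ∈ D ↔ z.1 ≠ z.2 ∧
    (centeredPoly (ZMod p) h).eval z.1 = (centeredPoly (ZMod p) h).eval z.2 := fun z => by simp [D]
  have hp' : 2 * j * (h + 1) ^ 2 < p := by
    refine lt_of_lt_of_le ?_ hp
    have h1 : 3 * (h + 1) ≤ 2 * j := by omega
    have h2 : 3 ≤ j := by omega
    nlinarith [Nat.mul_le_mul h1 h1, Nat.mul_le_mul (Nat.mul_le_mul h2 (le_refl j)) (Nat.mul_le_mul (le_refl j) (le_refl j))]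
  have hp0 : (0 : ℝ) < p := by exact_mod_cast (Fact.out : p.Prime).pos
  have hjs : (j : ℝ) ≤ √p := Real.le_sqrt_of_sq_le (by
    have : j ^ 2 ≤ p := (Nat.pow_le_pow_right (by omega) (by norm_num)).trans hp
    exact_mod_cast this)
  have hj1 : ((j - 1 : ℕ) : ℝ) ≤ j := by exact_mod_cast Nat.sub_le _ _
  have hK0 : 2 * ((j - 1 : ℕ) : ℝ) ^ 2 * √p + 2 * j ^ 3 ≤ 4 * j ^ 2 * √p := by
    have h1 : ((j - 1 : ℕ) : ℝ) ^ 2 * √p ≤ j ^ 2 * √p := by gcongr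
    have h2 : (j : ℝ) ^ 2 * j ≤ j ^ 2 * √p := by gcongr
    linarith [h1, h2, (by ring : (j : ℝ) ^ 3 = j ^ 2 * j)]
  have hK1 : 2 * (j : ℝ) ^ 3 ≤ 4 * j ^ 2 * √p := by
    have : 0 ≤ ((j - 1 : ℕ) : ℝ) ^ 2 * √p := by positivity
    linarith
  have hmain := norm_sum_centeredPoly_pairs_le p hjp hj hh hp' (D := D) (hD := hD)
  have hK : ∀ a b : ZMod p, (a, b) ≠ 0 →
      ‖∑ z ∈ D, (ZMod.stdAddChar (a * z.1 + b * z.2) : ℂ)‖ ≤ 4 * j ^ 2 * √p := by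
    intro a b hab
    have hab' : ¬(a = 0 ∧ b = 0) := fun h => hab (Prod.ext h.1 h.2)
    rcases hmain a b with h1 | ⟨h1, h2, -⟩
    · rw [if_neg hab', sub_zero] at h1
      exact h1.trans hK0
    · exact absurd ⟨h1, h2⟩ hab'
  have hcard : (D.card : ℝ) ≤ p + 4 * j ^ 2 * √p := by
    have h0 : ∑ z ∈ D, (ZMod.stdAddChar ((0 : ZMod p) * z.1 + 0 * z.2) : ℂ) = D.card := by simp
    have h3 : (D.card : ℝ) = ‖(D.card : ℂ)‖ := by simp
    rcases hmain 0 0 with h1 | ⟨-, -, h1⟩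
    · rw [if_pos ⟨rfl, rfl⟩, h0] at h1
      have h2 := norm_le_norm_sub_add (D.card : ℂ) (p : ℂ)
      rw [Complex.norm_natCast, Complex.norm_natCast] at h2
      linarith
    · rw [h0, Complex.norm_natCast] at h1
      linarith
  have hbox := card_box_le_of_charSum_le D hK s hr hN hNp (I := apImage p s r N) le_rfl
  have hset : (apImage p s r N ×ˢ apImage p s r N).filter (fun z => z.1 ≠ z.2 ∧
      (centeredPoly (ZMod p) h).eval z.1 = (centeredPoly (ZMod p) h).eval z.2) =
      D.filter fun z => z.1 ∈ apImage p s r N ∧ z.2 ∈ apImage p s r N := by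
    ext z
    simp only [Finset.mem_filter, Finset.mem_product, hD]
    tauto
  rw [hset]
  refine hbox.trans ?_
  have h1 : 16 * (N : ℝ) ^ 2 * D.card / p ^ 2 ≤ 16 * (N : ℝ) ^ 2 * (p + 4 * j ^ 2 * √p) / p ^ 2 := by
    gcongr
  have h2 : 16 * (N : ℝ) ^ 2 * (p + 4 * j ^ 2 * √p) / p ^ 2 =
      16 * ((N : ℝ) ^ 2 / p) + 64 * (j ^ 2 * √p) * ((N : ℝ) / p) ^ 2 := by
    field_simp
    ring
  have h3 : ((N : ℝ) / p) ^ 2 ≤ 1 := pow_le_one₀ (by positivity)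
    ((div_le_one hp0).2 (by exact_mod_cast hNp))
  have h4 : 64 * (j ^ 2 * √p) * ((N : ℝ) / p) ^ 2 ≤ 64 * (j ^ 2 * √p) :=
    mul_le_of_le_one_right (by positivity) h3
  have h5 : 0 ≤ (N : ℝ) ^ 2 / p := by positivity
  linarith

/-- **Equation (1).** For a large enough prime `p`, an odd prime `2 < j < p − 2`, and `I` (the
image of) a finite arithmetic progression,
`|I| ≥ |P_j(I)| ≥ |I| − C·(|I|²/p + j²·√p·(log p)²)`. -/
theorem card_image_Pfact_ap :
    ∃ C : ℝ, C > 0 ∧ ∃ p₀ : ℕ, ∀ p : ℕ, p.Prime → p > p₀ →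
      ∀ j : ℕ, j.Prime → Odd j → 2 < j → j + 2 < p →
      ∀ (s r : ZMod p) (m : ℕ), r ≠ 0 → 1 ≤ m →
        (((apImage p s r m).image (fun x => Polynomial.eval x (Pfact p j))).card ≤
            (apImage p s r m).card
        ∧
        ((((apImage p s r m).image (fun x => Polynomial.eval x (Pfact p j))).card : ℝ) ≥
          ((apImage p s r m).card : ℝ) -
            C * (((apImage p s r m).card : ℝ) ^ 2 / (p : ℝ) +
              (j : ℝ) ^ 2 * Real.sqrt p * (Real.log p) ^ 2))) := by
  refine ⟨128, by norm_num, 3, fun p hpp hp3 j hjp hodd hj2 hjp2 s r m hr hm =>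
    ⟨Finset.card_image_le, ?_⟩⟩
  have : Fact p.Prime := ⟨hpp⟩
  obtain ⟨h, hj⟩ := hodd
  obtain ⟨hmin, hcard⟩ := apImage_min_card p s hr m
  set N := min m p with hNdef
  have hN : 1 ≤ N := le_min hm hpp.one_le
  have hNp : N ≤ p := min_le_right _ _
  have hp0 : (0 : ℝ) < p := by exact_mod_cast hpp.pos
  have hlog : 1 ≤ Real.log p := by
    rw [Real.le_log_iff_exp_le hp0]
    have h3 : (3 : ℝ) ≤ p := by exact_mod_cast hp3.le
    linarith [Real.exp_one_lt_d9]
  have hlog2 : (j : ℝ) ^ 2 * √p ≤ (j : ℝ) ^ 2 * √p * (Real.log p) ^ 2 :=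
    le_mul_of_one_le_right (by positivity) (one_le_pow₀ hlog)
  have hdiv : 0 ≤ (N : ℝ) ^ 2 / p := by positivity
  rw [hcard, ge_iff_le, sub_le_iff_le_add]
  by_cases hbig : j ^ 4 ≤ p
  · have hshift : (apImage p s r m).image (fun x => Polynomial.eval x (Pfact p j)) =
        (apImage p (s + (h + 1 : ℕ)) r N).image fun x => (centeredPoly (ZMod p) h).eval x := by
      rw [hmin, apImage, apImage, Finset.image_image, Finset.image_image]
      refine Finset.image_congr fun i _ => ?_
      simp only [Function.comp_apply]
      rw [hj, eval_Pfact]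
      congr 1
      ring
    have h1 := Finset.card_le_card_image_add_card_collisions (apImage p (s + (h + 1 : ℕ)) r N)
      fun x => (centeredPoly (ZMod p) h).eval x
    have h2 := card_collisions_centeredPoly_le hjp hj (by omega) hbig (s + (h + 1 : ℕ)) hr hN hNp
    rw [(apImage_min_card p (s + (h + 1 : ℕ)) hr N).2, min_eq_left hNp] at h1
    rw [hshift]
    have h3 := (Nat.cast_le (α := ℝ)).2 h1
    rw [Nat.cast_add] at h3
    linarith
  · have h1 : √p ≤ (j : ℝ) ^ 2 := by
      rw [Real.sqrt_le_left (by positivity), ← pow_mul]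
      exact_mod_cast (not_le.1 hbig).le
    have h2 : (p : ℝ) ≤ (j : ℝ) ^ 2 * √p := by
      calc (p : ℝ) = √p * √p := (Real.mul_self_sqrt hp0.le).symm
        _ ≤ _ := by gcongr
    have h3 : (N : ℝ) ≤ p := by exact_mod_cast hNp
    have h4 : (0 : ℝ) ≤ ((apImage p s r m).image fun x => Polynomial.eval x (Pfact p j)).card := by
      positivity
    linarith
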